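/- For g ∈ {4,5}, if G is a g-minimal graph, then g = 5 and G is cubic, 3-connected, and has girth at least 5. -/

import Mathlib

open SimpleGraph

namespace InducedForest

/-- A graph is subcubic if every vertex has at most 3 neighbours. -/
def Subcubic {V : Type} (G : SimpleGraph V) : Prop := ∀ v : V, (G.neighborSet v).ncard ≤ 3

/-- A graph is cubic if every vertex has exactly 3 neighbours. -/
def Cubic {V : Type} (G : SimpleGraph V) : Prop := ∀ v : V, (G.neighborSet v).ncard = 3

/-- `S` is a feedback vertex set of `G` iff `G - S` is a forest. -/
def IsFVS {V : Type} (G : SimpleGraph V) (S : Set V) : Prop := (G.induce Sᶜ).IsAcyclic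

/-- `φ(G)`: the minimum size of a feedback vertex set of `G`. -/
noncomputable def fvs {V : Type} (G : SimpleGraph V) : ℕ :=
  sInf {n : ℕ | ∃ S : Set V, IsFVS G S ∧ S.ncard = n}

/-- `a(G)`: the maximum number of vertices of an induced forest in `G`. -/
noncomputable def indForestNum {V : Type} (G : SimpleGraph V) : ℕ :=
  sSup {n : ℕ | ∃ S : Set V, (G.induce S).IsAcyclic ∧ S.ncard = n}

/-- `v` is a cut-vertex of `G`: deleting it increases the number of connected components. -/
def IsCutVertex {V : Type} (G : SimpleGraph V) (v : V) : Prop :=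
  Nat.card G.ConnectedComponent < Nat.card (G.induce {u | u ≠ v}).ConnectedComponent

/-- `B` is a block of `G`: a maximal set of vertices inducing a connected subgraph
without cut-vertices. -/
def IsBlock {V : Type} (G : SimpleGraph V) (B : Set V) : Prop :=
  ((G.induce B).Connected ∧ ∀ v, ¬ IsCutVertex (G.induce B) v) ∧
  ∀ B' : Set V, B ⊆ B' →
    ((G.induce B').Connected ∧ ∀ v, ¬ IsCutVertex (G.induce B') v) → B' = B

/-- 2-connectedness: at least 3 vertices and removing fewer than 2 vertices
leaves a connected graph. -/
def TwoConnected {V : Type} (G : SimpleGraph V) : Prop :=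
  3 ≤ Nat.card V ∧ ∀ s : Set V, s.ncard < 2 → (G.induce sᶜ).Connected

/-- 3-connectedness: at least 4 vertices and removing fewer than 3 vertices
leaves a connected graph. -/
def ThreeConnected {V : Type} (G : SimpleGraph V) : Prop :=
  4 ≤ Nat.card V ∧ ∀ s : Set V, s.ncard < 3 → (G.induce sᶜ).Connected

/-- The graph obtained from `H` by subdividing the edge `xy` once;
the subdivision vertex is `none`. -/
def subdivide {V : Type} (H : SimpleGraph V) (x y : V) : SimpleGraph (Option V) :=
  SimpleGraph.fromRel (fun p q =>
    match p, q with
    | some u, some v => H.Adj u v ∧ s(u, v) ≠ s(x, y)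
    | some u, none => u = x ∨ u = y
    | _, _ => False)

/-- `G` is obtained from `H` by subdividing one edge once. -/
def IsSubdivisionOfOneEdge {V W : Type} (H : SimpleGraph V) (G : SimpleGraph W) : Prop :=
  ∃ x y : V, H.Adj x y ∧ Nonempty (G ≃g subdivide H x y)

/-- The graph obtained from `K` by adding one new vertex (`none`)
joined to all vertices of `S`. -/
def addApex {V : Type} (K : SimpleGraph V) (S : Set V) : SimpleGraph (Option V) :=
  SimpleGraph.fromRel (fun p q =>
    match p, q with
    | some u, some v => K.Adj u v
    | some u, none => u ∈ S
    | _, _ => False)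

/-- `G` is (isomorphic to) `H ∘ (e1, e2, a)`: subdivide `e1` and `e2` once each
(with `e1` subdivided twice if `e1 = e2`) and add a new vertex adjacent to `a` and to the
two subdivision vertices. -/
def IsCircOp {V W : Type} (H : SimpleGraph V) (e1 e2 : Sym2 V) (a : V)
    (G : SimpleGraph W) : Prop :=
  (e1 ≠ e2 ∧ ∃ x1 y1 x2 y2 : V, e1 = s(x1, y1) ∧ e2 = s(x2, y2) ∧
    Nonempty (G ≃g addApex (subdivide (subdivide H x1 y1) (some x2) (some y2))
      {some (some a), some none, none})) ∨
  (e1 = e2 ∧ ∃ x y : V, e1 = s(x, y) ∧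
    Nonempty (G ≃g addApex (subdivide (subdivide H x y) none (some y))
      {some (some a), some none, none}))

/-- The cycle of length `n` (for `n ≥ 3`). -/
def cyc (n : ℕ) : SimpleGraph (ZMod n) :=
  SimpleGraph.fromRel (fun u v => v = u + 1)

/-- The families `F_{i,j}` of graphs (closed under isomorphism):
`F_{i,0} = {C_i}` for `i ≥ 3`; `F_{1,1} = {K_4}`; `F_{j,j}` for `j ≥ 2` is obtained from
`F_{j-1,j-1}` by subdividing one edge once and then applying the `∘` operation at the
subdivision vertex; and `F_{i,j}` for `i > j ≥ 1` is obtained from `F_{j,j}` by `i - j`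
successive single-edge subdivisions. -/
inductive MemF : ℕ → ℕ → ∀ {V : Type}, SimpleGraph V → Prop
  | cycle {i : ℕ} (hi : 3 ≤ i) {V : Type} {G : SimpleGraph V}
      (h : Nonempty (G ≃g cyc i)) : MemF i 0 G
  | k4 {V : Type} {G : SimpleGraph V}
      (h : Nonempty (G ≃g (⊤ : SimpleGraph (Fin 4)))) : MemF 1 1 G
  | circ {j : ℕ} (hj : 2 ≤ j) {V : Type} {H : SimpleGraph V}
      (hH : MemF (j - 1) (j - 1) H) {x y : V} (hxy : H.Adj x y)
      {e1 e2 : Sym2 (Option V)} (he1 : e1 ∈ (subdivide H x y).edgeSet)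
      (he2 : e2 ∈ (subdivide H x y).edgeSet)
      {W : Type} {G : SimpleGraph W}
      (hG : IsCircOp (subdivide H x y) e1 e2 none G) : MemF j j G
  | subd {i j : ℕ} (hj : 1 ≤ j) {V : Type} {H : SimpleGraph V}
      (hH : MemF i j H) {x y : V} (hxy : H.Adj x y) {W : Type} {G : SimpleGraph W}
      (hG : Nonempty (G ≃g subdivide H x y)) : MemF (i + 1) j G

/-- `K_4^+`: the graph obtained from `K_4` by subdividing one edge once. -/
def K4plus : SimpleGraph (Option (Fin 4)) :=
  subdivide (⊤ : SimpleGraph (Fin 4)) 0 1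

/-- `L`: the graph obtained from `K_4` by subdividing once each edge
of a perfect matching. -/
def Lgraph : SimpleGraph (Option (Option (Fin 4))) :=
  subdivide (subdivide (⊤ : SimpleGraph (Fin 4)) 0 1) (some 2) (some 3)

/-- The Petersen graph. -/
def petersen : SimpleGraph (ZMod 5 × Fin 2) :=
  SimpleGraph.fromRel (fun u v =>
    (u.2 = 0 ∧ v.2 = 0 ∧ v.1 = u.1 + 1) ∨
    (u.2 = 1 ∧ v.2 = 1 ∧ v.1 = u.1 + 2) ∨
    (u.2 = 0 ∧ v.2 = 1 ∧ u.1 = v.1))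

/-- `R`: the Petersen graph minus one edge. -/
def Rgraph : SimpleGraph (ZMod 5 × Fin 2) :=
  petersen.deleteEdges {s(((0 : ZMod 5), (0 : Fin 2)), ((1 : ZMod 5), (0 : Fin 2)))}

/-- `Q_3`: the 3-dimensional cube graph. -/
def Q3 : SimpleGraph (Fin 2 × Fin 2 × Fin 2) :=
  SimpleGraph.fromRel (fun u v =>
    (u.1 ≠ v.1 ∧ u.2 = v.2) ∨ (u.1 = v.1 ∧ u.2.1 ≠ v.2.1 ∧ u.2.2 = v.2.2) ∨
    (u.1 = v.1 ∧ u.2.1 = v.2.1 ∧ u.2.2 ≠ v.2.2))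

/-- `V_8`: the Wagner graph. -/
def V8 : SimpleGraph (ZMod 8) :=
  SimpleGraph.fromRel (fun u v => v = u + 1 ∨ v = u + 4)

/-- The dodecahedron, presented as the generalized Petersen graph `GP(10,2)`. -/
def dodecahedron : SimpleGraph (ZMod 10 × Fin 2) :=
  SimpleGraph.fromRel (fun u v =>
    (u.2 = 0 ∧ v.2 = 0 ∧ v.1 = u.1 + 1) ∨
    (u.2 = 1 ∧ v.2 = 1 ∧ v.1 = u.1 + 2) ∨
    (u.2 = 0 ∧ v.2 = 1 ∧ u.1 = v.1))

/-- The families `F^g_{i,j,k}`: 2-connected subcubic graphs obtained from the disjoint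
union of `k` copies of `L` (when `g = 4`) or of `R` (when `g = 5`) and one member of
`F_{i,j}` by adding `k+1` edges; when `k ≥ 1`, each added edge joins two different
constituent copies. -/
def MemFG (g i j k : ℕ) {W : Type} (G : SimpleGraph W) : Prop :=
  TwoConnected G ∧ Subcubic G ∧
  ∃ (P : W → Fin (k + 1)) (H : SimpleGraph W),
    H ≤ G ∧ (∀ u v, H.Adj u v → P u = P v) ∧
    MemF i j (H.induce (P ⁻¹' {0})) ∧
    ((g = 4 ∧ ∀ l : Fin (k + 1), l ≠ 0 → Nonempty ((H.induce (P ⁻¹' {l})) ≃g Lgraph)) ∨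
     (g = 5 ∧ ∀ l : Fin (k + 1), l ≠ 0 → Nonempty ((H.induce (P ⁻¹' {l})) ≃g Rgraph))) ∧
    (G.edgeSet \ H.edgeSet).ncard = k + 1 ∧
    (1 ≤ k → ∀ u v, G.Adj u v → ¬ H.Adj u v → P u ≠ P v)

/-- `t_4 = 2/9`, `t_5 = 1/5`. -/
noncomputable def tg (g : ℕ) : ℝ := if g = 4 then 2 / 9 else 1 / 5

/-- The error function `ε_g` on graphs. -/
noncomputable def eps (g : ℕ) {V : Type} (G : SimpleGraph V) : ℝ := by
  classical
  exact
    if h1 : ∃ p : ℕ × ℕ, 1 ≤ p.1 ∧ p.2 ≤ p.1 ∧ MemF p.1 p.2 G then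
      max (1 - (h1.choose.2 : ℝ) * (5 * tg g - 1) - (h1.choose.1 : ℝ) * tg g) 0
    else if h2 : ∃ q : ℕ × ℕ × ℕ, 1 ≤ q.1 ∧ q.2.1 ≤ q.1 ∧ MemFG g q.1 q.2.1 q.2.2 G then
      max (1 - tg g - (h2.choose.2.1 : ℝ) * (5 * tg g - 1) - (h2.choose.1 : ℝ) * tg g) 0
    else if Nonempty (G ≃g (⊤ : SimpleGraph (Fin 2))) then -tg g
    else 0

/-- The error function `r_g(G)`: the sum of `ε_g(B)` over all blocks `B` of `G`. -/
noncomputable def rg (g : ℕ) {V : Type} (G : SimpleGraph V) : ℝ :=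
  ∑ᶠ B ∈ {B : Set V | IsBlock G B}, eps g (G.induce B)

/-- `G` has two vertex-disjoint cycles, each of length less than `g`. -/
def TwoDisjointCyclesLt {V : Type} (G : SimpleGraph V) (g : ℕ) : Prop :=
  ∃ (u v : V) (c1 : G.Walk u u) (c2 : G.Walk v v), c1.IsCycle ∧ c2.IsCycle ∧
    c1.length < g ∧ c2.length < g ∧ ∀ x, x ∈ c1.support → x ∉ c2.support

/-- `G` contains a (not necessarily induced) subgraph isomorphic to `K`. -/
def ContainsSubgraphCopy {U V : Type} (K : SimpleGraph U) (G : SimpleGraph V) : Prop :=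
  ∃ f : U → V, Function.Injective f ∧ ∀ u v, K.Adj u v → G.Adj (f u) (f v)

/-- `G` is obtained from `H` by adding edges, each of which is a cut-edge of `G`. -/
def AddCutEdges {V : Type} (H G : SimpleGraph V) : Prop :=
  H ≤ G ∧ ∀ e ∈ G.edgeSet \ H.edgeSet, G.IsBridge e

/-- The edges of `H` all lie inside the parts of the partition given by `P`. -/
def PartitionedBy {V ι : Type} (H : SimpleGraph V) (P : V → ι) : Prop :=
  ∀ u v, H.Adj u v → P u = P v

/-- `G` is `g`-minimal: a minimum counterexample to the main theorem. -/
def GMinimal (g : ℕ) {V : Type} [Fintype V] (G : SimpleGraph V) : Prop :=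
  Subcubic G ∧ ¬ TwoDisjointCyclesLt G g ∧
  tg g * G.edgeSet.ncard + rg g G < (fvs G : ℝ) ∧
  ∀ (W : Type) [Fintype W] (H : SimpleGraph W), Nat.card W < Nat.card V →
    Subcubic H → ¬ TwoDisjointCyclesLt H g →
    (fvs H : ℝ) ≤ tg g * H.edgeSet.ncard + rg g H

open scoped Classical in
/-- adjacency indicator -/
noncomputable def ad {V : Type} (X : SimpleGraph V) (u v : V) : ℕ := if X.Adj u v then 1 else 0

/-- number of adjacent ordered pairs between `A` and `B` -/
noncomputable def ee {V : Type} (X : SimpleGraph V) (A B : Finset V) : ℕ := ∑ u ∈ A, ∑ v ∈ B, ad X u v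

/-- number of edges inside `P` -/
noncomputable def en {V : Type} (X : SimpleGraph V) (P : Finset V) : ℕ := ee X P P / 2

/-- `X[Q]` is a forest, by counting -/
def AcyOn {V : Type} (X : SimpleGraph V) (Q : Finset V) : Prop :=
  ∀ A : Finset V, A ⊆ Q → A.Nonempty → ee X A A + 2 ≤ 2 * A.card

section
open scoped Classical
variable {V : Type} {X Y : SimpleGraph V}

lemma ad_comm (u v : V) : ad X u v = ad X v u := by simp [ad, X.adj_comm]
@[simp] lemma ad_self (u : V) : ad X u u = 0 := by simp [ad]
lemma ad_le (u v : V) : ad X u v ≤ 1 := by unfold ad; split_ifs <;> simp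
lemma ad_eq_one {u v : V} (h : X.Adj u v) : ad X u v = 1 := by simp [ad, h]
lemma ad_eq_zero {u v : V} (h : ¬ X.Adj u v) : ad X u v = 0 := by simp [ad, h]
lemma ad_pos {u v : V} : 0 < ad X u v ↔ X.Adj u v := by unfold ad; split_ifs <;> simp [*]

lemma ee_comm (A B : Finset V) : ee X A B = ee X B A := by
  unfold ee; rw [Finset.sum_comm]; simp only [ad_comm]

lemma ee_union_left {A B C : Finset V} (h : Disjoint A B) : ee X (A ∪ B) C = ee X A C + ee X B C :=
  Finset.sum_union h

lemma ee_union_right {A B C : Finset V} (h : Disjoint A B) : ee X C (A ∪ B) = ee X C A + ee X C B := by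
  rw [ee_comm, ee_union_left h, ee_comm A, ee_comm B]

lemma ee_insert_left {A C : Finset V} {v : V} (h : v ∉ A) : ee X (insert v A) C = ee X {v} C + ee X A C := by
  unfold ee; rw [Finset.sum_insert h]; simp

lemma ee_insert_right {A C : Finset V} {v : V} (h : v ∉ A) : ee X C (insert v A) = ee X C {v} + ee X C A := by
  rw [ee_comm, ee_insert_left h, ee_comm {v}, ee_comm A]

@[simp] lemma ee_empty_left (A : Finset V) : ee X ∅ A = 0 := by simp [ee]
@[simp] lemma ee_empty_right (A : Finset V) : ee X A ∅ = 0 := by simp [ee]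
@[simp] lemma ee_single (u v : V) : ee X {u} {v} = ad X u v := by simp [ee]

lemma ee_mono {A B A' B' : Finset V} (h : A ⊆ A') (h' : B ⊆ B') : ee X A B ≤ ee X A' B' := by
  unfold ee
  calc _ ≤ ∑ u ∈ A, ∑ v ∈ B', ad X u v := Finset.sum_le_sum fun u _ => Finset.sum_le_sum_of_subset h'
    _ ≤ _ := Finset.sum_le_sum_of_subset h

lemma ee_mono_graph (h : X ≤ Y) (A B : Finset V) : ee X A B ≤ ee Y A B := by
  unfold ee
  refine Finset.sum_le_sum fun u _ => Finset.sum_le_sum fun v _ => ?_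
  unfold ad; split_ifs with h1 h2 <;> simp
  exact h2 (h h1)

lemma ee_congr_graph {A B : Finset V} (h : ∀ u ∈ A, ∀ v ∈ B, X.Adj u v ↔ Y.Adj u v) : ee X A B = ee Y A B := by
  unfold ee
  refine Finset.sum_congr rfl fun u hu => Finset.sum_congr rfl fun v hv => ?_
  simp [ad, h u hu v hv]

lemma ee_eq_zero {A B : Finset V} : ee X A B = 0 ↔ ∀ u ∈ A, ∀ v ∈ B, ¬ X.Adj u v := by
  unfold ee
  simp [ad]

lemma ee_pos {A B : Finset V} : 0 < ee X A B ↔ ∃ u ∈ A, ∃ v ∈ B, X.Adj u v := by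
  rw [Nat.pos_iff_ne_zero, Ne, ee_eq_zero]; push Not; rfl

lemma ee_sdiff_right {A B C : Finset V} (h : B ⊆ C) : ee X A C = ee X A B + ee X A (C \ B) := by
  conv_lhs => rw [← Finset.union_sdiff_of_subset h]
  exact ee_union_right Finset.disjoint_sdiff

lemma ee_sdiff_left {A B C : Finset V} (h : B ⊆ C) : ee X C A = ee X B A + ee X (C \ B) A := by
  conv_lhs => rw [← Finset.union_sdiff_of_subset h]
  exact ee_union_left Finset.disjoint_sdiff

lemma ee_eq_card (A B : Finset V) :
    ee X A B = ((A ×ˢ B).filter fun p => X.Adj p.1 p.2).card := by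
  unfold ee ad
  rw [Finset.card_filter, Finset.sum_product]

lemma ee_single_card (u : V) (B : Finset V) : ee X {u} B = (B.filter fun v => X.Adj u v).card := by
  unfold ee ad
  rw [Finset.card_filter]; simp

lemma ee_even (A : Finset V) : Even (ee X A A) := by
  induction A using Finset.induction_on with
  | empty => simp
  | insert v A hv ih =>
    rw [ee_insert_left hv, ee_insert_right hv, ee_insert_right hv, ee_comm A {v}]
    simp only [ee_single, ad_self]
    rw [show 0 + ee X {v} A + (ee X {v} A + ee X A A) = (ee X {v} A + ee X {v} A) + ee X A A by ring]
    exact (Even.add_self _).add ih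

lemma ee_self (A : Finset V) : ee X A A = 2 * en X A := by
  unfold en; have := (ee_even (X := X) A).two_dvd; omega

lemma en_union {A B : Finset V} (h : Disjoint A B) : en X (A ∪ B) = en X A + en X B + ee X A B := by
  have h1 := ee_self (X := X) (A ∪ B)
  rw [ee_union_left h, ee_union_right h, ee_union_right h, ee_comm B A, ee_self, ee_self] at h1
  omega

lemma en_sdiff {A B : Finset V} (h : A ⊆ B) : en X B = en X A + en X (B \ A) + ee X A (B \ A) := by
  rw [← en_union Finset.disjoint_sdiff, Finset.union_sdiff_of_subset h]

lemma en_insert {A : Finset V} {v : V} (h : v ∉ A) : en X (insert v A) = en X A + ee X {v} A := by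
  rw [Finset.insert_eq, en_union (by simpa using h)]
  have : en X {v} = 0 := by unfold en; simp
  omega

lemma acyOn_iff {Q : Finset V} : AcyOn X Q ↔ ∀ A ⊆ Q, A.Nonempty → en X A + 1 ≤ A.card := by
  unfold AcyOn
  refine forall_congr' fun A => forall_congr' fun _ => forall_congr' fun _ => ?_
  rw [ee_self]; omega

/-- general number of edges: injection to `Sym2` -/
lemma en_eq_ncard_induce (P : Finset V) : (X.induce (P : Set V)).edgeSet.ncard = en X P := by
  have h := (X.induce (P : Set V)).sum_degrees_eq_twice_card_edges
  rw [← coe_edgeFinset, Set.ncard_coe_finset]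
  have h2 : ∑ v : (P : Set V), (X.induce (P : Set V)).degree v = ee X P P := by
    have : ∀ v : (P : Set V), (X.induce (P : Set V)).degree v = ee X {v.1} P := by
      intro v
      rw [ee_single_card, ← card_neighborFinset_eq_degree]
      refine Finset.card_bij (fun a _ => a.1) ?_ ?_ ?_
      · intro a ha; simpa using ha
      · intro a _ b _ hab; exact Subtype.ext hab
      · intro b hb; simp at hb; exact ⟨⟨b, by simpa using hb.1⟩, by simpa using hb.2, rfl⟩
    simp only [this]
    unfold ee
    simp only [Finset.sum_singleton]
    rw [← Finset.sum_coe_sort P]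
    rfl
  rw [h2, ee_self] at h
  omega

lemma en_univ [Fintype V] : X.edgeSet.ncard = en X Finset.univ := by
  have h := X.sum_degrees_eq_twice_card_edges
  rw [← coe_edgeFinset, Set.ncard_coe_finset]
  have h2 : ∑ v : V, X.degree v = ee X Finset.univ Finset.univ := by
    unfold ee
    refine Finset.sum_congr rfl fun v _ => ?_
    have := ee_single_card (X := X) v Finset.univ
    unfold ee at this
    rw [Finset.sum_singleton] at this
    rw [this, ← card_neighborFinset_eq_degree]; congr 1; ext; simp
  rw [h2, ee_self] at h
  omega

lemma acyclic_en [Fintype V] [Nonempty V] (h : X.IsAcyclic) : X.edgeSet.ncard + 1 ≤ Nat.card V := by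
  obtain ⟨T, h1, h2, h3⟩ := (connected_top (V := V)).exists_isTree_le_of_le_of_isAcyclic (le_top : X ≤ ⊤) h
  have := h3.card_edgeFinset
  have h4 : X.edgeSet.ncard ≤ T.edgeSet.ncard := Set.ncard_le_ncard (edgeSet_mono h1) (Set.toFinite _)
  rw [← coe_edgeFinset (G := T), Set.ncard_coe_finset] at h4
  rw [Nat.card_eq_fintype_card]; omega

lemma acyOn_of_acyclic {Q : Finset V} (h : (X.induce (Q : Set V)).IsAcyclic) : AcyOn X Q := by
  rw [acyOn_iff]
  intro A hA hne
  have : Nonempty (A : Set V) := ⟨⟨hne.choose, hne.choose_spec⟩⟩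
  have h1 : (X.induce (A : Set V)).IsAcyclic :=
    h.comap (induceHomOfLE X (by exact_mod_cast hA)).toHom (induceHomOfLE X (by exact_mod_cast hA)).injective
  have := acyclic_en h1
  rw [en_eq_ncard_induce] at this
  simpa using this

/-- a cycle gives a dense set -/
lemma cycle_en {v : V} {c : X.Walk v v} (hc : c.IsCycle) :
    c.support.toFinset.card = c.length ∧ c.length ≤ en X c.support.toFinset := by
  have h0 : c.support.toFinset = c.support.tail.toFinset := by
    ext x; simp only [List.mem_toFinset]
    constructor
    · intro h
      rcases (Walk.mem_support_iff c).1 h with rfl | h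
      · exact Walk.end_mem_tail_support hc.not_nil
      · exact h
    · intro h; exact List.mem_of_mem_tail h
  have h1 : c.support.toFinset.card = c.length := by
    rw [h0, List.toFinset_card_of_nodup hc.support_nodup]
    simp
  refine ⟨h1, ?_⟩
  have h2 : c.edges.toFinset.card = c.length := by
    rw [List.toFinset_card_of_nodup hc.edges_nodup]; simp
  rw [← h2, ← en_eq_ncard_induce]
  have h3 : (c.edges.toFinset : Set (Sym2 V)) ⊆
      Sym2.map Subtype.val '' (X.induce (c.support.toFinset : Set V)).edgeSet := by
    intro e he
    simp only [List.coe_toFinset, Set.mem_ofPred_eq] at he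
    induction e using Sym2.ind with
    | _ a b =>
    have ha := c.fst_mem_support_of_mem_edges he
    have hb := c.snd_mem_support_of_mem_edges he
    refine ⟨s(⟨a, by simpa using ha⟩, ⟨b, by simpa using hb⟩), ?_, rfl⟩
    simpa using c.adj_of_mem_edges he
  calc c.edges.toFinset.card = (c.edges.toFinset : Set (Sym2 V)).ncard := (Set.ncard_coe_finset _).symm
    _ ≤ _ := Set.ncard_le_ncard h3 (Set.toFinite _)
    _ ≤ _ := Set.ncard_image_le (Set.toFinite _)

lemma acyclic_of_acyOn {Q : Finset V} (h : AcyOn X Q) : (X.induce (Q : Set V)).IsAcyclic := by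
  intro v c hc
  have hc' := (Walk.isCycle_map_iff_of_injective (p := c) (f := (Embedding.induce (G := X) (Q : Set V)).toHom)
    (Embedding.induce (G := X) (Q : Set V)).injective).2 hc
  obtain ⟨h1, h2⟩ := cycle_en hc'
  rw [acyOn_iff] at h
  have := h (c.map (Embedding.induce (G := X) (Q : Set V)).toHom).support.toFinset (by
    intro x hx
    simp only [List.mem_toFinset, Walk.support_map, List.mem_map] at hx
    obtain ⟨y, _, rfl⟩ := hx
    exact y.2) ⟨v.1, by rw [List.mem_toFinset]; exact Walk.start_mem_support _⟩
  omega

end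

/-- minimum size of a feedback vertex set of `X[P]` -/
noncomputable def fv {V : Type} [Fintype V] (X : SimpleGraph V) (P : Finset V) : ℕ := by
  classical
  exact sInf {n : ℕ | ∃ S ⊆ P, AcyOn X (P \ S) ∧ S.card = n}

/-- add an edge -/
def addE {V : Type} (X : SimpleGraph V) (a b : V) : SimpleGraph V where
  Adj u v := X.Adj u v ∨ (u ≠ v ∧ ((u = a ∧ v = b) ∨ (u = b ∧ v = a)))
  symm := ⟨fun u v h => by
    rcases h with h | ⟨h, h'⟩
    · exact Or.inl h.symm
    · exact Or.inr ⟨h.symm, by tauto⟩⟩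
  loopless := ⟨fun u h => by
    rcases h with h | ⟨h, h'⟩
    · exact X.loopless.irrefl _ h
    · exact h rfl⟩

/-- 2-edge-connectedness of `X[P]` -/
def EC2 {V : Type} [Fintype V] (X : SimpleGraph V) (P : Finset V) : Prop := by
  classical
  exact ∀ Y ⊆ P, Y.Nonempty → Y ≠ P → 2 ≤ ee X Y (P \ Y)

/-- `z` is a degree-2 vertex of `X[P]` with non-adjacent neighbours `a`, `b` -/
structure Sup {V : Type} (X : SimpleGraph V) (P : Finset V) (z a b : V) : Prop where
  hz : z ∈ P
  ha : a ∈ P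
  hb : b ∈ P
  hab : a ≠ b
  za : X.Adj z a
  zb : X.Adj z b
  nab : ¬ X.Adj a b
  only : ∀ v ∈ P, X.Adj z v → v = a ∨ v = b

section
set_option linter.all false
open scoped Classical
variable {V : Type} {X Y : SimpleGraph V}

lemma AcyOn.mono {A B : Finset V} (h : AcyOn X B) (hAB : A ⊆ B) : AcyOn X A :=
  fun C hC hne => h C (hC.trans hAB) hne

lemma AcyOn.anti {A : Finset V} (h : AcyOn Y A) (hXY : ∀ u ∈ A, ∀ v ∈ A, X.Adj u v → Y.Adj u v) : AcyOn X A := by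
  intro C hC hne
  have h1 := h C hC hne
  have : ee X C C ≤ ee Y C C := by
    unfold ee
    refine Finset.sum_le_sum fun u hu => Finset.sum_le_sum fun v hv => ?_
    unfold ad; split_ifs with h1 h2 <;> simp
    exact h2 (hXY _ (hC hu) _ (hC hv) h1)
  omega

lemma acyOn_empty : AcyOn X ∅ := by
  intro A hA hne; simp at hA; simp [hA] at hne

lemma AcyOn.union {A B : Finset V} (hA : AcyOn X A) (hB : AcyOn X B) (hd : Disjoint A B) (h : ee X A B ≤ 1) :
    AcyOn X (A ∪ B) := by
  rw [acyOn_iff] at *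
  intro C hC hne
  have h1 : C = (C ∩ A) ∪ (C ∩ B) := by rw [← Finset.inter_union_distrib_left]; exact (Finset.inter_eq_left.2 hC).symm
  have h2 : Disjoint (C ∩ A) (C ∩ B) := hd.mono Finset.inter_subset_right Finset.inter_subset_right
  have h3 := en_union (X := X) h2
  have h4 := Finset.card_union_of_disjoint h2
  have h5 : ee X (C ∩ A) (C ∩ B) ≤ ee X A B := ee_mono Finset.inter_subset_right Finset.inter_subset_right
  rw [← h1] at h3 h4
  rcases (C ∩ A).eq_empty_or_nonempty with h6 | h6
  · rw [h6] at h1 h3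
    rw [Finset.empty_union] at h1
    have := hB (C ∩ B) Finset.inter_subset_right (h1 ▸ hne)
    rwa [← h1] at this
  rcases (C ∩ B).eq_empty_or_nonempty with h7 | h7
  · rw [h7] at h1 h3
    rw [Finset.union_empty] at h1
    have := hA (C ∩ A) Finset.inter_subset_right (h1 ▸ hne)
    rwa [← h1] at this
  have := hA (C ∩ A) Finset.inter_subset_right h6
  have := hB (C ∩ B) Finset.inter_subset_right h7
  omega

lemma acyOn_singleton (v : V) : AcyOn X {v} := by
  intro A hA hne
  have : A = {v} := (Finset.subset_singleton_iff.1 hA).resolve_left hne.ne_empty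
  subst this; simp

lemma AcyOn.insert {A : Finset V} {v : V} (hA : AcyOn X A) (h : ee X {v} A ≤ 1) : AcyOn X (insert v A) := by
  by_cases hv : v ∈ A
  · rwa [Finset.insert_eq_of_mem hv]
  · rw [Finset.insert_eq]; exact (acyOn_singleton v).union hA (by simpa using hv) h

lemma acyOn_card_le_two {A : Finset V} (h : A.card ≤ 2) : AcyOn X A := by
  intro C hC hne
  have h1 := Finset.card_le_card hC
  have h2 := hne.card_pos
  have h3 : ∀ u ∈ C, ee X {u} C ≤ C.card - 1 := by
    intro u hu
    rw [ee_single_card, ← Finset.card_erase_of_mem hu]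
    refine Finset.card_le_card fun v hv => ?_
    simp at hv ⊢
    exact ⟨hv.2.ne', hv.1⟩
  have h4 : ee X C C ≤ ∑ u ∈ C, (C.card - 1) := by
    unfold ee at *
    simp only [Finset.sum_singleton] at h3
    exact Finset.sum_le_sum h3
  rw [Finset.sum_const, smul_eq_mul] at h4
  have : C.card = 1 ∨ C.card = 2 := by omega
  rcases this with h | h <;> rw [h] at h4 ⊢ <;> omega

lemma addE_adj {a b u v : V} : (addE X a b).Adj u v ↔ X.Adj u v ∨ (u ≠ v ∧ ((u = a ∧ v = b) ∨ (u = b ∧ v = a))) := Iff.rfl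

lemma le_addE (a b : V) : X ≤ addE X a b := fun _ _ h => Or.inl h

lemma addE_comm (a b : V) : addE X a b = addE X b a := by
  ext u v; simp only [addE_adj]; tauto

lemma ee_addE {a b : V} (hab : a ≠ b) (hn : ¬ X.Adj a b) (A B : Finset V) :
    ee (addE X a b) A B = ee X A B + (if a ∈ A ∧ b ∈ B then 1 else 0) + (if b ∈ A ∧ a ∈ B then 1 else 0) := by
  have h : ∀ u v, ad (addE X a b) u v = ad X u v + (if u = a ∧ v = b then 1 else 0) + (if u = b ∧ v = a then 1 else 0) := by
    intro u v
    unfold ad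
    simp only [addE_adj]
    by_cases h1 : u = a ∧ v = b
    · obtain ⟨rfl, rfl⟩ := h1; simp [hab, hn]
    · by_cases h2 : u = b ∧ v = a
      · obtain ⟨rfl, rfl⟩ := h2; have hn' : ¬ X.Adj u v := fun k => hn k.symm
        simp [hab, hab.symm, hn']
      · simp [h1, h2]
  unfold ee
  simp only [h, Finset.sum_add_distrib]
  congr 1
  · congr 1
    rw [← Finset.sum_product', Finset.sum_ite, Finset.sum_const_zero, add_zero, Finset.sum_const, smul_eq_mul, mul_one]
    split_ifs with h1
    · rw [Finset.card_eq_one]; refine ⟨(a, b), ?_⟩; ext ⟨x, y⟩; simp; grind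
    · rw [Finset.card_eq_zero]; ext ⟨x, y⟩; simp; grind
  · rw [← Finset.sum_product', Finset.sum_ite, Finset.sum_const_zero, add_zero, Finset.sum_const, smul_eq_mul, mul_one]
    split_ifs with h1
    · rw [Finset.card_eq_one]; refine ⟨(b, a), ?_⟩; ext ⟨x, y⟩; simp; grind
    · rw [Finset.card_eq_zero]; ext ⟨x, y⟩; simp; grind

lemma Sup.symm {P : Finset V} {z a b : V} (h : Sup X P z a b) : Sup X P z b a :=
  ⟨h.hz, h.hb, h.ha, h.hab.symm, h.zb, h.za, fun k => h.nab k.symm, fun v hv k => (h.only v hv k).symm⟩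

lemma Sup.ee_z {P : Finset V} {z a b : V} (h : Sup X P z a b) {A : Finset V} (hA : A ⊆ P) :
    ee X {z} A = (if a ∈ A then 1 else 0) + (if b ∈ A then 1 else 0) := by
  have h0 := h.hab
  rw [ee_single_card]
  have : A.filter (fun v => X.Adj z v) = A.filter (fun v => v = a) ∪ A.filter (fun v => v = b) := by
    ext v; simp only [Finset.mem_filter, Finset.mem_union]
    constructor
    · rintro ⟨h1, h2⟩; rcases h.only v (hA h1) h2 with h3 | h3 <;> subst h3 <;> simp [h1]
    · rintro (⟨h1, rfl⟩ | ⟨h1, rfl⟩)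
      · exact ⟨h1, h.za⟩
      · exact ⟨h1, h.zb⟩
  rw [this, Finset.card_union_of_disjoint]
  · have key : ∀ c, (A.filter (fun v => v = c)).card = if c ∈ A then 1 else 0 := by
      intro c
      have : A.filter (fun v => v = c) = if c ∈ A then {c} else ∅ := by
        ext x; split_ifs <;> simp <;> grind
      rw [this]; split_ifs <;> simp
    rw [key, key]
  · rw [Finset.disjoint_left]; intro x; simp; rintro _ rfl _; exact h0

lemma Sup.ne_za {P : Finset V} {z a b : V} (h : Sup X P z a b) : a ≠ z := h.za.ne'
lemma Sup.ne_zb {P : Finset V} {z a b : V} (h : Sup X P z a b) : b ≠ z := h.zb.ne'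

lemma Sup.en {P : Finset V} {z a b : V} (h : Sup X P z a b) : en X P = en (addE X a b) (P.erase z) + 1 := by
  have h1 := en_insert (X := X) (Finset.notMem_erase z P)
  rw [Finset.insert_erase h.hz, h.ee_z (Finset.erase_subset _ _)] at h1
  have h2 := ee_self (X := addE X a b) (P.erase z)
  rw [ee_addE h.hab h.nab, ee_self] at h2
  simp [h.ha, h.hb, h.ne_za, h.ne_zb] at h1 h2
  omega

lemma Sup.deg {P : Finset V} {z a b v : V} (h : Sup X P z a b) (hv : v ∈ P) (hvz : v ≠ z) :
    ee (addE X a b) {v} (P.erase z) = ee X {v} P := by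
  have h1 := ee_insert_right (X := X) (C := {v}) (Finset.notMem_erase z P)
  rw [Finset.insert_erase h.hz, ee_comm {v} {z}, h.ee_z (by simpa using hv)] at h1
  rw [ee_addE h.hab h.nab, h1]
  have h3 := h.ha; have h4 := h.hb; have h5 := h.ne_za; have h6 := h.ne_zb; have h7 := h.hab
  simp [h3, h4, h5, h6, eq_comm]
  omega

lemma Sup.ec2 [Fintype V] {P : Finset V} {z a b : V} (h : Sup X P z a b) (hX : EC2 X P) :
    EC2 (addE X a b) (P.erase z) := by
  intro Y hY hne hneq
  have hzY : z ∉ Y := fun hh => by simpa using hY hh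
  have hYP : Y ⊆ P := hY.trans (Finset.erase_subset _ _)
  have e1 : P \ Y = insert z ((P.erase z) \ Y) := by
    ext x; simp; by_cases hx : x = z
    · subst hx; simp [hzY, h.hz]
    · simp [hx]
  have e2 : P \ (insert z Y) = (P.erase z) \ Y := by
    ext x; simp; tauto
  have c1 := hX Y hYP hne (by rintro rfl; exact hzY h.hz)
  have c2 := hX (insert z Y) (by intro x hx; rcases Finset.mem_insert.1 hx with rfl | hx; exacts [h.hz, hYP hx]) (by simp)
    (by rintro rfl; apply hneq; rw [Finset.erase_insert hzY])
  rw [e1, ee_insert_right (by simp), ee_comm Y {z}, h.ee_z hYP] at c1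
  rw [e2, ee_insert_left hzY, h.ee_z (Finset.sdiff_subset.trans (Finset.erase_subset _ _))] at c2
  rw [ee_addE h.hab h.nab]
  have h3 := h.ha; have h4 := h.hb; have h5 := h.ne_za; have h6 := h.ne_zb; have h7 := h.hab
  by_cases ha : a ∈ Y <;> by_cases hb : b ∈ Y <;> simp [ha, hb, h3, h4, h5, h6] at c1 c2 ⊢ <;> omega

/-- suppress lemma for acyclicity -/
lemma Sup.acy {P Q : Finset V} {z a b : V} (h : Sup X P z a b) (hQ : Q ⊆ P)
    (hX : AcyOn (addE X a b) (Q.erase z)) : AcyOn X Q := by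
  rw [acyOn_iff] at *
  intro A hA hne
  by_cases hz : z ∈ A
  · have h1 := en_insert (X := X) (Finset.notMem_erase z A)
    rw [Finset.insert_erase hz, h.ee_z ((Finset.erase_subset _ _).trans (hA.trans hQ))] at h1
    have h2 := ee_self (X := addE X a b) (A.erase z)
    rw [ee_addE h.hab h.nab, ee_self] at h2
    have h3 := Finset.card_erase_add_one hz
    rcases (A.erase z).eq_empty_or_nonempty with h4 | h4
    · rw [h4] at h1 h3
      have h5 : A.card = 1 := by simpa using h3.symm
      have : InducedForest.en X (∅ : Finset V) = 0 := by simp [InducedForest.en]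
      simp [this] at h1; omega
    · have := hX (A.erase z) (Finset.erase_subset_erase _ hA) h4
      simp only [Finset.mem_erase, ne_eq, h.ne_za, h.ne_zb, not_false_eq_true, true_and] at h1 h2
      by_cases ha : a ∈ A <;> by_cases hb : b ∈ A <;> simp [ha, hb] at h1 h2 <;> omega
  · have := hX A (fun x hx => by simp; exact ⟨fun hh => hz (hh ▸ hx), hA hx⟩) hne
    have h2 := ee_mono_graph (le_addE (X := X) a b) A A
    rw [ee_self, ee_self] at h2
    omega

variable [Fintype V]

lemma acyclic_transfer {W W' : Type} {A : SimpleGraph W} {B : SimpleGraph W'} (h : B.IsAcyclic) (f : W → W')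
    (hf : Function.Injective f) (hab : ∀ a b, A.Adj a b → B.Adj (f a) (f b)) : A.IsAcyclic :=
  h.comap ⟨f, fun {a b} => hab a b⟩ hf

lemma fv_exists (X : SimpleGraph V) (P : Finset V) : ∃ S ⊆ P, AcyOn X (P \ S) ∧ S.card = fv X P := by
  have := Nat.sInf_mem (s := {n : ℕ | ∃ S ⊆ P, AcyOn X (P \ S) ∧ S.card = n})
    ⟨P.card, P, subset_rfl, by rw [Finset.sdiff_self]; exact acyOn_empty, rfl⟩
  exact this

lemma fv_le {P S : Finset V} (h : AcyOn X (P \ S)) : fv X P ≤ S.card := by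
  calc fv X P ≤ (P ∩ S).card := by
        unfold fv
        refine Nat.sInf_le ⟨P ∩ S, Finset.inter_subset_left, ?_, rfl⟩
        rwa [Finset.sdiff_inter_self_left]
    _ ≤ _ := Finset.card_le_card Finset.inter_subset_right

lemma Sup.fv {P : Finset V} {z a b : V} (h : Sup X P z a b) : fv X P ≤ fv (addE X a b) (P.erase z) := by
  obtain ⟨S, h1, h2, h3⟩ := fv_exists (addE X a b) (P.erase z)
  rw [← h3]
  refine fv_le (h.acy Finset.sdiff_subset ?_)
  refine h2.mono ?_
  intro x; simp; tauto

lemma fv_union_le {A B : Finset V} (hd : Disjoint A B) (h : ee X A B ≤ 1) : fv X (A ∪ B) ≤ fv X A + fv X B := by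
  obtain ⟨S, h1, h2, h3⟩ := fv_exists X A
  obtain ⟨T, h4, h5, h6⟩ := fv_exists X B
  have : fv X (A ∪ B) ≤ (S ∪ T).card := by
    apply fv_le
    refine (h2.union h5 (hd.mono Finset.sdiff_subset Finset.sdiff_subset) ((ee_mono Finset.sdiff_subset Finset.sdiff_subset).trans h)).mono ?_
    intro x; simp; tauto
  have := Finset.card_union_le S T
  omega

lemma fvs_induce (X : SimpleGraph V) (P : Finset V) : fvs (X.induce (P : Set V)) = fv X P := by
  apply le_antisymm
  · obtain ⟨S, h1, h2, h3⟩ := fv_exists X P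
    refine Nat.sInf_le ⟨{x | x.1 ∈ S}, ?_, ?_⟩
    · unfold IsFVS
      have := acyclic_of_acyOn h2
      refine acyclic_transfer this (fun x => ⟨x.1.1, by exact Finset.mem_coe.2 (Finset.mem_sdiff.2 ⟨x.1.2, x.2⟩)⟩) ?_ (fun a b hab => hab)
      intro a b hab
      exact Subtype.ext (Subtype.ext (by simpa using hab))
    · rw [← h3, ← Set.ncard_coe_finset S, ← Set.ncard_image_of_injective _ Subtype.val_injective]
      congr 1; ext x; simp; intro hx; exact h1 hx
  · have := Nat.sInf_mem (s := {n : ℕ | ∃ S : Set (P : Set V), IsFVS (X.induce (P : Set V)) S ∧ S.ncard = n})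
      ⟨_, Set.univ, by unfold IsFVS; intro v; have := v.2; simp at this, rfl⟩
    obtain ⟨S, h1, h2⟩ := this
    have h2' : S.ncard = fvs (X.induce (P : Set V)) := h2
    rw [← h2']
    have h3 : S.ncard = (Subtype.val '' S).toFinset.card := by
      rw [← Set.ncard_eq_toFinset_card', Set.ncard_image_of_injective _ Subtype.val_injective]
    rw [h3]
    apply fv_le
    apply acyOn_of_acyclic
    unfold IsFVS at h1
    refine acyclic_transfer h1 (fun x => ⟨⟨x.1, by have h1 := x.2; simp at h1 ⊢; exact h1.1⟩, by
      have h1 := x.2; simp at h1 ⊢; exact h1.2 h1.1⟩) ?_ (fun a b hab => hab)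
    intro a b hab
    exact Subtype.ext (congrArg (fun x => x.1.1) hab)

lemma Iso.fvs_le {W W' : Type} [Finite W] [Finite W'] {A : SimpleGraph W} {B : SimpleGraph W'} (f : A ≃g B) : fvs A ≤ fvs B := by
  have := Nat.sInf_mem (s := {n : ℕ | ∃ S : Set W', IsFVS B S ∧ S.ncard = n})
      ⟨_, Set.univ, by unfold IsFVS; intro v; have := v.2; simp at this, rfl⟩
  obtain ⟨S, h1, h2⟩ := this
  have h2' : S.ncard = fvs B := h2
  rw [← h2']
  refine Nat.sInf_le ⟨f ⁻¹' S, ?_, ?_⟩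
  · unfold IsFVS at *
    refine acyclic_transfer h1 (fun x => ⟨f x.1, x.2⟩) ?_ (fun a b hab => f.map_adj_iff.2 hab)
    intro a b hab
    exact Subtype.ext (f.injective (congrArg (fun x => x.1) hab))
  · exact Set.ncard_preimage_of_injective_subset_range f.injective (by simp [f.surjective.range_eq])

lemma Iso.fvs_eq {W W' : Type} [Finite W] [Finite W'] {A : SimpleGraph W} {B : SimpleGraph W'} (f : A ≃g B) : fvs A = fvs B :=
  le_antisymm (Iso.fvs_le f) (Iso.fvs_le f.symm)

lemma fvs_univ (X : SimpleGraph V) : fvs X = fv X Finset.univ := by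
  rw [← fvs_induce]
  refine Iso.fvs_eq ((induceUnivIso X).symm.trans ?_)
  rw [Finset.coe_univ]

lemma ncard_neighborSet (v : V) : (X.neighborSet v).ncard = ee X {v} Finset.univ := by
  rw [ee_single_card, ← Set.ncard_coe_finset]; congr 1; ext; simp

end

open scoped Classical in
/-- walk-free version of the families `F_{i,j}` -/
inductive FF {V : Type} : ℕ → ℕ → SimpleGraph V → Finset V → Prop
  | tri {X : SimpleGraph V} {P : Finset V} (a b c : V) (hab : X.Adj a b) (hbc : X.Adj b c) (hac : X.Adj a c)
      (hP : P = {a, b, c}) : FF 3 0 X P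
  | sub {i j : ℕ} {X : SimpleGraph V} {P : Finset V} {z a b : V} (h : Sup X P z a b)
      (hF : FF i j (addE X a b) (P.erase z)) : FF (i + 1) j X P
  | apex {i j : ℕ} {X : SimpleGraph V} {P : Finset V} {n : V} (hn : n ∈ P) (h3 : ee X {n} (P.erase n) = 3)
      (h2 : ∀ v ∈ P.erase n, X.Adj n v → ee X {v} (P.erase n) = 2) (hF : FF (i + 2) j X (P.erase n)) :
      FF i (j + 1) X P

/-- delete an edge -/
def delE {V : Type} (X : SimpleGraph V) (a b : V) : SimpleGraph V where
  Adj u v := X.Adj u v ∧ ¬ ((u = a ∧ v = b) ∨ (u = b ∧ v = a))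
  symm := ⟨fun u v h => ⟨h.1.symm, by have := h.2; tauto⟩⟩
  loopless := ⟨fun u h => X.loopless.irrefl _ h.1⟩

section
set_option linter.all false
open scoped Classical
variable {V W : Type} {X Y : SimpleGraph V}

lemma delE_adj {a b u v : V} : (delE X a b).Adj u v ↔ X.Adj u v ∧ ¬ ((u = a ∧ v = b) ∨ (u = b ∧ v = a)) := Iff.rfl

lemma ee_image {Y : SimpleGraph W} {P A B : Finset V} (f : V → W) (hf : Set.InjOn f P)
    (hadj : ∀ u ∈ P, ∀ v ∈ P, Y.Adj (f u) (f v) ↔ X.Adj u v) (hA : A ⊆ P) (hB : B ⊆ P) :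
    ee Y (A.image f) (B.image f) = ee X A B := by
  unfold ee
  rw [Finset.sum_image (hf.mono (by exact_mod_cast hA))]
  refine Finset.sum_congr rfl fun u hu => ?_
  rw [Finset.sum_image (hf.mono (by exact_mod_cast hB))]
  refine Finset.sum_congr rfl fun v hv => ?_
  simp [ad, hadj u (hA hu) v (hB hv)]

lemma image_erase_injOn {P : Finset V} {f : V → W} (hf : Set.InjOn f P) {z : V} (hz : z ∈ P) :
    (P.image f).erase (f z) = (P.erase z).image f := by
  ext x; simp only [Finset.mem_erase, Finset.mem_image]
  constructor
  · rintro ⟨h1, y, hy, rfl⟩; exact ⟨y, ⟨fun h => h1 (h ▸ rfl), hy⟩, rfl⟩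
  · rintro ⟨y, ⟨h1, h2⟩, rfl⟩; exact ⟨fun h => h1 (hf h2 hz h), y, h2, rfl⟩

lemma FF.transport {i j : ℕ} {X : SimpleGraph V} {P : Finset V} (h : FF i j X P) :
    ∀ {Y : SimpleGraph W} (f : V → W), Set.InjOn f P →
      (∀ u ∈ P, ∀ v ∈ P, Y.Adj (f u) (f v) ↔ X.Adj u v) → FF i j Y (P.image f) := by
  induction h with
  | @tri X P a b c hab hbc hac hP =>
    intro Y f hf hadj
    subst hP
    refine FF.tri (f a) (f b) (f c) ?_ ?_ ?_ ?_
    · exact (hadj _ (by simp) _ (by simp)).2 hab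
    · exact (hadj _ (by simp) _ (by simp)).2 hbc
    · exact (hadj _ (by simp) _ (by simp)).2 hac
    · ext x; simp [Finset.mem_image, eq_comm]
  | @sub i j X P z a b h hF ih =>
    intro Y f hf hadj
    have ha := h.ha; have hb := h.hb; have hz := h.hz
    refine FF.sub (z := f z) (a := f a) (b := f b) ?_ ?_
    · refine ⟨Finset.mem_image_of_mem _ hz, Finset.mem_image_of_mem _ ha, Finset.mem_image_of_mem _ hb,
        fun k => h.hab (hf ha hb k), (hadj _ hz _ ha).2 h.za, (hadj _ hz _ hb).2 h.zb,
        fun k => h.nab ((hadj _ ha _ hb).1 k), ?_⟩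
      intro v hv hadjv
      obtain ⟨u, hu, rfl⟩ := Finset.mem_image.1 hv
      rcases h.only u hu ((hadj _ hz _ hu).1 hadjv) with rfl | rfl <;> simp
    · rw [image_erase_injOn hf hz]
      refine ih f (hf.mono (by simp [Finset.erase_subset])) ?_
      intro u hu v hv
      have hu' := Finset.mem_of_mem_erase hu
      have hv' := Finset.mem_of_mem_erase hv
      have e1 := hf.eq_iff hu' ha
      have e2 := hf.eq_iff hu' hb
      have e3 := hf.eq_iff hv' ha
      have e4 := hf.eq_iff hv' hb
      have e5 := hf.eq_iff hu' hv'
      rw [addE_adj, addE_adj, hadj u hu' v hv', e1, e2, e3, e4, Ne, e5]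
  | @apex i j X P n hn h3 h2 hF ih =>
    intro Y f hf hadj
    have hs : P.erase n ⊆ P := Finset.erase_subset _ _
    refine FF.apex (n := f n) (Finset.mem_image_of_mem _ hn) ?_ ?_ ?_
    · rw [image_erase_injOn hf hn, ← Finset.image_singleton, ee_image f hf hadj (by simpa) hs, h3]
    · rw [image_erase_injOn hf hn]
      intro v hv hadjv
      obtain ⟨u, hu, rfl⟩ := Finset.mem_image.1 hv
      rw [← Finset.image_singleton, ee_image f hf hadj (by simpa using hs hu) hs]
      exact h2 u hu ((hadj _ hn _ (hs hu)).1 hadjv)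
    · rw [image_erase_injOn hf hn]
      exact ih f (hf.mono (by simp [Finset.erase_subset])) fun u hu v hv => hadj u (hs hu) v (hs hv)

lemma FF.congr {i j : ℕ} {P : Finset V} (h : FF i j X P) (hXY : ∀ u ∈ P, ∀ v ∈ P, Y.Adj u v ↔ X.Adj u v) :
    FF i j Y P := by
  have := h.transport (Y := Y) id (Set.injOn_id _) hXY
  simpa using this

lemma ee_erase_self {P : Finset V} {n : V} (hn : n ∈ P) : ee X {n} P = ee X {n} (P.erase n) := by
  conv_lhs => rw [← Finset.insert_erase hn]
  rw [ee_insert_right (by simp)]; simp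

lemma ee_erase_right {P : Finset V} {v n : V} (hn : n ∈ P) : ee X {v} P = ad X v n + ee X {v} (P.erase n) := by
  conv_lhs => rw [← Finset.insert_erase hn]
  rw [ee_insert_right (by simp)]; simp

lemma FF.counts {i j : ℕ} {P : Finset V} (h : FF i j X P) :
    P.card = 3 * j + i ∧ en X P = 5 * j + i ∧ (∀ v ∈ P, 2 ≤ ee X {v} P ∧ ee X {v} P ≤ 3) ∧ (j = 0 → 3 ≤ i) := by
  induction h with
  | @tri X P a b c hab hbc hac hP =>
    subst hP
    have h1 := hab.ne; have h2 := hbc.ne; have h3 := hac.ne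
    have hc : ({a, b, c} : Finset V).card = 3 := by
      rw [Finset.card_insert_of_notMem, Finset.card_insert_of_notMem] <;> simp [h1, h2, h3]
    refine ⟨by simpa using hc, ?_, ?_, by simp⟩
    · rw [en_insert (by simp [h1, h3]), en_insert (by simp [h2]), ee_insert_right (by simp [h2])]
      simp [ad_eq_one hab, ad_eq_one hbc, ad_eq_one hac, en]
    · intro v hv
      simp only [Finset.mem_insert, Finset.mem_singleton] at hv
      rw [ee_insert_right (by simp [h1, h3]), ee_insert_right (by simp [h2])]
      rcases hv with rfl | rfl | rfl
      · simp [ad_eq_one hab, ad_eq_one hbc, ad_eq_one hac]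
      · simp [ad_eq_one hab.symm, ad_eq_one hbc, ad_eq_one hac]
      · simp [ad_eq_one hab, ad_eq_one hbc.symm, ad_eq_one hac.symm]
  | @sub i j X P z a b h hF ih =>
    obtain ⟨h1, h2, h3, h4⟩ := ih
    refine ⟨?_, ?_, ?_, ?_⟩
    · have := Finset.card_erase_add_one h.hz; omega
    · have := h.en; omega
    · intro v hv
      by_cases hvz : v = z
      · subst hvz
        rw [h.ee_z subset_rfl]; simp [h.ha, h.hb]
      · have := h3 v (Finset.mem_erase.2 ⟨hvz, hv⟩)
        rwa [h.deg hv hvz] at this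
    · intro hj; have := h4 hj; omega
  | @apex i j X P n hn h3 h2 hF ih =>
    obtain ⟨k1, k2, k3, k4⟩ := ih
    refine ⟨?_, ?_, ?_, ?_⟩
    · have := Finset.card_erase_add_one hn; omega
    · have := en_insert (X := X) (Finset.notMem_erase n P)
      rw [Finset.insert_erase hn] at this; omega
    · intro v hv
      by_cases hvz : v = n
      · subst hvz
        rw [ee_erase_self hn]; omega
      · rw [ee_erase_right hn]
        have hve := Finset.mem_erase.2 ⟨hvz, hv⟩
        by_cases hadj : X.Adj n v
        · rw [ad_eq_one hadj.symm, h2 v hve hadj]; simp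
        · rw [ad_eq_zero (fun k => hadj k.symm)]; have := k3 v hve; omega
    · omega

lemma ee_sum_left (A B : Finset V) : ee X A B = ∑ u ∈ A, ee X {u} B := by
  unfold ee; simp

lemma ee_le_of_deg {A B : Finset V} {d : ℕ} (h : ∀ u ∈ A, ee X {u} B ≤ d) : ee X A B ≤ d * A.card := by
  rw [ee_sum_left, mul_comm]
  exact Finset.sum_le_card_nsmul _ _ _ h

lemma FF.le {i j : ℕ} {P : Finset V} (h : FF i j X P) : j ≤ i ∧ 1 ≤ i := by
  obtain ⟨h1, h2, h3, h4⟩ := h.counts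
  have := ee_le_of_deg (fun u hu => (h3 u hu).2)
  rw [ee_self] at this
  omega

/-- edge-critical feedback vertex sets -/
lemma FF.ec {i j : ℕ} {P : Finset V} (h : FF i j X P) : ∀ u ∈ P, ∀ v ∈ P, X.Adj u v →
    ∃ S ⊆ P, S.card ≤ j ∧ AcyOn (delE X u v) (P \ S) := by
  induction h with
  | @tri X P a b c hab hbc hac hP =>
    subst hP
    intro u hu v hv huv
    refine ⟨∅, by simp, by simp, ?_⟩
    rw [Finset.sdiff_empty]
    have h1 := hab.ne; have h2 := hbc.ne; have h3 := hac.ne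
    have key : ∃ w, ({a, b, c} : Finset V) = insert u ({v, w} : Finset V) ∧ w ≠ v := by
      simp only [Finset.mem_insert, Finset.mem_singleton] at hu hv
      have h4 := huv.ne
      rcases hu with rfl | rfl | rfl <;> rcases hv with rfl | rfl | rfl <;> first
        | exact absurd rfl h4
        | (refine ⟨c, ?_, ?_⟩ <;> first | (ext x; simp; try tauto) | assumption | exact Ne.symm (by assumption); done)
        | (refine ⟨b, ?_, ?_⟩ <;> first | (ext x; simp; try tauto) | assumption | exact Ne.symm (by assumption); done)
        | (refine ⟨a, ?_, ?_⟩ <;> first | (ext x; simp; try tauto) | assumption | exact Ne.symm (by assumption); done)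
    obtain ⟨w, hw, hwv⟩ := key
    rw [hw]
    refine (acyOn_card_le_two (Finset.card_le_two)).insert ?_
    rw [ee_insert_right (by simpa using hwv.symm)]
    have : ¬ (delE X u v).Adj u v := by simp [delE_adj]
    simp [ad_eq_zero this, ad_le]
  | @sub i j X P z a b h hF ih =>
    intro u hu v hv huv
    have key : ∀ a b, Sup X P z a b → (∀ u ∈ P.erase z, ∀ v ∈ P.erase z, (addE X a b).Adj u v →
        ∃ S ⊆ P.erase z, S.card ≤ j ∧ AcyOn (delE (addE X a b) u v) (P.erase z \ S)) →
        ∃ S ⊆ P, S.card ≤ j ∧ AcyOn (delE X z a) (P \ S) := by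
      intro a b h ih
      obtain ⟨S, h1, h2, h3⟩ := ih a (by simp [h.ha, h.ne_za]) b (by simp [h.hb, h.ne_zb])
        (Or.inr ⟨h.hab, Or.inl ⟨rfl, rfl⟩⟩)
      refine ⟨S, h1.trans (Finset.erase_subset _ _), h2, ?_⟩
      have e : P \ S ⊆ insert z (P.erase z \ S) := by
        intro x; simp; tauto
      refine AcyOn.mono (AcyOn.insert (AcyOn.anti h3 ?_) ?_) e
      · intro p hp q hq hpq
        refine ⟨Or.inl hpq.1, ?_⟩
        rintro (⟨rfl, rfl⟩ | ⟨rfl, rfl⟩)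
        · exact h.nab hpq.1
        · exact h.nab hpq.1.symm
      · rw [ee_single_card, Finset.card_le_one]
        intro p hp q hq
        simp only [Finset.mem_filter, Finset.mem_sdiff, Finset.mem_erase, delE_adj] at hp hq
        have := h.only p hp.1.1.2 hp.2.1
        have := h.only q hq.1.1.2 hq.2.1
        grind
    have delc : ∀ p q, delE X p q = delE X q p := by
      intro p q; ext x y; simp only [delE_adj]; tauto
    by_cases huz : u = z
    · subst huz
      rcases h.only v hv huv with rfl | rfl
      · exact key _ _ h ih
      · exact key _ _ h.symm (by rw [addE_comm]; exact ih)
    by_cases hvz : v = z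
    · subst hvz
      rw [delc]
      rcases h.only u hu huv.symm with rfl | rfl
      · exact key _ _ h ih
      · exact key _ _ h.symm (by rw [addE_comm]; exact ih)
    obtain ⟨S, h1, h2, h3⟩ := ih u (by simp [huz, hu]) v (by simp [hvz, hv]) (Or.inl huv)
    refine ⟨S, h1.trans (Finset.erase_subset _ _), h2, ?_⟩
    have hs : Sup (delE X u v) P z a b := by
      refine ⟨h.hz, h.ha, h.hb, h.hab, ⟨h.za, by tauto⟩, ⟨h.zb, by tauto⟩, fun k => h.nab k.1, fun w hw k => h.only w hw k.1⟩
    refine hs.acy Finset.sdiff_subset ?_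
    have e : (P \ S).erase z ⊆ P.erase z \ S := by intro x; simp; tauto
    refine AcyOn.mono (AcyOn.anti h3 ?_) e
    intro p hp q hq hpq
    rcases hpq with hpq | hpq
    · exact ⟨Or.inl hpq.1, hpq.2⟩
    · refine ⟨Or.inr hpq, ?_⟩
      have h8 := h.nab
      have h9 : ¬ X.Adj b a := fun k => h8 k.symm
      have h10 := huv.symm
      rintro (⟨rfl, rfl⟩ | ⟨rfl, rfl⟩) <;> rcases hpq with ⟨_, ⟨rfl, rfl⟩ | ⟨rfl, rfl⟩⟩ <;> contradiction
  | @apex i j X P n hn h3 h2 hF ih =>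
    have key : ∀ v ∈ P.erase n, X.Adj n v → ∃ S ⊆ P, S.card ≤ j + 1 ∧ AcyOn (delE X n v) (P \ S) := by
      intro v hv hnv
      have : ∃ a ∈ P.erase n, X.Adj n a ∧ a ≠ v := by
        rw [ee_single_card] at h3
        obtain ⟨a, ha, hav⟩ := Finset.exists_mem_ne (by omega : 1 < ((P.erase n).filter fun v => X.Adj n v).card) v
        simp only [Finset.mem_filter] at ha
        exact ⟨a, ha.1, ha.2, hav⟩
      obtain ⟨a, ha, hna, hav⟩ := this
      have : ∃ b ∈ P.erase n, X.Adj a b := by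
        have := h2 a ha hna
        rw [ee_single_card] at this
        obtain ⟨b, hb, -⟩ := Finset.exists_mem_ne (by omega : 1 < ((P.erase n).filter fun v => X.Adj a v).card) v
        simp only [Finset.mem_filter] at hb
        exact ⟨b, hb.1, hb.2⟩
      obtain ⟨b, hb, hab⟩ := this
      obtain ⟨S, k1, k2, k3⟩ := ih a ha b hb hab
      refine ⟨insert a S, ?_, (Finset.card_insert_le _ _).trans (by omega), ?_⟩
      · intro x hx
        rcases Finset.mem_insert.1 hx with rfl | hx
        · exact Finset.mem_of_mem_erase ha
        · exact Finset.mem_of_mem_erase (k1 hx)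
      have e : P \ insert a S ⊆ insert n (P.erase n \ insert a S) := by
        intro x; simp; tauto
      refine AcyOn.mono (AcyOn.insert (AcyOn.anti (k3.mono ?_) ?_) ?_) e
      · intro x; simp; tauto
      · intro p hp q hq hpq
        simp at hp hq
        exact ⟨hpq.1, by tauto⟩
      · have hsub : (P.erase n \ insert a S).filter (fun w => (delE X n v).Adj n w) ⊆
            (((P.erase n).filter fun v => X.Adj n v).erase a).erase v := by
          intro x; simp [delE_adj]; tauto
        have hc := Finset.card_le_card hsub
        rw [← ee_single_card, Finset.card_erase_of_mem, Finset.card_erase_of_mem, ← ee_single_card, h3] at hc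
        · exact hc
        · simp only [Finset.mem_filter]; exact ⟨ha, hna⟩
        · simp only [Finset.mem_filter, Finset.mem_erase]; exact ⟨hav.symm, Finset.mem_erase.1 hv, hnv⟩
    intro u hu v hv huv
    by_cases hun : u = n
    · subst hun; exact key v (by simp [hv, huv.ne']) huv
    by_cases hvn : v = n
    · subst hvn
      have delc : ∀ p q, delE X p q = delE X q p := by
        intro p q; ext x y; simp only [delE_adj]; tauto
      rw [delc]; exact key u (by simp [hu, huv.ne]) huv.symm
    obtain ⟨S, k1, k2, k3⟩ := ih u (by simp [hun, hu]) v (by simp [hvn, hv]) huv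
    refine ⟨insert n S, ?_, (Finset.card_insert_le _ _).trans (by omega), ?_⟩
    · intro x hx
      rcases Finset.mem_insert.1 hx with rfl | hx
      · exact hn
      · exact Finset.mem_of_mem_erase (k1 hx)
    · refine k3.mono ?_
      intro x; simp; tauto

/-- feedback vertex set of size `j+1` through a given vertex -/
lemma FF.ec' {i j : ℕ} {P : Finset V} (h : FF i j X P) {a : V} (ha : a ∈ P) :
    ∃ S ⊆ P, a ∈ S ∧ S.card ≤ j + 1 ∧ AcyOn X (P \ S) := by
  obtain ⟨b, hb⟩ : ∃ b, b ∈ P.filter fun v => X.Adj a v := by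
    have := (h.counts.2.2.1 a ha).1
    rw [ee_single_card] at this
    exact Finset.card_pos.1 (by omega)
  simp only [Finset.mem_filter] at hb
  obtain ⟨S, h1, h2, h3⟩ := h.ec a ha b hb.1 hb.2
  refine ⟨insert a S, Finset.insert_subset ha h1, by simp, (Finset.card_insert_le _ _).trans (by omega), ?_⟩
  refine AcyOn.anti (h3.mono ?_) ?_
  · intro x; simp; tauto
  · intro p hp q hq hpq
    simp at hp hq
    exact ⟨hpq, by tauto⟩

end

/-- adjacency of the cycle `0,1,...,n-1` -/
def CN (n p q : ℕ) : Prop := q = p + 1 ∨ p = q + 1 ∨ (p = 0 ∧ q + 1 = n) ∨ (q = 0 ∧ p + 1 = n)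

/-- `f` enumerates `P` cyclically -/
def CycEnum {V : Type} (n : ℕ) (X : SimpleGraph V) (P : Finset V) (f : ℕ → V) : Prop :=
  (∀ x, x ∈ P ↔ ∃ p < n, f p = x) ∧ (∀ p < n, ∀ q < n, f p = f q → p = q) ∧
    ∀ p < n, ∀ q < n, X.Adj (f p) (f q) ↔ CN n p q

section
set_option linter.all false
open scoped Classical
variable {V W : Type} {X Y : SimpleGraph V}

lemma deg2_nbrs {P : Finset V} {x : V} (h : ee X {x} P = 2) :
    ∃ p ∈ P, ∃ q ∈ P, p ≠ q ∧ X.Adj x p ∧ X.Adj x q ∧ ∀ v ∈ P, X.Adj x v → v = p ∨ v = q := by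
  rw [ee_single_card, Finset.card_eq_two] at h
  obtain ⟨p, q, hpq, h⟩ := h
  have h1 : p ∈ P.filter fun v => X.Adj x v := by rw [h]; simp
  have h2 : q ∈ P.filter fun v => X.Adj x v := by rw [h]; simp
  simp only [Finset.mem_filter] at h1 h2
  refine ⟨p, h1.1, q, h2.1, hpq, h1.2, h2.2, ?_⟩
  intro v hv hxv
  have : v ∈ P.filter fun v => X.Adj x v := by simp only [Finset.mem_filter]; exact ⟨hv, hxv⟩
  rw [h] at this; simpa using this

lemma FF.tri_of {P : Finset V} (h : FF 3 0 X P) : ∃ a b c, X.Adj a b ∧ X.Adj b c ∧ X.Adj a c ∧ P = {a, b, c} := by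
  generalize hi : 3 = i at h
  generalize hj : 0 = j at h
  cases h with
  | tri a b c h1 h2 h3 h4 => exact ⟨a, b, c, h1, h2, h3, h4⟩
  | sub h hF => have := hF.counts.2.2.2 hj.symm; omega
  | apex => omega

set_option maxHeartbeats 1000000 in
lemma FF.U {i j : ℕ} {P : Finset V} (h : FF i j X P) : ∀ x ∈ P, ee X {x} P = 2 → ¬ (i = 3 ∧ j = 0) →
    ∃ a b, Sup X P x a b ∧ FF (i - 1) j (addE X a b) (P.erase x) := by
  induction h with
  | @tri X P a b c hab hbc hac hP => intro x _ _ h; simp at h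
  | @sub i j X P z a b h hF ih =>
    intro x hx hx2 _
    by_cases hxz : x = z
    · subst hxz; exact ⟨a, b, h, by simpa using hF⟩
    have hxe : x ∈ P.erase z := by simp [hxz, hx]
    by_cases h30 : i = 3 ∧ j = 0
    · obtain ⟨rfl, rfl⟩ := h30
      have hF' := hF
      have key : ∀ a b, Sup X P z a b → FF 3 0 (addE X a b) (P.erase z) →
          ∃ c, c ≠ a ∧ c ≠ b ∧ c ≠ z ∧ X.Adj a c ∧ X.Adj b c ∧ ¬ X.Adj z c ∧ P = {z, a, b, c} := by
        intro a b h hF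
        obtain ⟨u, v, w, h1, h2, h3, h4⟩ := hF.tri_of
        have ha : a ∈ P.erase z := by simp [h.ne_za, h.ha]
        have hb : b ∈ P.erase z := by simp [h.ne_zb, h.hb]
        have hab := h.hab
        have : ∃ c, P.erase z = {a, b, c} ∧ (addE X a b).Adj a c ∧ (addE X a b).Adj b c := by
          rw [h4] at ha hb ⊢
          simp only [Finset.mem_insert, Finset.mem_singleton] at ha hb
          have s1 := h1.symm; have s2 := h2.symm; have s3 := h3.symm
          rcases ha with rfl | rfl | rfl <;> rcases hb with rfl | rfl | rfl <;> first
            | exact absurd rfl hab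
            | (refine ⟨w, ?_, ?_, ?_⟩ <;> first | (ext x; simp; try tauto) | assumption; done)
            | (refine ⟨v, ?_, ?_, ?_⟩ <;> first | (ext x; simp; try tauto) | assumption; done)
            | (refine ⟨u, ?_, ?_, ?_⟩ <;> first | (ext x; simp; try tauto) | assumption; done)
        obtain ⟨c, hc, hac, hbc⟩ := this
        have hcP : c ∈ P.erase z := by rw [hc]; simp
        simp only [Finset.mem_erase] at hcP
        have n1 := hac.ne; have n2 := hbc.ne
        refine ⟨c, n1.symm, n2.symm, hcP.1, ?_, ?_, ?_, ?_⟩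
        · rcases hac with k | k
          · exact k
          · grind
        · rcases hbc with k | k
          · exact k
          · grind
        · intro k; have := h.only c hcP.2 k; grind
        · rw [← Finset.insert_erase h.hz, hc]
      have case1 : ∀ a b, Sup X P z a b → FF 3 0 (addE X a b) (P.erase z) → x = a →
          ∃ a b, Sup X P x a b ∧ FF (3 + 1 - 1) 0 (addE X a b) (P.erase x) := by
        rintro a b h hF rfl
        obtain ⟨c, h1, h2, h3, h4, h5, h6, h7⟩ := key _ _ h hF
        refine ⟨z, c, ⟨hx, h.hz, by rw [h7]; simp, h3.symm, h.za.symm, h4, h6, ?_⟩, ?_⟩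
        · intro v hv hxv
          rw [h7] at hv; simp only [Finset.mem_insert, Finset.mem_singleton] at hv
          rcases hv with rfl | rfl | rfl | rfl
          · left; rfl
          · exact absurd rfl hxv.ne
          · exact absurd hxv h.nab
          · right; rfl
        · refine FF.tri z b c (Or.inl h.zb) (Or.inl h5) (Or.inr ⟨h3.symm, Or.inl ⟨rfl, rfl⟩⟩) ?_
          have := h.hab; have := h.ne_za
          rw [h7]; ext y; simp; grind
      obtain ⟨c, h1, h2, h3, h4, h5, h6, h7⟩ := key _ _ h hF
      rw [h7] at hx
      simp only [Finset.mem_insert, Finset.mem_singleton] at hx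
      rcases hx with rfl | rfl | rfl | rfl
      · exact absurd rfl hxz
      · exact case1 _ _ h hF rfl
      · exact case1 _ _ h.symm (by rw [addE_comm]; exact hF) rfl
      · refine ⟨a, b, ⟨by rw [h7]; simp, h.ha, h.hb, h.hab, h4.symm, h5.symm, h.nab, ?_⟩, ?_⟩
        · intro v hv hxv
          rw [h7] at hv; simp only [Finset.mem_insert, Finset.mem_singleton] at hv
          rcases hv with rfl | rfl | rfl | rfl
          · exact absurd hxv.symm h6
          · left; rfl
          · right; rfl
          · exact absurd rfl hxv.ne
        · refine FF.tri z a b (Or.inl h.za) (Or.inr ⟨h.hab, Or.inl ⟨rfl, rfl⟩⟩) (Or.inl h.zb) ?_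
          rw [h7]; ext y; simp; grind
    have ih' := ih x hxe (by rw [h.deg hx hxz, hx2]) h30
    have hi1 : 1 ≤ i := hF.le.2
    have case1 : ∀ a b p q, Sup X P z a b → FF i j (addE X a b) (P.erase z) → x = a →
        Sup (addE X a b) (P.erase z) x p q → q = b →
          ∃ a b, Sup X P x a b ∧ FF (i + 1 - 1) j (addE X a b) (P.erase x) := by
      rintro a b p q h hF rfl hs rfl
      have hp := hs.ha
      simp only [Finset.mem_erase] at hp
      have hxp : X.Adj x p := by
        rcases hs.za with k | k
        · exact k
        · have := hs.hab; grind
      have only' : ∀ v ∈ P, X.Adj x v → v = p ∨ v = z := by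
        intro v hv hxv
        by_cases hvz : v = z
        · right; exact hvz
        · left
          rcases hs.only v (by simp [hv, hvz]) (Or.inl hxv) with k | rfl
          · exact k
          · exact absurd hxv h.nab
      have npz : ¬ X.Adj p z := by
        intro k
        rcases h.only p hp.2 k.symm with rfl | rfl
        · exact absurd rfl hxp.ne
        · exact hs.hab rfl
      refine ⟨p, z, ⟨hx, hp.2, h.hz, hp.1, hxp, h.za.symm, npz, only'⟩, ?_⟩
      rw [Nat.add_sub_cancel]
      have := hF.transport (Y := addE X p z) (fun u => if u = x then z else u) ?_ ?_
      · convert this using 1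
        ext y; simp only [Finset.mem_erase, Finset.mem_image]
        constructor
        · rintro ⟨k1, k2⟩
          by_cases hyz : y = z
          · exact ⟨x, ⟨hxz, hx⟩, by simp [hyz]⟩
          · exact ⟨y, ⟨hyz, k2⟩, by simp [k1]⟩
        · rintro ⟨u, ⟨k1, k2⟩, rfl⟩
          split_ifs with k3
          · exact ⟨fun k => hxz k.symm, h.hz⟩
          · exact ⟨k3, k2⟩
      · intro u hu v hv huv
        simp only [Finset.coe_erase, Set.mem_diff, Set.mem_singleton_iff] at hu hv
        simp only at huv
        grind
      · intro u hu v hv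
        simp only [Finset.mem_erase] at hu hv
        have zonly : ∀ v ∈ P, X.Adj z v → v = x ∨ v = q := h.only
        have hzb := h.zb
        have hzbs := h.zb.symm
        have hxps := hxp.symm
        have l1 : ¬ X.Adj x x := X.loopless.irrefl x
        have l2 : ¬ X.Adj z z := X.loopless.irrefl z
        by_cases hux : u = x
        · subst hux
          by_cases hvx : v = u
          · subst hvx; simp [addE_adj]
          · simp only [if_true, if_neg hvx, addE_adj]
            have := only' v hv.2; have := zonly v hv.2
            grind
        · by_cases hvx : v = x
          · subst hvx
            simp only [if_true, if_neg hux, addE_adj]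
            have h1 := only' u hu.2; have h2 := zonly u hu.2
            rw [X.adj_comm] at h1 h2
            grind
          · simp only [if_neg hux, if_neg hvx, addE_adj]
            grind
    obtain ⟨p, q, hs, hF'⟩ := ih'
    by_cases hxa : x = a
    · have hb : b = p ∨ b = q := hs.only b (by simp [h.hb, h.ne_zb]) (Or.inr ⟨hxa ▸ h.hab, Or.inl ⟨hxa, rfl⟩⟩)
      rcases hb with hb | hb
      · exact case1 _ _ _ _ h hF hxa hs.symm hb.symm
      · exact case1 _ _ _ _ h hF hxa hs hb.symm
    by_cases hxb : x = b
    · have hb : a = p ∨ a = q := hs.only a (by simp [h.ha, h.ne_za]) (Or.inr ⟨hxb ▸ h.hab.symm, Or.inr ⟨hxb, rfl⟩⟩)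
      rw [addE_comm] at hs hF
      rcases hb with hb | hb
      · exact case1 _ _ _ _ h.symm hF hxb hs.symm hb.symm
      · exact case1 _ _ _ _ h.symm hF hxb hs hb.symm
    have hp := hs.ha
    have hq := hs.hb
    simp only [Finset.mem_erase] at hp hq
    refine ⟨p, q, ⟨hx, hp.2, hq.2, hs.hab, ?_, ?_, fun k => hs.nab (Or.inl k), ?_⟩, ?_⟩
    · rcases hs.za with k | k
      · exact k
      · tauto
    · rcases hs.zb with k | k
      · exact k
      · tauto
    · intro v hv hxv
      by_cases hvz : v = z
      · subst hvz; have := h.only x hx hxv.symm; tauto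
      · exact hs.only v (by simp [hv, hvz]) (Or.inl hxv)
    · rw [show i + 1 - 1 = (i - 1) + 1 by omega]
      refine FF.sub (z := z) (a := a) (b := b) ⟨?_, ?_, ?_, h.hab, Or.inl h.za, Or.inl h.zb, ?_, ?_⟩ ?_
      · simp [Ne.symm hxz, h.hz]
      · simp [Ne.symm hxa, h.ha]
      · simp [Ne.symm hxb, h.hb]
      · rintro (k | ⟨k1, k2⟩)
        · exact h.nab k
        · apply hs.nab
          refine Or.inr ⟨hs.hab, ?_⟩
          tauto
      · intro v hv k
        rcases k with k | k
        · exact h.only v (Finset.mem_of_mem_erase hv) k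
        · exfalso; grind
      · rw [Finset.erase_right_comm]
        refine hF'.congr ?_
        intro u _ v _
        simp only [addE_adj]; exact or_right_comm
  | @apex i j X P n hn h3 h2 hF ih =>
    intro x hx hx2 _
    have hxn : x ≠ n := by
      rintro rfl; rw [ee_erase_self hx] at hx2; omega
    have hxe : x ∈ P.erase n := by simp [hxn, hx]
    have hnadj : ¬ X.Adj n x := by
      intro k
      have := h2 x hxe k
      rw [ee_erase_right hn, ad_eq_one k.symm] at hx2; omega
    have hx2' : ee X {x} (P.erase n) = 2 := by
      rw [ee_erase_right hn, ad_eq_zero (fun k => hnadj k.symm)] at hx2; omega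
    have h30 : ¬ (i + 2 = 3 ∧ j = 0) := by
      rintro ⟨e1, e2⟩
      have hc := hF.counts.1
      rw [ee_single_card] at h3
      have h4 : (P.erase n).filter (fun v => X.Adj n v) = P.erase n :=
        Finset.eq_of_subset_of_card_le (Finset.filter_subset _ _) (by omega)
      have : x ∈ (P.erase n).filter (fun v => X.Adj n v) := by rw [h4]; exact hxe
      simp only [Finset.mem_filter] at this
      exact hnadj this.2
    obtain ⟨p, q, hs, hF'⟩ := ih x hxe hx2' h30
    have hp := hs.ha
    have hq := hs.hb
    simp only [Finset.mem_erase] at hp hq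
    have hi : j + 1 ≤ i := (FF.apex hn h3 h2 hF).le.1
    refine ⟨p, q, ⟨hx, hp.2, hq.2, hs.hab, hs.za, hs.zb, hs.nab, ?_⟩, ?_⟩
    · intro v hv k
      refine hs.only v ?_ k
      simp only [Finset.mem_erase]
      refine ⟨?_, hv⟩
      rintro rfl; exact hnadj k.symm
    · refine FF.apex (n := n) (by simp [Ne.symm hxn, hn]) ?_ ?_ ?_
      · rw [ee_addE hs.hab hs.nab, Finset.erase_right_comm]
        have := ee_erase_right (X := X) (v := n) hxe
        rw [ad_eq_zero hnadj, h3] at this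
        simp [Ne.symm hp.1, hp.1, hq.1]
        omega
      · intro v hv hadj
        rw [Finset.erase_right_comm] at hv ⊢
        have hv' := Finset.mem_erase.1 hv
        rw [hs.deg hv'.2 hv'.1]
        apply h2 v hv'.2
        rcases hadj with k | k
        · exact k
        · exfalso; grind
      · rw [Finset.erase_right_comm]
        convert hF' using 1
        omega

lemma CycEnum.ff : ∀ (n : ℕ), 3 ≤ n → ∀ {X : SimpleGraph V} {P : Finset V} {f : ℕ → V}, CycEnum n X P f → FF n 0 X P := by
  intro n hn
  induction n, hn using Nat.le_induction with
  | base =>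
    rintro X P f ⟨h1, h2, h3⟩
    refine FF.tri (f 0) (f 1) (f 2) ?_ ?_ ?_ ?_
    · exact (h3 0 (by omega) 1 (by omega)).2 (by unfold CN; omega)
    · exact (h3 1 (by omega) 2 (by omega)).2 (by unfold CN; omega)
    · exact (h3 0 (by omega) 2 (by omega)).2 (by unfold CN; omega)
    · ext x; rw [h1]; simp
      constructor
      · rintro ⟨p, hp, rfl⟩
        interval_cases p <;> simp
      · rintro (rfl | rfl | rfl)
        exacts [⟨0, by omega, rfl⟩, ⟨1, by omega, rfl⟩, ⟨2, by omega, rfl⟩]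
  | succ n hn ih =>
    rintro X P f ⟨h1, h2, h3⟩
    refine FF.sub (z := f n) (a := f (n - 1)) (b := f 0) ⟨?_, ?_, ?_, ?_, ?_, ?_, ?_, ?_⟩ (ih (f := f) ⟨?_, ?_, ?_⟩)
    · exact (h1 _).2 ⟨n, by omega, rfl⟩
    · exact (h1 _).2 ⟨n - 1, by omega, rfl⟩
    · exact (h1 _).2 ⟨0, by omega, rfl⟩
    · intro k; have := h2 _ (by omega) _ (by omega) k; omega
    · exact (h3 _ (by omega) _ (by omega)).2 (by unfold CN; omega)
    · exact (h3 _ (by omega) _ (by omega)).2 (by unfold CN; omega)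
    · rw [h3 _ (by omega) _ (by omega)]; unfold CN; omega
    · intro v hv k
      obtain ⟨p, hp, rfl⟩ := (h1 v).1 hv
      rw [h3 _ (by omega) _ (by omega)] at k
      unfold CN at k
      have : p = n - 1 ∨ p = 0 := by omega
      rcases this with rfl | rfl <;> simp
    · intro x
      simp only [Finset.mem_erase, h1]
      constructor
      · rintro ⟨k, p, hp, rfl⟩
        exact ⟨p, by by_contra hh; exact k (by rw [show p = n by omega]), rfl⟩
      · rintro ⟨p, hp, rfl⟩
        exact ⟨fun k => by have := h2 _ (by omega) _ (by omega) k; omega, p, by omega, rfl⟩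
    · intro p hp q hq k; exact h2 _ (by omega) _ (by omega) k
    · intro p hp q hq
      have e1 : ∀ r < n + 1, ∀ s < n + 1, f r = f s ↔ r = s := fun r hr s hs => ⟨fun k => h2 r hr s hs k, fun k => k ▸ rfl⟩
      rw [addE_adj, h3 _ (by omega) _ (by omega), Ne, e1 _ (by omega) _ (by omega), e1 _ (by omega) _ (by omega),
        e1 _ (by omega) _ (by omega), e1 _ (by omega) _ (by omega), e1 _ (by omega) _ (by omega)]
      unfold CN; omega

lemma CycEnum.rotate {n : ℕ} {P : Finset V} {f : ℕ → V} (h : CycEnum n X P f) {s : ℕ} (hs : s < n) :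
    CycEnum n X P (fun k => f (if k + s < n then k + s else k + s - n)) := by
  obtain ⟨h1, h2, h3⟩ := h
  refine ⟨?_, ?_, ?_⟩
  · intro x; rw [h1]
    constructor
    · rintro ⟨p, hp, rfl⟩
      by_cases k : s ≤ p
      · refine ⟨p - s, by omega, ?_⟩; simp only; rw [if_pos (by omega)]; congr 1; omega
      · refine ⟨p + n - s, by omega, ?_⟩; simp only; rw [if_neg (by omega)]; congr 1; omega
    · rintro ⟨p, hp, rfl⟩
      exact ⟨_, by split_ifs <;> omega, rfl⟩
  · intro p hp q hq k
    have := h2 _ (by split_ifs <;> omega) _ (by split_ifs <;> omega) k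
    split_ifs at this <;> omega
  · intro p hp q hq
    simp only
    rw [h3 _ (by split_ifs <;> omega) _ (by split_ifs <;> omega)]
    unfold CN
    split_ifs <;> omega

lemma FF.cycEnum {i : ℕ} {P : Finset V} (h : FF i 0 X P) : ∃ f, CycEnum i X P f := by
  generalize hj : 0 = j at h
  induction h with
  | @tri X P a b c hab hbc hac hP =>
    subst hP
    have h1 := hab.ne; have h2 := hbc.ne; have h3 := hac.ne
    refine ⟨fun k => if k = 0 then a else if k = 1 then b else c, ?_, ?_, ?_⟩
    · intro x; simp
      constructor
      · rintro (rfl | rfl | rfl)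
        · exact ⟨0, by omega, by simp⟩
        · exact ⟨1, by omega, by simp⟩
        · exact ⟨2, by omega, by simp⟩
      · rintro ⟨p, hp, rfl⟩
        interval_cases p <;> simp
    · intro p hp q hq
      interval_cases p <;> interval_cases q <;> simp [h1, h2, h3, h1.symm, h2.symm, h3.symm]
    · intro p hp q hq
      interval_cases p <;> interval_cases q <;> simp [CN, hab, hbc, hac, hab.symm, hbc.symm, hac.symm]
  | @sub i j X P z a b h hF ih =>
    obtain ⟨f, hf⟩ := ih hj
    have hi := hF.counts.2.2.2 hj.symm
    have key : ∀ a b, Sup X P z a b → (∃ f, CycEnum i (addE X a b) (P.erase z) f ∧ f 0 = b ∧ f (i - 1) = a) →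
        ∃ f, CycEnum (i + 1) X P f := by
      rintro a b h ⟨f, ⟨h1, h2, h3⟩, hb, ha⟩
      have hzf : ∀ p < i, f p ≠ z := fun p hp k => by
        have := (h1 (f p)).2 ⟨p, hp, rfl⟩; simp [k] at this
      have hfP : ∀ p < i, f p ∈ P := fun p hp => Finset.mem_of_mem_erase ((h1 (f p)).2 ⟨p, hp, rfl⟩)
      have e1 : ∀ r < i, ∀ s < i, f r = f s ↔ r = s := fun r hr s hs => ⟨fun k => h2 r hr s hs k, fun k => k ▸ rfl⟩
      have hz : ∀ p < i, X.Adj z (f p) ↔ (p = 0 ∨ p = i - 1) := by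
        intro p hp
        constructor
        · intro k
          rcases h.only _ (hfP p hp) k with k | k
          · rw [← ha, e1 _ hp _ (by omega)] at k; omega
          · rw [← hb, e1 _ hp _ (by omega)] at k; omega
        · rintro (rfl | rfl)
          · rw [hb]; exact h.zb
          · rw [ha]; exact h.za
      refine ⟨fun k => if k < i then f k else z, ?_, ?_, ?_⟩
      · intro x
        constructor
        · intro hx
          by_cases hxz : x = z
          · exact ⟨i, by omega, by simp [hxz]⟩
          · obtain ⟨p, hp, rfl⟩ := (h1 x).1 (by simp [hxz, hx])
            exact ⟨p, by omega, by simp [hp]⟩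
        · rintro ⟨p, hp, rfl⟩
          show (if p < i then f p else z) ∈ P
          split_ifs with k
          · exact hfP p k
          · exact h.hz
      · intro p hp q hq k
        simp only at k
        split_ifs at k with k1 k2 k2
        · exact h2 p k1 q k2 k
        · exact absurd k (hzf p k1)
        · exact absurd k.symm (hzf q k2)
        · omega
      · intro p hp q hq
        simp only
        split_ifs with k1 k2 k2
        · have := h3 p k1 q k2
          have hnab : ∀ u v, u < i → v < i → f u = a → f v = b → ¬ X.Adj (f u) (f v) := by
            intro u v _ _ e1 e2; rw [e1, e2]; exact h.nab
          rw [addE_adj, ← ha, ← hb, Ne, e1 _ k1 _ k2, e1 _ k1 _ (by omega), e1 _ k1 _ (by omega), e1 _ k2 _ (by omega),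
            e1 _ k2 _ (by omega)] at this
          have hn1 : ¬ (X.Adj (f p) (f q) ∧ p = i - 1 ∧ q = 0) := by
            rintro ⟨k, rfl, rfl⟩; rw [ha, hb] at k; exact h.nab k
          have hn2 : ¬ (X.Adj (f p) (f q) ∧ q = i - 1 ∧ p = 0) := by
            rintro ⟨k, rfl, rfl⟩; rw [ha, hb] at k; exact h.nab k.symm
          unfold CN at *
          by_cases hX : X.Adj (f p) (f q)
          · simp only [hX, true_and, true_or, true_iff] at this hn1 hn2 ⊢
            omega
          · simp only [hX, false_or, false_iff] at this ⊢
            omega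
        · rw [X.adj_comm, hz p k1]; unfold CN; omega
        · rw [hz q k2]; unfold CN; omega
        · have : ¬ X.Adj z z := X.loopless.irrefl z
          simp only [this, false_iff]; unfold CN; omega
    have hab : (addE X a b).Adj a b := Or.inr ⟨h.hab, Or.inl ⟨rfl, rfl⟩⟩
    obtain ⟨p, hp, rfl⟩ := (hf.1 a).1 (by simp [h.ha, h.ne_za])
    obtain ⟨q, hq, rfl⟩ := (hf.1 b).1 (by simp [h.hb, h.ne_zb])
    have hpq := (hf.2.2 p hp q hq).1 hab
    have hf' : CycEnum i (addE X (f q) (f p)) (P.erase z) f := by rw [addE_comm]; exact hf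
    unfold CN at hpq
    rcases hpq with e | e | ⟨e, e'⟩ | ⟨e, e'⟩
    · refine key _ _ h ⟨_, hf.rotate hq, ?_, ?_⟩
      · rw [if_pos (by omega)]; congr 1; omega
      · rw [if_neg (by omega)]; congr 1; omega
    · refine key _ _ h.symm ⟨_, hf'.rotate hp, ?_, ?_⟩
      · rw [if_pos (by omega)]; congr 1; omega
      · rw [if_neg (by omega)]; congr 1; omega
    · refine key _ _ h.symm ⟨_, hf', ?_, ?_⟩
      · congr 1; omega
      · congr 1; omega
    · refine key _ _ h ⟨_, hf, ?_, ?_⟩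
      · congr 1; omega
      · congr 1; omega
  | apex => omega

end

section
set_option linter.all false
open scoped Classical
variable {V W : Type} {X Y : SimpleGraph V}

lemma subdivide_ss {H : SimpleGraph V} {x y u v : V} :
    (subdivide H x y).Adj (some u) (some v) ↔ H.Adj u v ∧ s(u, v) ≠ s(x, y) := by
  simp only [subdivide, fromRel_adj, ne_eq, Option.some.injEq]
  constructor
  · rintro ⟨h1, h2 | h2⟩
    · exact h2
    · exact ⟨h2.1.symm, by rw [Sym2.eq_swap]; exact h2.2⟩
  · intro h; exact ⟨h.1.ne, Or.inl h⟩

lemma subdivide_sn {H : SimpleGraph V} {x y u : V} :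
    (subdivide H x y).Adj (some u) none ↔ u = x ∨ u = y := by
  simp [subdivide, fromRel_adj]

lemma subdivide_ns {H : SimpleGraph V} {x y u : V} :
    (subdivide H x y).Adj none (some u) ↔ u = x ∨ u = y := by
  rw [SimpleGraph.adj_comm, subdivide_sn]

lemma addApex_ss {H : SimpleGraph V} {S : Set V} {u v : V} :
    (addApex H S).Adj (some u) (some v) ↔ H.Adj u v := by
  simp only [addApex, fromRel_adj, ne_eq, Option.some.injEq]
  constructor
  · rintro ⟨h1, h2 | h2⟩
    · exact h2
    · exact h2.symm
  · intro h; exact ⟨h.ne, Or.inl h⟩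

lemma addApex_sn {H : SimpleGraph V} {S : Set V} {u : V} :
    (addApex H S).Adj (some u) none ↔ u ∈ S := by
  simp [addApex, fromRel_adj]

lemma addApex_ns {H : SimpleGraph V} {S : Set V} {u : V} :
    (addApex H S).Adj none (some u) ↔ u ∈ S := by
  rw [SimpleGraph.adj_comm, addApex_sn]

/-- functoriality -/
lemma subdivide_iso {A : SimpleGraph V} {B : SimpleGraph W} (e : A ≃g B) (x y : V) :
    ∃ f : subdivide A x y ≃g subdivide B (e x) (e y), f none = none ∧ ∀ u, f (some u) = some (e u) := by
  refine ⟨⟨Equiv.optionCongr e.toEquiv, ?_⟩, rfl, fun u => rfl⟩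
  rintro (_ | u) (_ | v)
  · simp
  · show (subdivide B _ _).Adj none (some (e v)) ↔ _
    rw [subdivide_ns, subdivide_ns]; simp
  · show (subdivide B _ _).Adj (some (e u)) none ↔ _
    rw [subdivide_sn, subdivide_sn]; simp
  · show (subdivide B _ _).Adj (some (e u)) (some (e v)) ↔ _
    rw [subdivide_ss, subdivide_ss, e.map_adj_iff]; simp [Sym2.eq_iff]

lemma addApex_iso {A : SimpleGraph V} {B : SimpleGraph W} (e : A ≃g B) (S : Set V) (T : Set W)
    (h : ∀ u, e u ∈ T ↔ u ∈ S) : Nonempty (addApex A S ≃g addApex B T) := by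
  refine ⟨⟨Equiv.optionCongr e.toEquiv, ?_⟩⟩
  rintro (_ | u) (_ | v)
  · simp
  · show (addApex B _).Adj none (some (e v)) ↔ _
    rw [addApex_ns, addApex_ns]; exact h v
  · show (addApex B _).Adj (some (e u)) none ↔ _
    rw [addApex_sn, addApex_sn]; exact h u
  · show (addApex B _).Adj (some (e u)) (some (e v)) ↔ _
    rw [addApex_ss, addApex_ss, e.map_adj_iff]

lemma memF_iso {i j : ℕ} {A : SimpleGraph V} (h : MemF i j A) : ∀ {W : Type} {B : SimpleGraph W}, B ≃g A → MemF i j B := by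
  cases h with
  | cycle hi h => obtain ⟨h⟩ := h; intro W B e; exact MemF.cycle hi ⟨e.trans h⟩
  | k4 h => obtain ⟨h⟩ := h; intro W B e; exact MemF.k4 ⟨e.trans h⟩
  | circ hj hH hxy he1 he2 hG =>
    intro W B e
    refine MemF.circ hj hH hxy he1 he2 ?_
    rcases hG with ⟨h1, x1, y1, x2, y2, h2, h3, ⟨h⟩⟩ | ⟨h1, x, y, h2, ⟨h⟩⟩
    · exact Or.inl ⟨h1, x1, y1, x2, y2, h2, h3, ⟨e.trans h⟩⟩
    · exact Or.inr ⟨h1, x, y, h2, ⟨e.trans h⟩⟩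
  | subd hj hH hxy hG => obtain ⟨h⟩ := hG; intro W B e; exact MemF.subd hj hH hxy ⟨e.trans h⟩

/-! MemF → FF -/

lemma image_some_univ [Fintype V] [Fintype (Option V)] (d : DecidableEq (Option V)) :
    @Finset.image _ _ d some (Finset.univ : Finset V) = @Finset.erase _ d (Finset.univ : Finset (Option V)) none := by
  ext x; cases x <;> simp

lemma subdivide_sup [Fintype (Option V)] {H : SimpleGraph V} {x y : V} (h : H.Adj x y) :
    Sup (subdivide H x y) Finset.univ none (some x) (some y) := by
  refine ⟨by simp, by simp, by simp, by simpa using h.ne, by rw [subdivide_ns]; simp, by rw [subdivide_ns]; simp,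
    by rw [subdivide_ss]; simp, ?_⟩
  rintro (_ | v) _ hv
  · simp at hv
  · rw [subdivide_ns] at hv; simpa using hv

lemma subdivide_addE {H : SimpleGraph V} {x y : V} (h : H.Adj x y) (u v : V) :
    (addE (subdivide H x y) (some x) (some y)).Adj (some u) (some v) ↔ H.Adj u v := by
  rw [addE_adj, subdivide_ss]
  simp only [ne_eq, Sym2.eq_iff, Option.some.injEq]
  constructor
  · rintro (k | ⟨k, ⟨rfl, rfl⟩ | ⟨rfl, rfl⟩⟩)
    · exact k.1
    · exact h
    · exact h.symm
  · intro k
    by_cases hh : u = x ∧ v = y ∨ u = y ∧ v = x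
    · exact Or.inr ⟨k.ne, hh⟩
    · exact Or.inl ⟨k, hh⟩

lemma FF.subdivide [Fintype V] [Fintype (Option V)] {H : SimpleGraph V} {i j : ℕ} (hF : FF i j H Finset.univ) {x y : V} (h : H.Adj x y) :
    FF (i + 1) j (subdivide H x y) Finset.univ := by
  refine FF.sub (subdivide_sup h) ?_
  rw [← image_some_univ]
  refine hF.transport some (fun _ _ _ _ k => by simpa using k) ?_
  intro u _ v _; exact subdivide_addE h u v

lemma ee_image_some [Fintype V] [Fintype (Option V)] {H : SimpleGraph V} {K : SimpleGraph (Option V)}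
    (h : ∀ u v, K.Adj (some u) (some v) ↔ H.Adj u v) (v : V) (d : DecidableEq (Option V)) :
    ee K {some v} (@Finset.erase _ d Finset.univ none) = ee H {v} Finset.univ := by
  obtain rfl : d = (fun a b => Classical.propDecidable (a = b)) := Subsingleton.elim _ _
  have := ee_image (X := H) (Y := K) (P := Finset.univ) (A := {v}) (B := Finset.univ) some
    (fun _ _ _ _ k => by simpa using k) (fun u _ v _ => h u v) (by simp) (by simp)
  have e1 : ∀ d, @Finset.image V (Option V) d some {v} = {some v} := fun d => by ext; simp [eq_comm]
  rw [e1, image_some_univ] at this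
  exact this

lemma deg_subdivide_some [Fintype V] [Fintype (Option V)] {H : SimpleGraph V} {x y : V} (h : H.Adj x y) (v : V) :
    ee (subdivide H x y) {some v} Finset.univ = ee H {v} Finset.univ := by
  rw [← (subdivide_sup h).deg (by simp) (by simp), ee_image_some (subdivide_addE h)]

lemma deg_subdivide_none [Fintype V] [Fintype (Option V)] {H : SimpleGraph V} {x y : V} (h : H.Adj x y) :
    ee (subdivide H x y) {none} Finset.univ = 2 := by
  rw [(subdivide_sup h).ee_z (by simp)]; simp

lemma FF.addApex [Fintype V] [Fintype (Option V)] {K : SimpleGraph V} {i j : ℕ} (hF : FF (i + 2) j K Finset.univ) {a b c : V} (hab : a ≠ b)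
    (hac : a ≠ c) (hbc : b ≠ c) (ha : ee K {a} Finset.univ = 2) (hb : ee K {b} Finset.univ = 2)
    (hc : ee K {c} Finset.univ = 2) : FF i (j + 1) (addApex K {a, b, c}) Finset.univ := by
  have hinj : Set.InjOn (some : V → Option V) (Finset.univ : Finset V) := fun _ _ _ _ k => by simpa using k
  have hadj : ∀ u ∈ (Finset.univ : Finset V), ∀ v ∈ (Finset.univ : Finset V),
    (InducedForest.addApex K {a, b, c}).Adj (some u) (some v) ↔ K.Adj u v := fun u _ v _ => addApex_ss
  refine FF.apex (n := none) (by simp) ?_ ?_ ?_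
  · rw [ee_single_card]
    refine Finset.card_eq_three.2 ⟨some a, some b, some c, by simpa using hab, by simpa using hac, by simpa using hbc, ?_⟩
    ext x; rcases x with _ | x
    · simp
    · simp [addApex_ns]
  · rintro (_ | v) hv hadj'
    · simp at hadj'
    · rw [ee_image_some (fun u v => addApex_ss)]
      rw [addApex_ns] at hadj'
      rcases hadj' with rfl | rfl | rfl <;> assumption
  · rw [← image_some_univ]
    exact hF.transport some hinj hadj

lemma FF.of_iso [Fintype V] [Fintype W] {A : SimpleGraph V} {B : SimpleGraph W} {i j : ℕ} (h : FF i j A Finset.univ)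
    (e : B ≃g A) : FF i j B Finset.univ := by
  have := h.transport (Y := B) e.symm e.symm.injective.injOn (fun u _ v _ => by rw [e.symm.map_adj_iff])
  rwa [Finset.image_univ_of_surjective e.symm.surjective] at this

lemma cyc_cycEnum {n : ℕ} (hn : 3 ≤ n) [Fintype (ZMod n)] : CycEnum n (cyc n) Finset.univ (fun k => (k : ZMod n)) := by
  have : NeZero n := ⟨by omega⟩
  have key : ∀ p < n, ∀ q < n, (p : ZMod n) = q → p = q := by
    intro p hp q hq h
    have := congrArg ZMod.val h
    rwa [ZMod.val_natCast_of_lt hp, ZMod.val_natCast_of_lt hq] at this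
  refine ⟨?_, key, ?_⟩
  · intro x
    simp only [Finset.mem_univ, true_iff]
    exact ⟨x.val, x.val_lt, ZMod.natCast_zmod_val x⟩
  · intro p hp q hq
    have succ : ∀ p < n, ∀ q < n, (q : ZMod n) = p + 1 ↔ q = p + 1 ∨ (q = 0 ∧ p + 1 = n) := by
      intro p hp q hq
      constructor
      · intro h
        by_cases hpn : p + 1 = n
        · right
          refine ⟨key q hq 0 (by omega) ?_, hpn⟩
          rw [h, ← Nat.cast_succ, Nat.succ_eq_add_one, hpn]; simp
        · left
          refine key q hq (p + 1) (by omega) ?_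
          rw [h]; simp
      · rintro (rfl | ⟨rfl, h⟩)
        · simp
        · have : ((p + 1 : ℕ) : ZMod n) = 0 := by rw [h]; simp
          rw [Nat.cast_zero, ← this]; simp
    simp only [cyc, fromRel_adj, succ p hp q hq, succ q hq p hp]
    have : ((p : ZMod n) ≠ q) ↔ p ≠ q := by
      rw [not_iff_not]; exact ⟨key p hp q hq, fun h => by rw [h]⟩
    rw [this]; unfold CN; omega

lemma FF.of_k4 [Fintype V] {A : SimpleGraph V} (e : A ≃g (⊤ : SimpleGraph (Fin 4))) : FF 1 1 A Finset.univ := by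
  refine FF.of_iso (A := (⊤ : SimpleGraph (Fin 4))) ?_ e
  have h4 : ∀ d : DecidableEq (Fin 4), @Finset.erase _ d (Finset.univ : Finset (Fin 4)) 0 = {1, 2, 3} := by
    intro d
    obtain rfl : d = instDecidableEqFin 4 := Subsingleton.elim _ _
    decide
  refine FF.apex (n := 0) (by simp) ?_ ?_ ?_
  · rw [h4]; simp [ee, ad]
  · rw [h4]
    intro v hv _
    fin_cases v <;> simp [ee, ad] at *
  · exact FF.tri 1 2 3 (by simp) (by simp) (by simp) (by ext x; fin_cases x <;> simp)

lemma memF_ff' {i j : ℕ} {A : SimpleGraph V} (h : MemF i j A) : ∃ _ : Fintype V, FF i j A Finset.univ := by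
  induction h with
  | @cycle i hi V G h =>
    obtain ⟨h⟩ := h
    have : NeZero i := ⟨by omega⟩
    letI : Fintype V := Fintype.ofEquiv _ h.toEquiv.symm
    exact ⟨inferInstance, FF.of_iso (CycEnum.ff i hi (cyc_cycEnum hi)) h⟩
  | @k4 V G h =>
    obtain ⟨h⟩ := h
    letI : Fintype V := Fintype.ofEquiv _ h.toEquiv.symm
    exact ⟨inferInstance, FF.of_k4 h⟩
  | @subd i j hj V H hH x y hxy W G hG ih =>
    obtain ⟨h⟩ := hG
    obtain ⟨_, ih⟩ := ih
    letI : Fintype W := Fintype.ofEquiv _ h.toEquiv.symm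
    exact ⟨inferInstance, FF.of_iso (ih.subdivide hxy) h⟩
  | @circ j hj V H hH x y hxy e1 e2 he1 he2 W G hG ih =>
    obtain ⟨_, ih⟩ := ih
    have hK := ih.subdivide hxy
    have d0 : ee (subdivide H x y) {none} Finset.univ = 2 := deg_subdivide_none hxy
    obtain ⟨j, rfl⟩ : ∃ k, j = k + 1 := ⟨j - 1, by omega⟩
    simp only [Nat.add_sub_cancel] at *
    rcases hG with ⟨h1, x1, y1, x2, y2, rfl, rfl, ⟨h⟩⟩ | ⟨rfl, x1, y1, rfl, ⟨h⟩⟩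
    · letI : Fintype W := Fintype.ofEquiv _ h.toEquiv.symm
      refine ⟨inferInstance, FF.of_iso ?_ h⟩
      rw [mem_edgeSet] at he1 he2
      have he2' : (subdivide (subdivide H x y) x1 y1).Adj (some x2) (some y2) := by
        rw [subdivide_ss]; exact ⟨he2, h1.symm⟩
      have h3 := (hK.subdivide he1).subdivide he2'
      refine FF.addApex h3 (by simp) (by simp) (by simp) ?_ ?_ ?_
      · rw [deg_subdivide_some he2', deg_subdivide_some he1, d0]
      · rw [deg_subdivide_some he2', deg_subdivide_none he1]
      · rw [deg_subdivide_none he2']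
    · letI : Fintype W := Fintype.ofEquiv _ h.toEquiv.symm
      refine ⟨inferInstance, FF.of_iso ?_ h⟩
      rw [mem_edgeSet] at he1
      have he2' : (subdivide (subdivide H x y) x1 y1).Adj none (some y1) := by
        rw [subdivide_ns]; simp
      have h3 := (hK.subdivide he1).subdivide he2'
      refine FF.addApex h3 (by simp) (by simp) (by simp) ?_ ?_ ?_
      · rw [deg_subdivide_some he2', deg_subdivide_some he1, d0]
      · rw [deg_subdivide_some he2', deg_subdivide_none he1]
      · rw [deg_subdivide_none he2']

lemma memF_ff [Fintype V] {i j : ℕ} {A : SimpleGraph V} (h : MemF i j A) : FF i j A Finset.univ := by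
  obtain ⟨h1, h2⟩ := memF_ff' h
  convert h2

/-! FF → MemF -/

lemma Sup.iso {P : Finset V} {z a b : V} (h : Sup X P z a b) (ha : a ∈ P.erase z) (hb : b ∈ P.erase z) :
    ∃ f : X.induce (P : Set V) ≃g InducedForest.subdivide ((addE X a b).induce (↑(P.erase z) : Set V)) ⟨a, Finset.mem_coe.2 ha⟩ ⟨b, Finset.mem_coe.2 hb⟩,
      f.symm none = ⟨z, h.hz⟩ ∧ ∀ u, (f.symm (some u)).1 = u.1 := by
  have hP : ∀ u : (↑(P.erase z) : Set V), u.1 ∈ P := fun u => Finset.mem_of_mem_erase u.2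
  have hz : ∀ u : (↑(P.erase z) : Set V), u.1 ≠ z := fun u => Finset.ne_of_mem_erase u.2
  let e : Option (↑(P.erase z) : Set V) ≃ (P : Set V) :=
    { toFun := fun o => match o with
        | none => ⟨z, h.hz⟩
        | some u => ⟨u.1, hP u⟩
      invFun := fun u => if k : u.1 = z then none else some ⟨u.1, by simpa [k] using u.2⟩
      left_inv := by
        rintro (_ | u)
        · simp
        · have := hz u; simp; exact this
      right_inv := by
        rintro ⟨u, hu⟩
        by_cases k : u = z
        · simp [k]
        · simp [k] }
  refine ⟨RelIso.symm ⟨e, ?_⟩, rfl, fun u => rfl⟩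
  rintro (_ | u) (_ | v)
  · simp
  · show X.Adj z v.1 ↔ _
    rw [subdivide_ns]
    constructor
    · intro k
      rcases h.only _ (hP v) k with k | k
      · left; exact Subtype.ext k
      · right; exact Subtype.ext k
    · rintro (rfl | rfl)
      · exact h.za
      · exact h.zb
  · show X.Adj u.1 z ↔ _
    rw [subdivide_sn, X.adj_comm]
    constructor
    · intro k
      rcases h.only _ (hP u) k with k | k
      · left; exact Subtype.ext k
      · right; exact Subtype.ext k
    · rintro (rfl | rfl)
      · exact h.za
      · exact h.zb
  · show X.Adj u.1 v.1 ↔ _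
    rw [subdivide_ss]
    simp only [comap_adj, Function.Embedding.subtype_apply, addE_adj, ne_eq, Sym2.eq_iff, Subtype.ext_iff]
    constructor
    · intro k
      refine ⟨Or.inl k, ?_⟩
      rintro (⟨k1, k2⟩ | ⟨k1, k2⟩)
      · rw [k1, k2] at k; exact h.nab k
      · rw [k1, k2] at k; exact h.nab k.symm
    · rintro ⟨k | k, k'⟩
      · exact k
      · exact absurd k.2 k'

lemma apex_iso {P : Finset V} {n : V} (hn : n ∈ P) :
    Nonempty (X.induce (P : Set V) ≃g InducedForest.addApex (X.induce (↑(P.erase n) : Set V)) {v | X.Adj n v.1}) := by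
  have hP : ∀ u : (↑(P.erase n) : Set V), u.1 ∈ P := fun u => Finset.mem_of_mem_erase u.2
  have hz : ∀ u : (↑(P.erase n) : Set V), u.1 ≠ n := fun u => Finset.ne_of_mem_erase u.2
  let e : Option (↑(P.erase n) : Set V) ≃ (P : Set V) :=
    { toFun := fun o => match o with
        | none => ⟨n, hn⟩
        | some u => ⟨u.1, hP u⟩
      invFun := fun u => if k : u.1 = n then none else some ⟨u.1, by simpa [k] using u.2⟩
      left_inv := by
        rintro (_ | u)
        · simp
        · have := hz u; simp; exact this
      right_inv := by
        rintro ⟨u, hu⟩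
        by_cases k : u = n
        · simp [k]
        · simp [k] }
  refine ⟨RelIso.symm ⟨e, ?_⟩⟩
  rintro (_ | u) (_ | v)
  · simp
  · show X.Adj n v.1 ↔ _
    rw [addApex_ns]; rfl
  · show X.Adj u.1 n ↔ _
    rw [addApex_sn, X.adj_comm]; rfl
  · show X.Adj u.1 v.1 ↔ _
    rw [addApex_ss]; rfl

end

section
set_option linter.all false
open scoped Classical
variable {V W : Type} {X Y : SimpleGraph V}

lemma subdivide_comm (H : SimpleGraph V) (x y : V) : subdivide H x y = subdivide H y x := by
  ext u v
  rcases u with _ | u <;> rcases v with _ | v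
  · simp
  · rw [subdivide_ns, subdivide_ns, or_comm]
  · rw [subdivide_sn, subdivide_sn, or_comm]
  · rw [subdivide_ss, subdivide_ss, Sym2.eq_swap (a := x)]

lemma memF_circ1 {j : ℕ} (hj : 1 ≤ j) {H : SimpleGraph V} (hH : MemF j j H) {x y : V} (hxy : H.Adj x y)
    {B1 B2 : Option V} (hB : (subdivide H x y).Adj B1 B2) {p q : Option (Option V)}
    (hpq : (subdivide (subdivide H x y) B1 B2).Adj p q) {G : SimpleGraph W}
    (e : G ≃g addApex (subdivide (subdivide (subdivide H x y) B1 B2) p q) {some (some none), some none, none}) :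
    MemF (j + 1) (j + 1) G := by
  have key : ∀ B1 B2 (hB : (subdivide H x y).Adj B1 B2),
     G ≃g addApex (subdivide (subdivide (subdivide H x y) B1 B2) none (some B2)) {some (some none), some none, none} →
     MemF (j + 1) (j + 1) G := by
    intro B1 B2 hB e
    refine MemF.circ (by omega) (by simpa using hH) hxy (e1 := s(B1, B2)) (e2 := s(B1, B2)) hB hB ?_
    exact Or.inr ⟨rfl, B1, B2, rfl, ⟨e⟩⟩
  have key2 : ∀ q, (subdivide (subdivide H x y) B1 B2).Adj none (some q) →
      G ≃g addApex (subdivide (subdivide (subdivide H x y) B1 B2) none (some q)) {some (some none), some none, none} →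
     MemF (j + 1) (j + 1) G := by
    intro q hq e
    rw [subdivide_ns] at hq
    rcases hq with rfl | rfl
    · rw [subdivide_comm (subdivide H x y)] at e
      exact key _ _ hB.symm e
    · exact key _ _ hB e
  rcases p with _ | p <;> rcases q with _ | q
  · simp at hpq
  · exact key2 q hpq e
  · rw [subdivide_comm _ (some p)] at e; exact key2 p hpq.symm e
  · rw [subdivide_ss] at hpq
    refine MemF.circ (by omega) (by simpa using hH) hxy (e1 := s(B1, B2)) (e2 := s(p, q)) hB hpq.1 ?_
    exact Or.inl ⟨hpq.2.symm, B1, B2, p, q, rfl, rfl, ⟨e⟩⟩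

lemma memF_circ2 {A1 A2 A3 : Type} {j : ℕ} (hj : 1 ≤ j) {H : SimpleGraph V} (hH : MemF j j H) {x y : V} (hxy : H.Adj x y)
    {K1 : SimpleGraph A1} {K2 : SimpleGraph A2} {K3 : SimpleGraph A3} {G : SimpleGraph W}
    {b1 b2 : A1} {c1 c2 : A2} {S : Set A3}
    (e3 : K1 ≃g subdivide H x y) (e2 : K2 ≃g subdivide K1 b1 b2) (hb : K1.Adj b1 b2)
    (e1 : K3 ≃g subdivide K2 c1 c2) (hc : K2.Adj c1 c2) (e0 : G ≃g addApex K3 S)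
    (hS : ∀ u, u ∈ S ↔ u = e1.symm none ∨ u = e1.symm (some (e2.symm none)) ∨
      u = e1.symm (some (e2.symm (some (e3.symm none))))) : MemF (j + 1) (j + 1) G := by
  obtain ⟨f2, f2n, f2s⟩ := subdivide_iso e3 b1 b2
  obtain ⟨f1, f1n, f1s⟩ := subdivide_iso (e2.trans f2) c1 c2
  have f2n' : f2.symm none = none := by rw [RelIso.symm_apply_eq, f2n]
  have f2s' : ∀ v, f2.symm (some v) = some (e3.symm v) := by
    intro v; rw [RelIso.symm_apply_eq, f2s]; simp
  have f1n' : f1.symm none = none := by rw [RelIso.symm_apply_eq, f1n]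
  have f1s' : ∀ v, f1.symm (some v) = some (e2.symm (f2.symm v)) := by
    intro v; rw [RelIso.symm_apply_eq, f1s]; simp
  obtain ⟨f0⟩ := addApex_iso (e1.trans f1) S {some (some none), some none, none} (by
    intro u
    rw [hS]
    show f1 (e1 u) ∈ _ ↔ _
    simp only [Set.mem_insert_iff, Set.mem_singleton_iff,
      ← RelIso.eq_symm_apply, f1s', f1n', f2s', f2n']
    grind)
  exact memF_circ1 hj hH hxy ((e3.map_adj_iff).2 hb) ((Iso.map_adj_iff (e2.trans f2)).2 hc) (e0.trans f0)

lemma CycEnum.iso {n : ℕ} (hn : 3 ≤ n) {P : Finset V} {f : ℕ → V} (h : CycEnum n X P f) :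
    Nonempty (X.induce (P : Set V) ≃g cyc n) := by
  have : NeZero n := ⟨by omega⟩
  obtain ⟨h1, h2, h3⟩ := h
  obtain ⟨-, -, k3⟩ := cyc_cycEnum hn
  let F : ZMod n → (P : Set V) := fun x => ⟨f x.val, (h1 _).2 ⟨x.val, x.val_lt, rfl⟩⟩
  have hF : Function.Bijective F := by
    constructor
    · intro x y hxy
      have := h2 _ x.val_lt _ y.val_lt (congrArg Subtype.val hxy)
      exact ZMod.val_injective n this
    · rintro ⟨u, hu⟩
      obtain ⟨p, hp, rfl⟩ := (h1 u).1 hu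
      exact ⟨p, Subtype.ext (by simp [F, ZMod.val_natCast_of_lt hp])⟩
  refine ⟨RelIso.symm ⟨Equiv.ofBijective F hF, ?_⟩⟩
  intro x y
  show X.Adj (f x.val) (f y.val) ↔ _
  rw [h3 _ x.val_lt _ y.val_lt, ← k3 _ x.val_lt _ y.val_lt]
  simp

lemma FF.memF_aux (N : ℕ) : ∀ {i j : ℕ} {X : SimpleGraph V} {P : Finset V}, P.card = N → FF i j X P →
    MemF i j (X.induce (P : Set V)) := by
  induction N using Nat.strong_induction_on with
  | _ N IH =>
  intro i j X P hN hF
  obtain ⟨hc1, hc2, hc3, hc4⟩ := hF.counts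
  by_cases hj : j = 0
  · subst hj
    obtain ⟨f, hf⟩ := hF.cycEnum
    exact MemF.cycle (hc4 rfl) (hf.iso (hc4 rfl))
  by_cases h2 : ∃ x ∈ P, ee X {x} P = 2
  · obtain ⟨x, hx, hx2⟩ := h2
    obtain ⟨a, b, hs, hF'⟩ := hF.U x hx hx2 (by omega)
    have hlt : (P.erase x).card < N := by rw [← hN]; exact Finset.card_erase_lt_of_mem hx
    have := IH _ hlt rfl hF'
    have hi := hF.le
    obtain ⟨f, -, -⟩ := hs.iso (by simp [hs.ne_za, hs.ha]) (by simp [hs.ne_zb, hs.hb])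
    have h3 := MemF.subd (by omega) this (x := ⟨a, Finset.mem_coe.2 (by simp [hs.ne_za, hs.ha])⟩)
      (y := ⟨b, Finset.mem_coe.2 (by simp [hs.ne_zb, hs.hb])⟩) (Or.inr ⟨hs.hab, Or.inl ⟨rfl, rfl⟩⟩) ⟨f⟩
    rwa [show i - 1 + 1 = i by omega] at h3
  push Not at h2
  have hd3 : ∀ v ∈ P, ee X {v} P = 3 := fun v hv => by
    have h1 := hc3 v hv; have h2 := h2 v hv; omega
  have hij : i = j := by
    have h1 := ee_self (X := X) P
    rw [ee_sum_left, Finset.sum_congr rfl hd3] at h1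
    simp at h1; omega
  subst hij
  cases hF with
  | @sub i _ _ _ z a b hs hF =>
    have := h2 z hs.hz
    rw [hs.ee_z subset_rfl] at this; simp [hs.ha, hs.hb] at this
  | @apex _ j _ _ n hn hn3 hn2 hF =>
    obtain ⟨e0⟩ := apex_iso (X := X) hn
    obtain ⟨a, b, c, hab, hac, hbc, hnb⟩ : ∃ a b c, a ≠ b ∧ a ≠ c ∧ b ≠ c ∧
        (P.erase n).filter (fun v => X.Adj n v) = {a, b, c} := by
      have h := hn3
      rw [ee_single_card] at h
      exact Finset.card_eq_three.1 h
    have hmem : ∀ v, (v ∈ P.erase n ∧ X.Adj n v) ↔ v = a ∨ v = b ∨ v = c := by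
      intro v
      have := congrArg (fun s => v ∈ s) hnb
      simpa only [Finset.mem_filter, Finset.mem_insert, Finset.mem_singleton, eq_iff_iff] using this
    by_cases hj0 : j = 0
    · subst hj0
      refine MemF.k4 ?_
      obtain ⟨u, v, w, h1, h2, h3, h4⟩ := hF.tri_of
      have hall : ∀ u ∈ P, ∀ v ∈ P, u ≠ v → X.Adj u v := by
        have hnall : ∀ v ∈ P.erase n, X.Adj n v := by
          have hcard := hF.counts.1
          rw [ee_single_card] at hn3
          have h4 : (P.erase n).filter (fun v => X.Adj n v) = P.erase n :=
            Finset.eq_of_subset_of_card_le (Finset.filter_subset _ _) (by omega)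
          intro v hv; rw [← h4] at hv; exact (Finset.mem_filter.1 hv).2
        intro p hp q hq hpq
        by_cases hpn : p = n
        · subst hpn; exact hnall q (by simp [hq, hpq.symm])
        by_cases hqn : q = n
        · subst hqn; exact (hnall p (by simp [hp, hpq])).symm
        have hp' : p ∈ P.erase n := by simp [hp, hpn]
        have hq' : q ∈ P.erase n := by simp [hq, hqn]
        rw [h4] at hp' hq'
        simp only [Finset.mem_insert, Finset.mem_singleton] at hp' hq'
        rcases hp' with rfl | rfl | rfl <;> rcases hq' with rfl | rfl | rfl <;>
          first | exact absurd rfl hpq | assumption | (apply SimpleGraph.Adj.symm; assumption)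
      have hcard : Fintype.card (P : Set V) = 4 := by
        simp [hc1]
      refine ⟨⟨Fintype.equivFinOfCardEq hcard, ?_⟩⟩
      intro p q
      simp only [top_adj, ne_eq, EmbeddingLike.apply_eq_iff_eq]
      constructor
      · intro h; exact hall _ p.2 _ q.2 (fun k => h (Subtype.ext k))
      · intro h k; subst k; exact X.loopless.irrefl _ h
    · have ha := (hmem a).2 (by simp)
      have hb := (hmem b).2 (by simp)
      have hc := (hmem c).2 (by simp)
      obtain ⟨c1, c2, sc, F1⟩ := hF.U c hc.1 (hn2 c hc.1 hc.2) (by omega)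
      have hb1 : b ∈ (P.erase n).erase c := by rw [Finset.mem_erase]; exact ⟨hbc, hb.1⟩
      have ha1 : a ∈ (P.erase n).erase c := by rw [Finset.mem_erase]; exact ⟨hac, ha.1⟩
      obtain ⟨b1, b2, sb, F2⟩ := F1.U b hb1 (by rw [sc.deg hb.1 hbc]; exact hn2 b hb.1 hb.2) (by omega)
      have ha2 : a ∈ ((P.erase n).erase c).erase b := by rw [Finset.mem_erase]; exact ⟨hab, ha1⟩
      obtain ⟨a1, a2, sa, F3⟩ := F2.U a ha2 (by rw [sb.deg ha1 hab, sc.deg ha.1 hac]; exact hn2 a ha.1 ha.2) (by omega)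
      have hlt : ((((P.erase n).erase c).erase b).erase a).card < N := by
        rw [← hN]
        refine lt_of_le_of_lt (Finset.card_le_card ?_) (Finset.card_erase_lt_of_mem hn)
        exact (Finset.erase_subset _ _).trans ((Finset.erase_subset _ _).trans (Finset.erase_subset _ _))
      have ih := IH _ hlt rfl F3
      rw [show j + 1 + 2 - 1 - 1 - 1 = j by omega] at ih
      obtain ⟨e1, e1n, e1s⟩ := sc.iso (by rw [Finset.mem_erase]; exact ⟨sc.ne_za, sc.ha⟩) (by rw [Finset.mem_erase]; exact ⟨sc.ne_zb, sc.hb⟩)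
      obtain ⟨e2, e2n, e2s⟩ := sb.iso (by rw [Finset.mem_erase]; exact ⟨sb.ne_za, sb.ha⟩) (by rw [Finset.mem_erase]; exact ⟨sb.ne_zb, sb.hb⟩)
      obtain ⟨e3, e3n, e3s⟩ := sa.iso (by rw [Finset.mem_erase]; exact ⟨sa.ne_za, sa.ha⟩) (by rw [Finset.mem_erase]; exact ⟨sa.ne_zb, sa.hb⟩)
      refine memF_circ2 (by omega) ih ?_ e3 e2 ?_ e1 ?_ e0 ?_
      · exact Or.inr ⟨sa.hab, Or.inl ⟨rfl, rfl⟩⟩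
      · exact Or.inr ⟨sb.hab, Or.inl ⟨rfl, rfl⟩⟩
      · exact Or.inr ⟨sc.hab, Or.inl ⟨rfl, rfl⟩⟩
      intro u
      have hu : u.1 ∈ P.erase n := u.2
      have := hmem u.1
      simp only [hu, true_and] at this
      simp only [Set.mem_setOf_eq, this, Subtype.ext_iff, e1s, e1n, e2s, e2n, e3n]
      grind

lemma FF.memF {i j : ℕ} {P : Finset V} (h : FF i j X P) : MemF i j (X.induce (P : Set V)) := FF.memF_aux _ rfl h

lemma induce_univ_iso [Fintype V] (X : SimpleGraph V) : Nonempty (X ≃g X.induce ((Finset.univ : Finset V) : Set V)) := by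
  refine ⟨⟨⟨fun v => ⟨v, by simp⟩, fun v => v.1, fun v => rfl, fun v => rfl⟩, ?_⟩⟩
  intro a b; rfl

lemma FF.memF_univ [Fintype V] {i j : ℕ} (h : FF i j X Finset.univ) : MemF i j X := by
  obtain ⟨e⟩ := induce_univ_iso X
  exact memF_iso h.memF e

lemma memF_induce_ff {i j : ℕ} {P : Finset V} (h : MemF i j (X.induce (P : Set V))) : FF i j X P := by
  have h1 := memF_ff h
  have := h1.transport (Y := X) (fun x => x.1) Subtype.val_injective.injOn (fun u _ v _ => Iff.rfl)
  convert this
  ext x; simp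

end

/-- no cycle of length `< g` in `X[P]` -/
def NS {V : Type} (g : ℕ) (X : SimpleGraph V) (P : Finset V) : Prop :=
  ∀ A ⊆ P, A.card < g → AcyOn X A

/-- no two disjoint cycles of length `< g` in `X[P]` -/
def ND {V : Type} (g : ℕ) (X : SimpleGraph V) (P : Finset V) : Prop :=
  ∀ A ⊆ P, ∀ B ⊆ P, A.card < g → B.card < g → ¬ AcyOn X A → ¬ AcyOn X B → ¬ Disjoint A B

section
set_option linter.all false
open scoped Classical
variable {V W : Type} {X Y : SimpleGraph V}

lemma NS.mono {g : ℕ} {A B : Finset V} (h : NS g X B) (hAB : A ⊆ B) : NS g X A := fun C hC => h C (hC.trans hAB)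
lemma ND.mono {g : ℕ} {A B : Finset V} (h : ND g X B) (hAB : A ⊆ B) : ND g X A :=
  fun C hC D hD => h C (hC.trans hAB) D (hD.trans hAB)

lemma cycle_not_acy {v : V} {c : X.Walk v v} (hc : c.IsCycle) : ¬ AcyOn X c.support.toFinset := by
  obtain ⟨h1, h2⟩ := cycle_en hc
  intro h
  rw [acyOn_iff] at h
  have := h _ subset_rfl ⟨v, by simp⟩
  omega

lemma exists_cycle {A : Finset V} (h : ¬ AcyOn X A) : ∃ v, ∃ c : X.Walk v v, c.IsCycle ∧ (∀ x ∈ c.support, x ∈ A) ∧ c.length ≤ A.card := by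
  have h1 : ¬ (X.induce (A : Set V)).IsAcyclic := fun k => h (acyOn_of_acyclic k)
  unfold IsAcyclic at h1
  push Not at h1
  obtain ⟨v, c, hc⟩ := h1
  have hc' : (c.map (Embedding.induce (A : Set V)).toHom).IsCycle :=
    (Walk.map_isCycle_iff_of_injective (Embedding.induce (G := X) (A : Set V)).injective).2 hc
  have hs : ∀ x ∈ (c.map (Embedding.induce (A : Set V)).toHom).support, x ∈ A := by
    intro x hx
    rw [Walk.support_map, List.mem_map] at hx
    obtain ⟨y, _, rfl⟩ := hx
    exact y.2
  refine ⟨_, _, hc', hs, ?_⟩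
  rw [← (cycle_en hc').1]
  exact Finset.card_le_card fun x hx => hs x (by simpa using hx)

lemma ND.not_two {g : ℕ} {P : Finset V} (h : ND g X P) : ¬ TwoDisjointCyclesLt (X.induce (P : Set V)) g := by
  rintro ⟨u, v, c1, c2, h1, h2, l1, l2, hd⟩
  have h1' : (c1.map (Embedding.induce (P : Set V)).toHom).IsCycle := (Walk.map_isCycle_iff_of_injective (Embedding.induce (G := X) (P : Set V)).injective).2 h1
  have h2' : (c2.map (Embedding.induce (P : Set V)).toHom).IsCycle := (Walk.map_isCycle_iff_of_injective (Embedding.induce (G := X) (P : Set V)).injective).2 h2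
  have hs : ∀ {u : (P : Set V)} (c : (X.induce (P : Set V)).Walk u u),
      (c.map (Embedding.induce (P : Set V)).toHom).support.toFinset ⊆ P := by
    intro u c x hx
    rw [List.mem_toFinset, Walk.support_map, List.mem_map] at hx
    obtain ⟨y, _, rfl⟩ := hx
    exact y.2
  refine h _ (hs c1) _ (hs c2) ?_ ?_ (cycle_not_acy h1') (cycle_not_acy h2') ?_
  · rw [(cycle_en h1').1, Walk.length_map]; exact l1
  · rw [(cycle_en h2').1, Walk.length_map]; exact l2
  · rw [Finset.disjoint_left]
    intro x hx hx'
    simp only [List.mem_toFinset, Walk.support_map, List.mem_map] at hx hx'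
    obtain ⟨y, hy, rfl⟩ := hx
    obtain ⟨z, hz, hzy⟩ := hx'
    have : z = y := Subtype.ext hzy
    subst this
    exact hd _ hy hz

lemma nd_of_not_two [Fintype V] {g : ℕ} (h : ¬ TwoDisjointCyclesLt X g) : ND g X Finset.univ := by
  intro A _ B _ hA hB nA nB hd
  obtain ⟨u, c1, h1, s1, l1⟩ := exists_cycle nA
  obtain ⟨v, c2, h2, s2, l2⟩ := exists_cycle nB
  refine h ⟨u, v, c1, c2, h1, h2, by omega, by omega, fun x hx hx' => ?_⟩
  exact Finset.disjoint_left.1 hd (s1 x hx) (s2 x hx')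

lemma egirth_of_ns [Fintype V] (h : NS 5 X Finset.univ) : 5 ≤ X.egirth := by
  rw [le_egirth]
  intro v c hc
  by_contra hlt
  have hlt : c.length < 5 := by
    rw [not_le] at hlt; exact_mod_cast hlt
  refine cycle_not_acy hc (h _ (by simp) ?_)
  rw [(cycle_en hc).1]; exact hlt

/-! connectivity -/

lemma conn_of_cuts {P : Finset V} (hne : P.Nonempty) (h : ∀ Y ⊆ P, Y.Nonempty → Y ≠ P → 0 < ee X Y (P \ Y)) :
    (X.induce (P : Set V)).Connected := by
  obtain ⟨u, hu⟩ := hne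
  rw [connected_iff_exists_forall_reachable]
  refine ⟨⟨u, hu⟩, ?_⟩
  let Y : Finset V := P.filter fun v => ∃ hv : v ∈ P, (X.induce (P : Set V)).Reachable ⟨u, hu⟩ ⟨v, hv⟩
  have hY : Y = P := by
    by_contra hne
    have := h Y (Finset.filter_subset _ _) ⟨u, by simp only [Y, Finset.mem_filter]; exact ⟨hu, hu, Reachable.refl _⟩⟩ hne
    rw [ee_pos] at this
    obtain ⟨a, ha, b, hb, hab⟩ := this
    simp only [Y, Finset.mem_filter, Finset.mem_sdiff] at ha hb
    obtain ⟨_, hp, ha⟩ := ha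
    refine hb.2 ⟨hb.1, hb.1, ha.trans ?_⟩
    exact SimpleGraph.Adj.reachable (G := X.induce (P : Set V)) (u := ⟨a, hp⟩) (v := ⟨b, hb.1⟩) hab
  rintro ⟨v, hv⟩
  have hv' : v ∈ Y := by rw [hY]; exact hv
  simp only [Y, Finset.mem_filter] at hv'
  exact hv'.2.2

lemma cuts_of_conn {P : Finset V} (h : (X.induce (P : Set V)).Connected) : ∀ Y ⊆ P, Y.Nonempty → Y ≠ P → 0 < ee X Y (P \ Y) := by
  intro Y hY ⟨a, ha⟩ hne
  obtain ⟨b, hb, hb'⟩ : ∃ b ∈ P, b ∉ Y := by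
    by_contra hh; push Not at hh; exact hne (Finset.Subset.antisymm hY hh)
  obtain ⟨w⟩ := h.preconnected ⟨a, hY ha⟩ ⟨b, hb⟩
  obtain ⟨d, hd, h1, h2⟩ := w.exists_boundary_dart {x | x.1 ∈ Y} ha hb'
  rw [ee_pos]
  exact ⟨_, h1, _, by simp only [Finset.mem_sdiff]; exact ⟨d.snd.2, h2⟩, d.adj⟩

lemma ee_univ_sdiff [Fintype V] (A B : Finset V) : ee X A Finset.univ = ee X A B + ee X A (Finset.univ \ B) :=
  ee_sdiff_right (Finset.subset_univ B)

lemma conn_compl [Fintype V] {s : Set V} (h : ((Finset.univ \ s.toFinset : Finset V)).Nonempty)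
    (hc : ∀ Y ⊆ (Finset.univ \ s.toFinset : Finset V), Y.Nonempty → Y ≠ (Finset.univ \ s.toFinset : Finset V) →
      0 < ee X Y ((Finset.univ \ s.toFinset : Finset V) \ Y)) :
    (X.induce sᶜ).Connected := by
  have := conn_of_cuts h hc
  convert this
  all_goals ext x; simp

lemma EC2.two [Fintype V] (h : EC2 X Finset.univ) (hd : ∀ v, ee X {v} Finset.univ ≤ 3) (hV : 3 ≤ Fintype.card V) :
    TwoConnected X := by
  refine ⟨by rwa [Nat.card_eq_fintype_card], fun s hs => ?_⟩
  rw [Set.ncard_eq_toFinset_card'] at hs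
  apply conn_compl
  · rw [← Finset.card_pos, Finset.card_sdiff_of_subset (by simp), Finset.card_univ]; omega
  · intro Y hY hne hne'
    by_contra hz
    have hz : ee X Y ((Finset.univ \ s.toFinset : Finset V) \ Y) = 0 := by omega
    set S := s.toFinset
    set Z := (Finset.univ \ S : Finset V) \ Y with hZ
    have hZne : Z.Nonempty := by
      rw [Finset.sdiff_nonempty]; exact fun k => hne' (Finset.Subset.antisymm hY k)
    have hSY : Disjoint Y S := Finset.disjoint_left.2 fun x hx hx' => by
      have := hY hx; simp only [Finset.mem_sdiff] at this; exact this.2 hx'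
    have hSZ : Disjoint Z S := Finset.disjoint_left.2 fun x hx hx' => by
      simp only [hZ, Finset.mem_sdiff] at hx; exact hx.1.2 hx'
    have hYZ : Disjoint Y Z := Finset.disjoint_left.2 fun x hx hx' => by
      simp only [hZ, Finset.mem_sdiff] at hx'; exact hx'.2 hx
    have e1 : (Finset.univ \ Y : Finset V) = Z ∪ S := by
      ext x; simp only [Finset.mem_sdiff, Finset.mem_union, Finset.mem_univ, true_and, hZ]
      have : x ∈ Y → x ∉ S := fun k => Finset.disjoint_left.1 hSY k
      tauto
    have e2 : (Finset.univ \ Z : Finset V) = Y ∪ S := by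
      ext x; simp only [Finset.mem_sdiff, Finset.mem_union, Finset.mem_univ, true_and, hZ]
      have : x ∈ Y → x ∉ S := fun k => Finset.disjoint_left.1 hSY k
      tauto
    have h1 := h Y (by simp) hne (by
      rintro rfl
      obtain ⟨z, hz⟩ := hZne
      exact Finset.disjoint_left.1 hYZ (by simp) hz)
    have h2 := h Z (by simp) hZne (by
      intro k
      obtain ⟨z, hz⟩ := hne
      exact Finset.disjoint_left.1 hYZ hz (by rw [k]; simp))
    rw [e1, ee_union_right hSZ, hz] at h1
    rw [e2, ee_union_right hSY, ee_comm Z Y, hz] at h2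
    have h3 : ee X S Finset.univ ≤ 3 * S.card := ee_le_of_deg fun u _ => hd u
    rw [ee_univ_sdiff S Y, e1, ee_union_right hSZ, ee_comm S Y, ee_comm S Z] at h3
    omega

lemma three_conn [Fintype V] (h : ∀ Y : Finset V, Y.Nonempty → Y ≠ Finset.univ → 3 ≤ ee X Y (Finset.univ \ Y))
    (hd : ∀ v, ee X {v} Finset.univ = 3) (hV : 4 ≤ Fintype.card V) : ThreeConnected X := by
  refine ⟨by rwa [Nat.card_eq_fintype_card], fun s hs => ?_⟩
  rw [Set.ncard_eq_toFinset_card'] at hs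
  apply conn_compl
  · rw [← Finset.card_pos, Finset.card_sdiff_of_subset (by simp), Finset.card_univ]; omega
  · intro Y hY hne hne'
    by_contra hz
    have hz : ee X Y ((Finset.univ \ s.toFinset : Finset V) \ Y) = 0 := by omega
    set S := s.toFinset
    set Z := (Finset.univ \ S : Finset V) \ Y with hZ
    have hZne : Z.Nonempty := by
      rw [Finset.sdiff_nonempty]; exact fun k => hne' (Finset.Subset.antisymm hY k)
    have hSY : Disjoint Y S := Finset.disjoint_left.2 fun x hx hx' => by
      have := hY hx; simp only [Finset.mem_sdiff] at this; exact this.2 hx'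
    have hSZ : Disjoint Z S := Finset.disjoint_left.2 fun x hx hx' => by
      simp only [hZ, Finset.mem_sdiff] at hx; exact hx.1.2 hx'
    have hYZ : Disjoint Y Z := Finset.disjoint_left.2 fun x hx hx' => by
      simp only [hZ, Finset.mem_sdiff] at hx'; exact hx'.2 hx
    have e1 : (Finset.univ \ Y : Finset V) = Z ∪ S := by
      ext x; simp only [Finset.mem_sdiff, Finset.mem_union, Finset.mem_univ, true_and, hZ]
      have : x ∈ Y → x ∉ S := fun k => Finset.disjoint_left.1 hSY k
      tauto
    have e2 : (Finset.univ \ Z : Finset V) = Y ∪ S := by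
      ext x; simp only [Finset.mem_sdiff, Finset.mem_union, Finset.mem_univ, true_and, hZ]
      have : x ∈ Y → x ∉ S := fun k => Finset.disjoint_left.1 hSY k
      tauto
    have h1 := h Y hne (by
      rintro rfl
      obtain ⟨z, hz⟩ := hZne
      exact Finset.disjoint_left.1 hYZ (by simp) hz)
    have h2 := h Z hZne (by
      intro k
      obtain ⟨z, hz⟩ := hne
      exact Finset.disjoint_left.1 hYZ hz (by rw [k]; simp))
    rw [e1, ee_union_right hSZ, hz] at h1
    rw [e2, ee_union_right hSY, ee_comm Z Y, hz] at h2
    have h3 : ee X S Finset.univ ≤ 3 * S.card := ee_le_of_deg fun u _ => (hd u).le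
    have h3' := h3
    rw [ee_univ_sdiff S Y, e1, ee_union_right hSZ, ee_comm S Y, ee_comm S Z] at h3
    have hS2 : S.card = 2 := by omega
    obtain ⟨p, q, hpq, hSpq⟩ := Finset.card_eq_two.1 hS2
    have hSS : ee X S S = 0 := by omega
    have hpqn : ee X {p} {q} = 0 := by
      have : ee X {p} {q} ≤ ee X S S := ee_mono (by simp [hSpq]) (by simp [hSpq])
      omega
    have hp := hd p
    have hq := hd q
    have hSdec : S = {p} ∪ {q} := by rw [hSpq]; rfl
    have hd' : Disjoint ({p} : Finset V) {q} := by simpa using hpq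
    have pp : ∀ p, ee X {p} {p} = 0 := fun p => by simp [ee_single]
    have hpS : p ∈ S := by simp [hSpq]
    have hqS : q ∈ S := by simp [hSpq]
    have hYp : Disjoint Y {p} := hSY.mono_right (by simpa using hpS)
    have hYq : Disjoint Y {q} := hSY.mono_right (by simpa using hqS)
    have hZp : Disjoint Z {p} := hSZ.mono_right (by simpa using hpS)
    have hZq : Disjoint Z {q} := hSZ.mono_right (by simpa using hqS)
    rw [ee_univ_sdiff _ Y, e1, ee_union_right hSZ, hSdec, ee_union_right hd', pp, hpqn] at hp
    rw [ee_univ_sdiff _ Y, e1, ee_union_right hSZ, hSdec, ee_union_right hd', pp, ee_comm {q} {p}, hpqn] at hq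
    rw [hSdec, ee_union_right hd'] at h1 h2
    have hY1 : ∀ p q : V, S = {p} ∪ {q} → p ≠ q → Disjoint Y {p} → Disjoint Y {q} → Disjoint Z {p} → Disjoint Z {q} → ee X {p} {q} = 0 →
        3 ≤ ee X Y {q} + ee X Z {p} := by
      intro p q hS hpq y1 y2 z1 z2 h0
      have h4 := h (Y ∪ {p}) (hne.mono Finset.subset_union_left) (by
        intro k
        have : q ∈ Y ∪ {p} := by rw [k]; simp
        simp only [Finset.mem_union, Finset.mem_singleton] at this
        rcases this with k | k
        · exact Finset.disjoint_left.1 y2 k (by simp)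
        · exact hpq k.symm)
      have e3 : (Finset.univ \ (Y ∪ {p}) : Finset V) = Z ∪ {q} := by
        have e4 : (Finset.univ \ (Y ∪ {p}) : Finset V) = (Finset.univ \ Y) \ {p} := by
          ext x; simp only [Finset.mem_sdiff, Finset.mem_union, Finset.mem_univ, true_and, not_or]
        rw [e4, e1, hS]
        ext x
        simp only [Finset.mem_sdiff, Finset.mem_union, Finset.mem_singleton]
        have : x ∈ Z → x ∉ ({p} : Finset V) := fun k => Finset.disjoint_left.1 z1 k
        simp only [Finset.mem_singleton] at this
        constructor
        · tauto
        · rintro (k | rfl)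
          · exact ⟨Or.inl k, this k⟩
          · exact ⟨Or.inr (Or.inr rfl), fun k => hpq k.symm⟩
      rw [e3, ee_union_left y1, ee_union_right z2, ee_union_right z2, hz, h0, ee_comm {p} Z] at h4
      omega
    have h5 := hY1 p q hSdec hpq hYp hYq hZp hZq hpqn
    have h6 := hY1 q p (by rw [hSdec, Finset.union_comm]) hpq.symm hYq hYp hZq hZp (by rw [ee_comm]; exact hpqn)
    simp only [ee_comm {p} Y, ee_comm {q} Y, ee_comm {p} Z, ee_comm {q} Z] at *
    have h7 : ee X S Finset.univ = ee X {p} Finset.univ + ee X {q} Finset.univ := by rw [hSdec, ee_union_left hd']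
    omega

end

instance decPetersen : DecidableRel petersen.Adj := fun u v => by
  unfold petersen; rw [SimpleGraph.fromRel_adj]; infer_instance

instance decRgraph : DecidableRel Rgraph.Adj := fun u v =>
  decidable_of_iff (petersen.Adj u v ∧ ¬ (s(u,v) = s(((0 : ZMod 5), (0 : Fin 2)), ((1 : ZMod 5), (0 : Fin 2))))) (by
    unfold Rgraph; rw [SimpleGraph.deleteEdges_adj]; rfl)

section
set_option linter.all false

lemma R_edges : Rgraph.edgeSet.ncard = 14 := by
  rw [Set.ncard_eq_toFinset_card']
  have : Rgraph.edgeFinset.card = 14 := by decide +kernel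
  unfold SimpleGraph.edgeFinset at this
  rw [← this]

lemma ee_le_one_of {V : Type} {X : SimpleGraph V} {A : Finset V} {u : V} [DecidableRel X.Adj] (h : (A.filter (fun v => X.Adj u v)).card ≤ 1) :
    ee X {u} A ≤ 1 := by
  rw [ee_single_card]; convert h

lemma AcyOn.insert' {V : Type} [d : DecidableEq V] {X : SimpleGraph V} {A : Finset V} {v : V} (hA : AcyOn X A) (h : ee X {v} A ≤ 1) : AcyOn X (Insert.insert v A) := by
  convert AcyOn.insert hA h

lemma nm_sdiff {α : Type} (d : DecidableEq α) {s t : Finset α} {a : α} (h : a ∈ s \ t) : a ∉ t := (Finset.mem_sdiff.1 h).2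

lemma R_fvs : fvs Rgraph ≤ 3 := by
  rw [fvs_univ]
  have h : AcyOn Rgraph {(0, 1), (1, 0), (2, 0), (3, 1), (3, 0), (4, 0), (4, 1)} := by
    iterate 6 refine AcyOn.insert' ?_ ?_
    exact acyOn_singleton _
    all_goals
   
    · apply ee_le_one_of; decide +kernel
  refine (fv_le (S := {(0,0),(1,1),(2,1)}) ?_).trans (by decide +kernel)
  apply h.mono
  intro x
  have : ∀ x : ZMod 5 × Fin 2, x ∉ ({(0,0),(1,1),(2,1)} : Finset (ZMod 5 × Fin 2)) → x ∈ ({(0, 1), (1, 0), (2, 0), (3, 1), (3, 0), (4, 0), (4, 1)} : Finset (ZMod 5 × Fin 2)) := by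
    decide +kernel
  intro hx
  exact this x (nm_sdiff _ hx)

lemma L_memF : MemF 3 1 Lgraph := by
  refine MemF.subd (le_refl 1) (MemF.subd (le_refl 1) (MemF.k4 ⟨Iso.refl⟩) (x := 0) (y := 1) (by simp) ⟨Iso.refl⟩) (x := some 2) (y := some 3) ?_ ⟨Iso.refl⟩
  rw [subdivide_ss]; exact ⟨by simp, by simp⟩

/-- basic data of an `L`/`R` piece -/
def PieceIso (g : ℕ) {V : Type} (H : SimpleGraph V) : Prop :=
  (g = 4 ∧ Nonempty (H ≃g Lgraph)) ∨ (g = 5 ∧ Nonempty (H ≃g Rgraph))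

open scoped Classical
variable {V W : Type} {X Y : SimpleGraph V}

lemma L_counts : Lgraph.edgeSet.ncard = 8 ∧ fvs Lgraph ≤ 2 := by
  have h := memF_ff L_memF
  have h1 := h.counts
  refine ⟨by rw [en_univ, h1.2.1], ?_⟩
  obtain ⟨S, hS, _, h2, h3⟩ := h.ec' (Finset.mem_univ none)
  rw [fvs_univ]
  have := fv_le h3
  omega

lemma iso_edges {A : SimpleGraph V} {B : SimpleGraph W} (e : A ≃g B) : A.edgeSet.ncard = B.edgeSet.ncard := by
  rw [← Nat.card_coe_set_eq, ← Nat.card_coe_set_eq]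
  exact Nat.card_congr e.mapEdgeSet

lemma PieceIso.counts [Fintype V] {g : ℕ} {P : Finset V} (h : PieceIso g (X.induce (P : Set V))) :
    P.card = 4 * g - 10 ∧ en X P = 6 * g - 16 ∧ fv X P ≤ g - 2 := by
  rw [← fvs_induce, ← en_eq_ncard_induce]
  have hc : Nat.card (P : Set V) = P.card := by simp
  rw [← hc]
  rcases h with ⟨rfl, ⟨e⟩⟩ | ⟨rfl, ⟨e⟩⟩
  · rw [iso_edges e, Iso.fvs_eq e, Nat.card_congr e.toEquiv]
    refine ⟨by simp, L_counts.1, L_counts.2⟩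
  · have : Finite (ZMod 5 × Fin 2) := inferInstance
    rw [iso_edges e, Iso.fvs_eq e, Nat.card_congr e.toEquiv]
    refine ⟨by simp, R_edges, R_fvs⟩

end

section
set_option linter.all false
open scoped Classical
variable {V W : Type} {X Y : SimpleGraph V}

/-- part `l` of a partition, inside `T` -/
noncomputable def pt {V : Type} {n : ℕ} (q : V → Fin n) (T : Finset V) (l : Fin n) : Finset V := T.filter fun v => q v = l

structure FGD [Fintype V] (g i j k : ℕ) (G H : SimpleGraph V) (q : V → Fin (k + 1)) : Prop where
  le : H ≤ G
  inH : ∀ u v, H.Adj u v → q u = q v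
  ff : FF i j H (pt q Finset.univ 0)
  pc : ∀ l : Fin (k + 1), l ≠ 0 → PieceIso g (H.induce (↑(pt q Finset.univ l) : Set V))
  cnt : (G.edgeSet \ H.edgeSet).ncard = k + 1
  cross : 1 ≤ k → ∀ u v, G.Adj u v → ¬ H.Adj u v → q u ≠ q v

lemma MemFG.fgd [Fintype V] {g i j k : ℕ} {G : SimpleGraph V} (h : MemFG g i j k G) : ∃ H q, FGD g i j k G H q := by
  obtain ⟨_, _, q, H, h1, h2, h3, h4, h5, h6⟩ := h
  have e : ∀ l, q ⁻¹' {l} = (↑(pt q Finset.univ l) : Set V) := by intro l; ext x; simp [pt]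
  refine ⟨H, q, h1, h2, ?_, ?_, h5, h6⟩
  · apply memF_induce_ff; rw [← e]; exact h3
  · intro l hl
    rw [← e]
    rcases h4 with ⟨hg, h4⟩ | ⟨hg, h4⟩
    · exact Or.inl ⟨hg, h4 l hl⟩
    · exact Or.inr ⟨hg, h4 l hl⟩

lemma ee_part {n : ℕ} {q : V → Fin n} (hq : ∀ u v, X.Adj u v → q u = q v) (T : Finset V) :
    ee X T T = ∑ l, ee X (pt q T l) (pt q T l) := by
  have h1 : ee X T T = ∑ l, ee X (pt q T l) T := by
    unfold ee pt
    rw [Finset.sum_fiberwise]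
  rw [h1]
  refine Finset.sum_congr rfl fun l _ => ?_
  rw [ee_sdiff_right (X := X) (A := pt q T l) (B := pt q T l) (C := T) (Finset.filter_subset _ _)]
  rw [(ee_eq_zero (A := pt q T l) (B := T \ pt q T l)).2, add_zero]
  intro u hu v hv hadj
  simp only [pt, Finset.mem_filter, Finset.mem_sdiff] at hu hv
  exact hv.2 ⟨hv.1, by rw [← hq _ _ hadj, hu.2]⟩

lemma en_part {n : ℕ} {q : V → Fin n} (hq : ∀ u v, X.Adj u v → q u = q v) (T : Finset V) :
    en X T = ∑ l, en X (pt q T l) := by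
  have := ee_part hq T
  simp only [ee_self] at this
  rw [← Finset.mul_sum] at this
  omega

lemma card_part {n : ℕ} (q : V → Fin n) (T : Finset V) : T.card = ∑ l, (pt q T l).card :=
  Finset.card_eq_sum_card_fiberwise (fun _ _ => Finset.mem_univ _)

lemma ee_sdiff_graph (h : X ≤ Y) (A B : Finset V) : ee Y A B = ee X A B + ee (Y \ X) A B := by
  unfold ee
  rw [← Finset.sum_add_distrib]
  refine Finset.sum_congr rfl fun u _ => ?_
  rw [← Finset.sum_add_distrib]
  refine Finset.sum_congr rfl fun v _ => ?_
  unfold ad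
  by_cases h1 : X.Adj u v
  · simp [h1, h h1, SimpleGraph.sdiff_adj]
  · by_cases h2 : Y.Adj u v <;> simp [h1, h2, SimpleGraph.sdiff_adj]

lemma en_sdiff_graph (h : X ≤ Y) (A : Finset V) : en Y A = en X A + en (Y \ X) A := by
  have := ee_sdiff_graph h A A
  simp only [ee_self] at this
  omega

variable [Fintype V]

lemma FGD.enD {g i j k : ℕ} {G H : SimpleGraph V} {q : V → Fin (k + 1)} (h : FGD g i j k G H q) : en (G \ H) Finset.univ = k + 1 := by
  rw [← en_univ, edgeSet_sdiff]; exact h.cnt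

lemma FGD.counts {g i j k : ℕ} {G H : SimpleGraph V} {q : V → Fin (k + 1)} (h : FGD g i j k G H q) :
    Fintype.card V = 3 * j + i + k * (4 * g - 10) ∧ en G Finset.univ = 5 * j + i + k * (6 * g - 16) + k + 1 := by
  constructor
  · rw [← Finset.card_univ, card_part q, Fin.sum_univ_succ, h.ff.counts.1,
      Finset.sum_congr rfl (fun l _ => (h.pc (Fin.succ l) (Fin.succ_ne_zero l)).counts.1)]
    simp
  · rw [en_sdiff_graph h.le, h.enD, en_part h.inH, Fin.sum_univ_succ, h.ff.counts.2.1,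
      Finset.sum_congr rfl (fun l _ => (h.pc (Fin.succ l) (Fin.succ_ne_zero l)).counts.2.1)]
    simp; ring

/-- union of parts -/
noncomputable def pu {n : ℕ} (q : V → Fin n) (L : Finset (Fin n)) : Finset V := Finset.univ.filter fun v => q v ∈ L

lemma grow {n : ℕ} {q : V → Fin n} {D : SimpleGraph V} {N : ℕ} (hN : en D Finset.univ ≤ N)
    (hcut : ∀ L : Finset (Fin n), L.Nonempty → L ≠ Finset.univ → 0 < ee D (pu q L) (Finset.univ \ pu q L)) :
    ∀ (m : ℕ) (L : Finset (Fin n)), L.Nonempty → n = L.card + m → en D (pu q L) + m ≤ N := by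
  intro m
  induction m with
  | zero =>
    intro L _ hL
    have : L = Finset.univ := by
      apply Finset.eq_univ_of_card; simp; omega
    subst this
    simpa [pu] using hN
  | succ m IH =>
    intro L hne hL
    have := hcut L hne (by rintro rfl; simp at hL)
    rw [ee_pos] at this
    obtain ⟨u, hu, v, hv, huv⟩ := this
    simp only [pu, Finset.mem_sdiff, Finset.mem_filter, Finset.mem_univ, true_and] at hu hv
    have h1 := IH (insert (q v) L) (by simp) (by rw [Finset.card_insert_of_notMem hv]; omega)
    have hsub : pu q L ⊆ pu q (insert (q v) L) := by
      intro x; simp only [pu, Finset.mem_filter, Finset.mem_univ, true_and, Finset.mem_insert]; exact Or.inr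
    rw [en_sdiff hsub] at h1
    have : 0 < ee D (pu q L) (pu q (insert (q v) L) \ pu q L) := by
      rw [ee_pos]
      refine ⟨u, by simp [pu, hu], v, by simp [pu, hv], huv⟩
    omega

lemma en_delE {a b : V} (h : X.Adj a b) : en X Finset.univ = en (delE X a b) Finset.univ + 1 := by
  have h1 : addE (delE X a b) a b = X := by
    ext u v
    rw [addE_adj, delE_adj]
    constructor
    · rintro (k | ⟨_, ⟨rfl, rfl⟩ | ⟨rfl, rfl⟩⟩)
      · exact k.1
      · exact h
      · exact h.symm
    · intro k
      by_cases hh : (u = a ∧ v = b) ∨ (u = b ∧ v = a)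
      · exact Or.inr ⟨k.ne, hh⟩
      · exact Or.inl ⟨k, hh⟩
  have h2 := ee_addE (X := delE X a b) h.ne (by simp [delE_adj]) Finset.univ Finset.univ
  rw [h1] at h2
  simp [ee_self] at h2
  omega

lemma ee_delE_ge {a b : V} (A B : Finset V) (hAB : Disjoint A B) : ee X A B ≤ ee (delE X a b) A B + 1 := by
  by_cases h : X.Adj a b
  · have h1 : addE (delE X a b) a b = X := by
      ext u v
      rw [addE_adj, delE_adj]
      constructor
      · rintro (k | ⟨_, ⟨rfl, rfl⟩ | ⟨rfl, rfl⟩⟩)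
        · exact k.1
        · exact h
        · exact h.symm
      · intro k
        by_cases hh : (u = a ∧ v = b) ∨ (u = b ∧ v = a)
        · exact Or.inr ⟨k.ne, hh⟩
        · exact Or.inl ⟨k, hh⟩
    have h2 := ee_addE (X := delE X a b) h.ne (by simp [delE_adj]) A B
    rw [h1] at h2
    rw [Finset.disjoint_left] at hAB
    by_cases k1 : a ∈ A ∧ b ∈ B
    · have : ¬ (b ∈ A ∧ a ∈ B) := fun k => hAB k1.1 k.2
      simp [k1, this] at h2; omega
    · simp [k1] at h2
      split_ifs at h2 <;> omega
  · have : delE X a b = X := by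
      ext u v; rw [delE_adj]
      constructor
      · exact fun k => k.1
      · refine fun k => ⟨k, ?_⟩
        rintro (⟨rfl, rfl⟩ | ⟨rfl, rfl⟩)
        · exact h k
        · exact h k.symm
    rw [this]; omega

lemma FGD.fv_le {g i j k : ℕ} {G H : SimpleGraph V} {q : V → Fin (k + 1)} (h : FGD g i j k G H q) (hG : EC2 G Finset.univ) :
    fv G Finset.univ ≤ k * (g - 2) + j + 1 := by
  have hne0 : (pt q Finset.univ 0).Nonempty := by
    rw [← Finset.card_pos, h.ff.counts.1]; have := h.ff.le; omega
  have hcut0 : ∀ L : Finset (Fin (k + 1)), L.Nonempty → L ≠ Finset.univ → 2 ≤ ee (G \ H) (pu q L) (Finset.univ \ pu q L) := by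
    intro L hL hL'
    have hpt : ∀ l, (pt q Finset.univ l).Nonempty := by
      intro l
      by_cases hl : l = 0
      · rw [hl]; exact hne0
      · have := (h.pc l hl).counts.1
        have hg : g = 4 ∨ g = 5 := by rcases h.pc l hl with k | k <;> simp [k.1]
        rw [← Finset.card_pos]; omega
    have h1 := hG (pu q L) (by simp) (by
      obtain ⟨l, hl⟩ := hL
      obtain ⟨x, hx⟩ := hpt l
      simp only [pt, Finset.mem_filter] at hx
      exact ⟨x, by simp [pu, hx.2, hl]⟩) (by
      intro hh
      apply hL'
      ext l
      simp only [Finset.mem_univ, iff_true]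
      obtain ⟨x, hx⟩ := hpt l
      simp only [pt, Finset.mem_filter] at hx
      have : x ∈ pu q L := by rw [hh]; simp
      simp only [pu, Finset.mem_filter, hx.2] at this
      exact this.2)
    have h2 : ee H (pu q L) (Finset.univ \ pu q L) = 0 := by
      rw [ee_eq_zero]
      intro u hu v hv huv
      simp only [pu, Finset.mem_filter, Finset.mem_sdiff, Finset.mem_univ, true_and] at hu hv
      rw [← h.inH _ _ huv] at hv; exact hv hu
    rw [ee_sdiff_graph h.le, h2] at h1; omega
  obtain ⟨a, b, hab, ha⟩ : ∃ a b, (G \ H).Adj a b ∧ a ∈ pt q Finset.univ 0 := by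
    rcases Nat.eq_zero_or_pos k with rfl | hk
    · have := h.enD
      have h2 : 0 < ee (G \ H) Finset.univ Finset.univ := by rw [ee_self]; omega
      rw [ee_pos] at h2
      obtain ⟨u, _, v, _, huv⟩ := h2
      exact ⟨u, v, huv, by simp only [pt, Finset.mem_filter, Finset.mem_univ, true_and]; exact Subsingleton.elim (α := Fin 1) _ _⟩
    · have := hcut0 {0} (by simp) (by
        intro hh
        have := congrArg Finset.card hh
        simp at this; omega)
      have h2 : 0 < ee (G \ H) (pu q {0}) (Finset.univ \ pu q {0}) := by omega
      rw [ee_pos] at h2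
      obtain ⟨u, hu, v, _, huv⟩ := h2
      exact ⟨u, v, huv, by simpa [pu, pt] using hu⟩
  obtain ⟨S0, hS0, haS, hS0c, hS0a⟩ := h.ff.ec' ha
  have hS : ∀ l : Fin (k + 1), ∃ S, l ≠ 0 → S ⊆ pt q Finset.univ l ∧ AcyOn H (pt q Finset.univ l \ S) ∧ S.card ≤ g - 2 := by
    intro l
    by_cases hl : l = 0
    · exact ⟨∅, fun k => absurd hl k⟩
    · obtain ⟨S, h1, h2, h3⟩ := fv_exists H (pt q Finset.univ l)
      exact ⟨S, fun _ => ⟨h1, h2, by rw [h3]; exact (h.pc l hl).counts.2.2⟩⟩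
  choose S1 hS1 using hS
  let S : Fin (k + 1) → Finset V := fun l => if l = 0 then S0 else S1 l
  have hSa : ∀ l, AcyOn H (pt q Finset.univ l \ S l) := by
    intro l; by_cases hl : l = 0
    · simp only [S, hl, if_true]; exact hS0a
    · simp only [S, hl, if_false]; exact (hS1 l hl).2.1
  let T := Finset.univ.biUnion S
  have hT : T.card ≤ k * (g - 2) + j + 1 := by
    refine Finset.card_biUnion_le.trans ?_
    rw [Fin.sum_univ_succ]
    have : ∑ l : Fin k, (S l.succ).card ≤ ∑ l : Fin k, (g - 2) := Finset.sum_le_sum fun l _ => by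
      simp only [S, Fin.succ_ne_zero, if_false]; exact (hS1 _ (Fin.succ_ne_zero l)).2.2
    simp at this
    have h0 : (S 0).card ≤ j + 1 := by simpa [S] using hS0c
    omega
  refine le_trans (InducedForest.fv_le (S := T) ?_) hT
  rw [acyOn_iff]
  intro A hA hAne
  let L : Finset (Fin (k + 1)) := Finset.univ.filter fun l => (pt q A l).Nonempty
  have hLne : L.Nonempty := by
    obtain ⟨x, hx⟩ := hAne
    exact ⟨q x, by simp only [L, Finset.mem_filter, Finset.mem_univ, true_and]; exact ⟨x, by simp [pt, hx]⟩⟩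
  have hLc : L.card ≤ k + 1 := by have := Finset.card_le_univ L; simpa using this
  have h1 := grow (q := q) (D := delE (G \ H) a b) (N := k) (by have := en_delE hab; have := h.enD; omega) (by
    intro L h1 h2
    have := hcut0 L h1 h2
    have := ee_delE_ge (X := G \ H) (a := a) (b := b) (pu q L) (Finset.univ \ pu q L) Finset.disjoint_sdiff
    omega) (k + 1 - L.card) L hLne (by omega)
  have h2 : en (G \ H) A ≤ en (delE (G \ H) a b) (pu q L) := by
    have e1 : ee (G \ H) A A = ee (delE (G \ H) a b) A A := by
      have haA : a ∉ A := by
        intro k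
        have := hA k
        rw [Finset.mem_sdiff] at this
        apply this.2
        simp only [T, Finset.mem_biUnion, Finset.mem_univ, true_and]
        exact ⟨0, by simpa [S] using haS⟩
      apply ee_congr_graph
      intro u hu v hv
      rw [delE_adj]
      constructor
      · refine fun k => ⟨k, ?_⟩
        rintro (⟨rfl, rfl⟩ | ⟨rfl, rfl⟩)
        · exact haA hu
        · exact haA hv
      · exact fun k => k.1
    have e2 : A ⊆ pu q L := by
      intro x hx
      simp only [pu, L, Finset.mem_filter, Finset.mem_univ, true_and]; exact ⟨x, by simp [pt, hx]⟩
    have := ee_mono (X := delE (G \ H) a b) e2 e2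
    simp only [ee_self] at this e1
    omega
  have h3 : en H A + L.card ≤ A.card := by
    rw [en_part h.inH, card_part q A, Finset.card_filter, ← Finset.sum_add_distrib]
    refine Finset.sum_le_sum fun l _ => ?_
    split_ifs with hl
    · have := acyOn_iff.1 (hSa l) (pt q A l) (by
        intro x hx
        simp only [pt, Finset.mem_filter] at hx
        simp only [pt, Finset.mem_sdiff, Finset.mem_filter, Finset.mem_univ, true_and]
        refine ⟨hx.2, fun k => ?_⟩
        have := hA hx.1
        rw [Finset.mem_sdiff] at this
        exact this.2 (by simp only [T, Finset.mem_biUnion, Finset.mem_univ, true_and]; exact ⟨l, k⟩)) hl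
      exact this
    · rw [Finset.not_nonempty_iff_eq_empty] at hl
      simp [hl, en]
  rw [en_sdiff_graph h.le]
  have := hLne.card_pos
  omega

lemma FGD.tri {k : ℕ} {G H : SimpleGraph V} {q : V → Fin (k + 1)} (h : FGD 5 3 0 k G H q) (hG : EC2 G Finset.univ)
    (hd : ∀ v, ee G {v} Finset.univ ≤ 3) :
    4 ≤ Fintype.card V ∧ ∀ x, ee G {x} Finset.univ ≤ 2 → ∃ y z, G.Adj x y ∧ G.Adj x z ∧ G.Adj y z := by
  have hc := h.counts
  have hk : 1 ≤ k := by
    rcases Nat.eq_zero_or_pos k with rfl | hk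
    · exfalso
      have h1 : en G Finset.univ ≤ 3 := by
        have : ee G Finset.univ Finset.univ ≤ 2 * (Finset.univ : Finset V).card := by
          apply ee_le_of_deg
          intro u _
          have : ee G {u} Finset.univ ≤ (Finset.univ.erase u).card := by
            rw [ee_single_card]; apply Finset.card_le_card
            intro v; simp only [Finset.mem_filter, Finset.mem_erase, Finset.mem_univ, true_and, and_true]
            exact fun k => k.ne'
          rw [Finset.card_erase_of_mem (by simp), Finset.card_univ, hc.1] at this
          simpa using this
        rw [ee_self, Finset.card_univ, hc.1] at this; omega
      omega
    · exact hk
  refine ⟨by omega, fun x hx => ?_⟩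
  have hx0 : x ∈ pt q Finset.univ 0 := by
    by_contra hne
    have hl : q x ≠ 0 := fun k => hne (by simp [pt, k])
    set A := pt q Finset.univ (q x) with hA
    have hxA : x ∈ A := by simp [hA, pt]
    have hcA := (h.pc _ hl).counts
    rw [← hA] at hcA
    have h0 : (pt q Finset.univ 0).Nonempty := by
      rw [← Finset.card_pos, h.ff.counts.1]; omega
    have h1 := hG A (by simp) ⟨x, hxA⟩ (by
      intro k
      obtain ⟨y, hy⟩ := h0
      have hyA : y ∈ A := by rw [k]; simp
      simp only [hA, pt, Finset.mem_filter] at hy hyA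
      exact hl (hyA.2.symm.trans hy.2))
    have h2 : ee G A A = 28 := by
      have : ee G A A = ee H A A := ee_congr_graph fun u hu v hv => ⟨fun k => by
        by_contra hn
        simp only [hA, pt, Finset.mem_filter] at hu hv
        exact h.cross hk u v k hn (hu.2.trans hv.2.symm), fun k => h.le k⟩
      rw [this, ee_self, hcA.2.1]
    have h3 := ee_univ_sdiff (X := G) A A
    have h4 : ee G (A.erase x) Finset.univ ≤ 3 * (A.erase x).card := ee_le_of_deg fun u _ => hd u
    rw [Finset.card_erase_of_mem hxA] at h4
    have h5 := ee_insert_left (X := G) (C := Finset.univ) (Finset.notMem_erase x A)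
    rw [Finset.insert_erase hxA] at h5
    omega
  obtain ⟨a, b, c, hab, hbc, hac, hP⟩ := h.ff.tri_of
  rw [hP] at hx0
  simp only [Finset.mem_insert, Finset.mem_singleton] at hx0
  have hab := h.le hab
  have hbc := h.le hbc
  have hac := h.le hac
  rcases hx0 with rfl | rfl | rfl
  · exact ⟨b, c, hab, hac, hbc⟩
  · exact ⟨a, c, hab.symm, hbc, hac⟩
  · exact ⟨a, b, hac.symm, hbc.symm, hab⟩

end

section
set_option linter.all false
open scoped Classical
variable {V W : Type} {X Y : SimpleGraph V}

lemma induce_iso {A : SimpleGraph V} {B : SimpleGraph W} (e : A ≃g B) (s : Set V) (t : Set W) (h : ∀ v, v ∈ s ↔ e v ∈ t) :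
    Nonempty (A.induce s ≃g B.induce t) := by
  refine ⟨⟨e.toEquiv.subtypeEquiv h, ?_⟩⟩
  intro a b
  exact e.map_adj_iff (v := a.1) (w := b.1)

lemma two_iso {A : SimpleGraph V} {B : SimpleGraph W} (e : A ≃g B) (h : TwoConnected B) : TwoConnected A := by
  refine ⟨by rw [Nat.card_congr e.toEquiv]; exact h.1, fun s hs => ?_⟩
  obtain ⟨f⟩ := induce_iso e sᶜ (e '' s)ᶜ (by intro v; simp)
  refine (Iso.connected_iff f).2 (h.2 _ ?_)
  rwa [Set.ncard_image_of_injective _ e.injective]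

lemma subcubic_iso {A : SimpleGraph V} {B : SimpleGraph W} (e : A ≃g B) (h : Subcubic B) : Subcubic A := by
  intro v
  refine le_trans (le_of_eq ?_) (h (e v))
  rw [← Set.ncard_image_of_injective _ e.injective]
  congr 1
  ext x
  simp only [Set.mem_image, mem_neighborSet]
  constructor
  · rintro ⟨y, hy, rfl⟩; exact e.map_adj_iff.2 hy
  · intro hx
    refine ⟨e.symm x, ?_, by simp⟩
    rw [← e.map_adj_iff]; simpa using hx

lemma memFG_iso {g i j k : ℕ} {A : SimpleGraph V} {B : SimpleGraph W} (e : A ≃g B) (h : MemFG g i j k B) : MemFG g i j k A := by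
  obtain ⟨h1, h2, P, H, h3, h4, h5, h6, h7, h8⟩ := h
  have hf : ∀ l, Nonempty ((H.comap e).induce ((P ∘ e) ⁻¹' {l}) ≃g H.induce (P ⁻¹' {l})) := by
    intro l
    exact induce_iso (A := H.comap e) (B := H) ⟨e.toEquiv, Iff.rfl⟩ _ _ (by intro v; rfl)
  refine ⟨two_iso e h1, subcubic_iso e h2, P ∘ e, H.comap e, ?_, ?_, ?_, ?_, ?_, ?_⟩
  · intro u v huv
    exact e.map_adj_iff.1 (h3 huv)
  · intro u v huv; exact h4 _ _ huv
  · obtain ⟨f⟩ := hf 0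
    exact memF_iso h5 f
  · rcases h6 with ⟨hg, h6⟩ | ⟨hg, h6⟩
    · refine Or.inl ⟨hg, fun l hl => ?_⟩
      obtain ⟨f⟩ := hf l
      obtain ⟨f'⟩ := h6 l hl
      exact ⟨f.trans f'⟩
    · refine Or.inr ⟨hg, fun l hl => ?_⟩
      obtain ⟨f⟩ := hf l
      obtain ⟨f'⟩ := h6 l hl
      exact ⟨f.trans f'⟩
  · rw [← h7, ← edgeSet_sdiff, ← edgeSet_sdiff]
    refine iso_edges ⟨e.toEquiv, ?_⟩
    intro a b
    rw [SimpleGraph.sdiff_adj, SimpleGraph.sdiff_adj]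
    exact and_congr e.map_adj_iff Iff.rfl
  · intro hk u v huv hn
    exact h8 hk _ _ (e.map_adj_iff.2 huv) hn

lemma eps_iso (g : ℕ) {A : SimpleGraph V} {B : SimpleGraph W} (e : A ≃g B) : eps g A = eps g B := by
  have h1 : (fun p : ℕ × ℕ => 1 ≤ p.1 ∧ p.2 ≤ p.1 ∧ MemF p.1 p.2 A) = (fun p : ℕ × ℕ => 1 ≤ p.1 ∧ p.2 ≤ p.1 ∧ MemF p.1 p.2 B) := by
    funext p
    exact propext (and_congr Iff.rfl (and_congr Iff.rfl ⟨fun h => memF_iso h e.symm, fun h => memF_iso h e⟩))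
  have h2 : (fun q : ℕ × ℕ × ℕ => 1 ≤ q.1 ∧ q.2.1 ≤ q.1 ∧ MemFG g q.1 q.2.1 q.2.2 A) = (fun q : ℕ × ℕ × ℕ => 1 ≤ q.1 ∧ q.2.1 ≤ q.1 ∧ MemFG g q.1 q.2.1 q.2.2 B) := by
    funext p
    exact propext (and_congr Iff.rfl (and_congr Iff.rfl ⟨fun h => memFG_iso e.symm h, fun h => memFG_iso e h⟩))
  have h3 : Nonempty (A ≃g (⊤ : SimpleGraph (Fin 2))) = Nonempty (B ≃g (⊤ : SimpleGraph (Fin 2))) :=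
    propext ⟨fun ⟨f⟩ => ⟨e.symm.trans f⟩, fun ⟨f⟩ => ⟨e.trans f⟩⟩
  have key : ∀ (p p' : ℕ × ℕ → Prop) (q q' : ℕ × ℕ × ℕ → Prop) (r r' : Prop), p = p' → q = q' → r = r' →
    (if h1 : ∃ x, p x then
      max (1 - (h1.choose.2 : ℝ) * (5 * tg g - 1) - (h1.choose.1 : ℝ) * tg g) 0
    else if h2 : ∃ x, q x then
      max (1 - tg g - (h2.choose.2.1 : ℝ) * (5 * tg g - 1) - (h2.choose.1 : ℝ) * tg g) 0
    else if r then -tg g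
    else 0) = (if h1 : ∃ x, p' x then
      max (1 - (h1.choose.2 : ℝ) * (5 * tg g - 1) - (h1.choose.1 : ℝ) * tg g) 0
    else if h2 : ∃ x, q' x then
      max (1 - tg g - (h2.choose.2.1 : ℝ) * (5 * tg g - 1) - (h2.choose.1 : ℝ) * tg g) 0
    else if r' then -tg g
    else 0) := by
    intro p p' q q' r r' h1 h2 h3
    subst h1 h2 h3; rfl
  exact key _ _ _ _ _ _ h1 h2 h3

lemma memF_card [Fintype V] {i j : ℕ} {A : SimpleGraph V} (h : MemF i j A) : 3 ≤ Fintype.card V := by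
  have h1 := memF_ff h
  have := h1.counts
  have := h1.le
  rw [Finset.card_univ] at *
  omega

lemma eps_small [Fintype V] (g : ℕ) {A : SimpleGraph V} (h : Fintype.card V ≤ 2) :
    eps g A = if Nonempty (A ≃g (⊤ : SimpleGraph (Fin 2))) then -tg g else 0 := by
  unfold eps
  rw [dif_neg, dif_neg]
  · rintro ⟨q, _, _, hq⟩
    have := hq.1.1
    rw [Nat.card_eq_fintype_card] at this; omega
  · rintro ⟨q, _, _, hq⟩
    have := memF_card hq
    omega

lemma eps_one [Fintype V] (g : ℕ) {A : SimpleGraph V} (h : Fintype.card V ≤ 1) : eps g A = 0 := by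
  rw [eps_small g (by omega), if_neg]
  rintro ⟨e⟩
  have := Fintype.card_congr e.toEquiv
  simp at this; omega

/-- connectedness of `X[P]` by cuts -/
def Cn {V : Type} (X : SimpleGraph V) (P : Finset V) : Prop := by
  classical
  exact ∀ Y ⊆ P, Y.Nonempty → Y ≠ P → 0 < ee X Y (P \ Y)

/-- connected without cut vertex -/
def GoodF {V : Type} (X : SimpleGraph V) (P : Finset V) : Prop := by
  classical
  exact P.Nonempty ∧ Cn X P ∧ ∀ v ∈ P, Cn X (P.erase v)

lemma conn_iff {P : Finset V} : (X.induce (P : Set V)).Connected ↔ P.Nonempty ∧ Cn X P := by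
  constructor
  · intro h
    refine ⟨?_, cuts_of_conn h⟩
    obtain ⟨v⟩ := h.nonempty
    exact ⟨v.1, v.2⟩
  · exact fun h => conn_of_cuts h.1 h.2

lemma card_cc_conn {A : SimpleGraph V} (h : A.Connected) : Nat.card A.ConnectedComponent = 1 := by
  rw [Nat.card_eq_one_iff_unique]
  exact ⟨h.preconnected.subsingleton_connectedComponent, ⟨A.connectedComponentMk h.nonempty.some⟩⟩

lemma cut_iff [Finite V] {A : SimpleGraph V} (h : A.Connected) (v : V) : ¬ IsCutVertex A v ↔ (A.induce {u | u ≠ v}).Preconnected := by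
  unfold IsCutVertex
  rw [card_cc_conn h, not_lt]
  constructor
  · intro h1
    have : Subsingleton (A.induce {u | u ≠ v}).ConnectedComponent := by
      rw [← Finite.card_le_one_iff_subsingleton]; exact h1
    intro a b
    exact ConnectedComponent.exact (Subsingleton.elim _ _)
  · intro h1
    have := h1.subsingleton_connectedComponent
    rw [← Finite.card_le_one_iff_subsingleton] at this; exact this

lemma good_iff {W : Type} {A : SimpleGraph W} {P : Finset V} (e : A ≃g X.induce (P : Set V)) :
    (A.Connected ∧ ∀ v, ¬ IsCutVertex A v) ↔ GoodF X P := by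
  have : Finite W := Finite.of_equiv _ e.symm.toEquiv
  have hpre : ∀ v : W, (A.induce {u | u ≠ v}).Preconnected ↔ Cn X (P.erase (e v).1) := by
    intro v
    obtain ⟨f⟩ : Nonempty (A.induce {u | u ≠ v} ≃g X.induce (↑(P.erase (e v).1) : Set V)) := by
      refine ⟨⟨⟨fun u => ⟨(e u.1).1, ?_⟩, fun x => ⟨e.symm ⟨x.1, ?_⟩, ?_⟩, ?_, ?_⟩, ?_⟩⟩
      · have hu := u.2
        simp only [Set.mem_setOf_eq] at hu
        simp only [Finset.mem_coe, Finset.mem_erase]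
        refine ⟨fun k => hu (e.injective (Subtype.ext k)), (e u.1).2⟩
      · have := x.2
        simp only [Finset.mem_coe, Finset.mem_erase] at this
        exact this.2
      · have := x.2
        simp only [Finset.mem_coe, Finset.mem_erase] at this
        simp only [Set.mem_setOf_eq]
        intro k
        have h2 := congrArg e k
        rw [RelIso.apply_symm_apply] at h2
        exact this.1 (congrArg Subtype.val h2)
      · intro u; apply Subtype.ext; simp
      · intro u; apply Subtype.ext; simp
      · intro a b
        exact e.map_adj_iff (v := a.1) (w := b.1)
    rw [f.preconnected_iff]
    by_cases hne : (P.erase (e v).1).Nonempty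
    · have : (X.induce (↑(P.erase (e v).1) : Set V)).Preconnected ↔ (X.induce (↑(P.erase (e v).1) : Set V)).Connected :=
        ⟨fun h => { preconnected := h, nonempty := ⟨⟨hne.choose, hne.choose_spec⟩⟩ }, fun h => h.preconnected⟩
      rw [this, conn_iff]; exact ⟨fun h => h.2, fun h => ⟨hne, h⟩⟩
    · rw [Finset.not_nonempty_iff_eq_empty] at hne
      rw [hne]
      constructor
      · intro _ Y hY hYn
        rw [Finset.subset_empty] at hY; simp [hY] at hYn
      · intro _ a
        have := a.2
        simp at this
  constructor
  · rintro ⟨h1, h2⟩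
    have h3 := conn_iff.1 (e.connected_iff.1 h1)
    refine ⟨h3.1, h3.2, fun v hv => ?_⟩
    have := (hpre (e.symm ⟨v, hv⟩)).1 ((cut_iff h1 _).1 (h2 _))
    simpa using this
  · rintro ⟨h1, h2, h3⟩
    have hc := e.connected_iff.2 (conn_iff.2 ⟨h1, h2⟩)
    exact ⟨hc, fun v => (cut_iff hc v).2 ((hpre v).2 (h3 _ (e v).2))⟩

/-- blocks of `X[P]` -/
noncomputable def blk (X : SimpleGraph V) (P : Finset V) : Finset (Finset V) :=
  P.powerset.filter fun B => GoodF X B ∧ ∀ B' ⊆ P, B ⊆ B' → GoodF X B' → B' = B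

lemma rg_eq' (g : ℕ) {W : Type} {A : SimpleGraph W} {P : Finset V} (e : A ≃g X.induce (P : Set V)) :
    rg g A = ∑ B ∈ blk X P, eps g (X.induce (B : Set V)) := by
  unfold rg
  have hfin : Finite W := Finite.of_equiv _ e.symm.toEquiv
  let f : W → V := fun w => (e w).1
  have finj : Function.Injective f := fun a b h => e.injective (Subtype.ext h)
  have hfs : ∀ B : Set W, (f '' B).Finite := fun B => (Set.toFinite B).image f
  let F : Set W → Finset V := fun B => (hfs B).toFinset
  have mF : ∀ B x, x ∈ F B ↔ ∃ y ∈ B, f y = x := by intro B x; simp [F]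
  have im : ∀ B, F B ⊆ P := by
    intro B x hx
    rw [mF] at hx
    obtain ⟨y, _, rfl⟩ := hx; exact (e y).2
  have iso : ∀ B, Nonempty ((A.induce B) ≃g X.induce (↑(F B) : Set V)) := by
    intro B
    have hbij : Function.Bijective (fun u : B => (⟨f u.1, (mF B _).2 ⟨u.1, u.2, rfl⟩⟩ : (↑(F B) : Set V))) := by
      constructor
      · intro a b h
        have h' : f a.1 = f b.1 := congrArg (fun z : (↑(F B) : Set V) => z.1) h
        exact Subtype.ext (finj h')
      · rintro ⟨x, hx⟩
        obtain ⟨y, hy, rfl⟩ := (mF B x).1 hx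
        exact ⟨⟨y, hy⟩, rfl⟩
    refine ⟨⟨Equiv.ofBijective _ hbij, ?_⟩⟩
    intro a b
    exact e.map_adj_iff (v := a.1) (w := b.1)
  have gd : ∀ B, ((A.induce B).Connected ∧ ∀ v, ¬ IsCutVertex (A.induce B) v) ↔ GoodF X (F B) := by
    intro B; obtain ⟨f⟩ := iso B; exact good_iff f
  have inj : ∀ B B' : Set W, B ⊆ B' ↔ F B ⊆ F B' := by
    intro B B'
    constructor
    · intro h x hx
      rw [mF] at *
      obtain ⟨y, hy, rfl⟩ := hx
      exact ⟨y, h hy, rfl⟩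
    · intro h y hy
      obtain ⟨z, hz, hzy⟩ := (mF _ _).1 (h ((mF B (f y)).2 ⟨y, hy, rfl⟩))
      rwa [← finj hzy]
  have surj : ∀ Q ⊆ P, ∃ B, F B = Q := by
    intro Q hQ
    refine ⟨{x | f x ∈ Q}, ?_⟩
    ext x
    rw [mF]
    constructor
    · rintro ⟨y, hy, rfl⟩; exact hy
    · intro hx
      have : f (e.symm ⟨x, hQ hx⟩) = x := by simp [f]
      exact ⟨e.symm ⟨x, hQ hx⟩, by simpa only [Set.mem_setOf_eq, this] using hx, this⟩
  have inj2 : ∀ B B', F B = F B' → B = B' :=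
    fun B B' h => Set.Subset.antisymm ((inj _ _).2 h.subset) ((inj _ _).2 h.symm.subset)
  rw [← finsum_mem_coe_finset]
  refine finsum_mem_eq_of_bijOn F ⟨?_, ?_, ?_⟩ ?_
  · rintro B ⟨h1, h2⟩
    simp only [blk, Finset.coe_filter, Finset.mem_powerset, Set.mem_setOf_eq]
    refine ⟨im B, (gd B).1 h1, fun Q hQ hBQ hg => ?_⟩
    obtain ⟨B', rfl⟩ := surj Q hQ
    rw [h2 B' ((inj _ _).2 hBQ) ((gd _).2 hg)]
  · intro B _ B' _ h; exact inj2 _ _ h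
  · intro Q hQ
    simp only [blk, Finset.coe_filter, Finset.mem_powerset, Set.mem_setOf_eq] at hQ
    obtain ⟨B, rfl⟩ := surj Q hQ.1
    refine ⟨B, ⟨(gd B).2 hQ.2.1, fun B' hB hB' => ?_⟩, rfl⟩
    exact inj2 _ _ (hQ.2.2 _ (im B') ((inj _ _).1 hB) ((gd _).1 hB'))
  · intro B _
    obtain ⟨f⟩ := iso B
    exact eps_iso g f

lemma rg_eq (g : ℕ) (P : Finset V) : rg g (X.induce (P : Set V)) = ∑ B ∈ blk X P, eps g (X.induce (B : Set V)) :=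
  rg_eq' g Iso.refl

end

section
set_option linter.all false
open scoped Classical
variable {V W : Type} {X Y : SimpleGraph V}

lemma tg_pos (g : ℕ) : 0 < tg g := by unfold tg; split_ifs <;> norm_num

lemma uniq_of_ee {A B : Finset V} (h : ee X A B ≤ 1) {u v u' v' : V} (hu : u ∈ A) (hv : v ∈ B) (huv : X.Adj u v)
    (hu' : u' ∈ A) (hv' : v' ∈ B) (huv' : X.Adj u' v') : u = u' ∧ v = v' := by
  rw [ee_eq_card, Finset.card_le_one] at h
  have := h (u, v) (by simp [hu, hv, huv]) (u', v') (by simp [hu', hv', huv'])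
  simpa using this

lemma crossing {A B C : Finset V} (hd : Disjoint A B) (h : ee X A B ≤ 1) (hC : C ⊆ A ∪ B) (hg : GoodF X C)
    (hA : ¬ C ⊆ A) (hB : ¬ C ⊆ B) : ∃ u ∈ A, ∃ v ∈ B, X.Adj u v ∧ C = {u, v} := by
  have memAB : ∀ x ∈ C, x ∉ B → x ∈ A := fun x hx hxB => (Finset.mem_union.1 (hC hx)).resolve_right hxB
  have memBA : ∀ x ∈ C, x ∉ A → x ∈ B := fun x hx hxA => (Finset.mem_union.1 (hC hx)).resolve_left hxA
  obtain ⟨b, hbC, hbA⟩ := Finset.not_subset.1 hA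
  obtain ⟨a, haC, haB⟩ := Finset.not_subset.1 hB
  have haA := memAB a haC haB
  have hbB := memBA b hbC hbA
  have h1 := hg.2.1 (C.filter (· ∈ A)) (Finset.filter_subset _ _) ⟨a, by simp [haC, haA]⟩ (by
    intro k
    rw [← k] at hbC
    simp at hbC; exact hbA hbC.2)
  rw [ee_pos] at h1
  obtain ⟨u, hu, v, hv, huv⟩ := h1
  simp only [Finset.mem_filter, Finset.mem_sdiff] at hu hv
  have hvA : v ∉ A := fun k => hv.2 ⟨hv.1, k⟩
  have hvB := memBA v hv.1 hvA
  refine ⟨u, hu.2, v, hvB, huv, ?_⟩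
  have k1 : ∀ x ∈ C, x ∈ A → x = u := by
    intro x hx hxA
    by_contra hxu
    have h2 := hg.2.2 u hu.1 ((C.erase u).filter (· ∈ A)) (Finset.filter_subset _ _) ⟨x, by simp [hx, hxA, hxu]⟩ (by
      intro k
      have : v ∈ C.erase u := by simp [hv.1, huv.ne']
      rw [← k] at this
      simp at this; exact hvA this.2)
    rw [ee_pos] at h2
    obtain ⟨y, hy, z, hz, hyz⟩ := h2
    simp only [Finset.mem_filter, Finset.mem_sdiff, Finset.mem_erase] at hy hz
    have hzA : z ∉ A := fun k => hz.2 ⟨hz.1, k⟩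
    have := uniq_of_ee h hu.2 hvB huv hy.2 (memBA z hz.1.2 hzA) hyz
    exact hy.1.1 this.1.symm
  have k2 : ∀ x ∈ C, x ∈ B → x = v := by
    intro x hx hxB
    by_contra hxu
    have h2 := hg.2.2 v hv.1 ((C.erase v).filter (· ∈ A)) (Finset.filter_subset _ _) ⟨u, by simp [hu.1, hu.2, huv.ne]⟩ (by
      intro k
      have : x ∈ C.erase v := by simp [hx, hxu]
      rw [← k] at this
      simp at this; exact Finset.disjoint_left.1 hd this.2 hxB)
    rw [ee_pos] at h2
    obtain ⟨y, hy, z, hz, hyz⟩ := h2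
    simp only [Finset.mem_filter, Finset.mem_sdiff, Finset.mem_erase] at hy hz
    have hzA : z ∉ A := fun k => hz.2 ⟨hz.1, k⟩
    have := uniq_of_ee h hu.2 hvB huv hy.2 (memBA z hz.1.2 hzA) hyz
    exact hz.1.1 this.2.symm
  ext x
  simp only [Finset.mem_insert, Finset.mem_singleton]
  constructor
  · intro hx
    rcases Finset.mem_union.1 (hC hx) with k | k
    · exact Or.inl (k1 x hx k)
    · exact Or.inr (k2 x hx k)
  · rintro (rfl | rfl)
    · exact hu.1
    · exact hv.1

lemma eps_le_one (g : ℕ) {B : Finset V} (h : B.card ≤ 1) : eps g (X.induce (B : Set V)) = 0 :=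
  eps_one g (by simpa using h)

lemma eps_pair (g : ℕ) {u v : V} (h : X.Adj u v) : eps g (X.induce (↑({u, v} : Finset V) : Set V)) = - tg g := by
  rw [eps_small g (by simpa using Finset.card_le_two), if_pos]
  have hc : Nat.card (↑({u, v} : Finset V) : Set V) = 2 := by simp [Finset.card_pair h.ne]
  refine ⟨⟨Finite.equivFinOfCardEq hc, ?_⟩⟩
  intro a b
  simp only [top_adj, ne_eq, EmbeddingLike.apply_eq_iff_eq, comap_adj, Function.Embedding.subtype_apply]
  constructor
  · intro hab
    have h1 := a.2
    have h2 := b.2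
    simp only [Finset.coe_insert, Finset.coe_singleton, Set.mem_insert_iff, Set.mem_singleton_iff] at h1 h2
    have : a.1 ≠ b.1 := fun k => hab (Subtype.ext k)
    rcases h1 with h1 | h1 <;> rcases h2 with h2 | h2 
    · exact absurd (h1.trans h2.symm) this
    · rw [h1, h2]; exact h
    · rw [h1, h2]; exact h.symm
    · exact absurd (h1.trans h2.symm) this
  · intro hab k
    rw [k] at hab; exact hab.ne rfl

lemma blk_mem {P B : Finset V} : B ∈ blk X P ↔ B ⊆ P ∧ GoodF X B ∧ ∀ B' ⊆ P, B ⊆ B' → GoodF X B' → B' = B := by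
  simp [blk]

lemma sum_blk (g : ℕ) (P : Finset V) : ∑ B ∈ blk X P, eps g (X.induce (B : Set V)) =
    ∑ B ∈ (blk X P).filter (fun B => 2 ≤ B.card), eps g (X.induce (B : Set V)) := by
  rw [Finset.sum_filter_of_ne]
  intro B _ hne
  by_contra hc
  exact hne (eps_le_one g (by omega))

lemma rg_split (g : ℕ) {A B : Finset V} (hd : Disjoint A B) (h : ee X A B ≤ 1) :
    rg g (X.induce (A : Set V)) + rg g (X.induce (B : Set V)) ≤ rg g (X.induce (↑(A ∪ B) : Set V)) + tg g * ee X A B := by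
  rw [rg_eq, rg_eq, rg_eq, sum_blk, sum_blk g B, sum_blk g (A ∪ B)]
  set bA := (blk X A).filter (fun B => 2 ≤ B.card)
  set bB := (blk X B).filter (fun B => 2 ≤ B.card)
  set bU := (blk X (A ∪ B)).filter (fun B => 2 ≤ B.card)
  have sub : ∀ A B : Finset V, Disjoint A B → ee X A B ≤ 1 → ∀ C, (C ∈ blk X A ∧ 2 ≤ C.card) ↔ ((C ∈ blk X (A ∪ B) ∧ 2 ≤ C.card) ∧ C ⊆ A) := by
    intro A B hd h C
    rw [blk_mem, blk_mem]
    constructor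
    · rintro ⟨⟨h1, h2, h3⟩, h4⟩
      refine ⟨⟨⟨h1.trans Finset.subset_union_left, h2, fun B' hB' hCB' hg => ?_⟩, h4⟩, h1⟩
      by_cases hA : B' ⊆ A
      · exact h3 B' hA hCB' hg
      exfalso
      by_cases hB : B' ⊆ B
      · obtain ⟨x, hx⟩ := h2.1
        exact Finset.disjoint_left.1 hd (h1 hx) (hB (hCB' hx))
      · obtain ⟨u, hu, v, hv, huv, rfl⟩ := crossing hd h hB' hg hA hB
        have : C ⊆ {u} := by
          intro x hx
          have := hCB' hx
          simp only [Finset.mem_insert, Finset.mem_singleton] at this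
          rcases this with rfl | rfl
          · simp
          · exact absurd hv (Finset.disjoint_left.1 hd (h1 hx))
        have := Finset.card_le_card this
        simp at this; omega
    · rintro ⟨⟨⟨h1, h2, h3⟩, h4⟩, h5⟩
      exact ⟨⟨h5, h2, fun B' hB' => h3 B' (hB'.trans Finset.subset_union_left)⟩, h4⟩
  have eA : bA = bU.filter (· ⊆ A) := by
    ext C
    simp only [bA, bU, Finset.mem_filter]
    exact sub A B hd h C
  have eB : bB = (bU.filter (fun C => ¬ C ⊆ A)).filter (· ⊆ B) := by
    ext C
    simp only [bB, bU, Finset.mem_filter]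
    rw [sub B A hd.symm (by rwa [ee_comm]) C, Finset.union_comm B A]
    constructor
    · rintro ⟨h1, h2⟩
      refine ⟨⟨h1, fun k => ?_⟩, h2⟩
      obtain ⟨x, hx⟩ := (blk_mem.1 h1.1).2.1.1
      exact Finset.disjoint_left.1 hd (k hx) (h2 hx)
    · rintro ⟨⟨h1, _⟩, h2⟩; exact ⟨h1, h2⟩
  rw [← Finset.sum_filter_add_sum_filter_not bU (· ⊆ A), ← Finset.sum_filter_add_sum_filter_not (bU.filter (fun C => ¬ C ⊆ A)) (· ⊆ B), ← eA, ← eB]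
  set cr := (bU.filter (fun C => ¬ C ⊆ A)).filter (fun C => ¬ C ⊆ B)
  have hcr : ∀ C ∈ cr, ∃ u ∈ A, ∃ v ∈ B, X.Adj u v ∧ C = {u, v} := by
    intro C hC
    simp only [cr, bU, Finset.mem_filter] at hC
    exact crossing hd h (blk_mem.1 hC.1.1.1).1 (blk_mem.1 hC.1.1.1).2.1 hC.1.2 hC.2
  have hs : ∑ C ∈ cr, eps g (X.induce (C : Set V)) = - tg g * cr.card := by
    have : ∀ C ∈ cr, eps g (X.induce ((C : Finset V) : Set V)) = - tg g := by
      intro C hC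
      obtain ⟨u, _, v, _, huv, rfl⟩ := hcr C hC
      exact eps_pair g huv
    rw [Finset.sum_congr rfl this]
    simp; ring
  have hc : cr.card ≤ ee X A B := by
    rcases Finset.eq_empty_or_nonempty cr with h0 | ⟨C, hC⟩
    · simp [h0]
    · obtain ⟨u, hu, v, hv, huv, rfl⟩ := hcr C hC
      have h1 : 0 < ee X A B := ee_pos.2 ⟨u, hu, v, hv, huv⟩
      have h2 : cr.card ≤ 1 := by
        rw [Finset.card_le_one]
        intro C1 h1 C2 h2
        obtain ⟨u, hu, v, hv, huv, rfl⟩ := hcr C1 h1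
        obtain ⟨u', hu', v', hv', huv', rfl⟩ := hcr C2 h2
        obtain ⟨rfl, rfl⟩ := uniq_of_ee h hu hv huv hu' hv' huv'
        rfl
      omega
  rw [hs]
  have hc' : (cr.card : ℝ) ≤ ee X A B := by exact_mod_cast hc
  have := mul_le_mul_of_nonneg_left hc' (tg_pos g).le
  linarith

lemma rg_good (g : ℕ) {P : Finset V} {W : Type} {A : SimpleGraph W} (e : A ≃g X.induce (P : Set V)) (h : GoodF X P) :
    rg g A = eps g A := by
  rw [rg_eq' g e, eps_iso g e]
  have : blk X P = {P} := by
    ext B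
    rw [blk_mem, Finset.mem_singleton]
    constructor
    · rintro ⟨h1, h2, h3⟩; exact (h3 P subset_rfl h1 h).symm
    · rintro rfl
      exact ⟨subset_rfl, h, fun B' h1 h2 _ => Finset.Subset.antisymm h1 h2⟩
  rw [this, Finset.sum_singleton]

lemma rg_small (g : ℕ) {P : Finset V} {W : Type} {A : SimpleGraph W} (e : A ≃g X.induce (P : Set V)) (h : P.card ≤ 1) : rg g A = 0 := by
  rw [rg_eq' g e]
  apply Finset.sum_eq_zero
  intro B hB
  exact eps_le_one g ((Finset.card_le_card (blk_mem.1 hB).1).trans h)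

lemma rg_twoconn [Fintype V] (g : ℕ) {A : SimpleGraph V} (h : TwoConnected A) : rg g A = eps g A := by
  obtain ⟨e⟩ := induce_univ_iso A
  refine rg_good g e ((good_iff e).1 ?_)
  have h0 : A.Connected := by
    have := h.2 ∅ (by simp)
    rw [Set.compl_empty] at this
    exact (SimpleGraph.induceUnivIso A).connected_iff.1 this
  refine ⟨h0, fun v => (cut_iff h0 v).2 ?_⟩
  exact (h.2 {v} (by simp)).preconnected

/-- transfer to the induced subgraph type -/
lemma ee_induce (P : Finset V) (S T : Finset (P : Set V)) :
    ee (X.induce (P : Set V)) S T = ee X (S.image Subtype.val) (T.image Subtype.val) := by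
  rw [ee_image (X := X.induce (P : Set V)) (Y := X) (P := S ∪ T) Subtype.val Subtype.val_injective.injOn (fun u _ v _ => Iff.rfl)
    Finset.subset_union_left Finset.subset_union_right]

lemma image_univ_val (P : Finset V) : (Finset.univ : Finset (P : Set V)).image Subtype.val = P := by
  ext x; simp

lemma ec2_induce [Fintype V] {P : Finset V} (h : EC2 X P) : EC2 (X.induce (P : Set V)) Finset.univ := by
  intro Y _ hne hneq
  rw [ee_induce]
  have h1 : (Finset.univ \ Y).image Subtype.val = P \ Y.image Subtype.val := by
    rw [Finset.image_sdiff _ _ Subtype.val_injective, image_univ_val]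
  have h2 : 2 ≤ ee X (Y.image Subtype.val) (P \ Y.image Subtype.val) := ?_
  · convert h2
    ext x
    rw [← h1]
    simp
  apply h
  · intro x hx
    rw [Finset.mem_image] at hx
    obtain ⟨y, _, rfl⟩ := hx; exact y.2
  · exact hne.image _
  · intro k
    apply hneq
    exact Finset.image_injective Subtype.val_injective (k.trans (image_univ_val P).symm)

lemma deg_induce (P : Finset V) (v : (P : Set V)) : ee (X.induce (P : Set V)) {v} Finset.univ = ee X {v.1} P := by
  rw [ee_induce, image_univ_val, Finset.image_singleton]

end

/-- numerator/denominator of `t_g` -/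
def cc (g : ℕ) : ℤ := if g = 4 then 9 else 5
def tt (g : ℕ) : ℤ := if g = 4 then 2 else 1
noncomputable def wt {V : Type} [Fintype V] (g : ℕ) (X : SimpleGraph V) (P : Finset V) : ℤ := cc g * fv X P - tt g * en X P

structure MC {V : Type} [Fintype V] (g : ℕ) (G : SimpleGraph V) : Prop where
  hg : g = 4 ∨ g = 5
  deg : ∀ v, ee G {v} Finset.univ ≤ 3
  nd : ND g G Finset.univ
  ec : EC2 G Finset.univ
  card : 3 ≤ Fintype.card V
  pos : 1 ≤ wt g G Finset.univ
  nF : ∀ i j, ¬ FF i j G Finset.univ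
  nFG : ∀ i j k, ¬ MemFG g i j k G
  min : ∀ (X : SimpleGraph V) (P : Finset V), P ≠ Finset.univ → EC2 X P → 3 ≤ P.card → (∀ v ∈ P, ee X {v} P ≤ 3) →
    ND g X P → wt g X P ≤ 0 ∨ (∃ i j, FF i j X P ∧ wt g X P ≤ cc g - j * (5 * tt g - cc g) - i * tt g) ∨
      (∃ i j k, MemFG g i j k (X.induce (P : Set V)) ∧ wt g X P ≤ cc g - tt g - j * (5 * tt g - cc g) - i * tt g)

section
set_option linter.all false
open scoped Classical
variable {V W : Type} {X Y : SimpleGraph V}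

lemma cc_pos (g : ℕ) : (0 : ℝ) < cc g := by unfold cc; split_ifs <;> norm_num
lemma tg_eq (g : ℕ) : tg g = tt g / cc g := by unfold tg cc tt; split_ifs <;> norm_num

lemma subcubic_induce [Fintype V] {P : Finset V} (h : ∀ v ∈ P, ee X {v} P ≤ 3) : Subcubic (X.induce (P : Set V)) := by
  intro v
  rw [ncard_neighborSet, deg_induce]
  exact h v.1 v.2

lemma eps_cases (g : ℕ) {A : SimpleGraph W} : eps g A ≤ 0 ∨
    (∃ i j, MemF i j A ∧ eps g A = 1 - (j : ℝ) * (5 * tg g - 1) - (i : ℝ) * tg g) ∨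
    (∃ i j k, MemFG g i j k A ∧ eps g A = 1 - tg g - (j : ℝ) * (5 * tg g - 1) - (i : ℝ) * tg g) := by
  unfold eps
  split_ifs with h1 h2 h3
  · rcases max_cases (1 - (h1.choose.2 : ℝ) * (5 * tg g - 1) - (h1.choose.1 : ℝ) * tg g) 0 with h | h
    · right; left
      exact ⟨_, _, h1.choose_spec.2.2, h.1⟩
    · left; exact h.1.le
  · rcases max_cases (1 - tg g - (h2.choose.2.1 : ℝ) * (5 * tg g - 1) - (h2.choose.1 : ℝ) * tg g) 0 with h | h
    · right; right
      exact ⟨_, _, _, h2.choose_spec.2.2, h.1⟩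
    · left; exact h.1.le
  · left; have := tg_pos g; linarith
  · left; exact le_rfl

lemma eps_lower (g : ℕ) {A : SimpleGraph W} : 
    (∃ i j, MemF i j A ∧ 1 - (j : ℝ) * (5 * tg g - 1) - (i : ℝ) * tg g ≤ eps g A) ∨
    ((¬ ∃ i j, 1 ≤ i ∧ j ≤ i ∧ MemF i j A) ∧ ∃ i j k, MemFG g i j k A ∧ 1 - tg g - (j : ℝ) * (5 * tg g - 1) - (i : ℝ) * tg g ≤ eps g A) ∨
    ((¬ ∃ i j, 1 ≤ i ∧ j ≤ i ∧ MemF i j A) ∧ (¬ ∃ i j k, 1 ≤ i ∧ j ≤ i ∧ MemFG g i j k A) ∧ ((Nonempty (A ≃g (⊤ : SimpleGraph (Fin 2)))) ∨ 0 ≤ eps g A)) := by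
  unfold eps
  split_ifs with h1 h2 h3
  · left
    exact ⟨_, _, h1.choose_spec.2.2, le_max_left _ _⟩
  · right; left
    refine ⟨?_, _, _, _, h2.choose_spec.2.2, le_max_left _ _⟩
    rintro ⟨i, j, h⟩; exact h1 ⟨(i, j), h⟩
  · right; right
    refine ⟨?_, ?_, Or.inl h3⟩
    · rintro ⟨i, j, h⟩; exact h1 ⟨(i, j), h⟩
    · rintro ⟨i, j, k, h⟩; exact h2 ⟨(i, j, k), h⟩
  · right; right
    refine ⟨?_, ?_, Or.inr le_rfl⟩
    · rintro ⟨i, j, h⟩; exact h1 ⟨(i, j), h⟩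
    · rintro ⟨i, j, k, h⟩; exact h2 ⟨(i, j, k), h⟩

lemma GMinimal.mc [Fintype V] {g : ℕ} {G : SimpleGraph V} (hg : g = 4 ∨ g = 5) (h : GMinimal g G) : MC g G := by
  obtain ⟨hs, hnd, hlt, hmin⟩ := h
  have deg : ∀ v, ee G {v} Finset.univ ≤ 3 := by
    intro v; have := hs v; rwa [ncard_neighborSet] at this
  have nd := nd_of_not_two hnd
  have gen : ∀ (X : SimpleGraph V) (P : Finset V), P ≠ Finset.univ → (∀ v ∈ P, ee X {v} P ≤ 3) → ND g X P →
      (fv X P : ℝ) ≤ tg g * en X P + rg g (X.induce (P : Set V)) := by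
    intro X P hP hd hn
    have := hmin (P : Set V) (X.induce (P : Set V)) (by
      have : P.card < Fintype.card V := by
        rw [← Finset.card_univ]
        exact Finset.card_lt_card (Finset.ssubset_univ_iff.2 hP)
      simpa using this) (subcubic_induce hd) hn.not_two
    rwa [fvs_induce, en_eq_ncard_induce] at this
  rw [fvs_univ, en_univ] at hlt
  obtain ⟨e⟩ := induce_univ_iso G
  have hru : rg g G = rg g (G.induce (↑(Finset.univ : Finset V) : Set V)) := by rw [rg_eq, rg_eq' g e]
  have ec : EC2 G Finset.univ := by
    intro Y _ hne hneq
    by_contra hcon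
    push Not at hcon
    set Z := Finset.univ \ Y with hZ
    have hd : Disjoint Y Z := Finset.disjoint_sdiff
    have hu : Y ∪ Z = Finset.univ := Finset.union_sdiff_of_subset (Finset.subset_univ _)
    have hZn : Z ≠ Finset.univ := by
      intro k
      obtain ⟨x, hx⟩ := hne
      exact Finset.disjoint_left.1 hd hx (k ▸ Finset.mem_univ x)
    have hdeg : ∀ P : Finset V, ∀ v ∈ P, ee G {v} P ≤ 3 := fun P v _ => (ee_mono subset_rfl (Finset.subset_univ _)).trans (deg v)
    have h1 := gen G Y hneq (hdeg _) (nd.mono (Finset.subset_univ _))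
    have h2 := gen G Z hZn (hdeg _) (nd.mono (Finset.subset_univ _))
    have h3 := rg_split g hd (by omega : ee G Y Z ≤ 1)
    have h4 := fv_union_le hd (by omega : ee G Y Z ≤ 1)
    have h5 := en_union (X := G) hd
    rw [hu] at h3 h4 h5
    rw [hru, h5] at hlt
    have h4' : (fv G Finset.univ : ℝ) ≤ fv G Y + fv G Z := by exact_mod_cast h4
    push_cast at hlt
    linarith
  have hcard : 3 ≤ Fintype.card V := by
    by_contra hc
    push Not at hc
    by_cases h1 : Fintype.card V ≤ 1
    · have h2 := rg_small g e (by rwa [Finset.card_univ])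
      have h3 : fv G Finset.univ ≤ (∅ : Finset V).card := fv_le (acyOn_card_le_two ((Finset.card_le_card (Finset.subset_univ _)).trans (by rw [Finset.card_univ]; omega)))
      simp at h3
      rw [h3, h2] at hlt
      have := mul_nonneg (tg_pos g).le (Nat.cast_nonneg (α := ℝ) (en G Finset.univ))
      simp at hlt; linarith
    · have h2 : (Finset.univ : Finset V).card = 2 := by rw [Finset.card_univ]; omega
      obtain ⟨a, b, hab, hu⟩ := Finset.card_eq_two.1 h2
      have h3 := ec {a} (Finset.subset_univ _) (Finset.singleton_nonempty a) (by
        intro k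
        rw [← k] at h2; simp at h2)
      have h4 : ee G {a} (Finset.univ \ {a}) ≤ ee G {a} {b} := ee_mono subset_rfl (by
        intro x hx; rw [hu] at hx; simp at hx ⊢; tauto)
      have : ee G {a} {b} ≤ 1 := by rw [ee_single]; exact ad_le a b
      omega
  have tw := ec.two deg hcard
  have hre := rg_twoconn g tw
  rw [hre] at hlt
  have hc := cc_pos g
  have key : (∀ i j, ¬ FF i j G Finset.univ) ∧ (∀ i j k, ¬ MemFG g i j k G) ∧ 0 ≤ eps g G := by
    have hct := tg_eq g
    have hFG : ∀ i j k, MemFG g i j k G → 1 ≤ i ∧ j ≤ i := by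
      intro i j k hm
      obtain ⟨H, q, hf⟩ := hm.fgd
      exact ⟨hf.ff.le.2, hf.ff.le.1⟩
    rcases eps_lower g (A := G) with ⟨i, j, hm, he⟩ | ⟨hno, i, j, k, hm, he⟩ | ⟨h1, h2, h3⟩
    · exfalso
      have hf := memF_ff hm
      have hne : (Finset.univ : Finset V).Nonempty := by rw [← Finset.card_pos, Finset.card_univ]; omega
      obtain ⟨a, ha⟩ := hne
      obtain ⟨S, hS, _, hSc, hac⟩ := hf.ec' ha
      have h1 := (fv_le hac).trans hSc
      have h2 := hf.counts.2.1
      rw [h2] at hlt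
      have h1' : (fv G Finset.univ : ℝ) ≤ j + 1 := by exact_mod_cast h1
      push_cast at hlt
      nlinarith
    · exfalso
      obtain ⟨H, q, hf⟩ := hm.fgd
      have h1 := hf.fv_le ec
      have h2 := hf.counts.2
      rw [h2] at hlt
      have h1' : (fv G Finset.univ : ℝ) ≤ ((k * (g - 2) + j + 1 : ℕ) : ℝ) := by exact_mod_cast h1
      rcases hg with rfl | rfl
      · norm_num at h1'
        norm_num [tg] at hlt he
        linarith
      · norm_num at h1'
        norm_num [tg] at hlt he
        linarith
    · refine ⟨fun i j hf => ?_, fun i j k hf => ?_, ?_⟩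
      · exact h1 ⟨i, j, hf.le.2, hf.le.1, hf.memF_univ⟩
      · exact h2 ⟨i, j, k, (hFG _ _ _ hf).1, (hFG _ _ _ hf).2, hf⟩
      · rcases h3 with ⟨⟨e⟩⟩ | h3
        · exfalso
          have := Fintype.card_congr e.toEquiv
          simp at this; omega
        · exact h3
  refine ⟨hg, deg, nd, ec, hcard, ?_, key.1, key.2.1, ?_⟩
  · have h0 := key.2.2
    have h1 : tg g * en G Finset.univ < fv G Finset.univ := by linarith
    rw [tg_eq, div_mul_eq_mul_div, div_lt_iff₀ hc] at h1
    have h2 : tt g * en G Finset.univ < fv G Finset.univ * cc g := by exact_mod_cast h1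
    unfold wt
    linarith
  · intro X P hP hec h3 hd hn
    have h1 := gen X P hP hd hn
    have tw' : TwoConnected (X.induce (P : Set V)) := (ec2_induce hec).two (fun v => by rw [deg_induce]; exact hd v.1 v.2) (by simpa using h3)
    rw [rg_twoconn g tw'] at h1
    rw [tg_eq, div_mul_eq_mul_div] at h1
    have h2 : (wt g X P : ℝ) ≤ cc g * eps g (X.induce (P : Set V)) := by
      have := mul_le_mul_of_nonneg_left h1 hc.le
      rw [mul_add, mul_div_cancel₀ _ hc.ne'] at this
      unfold wt; push_cast; linarith
    rcases eps_cases g (A := X.induce (P : Set V)) with h | ⟨i, j, hm, h⟩ | ⟨i, j, k, hm, h⟩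
    · left
      have : (wt g X P : ℝ) ≤ 0 := h2.trans (mul_nonpos_of_nonneg_of_nonpos hc.le h)
      exact_mod_cast this
    · right; left
      refine ⟨i, j, memF_induce_ff hm, ?_⟩
      rw [h, tg_eq] at h2
      have e1 : (cc g : ℝ) * (1 - (j : ℝ) * (5 * (tt g / cc g) - 1) - (i : ℝ) * (tt g / cc g)) = cc g - j * (5 * tt g - cc g) - i * tt g := by
        field_simp
      rw [e1] at h2
      exact_mod_cast h2
    · right; right
      refine ⟨i, j, k, hm, ?_⟩
      rw [h, tg_eq] at h2
      have e1 : (cc g : ℝ) * (1 - (tt g / cc g) - (j : ℝ) * (5 * (tt g / cc g) - 1) - (i : ℝ) * (tt g / cc g)) = cc g - tt g - j * (5 * tt g - cc g) - i * tt g := by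
        field_simp
      rw [e1] at h2
      exact_mod_cast h2

end

open scoped Classical in
noncomputable def dd {V : Type} [Fintype V] (G : SimpleGraph V) (Y : Finset V) : ℕ := ee G Y (Finset.univ \ Y)

section
set_option linter.all false
open scoped Classical
variable {V : Type} [Fintype V] {X G : SimpleGraph V} {g : ℕ}

lemma dd_compl (Y : Finset V) : dd G (Finset.univ \ Y) = dd G Y := by
  unfold dd
  rw [ee_comm, Finset.sdiff_sdiff_eq_self (Finset.subset_univ _)]

lemma dd_eq (Y : Finset V) : ee G Y Finset.univ = 2 * en G Y + dd G Y := by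
  rw [ee_univ_sdiff Y Y, ee_self]; rfl

lemma MC.dd_cnt (h : MC g G) (Y : Finset V) : 2 * en G Y + dd G Y ≤ 3 * Y.card := by
  rw [← dd_eq]; exact ee_le_of_deg fun u _ => h.deg u

lemma MC.degP (h : MC g G) (P : Finset V) (v : V) : ee G {v} P ≤ 3 :=
  (ee_mono subset_rfl (Finset.subset_univ _)).trans (h.deg v)

lemma MC.dd_ge (h : MC g G) {Y : Finset V} (h1 : Y.Nonempty) (h2 : Y ≠ Finset.univ) : 2 ≤ dd G Y :=
  h.ec Y (Finset.subset_univ _) h1 h2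

lemma MC.tt_pos (h : MC g G) : (g = 4 ∧ tt g = 2 ∧ cc g = 9) ∨ (g = 5 ∧ tt g = 1 ∧ cc g = 5) := by
  rcases h.hg with rfl | rfl <;> simp [tt, cc]

lemma EC2.card3 {P : Finset V} (h : EC2 X P) (h2 : 2 ≤ P.card) : 3 ≤ P.card := by
  by_contra hc
  obtain ⟨a, b, hab, rfl⟩ := Finset.card_eq_two.1 (by omega : P.card = 2)
  have h1 := h {a} (by simp) (by simp) (by
    intro k
    have : ({a} : Finset V).card = 2 := by rw [k]; exact Finset.card_pair hab
    simp at this)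
  have h3 : ee X {a} ({a, b} \ {a}) ≤ ee X {a} {b} := ee_mono subset_rfl (by intro x hx; simp at hx ⊢; tauto)
  have : ee X {a} {b} ≤ 1 := by rw [ee_single]; exact ad_le a b
  omega

lemma MC.min' (h : MC g G) {P : Finset V} (hP : P ≠ Finset.univ) (hec : EC2 X P) (h2 : 2 ≤ P.card)
    (hd : ∀ v ∈ P, ee X {v} P ≤ 3) (hn : ND g X P) : wt g X P ≤ 0 ∨
    (∃ i j : ℕ, FF i j X P ∧ wt g X P ≤ cc g - j * (5 * tt g - cc g) - i * tt g) ∨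
    (wt g X P = 1 ∧ (2 * en X P < 3 * P.card → ∃ k, MemFG g 3 0 k (X.induce (P : Set V)) ∧ 3 * P.card = 2 * en X P + 1)) := by
  rcases h.min X P hP hec (hec.card3 h2) hd hn with h1 | h1 | ⟨i, j, k, hm, hw⟩
  · exact Or.inl h1
  · exact Or.inr (Or.inl h1)
  · by_cases h0 : wt g X P ≤ 0
    · exact Or.inl h0
    right; right
    obtain ⟨H, q, hf⟩ := hm.fgd
    have c1 := hf.counts
    have c2 := hf.ff.counts.2.2.2
    have c3 := hf.ff.le
    rw [Fintype.card_eq_nat_card, ← en_univ, en_eq_ncard_induce] at c1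
    have c4 : Nat.card (P : Set V) = P.card := by simp
    rw [c4] at c1
    have c5 : (∀ v ∈ P, ee X {v} P ≤ 3) → 2 * en X P ≤ 3 * P.card := by
      intro hh; rw [← ee_self]; exact ee_le_of_deg hh
    have c6 := c5 hd
    rcases h.tt_pos with ⟨rfl, e1, e2⟩ | ⟨rfl, e1, e2⟩
    · rw [e1, e2] at hw
      have : i = 3 ∧ j = 0 := by omega
      obtain ⟨rfl, rfl⟩ := this
      exact ⟨by push_cast at hw; omega, fun _ => ⟨k, hm, by omega⟩⟩
    · rw [e1, e2] at hw
      have : i = 3 := by omega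
      subst this
      refine ⟨by push_cast at hw; omega, fun hlt => ?_⟩
      have : j = 0 := by omega
      subst this
      exact ⟨k, hm, by omega⟩

/-- reduction with weight at least two -/
lemma MC.red (h : MC g G) {P : Finset V} (hP : P ≠ Finset.univ) (hec : EC2 X P) (h2 : 2 ≤ P.card)
    (hd : ∀ v ∈ P, ee X {v} P ≤ 3) (hn : ND g X P) (hw : 2 ≤ wt g X P) :
    ∃ i j : ℕ, FF i j X P ∧ wt g X P ≤ cc g - j * (5 * tt g - cc g) - i * tt g := by
  rcases h.min' hP hec h2 hd hn with h1 | h1 | h1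
  · omega
  · exact h1
  · omega

lemma Sup.wt {P : Finset V} {z a b : V} (h : Sup X P z a b) (hg : MC g G) : wt g X P ≤ wt g (addE X a b) (P.erase z) - tt g := by
  have h1 := h.en
  have h2 := h.fv
  unfold InducedForest.wt
  rcases hg.tt_pos with ⟨_, e1, e2⟩ | ⟨_, e1, e2⟩ <;> rw [e1, e2] <;> omega

lemma MC.B1 (h : MC g G) {x a b : V} (hs : Sup G Finset.univ x a b) (hn : ND g (addE G a b) (Finset.univ.erase x)) : False := by
  have h1 := hs.wt h
  have h2 := h.pos
  have hc : (Finset.univ.erase x).card = Fintype.card V - 1 := by rw [Finset.card_erase_of_mem (Finset.mem_univ x), Finset.card_univ]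
  have h3 := h.card
  have hne : Finset.univ.erase x ≠ Finset.univ := by
    intro k; have := Finset.mem_univ x; rw [← k] at this; simp at this
  obtain ⟨i, j, hf, _⟩ := h.red hne (hs.ec2 h.ec) (by omega) (fun v hv => by
    rw [hs.deg (Finset.mem_univ v) (Finset.ne_of_mem_erase hv)]; exact h.deg v) hn (by
      rcases h.tt_pos with ⟨_, e1, e2⟩ | ⟨_, e1, e2⟩ <;> rw [e1] at h1 <;> omega)
  exact h.nF _ _ (FF.sub hs hf)

/-- a nontrivial vertex of degree at most two inside `P` -/
lemma exists_low {P : Finset V} {d : ℕ} (h : 2 * en X P < (d + 1) * P.card) : ∃ v ∈ P, ee X {v} P ≤ d := by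
  by_contra hc
  push Not at hc
  have : (d + 1) * P.card ≤ ee X P P := by
    rw [ee_sum_left, mul_comm, ← smul_eq_mul]
    exact Finset.card_nsmul_le_sum _ _ _ fun v hv => hc v hv
  rw [ee_self] at this; omega

lemma en_erase {P : Finset V} {v : V} (hv : v ∈ P) : en X P = en X (P.erase v) + ee X {v} P := by
  conv_lhs => rw [← Finset.insert_erase hv]
  rw [en_insert (Finset.notMem_erase v P), ← ee_erase_self hv]

lemma not_acy_of_en {P : Finset V} (h : P.card ≤ en X P) (hne : P.Nonempty) : ¬ AcyOn X P := by
  intro k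
  rw [acyOn_iff] at k
  have := k P subset_rfl hne; omega

end

section
set_option linter.all false
open scoped Classical
variable {V W : Type} {X Y G : SimpleGraph V} {g : ℕ}

lemma ee_pair {a b c : V} (h : b ≠ c) : ee X {a} {b, c} = ad X a b + ad X a c := by
  rw [ee_insert_right (by simpa using h), ee_single, ee_single]

lemma en_single (a : V) : en X {a} = 0 := by
  have := ee_self (X := X) {a}; rw [ee_single, ad_self] at this; omega

lemma en_pair {a b : V} (h : a ≠ b) : en X {a, b} = ad X a b := by
  rw [en_insert (by simpa using h), ee_single, en_single, zero_add]

lemma en_triple {a b c : V} (h1 : a ≠ b) (h2 : a ≠ c) (h3 : b ≠ c) : en X {a, b, c} = ad X a b + ad X a c + ad X b c := by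
  rw [en_insert (by simp [h1, h2]), ee_pair h3, en_pair h3]; ring

lemma en_quad {a b c d : V} (h1 : a ≠ b) (h2 : a ≠ c) (h3 : a ≠ d) (h4 : b ≠ c) (h5 : b ≠ d) (h6 : c ≠ d) :
    en X {a, b, c, d} = ad X a b + ad X a c + ad X a d + ad X b c + ad X b d + ad X c d := by
  rw [en_insert (by simp [h1, h2, h3]), ee_insert_right (by simp [h4, h5]), ee_single, ee_pair h6, en_triple h4 h5 h6]; ring

lemma tri_not_acy {a b c : V} (h1 : X.Adj a b) (h2 : X.Adj b c) (h3 : X.Adj a c) : ¬ AcyOn X {a, b, c} := by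
  intro k
  rw [acyOn_iff] at k
  have := k _ subset_rfl (by simp)
  rw [en_triple h1.ne h3.ne h2.ne, ad_eq_one h1, ad_eq_one h2, ad_eq_one h3] at this
  have : ({a, b, c} : Finset V).card ≤ 3 := Finset.card_le_three
  omega

lemma quad_not_acy {a b c d : V} (h1 : X.Adj a b) (h2 : X.Adj b c) (h3 : X.Adj c d) (h4 : X.Adj d a) (hac : a ≠ c) (hbd : b ≠ d) :
    ¬ AcyOn X {a, b, c, d} := by
  intro k
  rw [acyOn_iff] at k
  have := k _ subset_rfl (by simp)
  rw [en_quad h1.ne hac h4.ne' h2.ne hbd h3.ne, ad_eq_one h1, ad_eq_one h2, ad_eq_one h3, ad_eq_one h4.symm] at this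
  have : ({a, b, c, d} : Finset V).card ≤ 4 := Finset.card_le_four
  omega

lemma NS.tri {P : Finset V} (h : NS g X P) (hg : 4 ≤ g) {a b c : V} (ha : a ∈ P) (hb : b ∈ P) (hc : c ∈ P)
    (h1 : X.Adj a b) (h2 : X.Adj b c) (h3 : X.Adj a c) : False := by
  refine tri_not_acy h1 h2 h3 (h _ ?_ ?_)
  · intro x hx; simp at hx; rcases hx with rfl | rfl | rfl <;> assumption
  · exact Finset.card_le_three.trans_lt (by omega)

lemma NS.quad {P : Finset V} (h : NS g X P) (hg : 5 ≤ g) {a b c d : V} (ha : a ∈ P) (hb : b ∈ P) (hc : c ∈ P) (hd : d ∈ P)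
    (h1 : X.Adj a b) (h2 : X.Adj b c) (h3 : X.Adj c d) (h4 : X.Adj d a) (hac : a ≠ c) (hbd : b ≠ d) : False := by
  refine quad_not_acy h1 h2 h3 h4 hac hbd (h _ ?_ ?_)
  · intro x hx; simp at hx; rcases hx with rfl | rfl | rfl | rfl <;> assumption
  · exact Finset.card_le_four.trans_lt (by omega)

lemma short4 {A : Finset V} (h : ¬ AcyOn X A) (hc : A.card < 5) :
    (∃ a ∈ A, ∃ b ∈ A, ∃ c ∈ A, X.Adj a b ∧ X.Adj b c ∧ X.Adj a c) ∨
    (A.card = 4 ∧ ∃ a ∈ A, ∃ b ∈ A, ∃ c ∈ A, ∃ d ∈ A, X.Adj a b ∧ X.Adj b c ∧ X.Adj c d ∧ X.Adj d a ∧ a ≠ c ∧ b ≠ d ∧ A = {a, b, c, d}) := by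
  by_cases ht : ∃ a ∈ A, ∃ b ∈ A, ∃ c ∈ A, X.Adj a b ∧ X.Adj b c ∧ X.Adj a c
  · exact Or.inl ht
  right
  have ht' : ∀ a ∈ A, ∀ b ∈ A, ∀ c ∈ A, ad X a b + ad X a c + ad X b c ≤ 2 := by
    intro a ha b hb c hc
    by_contra hcon
    have := ad_le (X := X) a b
    have := ad_le (X := X) a c
    have := ad_le (X := X) b c
    exact ht ⟨a, ha, b, hb, c, hc, ad_pos.1 (by omega), ad_pos.1 (by omega), ad_pos.1 (by omega)⟩
  rw [acyOn_iff] at h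
  push Not at h
  obtain ⟨B, hB, hne, hen⟩ := h
  have hBA := Finset.card_le_card hB
  have h3 : 4 ≤ B.card := by
    by_contra hlt
    have : B.card = 0 ∨ B.card = 1 ∨ B.card = 2 ∨ B.card = 3 := by omega
    rcases this with k | k | k | k
    · rw [Finset.card_eq_zero] at k; subst k; simp at hne
    · obtain ⟨a, rfl⟩ := Finset.card_eq_one.1 k; rw [en_single] at hen; omega
    · obtain ⟨a, b, hab, rfl⟩ := Finset.card_eq_two.1 k
      rw [en_pair hab] at hen
      have := ad_le (X := X) a b; omega
    · obtain ⟨a, b, c, hab, hac, hbc, rfl⟩ := Finset.card_eq_three.1 k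
      rw [en_triple hab hac hbc] at hen
      have := ht' a (hB (by simp)) b (hB (by simp)) c (hB (by simp))
      omega
  have hBA' : B = A := Finset.eq_of_subset_of_card_le hB (by omega)
  subst hBA'
  refine ⟨by omega, ?_⟩
  obtain ⟨a, b, c, d, hab, hac, had, hbc, hbd, hcd, rfl⟩ := Finset.card_eq_four.1 (by omega : B.card = 4)
  rw [en_quad hab hac had hbc hbd hcd] at hen
  have t1 := ht' a (by simp) b (by simp) c (by simp)
  have t2 := ht' a (by simp) b (by simp) d (by simp)
  have t3 := ht' a (by simp) c (by simp) d (by simp)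
  have t4 := ht' b (by simp) c (by simp) d (by simp)
  have l1 := ad_le (X := X) a c
  have l2 := ad_le (X := X) a d
  have l3 := ad_le (X := X) b c
  have l4 := ad_le (X := X) b d
  have l5 := ad_le (X := X) c d
  by_cases k1 : X.Adj a b
  · by_cases k2 : X.Adj b c
    · have := ad_eq_one k1
      have := ad_eq_one k2
      exact ⟨a, by simp, b, by simp, c, by simp, d, by simp, k1, k2, ad_pos.1 (by omega), (ad_pos.1 (by omega : 0 < ad X a d)).symm, hac, hbd, rfl⟩
    · have := ad_eq_one k1
      have := ad_eq_zero k2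
      refine ⟨b, by simp, a, by simp, c, by simp, d, by simp, k1.symm, ad_pos.1 (by omega), ad_pos.1 (by omega), (ad_pos.1 (by omega : 0 < ad X b d)).symm, hbc, had, ?_⟩
      ext x; simp; tauto
  · have := ad_eq_zero k1
    refine ⟨a, by simp, c, by simp, b, by simp, d, by simp, ad_pos.1 (by omega), (ad_pos.1 (by omega : 0 < ad X b c)).symm, ad_pos.1 (by omega), (ad_pos.1 (by omega : 0 < ad X a d)).symm, hab, hcd, ?_⟩
    ext x; simp; tauto

lemma short3 {A : Finset V} (h : ¬ AcyOn X A) (hc : A.card < 4) :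
    ∃ a ∈ A, ∃ b ∈ A, ∃ c ∈ A, X.Adj a b ∧ X.Adj b c ∧ X.Adj a c := by
  rcases short4 h (by omega) with k | k
  · exact k
  · omega

lemma iso_of_hom [Fintype W] {B : SimpleGraph W} {P : Finset V} (f : W → V) (hinj : Function.Injective f) (hP : ∀ w, f w ∈ P)
    (hc : P.card = Fintype.card W) (hom : ∀ u v, B.Adj u v → X.Adj (f u) (f v)) (he : B.edgeSet.ncard = en X P) :
    Nonempty (X.induce (P : Set V) ≃g B) := by
  have him : Finset.univ.image f = P := by
    apply Finset.eq_of_subset_of_card_le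
    · intro x hx; simp at hx; obtain ⟨w, rfl⟩ := hx; exact hP w
    · rw [Finset.card_image_of_injective _ hinj, hc, Finset.card_univ]
  have h1 : B ≤ X.comap f := fun u v h => hom u v h
  have h2 : ee X (Finset.univ.image f) (Finset.univ.image f) = ee (X.comap f) Finset.univ Finset.univ :=
    ee_image (P := Finset.univ) f hinj.injOn (fun u _ v _ => Iff.rfl) subset_rfl subset_rfl
  rw [him, ee_self, ee_self] at h2
  rw [en_univ] at he
  have h3 := en_sdiff_graph h1 Finset.univ
  have h4 : ee (X.comap f \ B) Finset.univ Finset.univ = 0 := by rw [ee_self]; omega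
  rw [ee_eq_zero] at h4
  have hbij : Function.Bijective (fun w => (⟨f w, hP w⟩ : (P : Set V))) := by
    refine ⟨fun a b h => hinj (congrArg (fun z : (P : Set V) => z.1) h), ?_⟩
    rintro ⟨x, hx⟩
    rw [← him] at hx
    simp at hx
    obtain ⟨w, rfl⟩ := hx
    exact ⟨w, rfl⟩
  refine ⟨Iso.symm ⟨Equiv.ofBijective _ hbij, ?_⟩⟩
  intro a b
  constructor
  · intro h
    by_contra hB
    exact h4 a (Finset.mem_univ _) b (Finset.mem_univ _) ⟨h, hB⟩
  · intro h; exact hom a b h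

end

section
set_option linter.all false
open scoped Classical
variable {V W : Type} {X Y G : SimpleGraph V} {g : ℕ}

lemma L_fin {P : Finset V} (hc : P.card = 6) (he : en X P = 8) {a1 a2 a3 b1 b2 b3 : V} (hP : P = {a1, a2, a3, b1, b2, b3})
    (h11 : X.Adj a1 b1) (h12 : X.Adj a1 b2) (h13 : X.Adj a1 b3) (h21 : X.Adj a2 b1) (h22 : X.Adj a2 b2) (h23 : X.Adj a2 b3)
    (h31 : X.Adj a3 b1) (h32 : X.Adj a3 b2) : Nonempty (X.induce (P : Set V) ≃g Lgraph) := by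
  let f : Option (Option (Fin 4)) → V := fun o => match o with
    | none => a3
    | some none => b3
    | some (some i) => ![a1, a2, b1, b2] i
  have him : Finset.univ.image f = P := by
    rw [hP]; ext x
    simp only [Finset.mem_image, Finset.mem_univ, true_and, Finset.mem_insert, Finset.mem_singleton]
    constructor
    · rintro ⟨w, rfl⟩
      rcases w with _ | _ | i
      · simp [f]
      · simp [f]
      · fin_cases i <;> simp [f]
    · rintro (rfl | rfl | rfl | rfl | rfl | rfl)
      · exact ⟨some (some 0), rfl⟩
      · exact ⟨some (some 1), rfl⟩
      · exact ⟨none, rfl⟩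
      · exact ⟨some (some 2), rfl⟩
      · exact ⟨some (some 3), rfl⟩
      · exact ⟨some none, rfl⟩
  refine iso_of_hom f ?_ (fun w => by rw [← him]; exact Finset.mem_image_of_mem _ (Finset.mem_univ _)) (by rw [hc]; rfl) ?_ (by rw [he]; exact L_counts.1)
  · rw [← Set.injOn_univ, ← Finset.coe_univ]
    exact Finset.card_image_iff.1 (by rw [him, hc]; rfl)
  · have key : ∀ u v : Option (Option (Fin 4)), Lgraph.Adj u v → X.Adj (f u) (f v) := by
      intro u v h
      unfold Lgraph at h
      rcases u with _ | _ | i <;> rcases v with _ | _ | k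
      · exact absurd h (SimpleGraph.irrefl _)
      · rw [subdivide_ns] at h; simp at h
      · rw [subdivide_ns] at h
        simp only [Option.some.injEq] at h
        rcases h with rfl | rfl
        · exact h31
        · exact h32
      · rw [subdivide_sn] at h; simp at h
      · exact absurd h (SimpleGraph.irrefl _)
      · rw [subdivide_ss, subdivide_ns] at h
        rcases h.1 with rfl | rfl
        · exact h13.symm
        · exact h23.symm
      · rw [subdivide_sn] at h
        simp only [Option.some.injEq] at h
        rcases h with rfl | rfl
        · exact h31.symm
        · exact h32.symm
      · rw [subdivide_ss, subdivide_sn] at h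
        rcases h.1 with rfl | rfl
        · exact h13
        · exact h23
      · rw [subdivide_ss, subdivide_ss] at h
        fin_cases i <;> fin_cases k <;> first | (exfalso; revert h; simp; done) | assumption | (apply SimpleGraph.Adj.symm; assumption)
    exact key

lemma nb3 {P : Finset V} {v : V} (h : ee X {v} P = 3) : ∃ x y z, x ≠ y ∧ x ≠ z ∧ y ≠ z ∧ x ∈ P ∧ y ∈ P ∧ z ∈ P ∧
    X.Adj v x ∧ X.Adj v y ∧ X.Adj v z ∧ ∀ w ∈ P, X.Adj v w → w = x ∨ w = y ∨ w = z := by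
  rw [ee_single_card, Finset.card_eq_three] at h
  obtain ⟨x, y, z, h1, h2, h3, h4⟩ := h
  have hm : ∀ w, w ∈ P ∧ X.Adj v w ↔ w = x ∨ w = y ∨ w = z := by
    intro w
    have : w ∈ P.filter (fun v' => X.Adj v v') ↔ w ∈ ({x, y, z} : Finset V) := by rw [h4]
    simpa using this
  refine ⟨x, y, z, h1, h2, h3, ((hm x).2 (by simp)).1, ((hm y).2 (by simp)).1, ((hm z).2 (by simp)).1,
    ((hm x).2 (by simp)).2, ((hm y).2 (by simp)).2, ((hm z).2 (by simp)).2, fun w hw hvw => (hm w).1 ⟨hw, hvw⟩⟩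

lemma p6a {p q v x y z : V} : ({p, q, v, x, y, z} : Finset V) = {v, q, p, y, z, x} := by ext; simp; tauto
lemma p6b {p q v x y z : V} : ({p, q, v, x, y, z} : Finset V) = {v, q, p, x, z, y} := by ext; simp; tauto
lemma p6c {p q v x y z : V} : ({p, q, v, x, y, z} : Finset V) = {v, q, p, x, y, z} := by ext; simp; tauto

lemma L_uniq [Fintype V] {P : Finset V} (hc : P.card = 6) (he : en X P = 8) (hd : ∀ v ∈ P, ee X {v} P ≤ 3) (hn : NS 4 X P) :
    Nonempty (X.induce (P : Set V) ≃g Lgraph) := by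
  obtain ⟨v, hv, hv3⟩ : ∃ v ∈ P, ee X {v} P = 3 := by
    by_contra hcon
    push Not at hcon
    have : ee X P P ≤ 2 * P.card := ee_le_of_deg fun u hu => by have := hd u hu; have := hcon u hu; omega
    rw [ee_self] at this; omega
  obtain ⟨x, y, z, hxy, hxz, hyz, hx, hy, hz, vx, vy, vz, only⟩ := nb3 hv3
  have hQ : ({v, x, y, z} : Finset V).card = 4 := Finset.card_eq_four.2 ⟨v, x, y, z, vx.ne, vy.ne, vz.ne, hxy, hxz, hyz, rfl⟩
  have hQP : ({v, x, y, z} : Finset V) ⊆ P := by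
    intro w hw; simp at hw; rcases hw with rfl | rfl | rfl | rfl <;> assumption
  obtain ⟨p, q, hpq, hpqe⟩ := Finset.card_eq_two.1 (by rw [Finset.card_sdiff_of_subset hQP]; omega : (P \ {v, x, y, z}).card = 2)
  have hmem : ∀ w, w ∈ P ∧ ¬ (w = v ∨ w = x ∨ w = y ∨ w = z) ↔ w = p ∨ w = q := by
    intro w
    have : w ∈ P \ {v, x, y, z} ↔ w ∈ ({p, q} : Finset V) := by rw [hpqe]
    simpa using this
  have hp := (hmem p).2 (Or.inl rfl)
  have hq := (hmem q).2 (Or.inr rfl)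
  have nxy : ¬ X.Adj x y := fun k => hn.tri le_rfl hv hx hy vx k vy
  have nxz : ¬ X.Adj x z := fun k => hn.tri le_rfl hv hx hz vx k vz
  have nyz : ¬ X.Adj y z := fun k => hn.tri le_rfl hv hy hz vy k vz
  have nvp : ¬ X.Adj v p := fun k => hp.2 (Or.inr (only p hp.1 k))
  have nvq : ¬ X.Adj v q := fun k => hq.2 (Or.inr (only q hq.1 k))
  have hPe : P = {p, q, v, x, y, z} := by
    ext w
    have := hmem w
    simp only [Finset.mem_insert, Finset.mem_singleton]
    constructor
    · intro hw; by_cases k : w = v ∨ w = x ∨ w = y ∨ w = z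
      · tauto
      · have := this.1 ⟨hw, k⟩; tauto
    · rintro (rfl | rfl | rfl | rfl | rfl | rfl)
      exacts [hp.1, hq.1, hv, hx, hy, hz]
  have pv : p ≠ v ∧ p ≠ x ∧ p ≠ y ∧ p ≠ z := by have := hp.2; push Not at this; exact this
  have qv : q ≠ v ∧ q ≠ x ∧ q ≠ y ∧ q ≠ z := by have := hq.2; push Not at this; exact this
  have eeT : ∀ w, ee X {w} {v, x, y, z} = ad X w v + (ad X w x + (ad X w y + ad X w z)) := by
    intro w
    rw [ee_insert_right (by simp [vx.ne, vy.ne, vz.ne]), ee_insert_right (by simp [hxy, hxz]), ee_pair hyz, ee_single, ee_single]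
  have hen : en X P = ad X v x + ad X v y + ad X v z + ad X x y + ad X x z + ad X y z + (ad X q v + (ad X q x + (ad X q y + ad X q z))) +
      (ad X p q + (ad X p v + (ad X p x + (ad X p y + ad X p z)))) := by
    rw [hPe, en_insert (by simp [hpq, pv]), en_insert (by simp [qv]), en_quad vx.ne vy.ne vz.ne hxy hxz hyz, eeT q,
      ee_insert_right (by simp [qv]), eeT p, ee_single]
  have z1 := ad_eq_zero nxy
  have z2 := ad_eq_zero nxz
  have z3 := ad_eq_zero nyz
  have z4 : ad X p v = 0 := ad_eq_zero fun k => nvp k.symm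
  have z5 : ad X q v = 0 := ad_eq_zero fun k => nvq k.symm
  have o1 := ad_eq_one vx
  have o2 := ad_eq_one vy
  have o3 := ad_eq_one vz
  have bq1 := ad_le (X := X) q x
  have bq2 := ad_le (X := X) q y
  have bq3 := ad_le (X := X) q z
  have bp1 := ad_le (X := X) p x
  have bp2 := ad_le (X := X) p y
  have bp3 := ad_le (X := X) p z
  have npq : ad X p q = 0 := by
    apply ad_eq_zero
    intro k
    have t : ∀ w ∈ P, ad X p w + ad X q w ≤ 1 := by
      intro w hw
      by_contra hcon
      have := ad_le (X := X) p w
      have := ad_le (X := X) q w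
      exact hn.tri le_rfl hp.1 hq.1 hw k (ad_pos.1 (by omega)) (ad_pos.1 (by omega))
    have := t x hx
    have := t y hy
    have := t z hz
    have := ad_le (X := X) p q
    omega
  rw [he] at hen
  have vpq : ∀ w, w = x ∨ w = y ∨ w = z → (ad X p w = 0 ∨ ad X q w = 0) → Nonempty (X.induce (P : Set V) ≃g Lgraph) := by
    have core : ∀ p' q' w1 w2 w3, P = {v, q', p', w1, w2, w3} → X.Adj v w1 → X.Adj v w2 → X.Adj v w3 → X.Adj q' w1 → X.Adj q' w2 → X.Adj q' w3 →
        X.Adj p' w1 → X.Adj p' w2 → Nonempty (X.induce (P : Set V) ≃g Lgraph) :=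
      fun p' q' w1 w2 w3 h a b c d e f i j => L_fin hc he h a b c d e f i j
    have hPe2 : P = {q, p, v, x, y, z} := by rw [hPe, Finset.insert_comm]
    rintro w (hw | hw | hw) (h0 | h0) <;> rw [hw] at h0
    · exact core p q y z x (hPe.trans p6a) vy vz vx (ad_pos.1 (by omega)) (ad_pos.1 (by omega)) (ad_pos.1 (by omega)) (ad_pos.1 (by omega)) (ad_pos.1 (by omega))
    · exact core q p y z x (hPe2.trans p6a) vy vz vx (ad_pos.1 (by omega)) (ad_pos.1 (by omega)) (ad_pos.1 (by omega)) (ad_pos.1 (by omega)) (ad_pos.1 (by omega))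
    · exact core p q x z y (hPe.trans p6b) vx vz vy (ad_pos.1 (by omega)) (ad_pos.1 (by omega)) (ad_pos.1 (by omega)) (ad_pos.1 (by omega)) (ad_pos.1 (by omega))
    · exact core q p x z y (hPe2.trans p6b) vx vz vy (ad_pos.1 (by omega)) (ad_pos.1 (by omega)) (ad_pos.1 (by omega)) (ad_pos.1 (by omega)) (ad_pos.1 (by omega))
    · exact core p q x y z (hPe.trans p6c) vx vy vz (ad_pos.1 (by omega)) (ad_pos.1 (by omega)) (ad_pos.1 (by omega)) (ad_pos.1 (by omega)) (ad_pos.1 (by omega))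
    · exact core q p x y z (hPe2.trans p6c) vx vy vz (ad_pos.1 (by omega)) (ad_pos.1 (by omega)) (ad_pos.1 (by omega)) (ad_pos.1 (by omega)) (ad_pos.1 (by omega))
  by_cases k1 : ad X p x = 0
  · exact vpq x (by simp) (Or.inl k1)
  by_cases k2 : ad X p y = 0
  · exact vpq y (by simp) (Or.inl k2)
  by_cases k3 : ad X p z = 0
  · exact vpq z (by simp) (Or.inl k3)
  by_cases k4 : ad X q x = 0
  · exact vpq x (by simp) (Or.inr k4)
  by_cases k5 : ad X q y = 0
  · exact vpq y (by simp) (Or.inr k5)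
  exact vpq z (by simp) (Or.inr (by omega))

end

section
set_option linter.all false

def RE : List ((ZMod 5 × Fin 2) × (ZMod 5 × Fin 2)) :=
  [((3,0),(2,0)), ((3,0),(3,1)), ((3,0),(4,0)), ((2,0),(2,1)), ((2,0),(1,0)), ((3,1),(0,1)), ((3,1),(1,1)), ((4,0),(0,0)), ((4,0),(4,1)),
   ((2,1),(0,1)), ((1,0),(1,1)), ((0,0),(0,1)), ((4,1),(1,1)), ((2,1),(4,1))]

lemma RE_all : ∀ u v : ZMod 5 × Fin 2, Rgraph.Adj u v → (u, v) ∈ RE ∨ (v, u) ∈ RE := by decide +kernel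

open scoped Classical
variable {V W : Type} {X Y G : SimpleGraph V} {g : ℕ}

/-- spanning tree of the second neighbourhood -/
structure RC (X : SimpleGraph V) (P : Finset V) (v x1 x2 x3 y1 z1 y2 z2 y3 z3 : V) : Prop where
  hc : ∀ w ∈ P, w = v ∨ (w = x1 ∨ w = x2 ∨ w = x3) ∨ (w = y1 ∨ w = z1) ∨ (w = y2 ∨ w = z2) ∨ (w = y3 ∨ w = z3)
  v1 : X.Adj v x1
  v2 : X.Adj v x2
  v3 : X.Adj v x3
  a1 : X.Adj x1 y1
  b1 : X.Adj x1 z1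
  a2 : X.Adj x2 y2
  b2 : X.Adj x2 z2
  a3 : X.Adj x3 y3
  b3 : X.Adj x3 z3
  m1 : y1 ∈ P ∧ z1 ∈ P
  m2 : y2 ∈ P ∧ z2 ∈ P
  m3 : y3 ∈ P ∧ z3 ∈ P

variable {P : Finset V} {v x1 x2 x3 y1 z1 y2 z2 y3 z3 : V}

lemma RC.s1 (r : RC X P v x1 x2 x3 y1 z1 y2 z2 y3 z3) : RC X P v x1 x2 x3 z1 y1 y2 z2 y3 z3 :=
  ⟨fun w hw => by have := r.hc w hw; rwa [or_comm (a := w = z1)], r.v1, r.v2, r.v3, r.b1, r.a1, r.a2, r.b2, r.a3, r.b3, r.m1.symm, r.m2, r.m3⟩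
lemma RC.s2 (r : RC X P v x1 x2 x3 y1 z1 y2 z2 y3 z3) : RC X P v x1 x2 x3 y1 z1 z2 y2 y3 z3 :=
  ⟨fun w hw => by have := r.hc w hw; rwa [or_comm (a := w = z2)], r.v1, r.v2, r.v3, r.a1, r.b1, r.b2, r.a2, r.a3, r.b3, r.m1, r.m2.symm, r.m3⟩
lemma RC.s3 (r : RC X P v x1 x2 x3 y1 z1 y2 z2 y3 z3) : RC X P v x1 x2 x3 y1 z1 y2 z2 z3 y3 :=
  ⟨fun w hw => by have := r.hc w hw; rwa [or_comm (a := w = z3)], r.v1, r.v2, r.v3, r.a1, r.b1, r.a2, r.b2, r.b3, r.a3, r.m1, r.m2, r.m3.symm⟩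
lemma RC.p12 (r : RC X P v x1 x2 x3 y1 z1 y2 z2 y3 z3) : RC X P v x2 x1 x3 y2 z2 y1 z1 y3 z3 :=
  ⟨fun w hw => by have := r.hc w hw; rwa [or_left_comm (a := w = x2), or_left_comm (a := (w = y2 ∨ w = z2))], r.v2, r.v1, r.v3, r.a2, r.b2, r.a1, r.b1, r.a3, r.b3, r.m2, r.m1, r.m3⟩
lemma RC.p23 (r : RC X P v x1 x2 x3 y1 z1 y2 z2 y3 z3) : RC X P v x1 x3 x2 y1 z1 y3 z3 y2 z2 :=
  ⟨fun w hw => by have := r.hc w hw; rwa [or_comm (a := w = x3), or_comm (a := (w = y3 ∨ w = z3))], r.v1, r.v3, r.v2, r.a1, r.b1, r.a3, r.b3, r.a2, r.b2, r.m1, r.m3, r.m2⟩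

lemma RC.fin (r : RC X P v x1 x2 x3 y1 z1 y2 z2 y3 z3) (hc : P.card = 10) (he : en X P = 14)
    (e1 : X.Adj y1 y2) (e2 : X.Adj z1 z2) (e3 : X.Adj y3 y2) (e4 : X.Adj z3 z2) (e5 : X.Adj y1 z3) :
    Nonempty (X.induce (P : Set V) ≃g Rgraph) := by
  let f : ZMod 5 × Fin 2 → V := fun w => (![ ![y3, z1, x1, v, x3], ![y2, z2, y1, x2, z3] ] : Fin 2 → Fin 5 → V) w.2 w.1
  have hsub : P ⊆ Finset.univ.image f := by
    intro w hw
    rw [Finset.mem_image]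
    rcases r.hc w hw with rfl | (rfl | rfl | rfl) | (rfl | rfl) | (rfl | rfl) | (rfl | rfl)
    exacts [⟨(3,0), Finset.mem_univ _, rfl⟩, ⟨(2,0), Finset.mem_univ _, rfl⟩, ⟨(3,1), Finset.mem_univ _, rfl⟩, ⟨(4,0), Finset.mem_univ _, rfl⟩,
      ⟨(2,1), Finset.mem_univ _, rfl⟩, ⟨(1,0), Finset.mem_univ _, rfl⟩, ⟨(0,1), Finset.mem_univ _, rfl⟩, ⟨(1,1), Finset.mem_univ _, rfl⟩,
      ⟨(0,0), Finset.mem_univ _, rfl⟩, ⟨(4,1), Finset.mem_univ _, rfl⟩]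
  have hu : (Finset.univ : Finset (ZMod 5 × Fin 2)).card = 10 := by decide
  have him : P = Finset.univ.image f := Finset.eq_of_subset_of_card_le hsub (by rw [hc, ← hu]; exact Finset.card_image_le)
  refine iso_of_hom f ?_ (fun w => by rw [him]; exact Finset.mem_image_of_mem _ (Finset.mem_univ _)) (by rw [hc, ← hu]; rfl) ?_ (by rw [he]; exact R_edges)
  · rw [← Set.injOn_univ, ← Finset.coe_univ]
    exact Finset.card_image_iff.1 (by rw [← him, hc, hu])
  · have key : ∀ p ∈ RE, X.Adj (f p.1) (f p.2) := by
      unfold RE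
      simp only [List.forall_mem_cons]
      exact ⟨r.v1, r.v2, r.v3, r.a1, r.b1, r.a2, r.b2, r.a3, r.b3, e1, e2, e3, e4, e5, by simp⟩
    intro u w h
    rcases RE_all u w h with k | k
    · exact key _ k
    · exact (key _ k).symm

lemma RC.mid (r : RC X P v x1 x2 x3 y1 z1 y2 z2 y3 z3) (hn : NS 5 X P) (hc : P.card = 10) (he : en X P = 14)
    (h1 : X.Adj y1 y2 ∧ X.Adj z1 z2 ∨ X.Adj y1 z2 ∧ X.Adj z1 y2) (h3 : X.Adj y3 y2 ∧ X.Adj z3 z2 ∨ X.Adj y3 z2 ∧ X.Adj z3 y2)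
    (h2 : X.Adj y1 y3 ∨ X.Adj y1 z3 ∨ X.Adj z1 y3 ∨ X.Adj z1 z3) : Nonempty (X.induce (P : Set V) ≃g Rgraph) := by
  have core : ∀ {y1 z1 y3 z3 : V}, RC X P v x1 x2 x3 y1 z1 y2 z2 y3 z3 → X.Adj y1 y2 → X.Adj z1 z2 → X.Adj y3 y2 → X.Adj z3 z2 →
     (X.Adj y1 y3 ∨ X.Adj y1 z3 ∨ X.Adj z1 y3 ∨ X.Adj z1 z3) → Nonempty (X.induce (P : Set V) ≃g Rgraph) := by
    intro y1 z1 y3 z3 r a b c d e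
    rcases e with e | e | e | e
    · exact (hn.tri (by omega) r.m1.1 r.m2.1 r.m3.1 a c.symm e).elim
    · exact r.fin hc he a b c d e
    · exact r.s1.s2.s3.fin hc he b a d c e
    · exact (hn.tri (by omega) r.m1.2 r.m2.2 r.m3.2 b d.symm e).elim
  rcases h1 with ⟨a, b⟩ | ⟨a, b⟩ <;> rcases h3 with ⟨c, d⟩ | ⟨c, d⟩
  · exact core r a b c d h2
  · exact core r.s3 a b d c (by rcases h2 with h | h | h | h <;> simp [h])
  · exact core r.s1 b a c d (by rcases h2 with h | h | h | h <;> simp [h])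
  · exact core r.s1.s3 b a d c (by rcases h2 with h | h | h | h <;> simp [h])

lemma nb3_of {P : Finset V} {u v : V} (h : ee X {u} P = 3) (hv : v ∈ P) (huv : X.Adj u v) : ∃ y z, y ≠ z ∧ y ≠ v ∧ z ≠ v ∧ y ∈ P ∧ z ∈ P ∧
    X.Adj u y ∧ X.Adj u z ∧ ∀ w ∈ P, X.Adj u w → w = v ∨ w = y ∨ w = z := by
  obtain ⟨x, y, z, h1, h2, h3, hx, hy, hz, ax, ay, az, ho⟩ := nb3 h
  rcases ho v hv huv with rfl | rfl | rfl
  · exact ⟨y, z, h3, h1.symm, h2.symm, hy, hz, ay, az, ho⟩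
  · exact ⟨x, z, h2, h1, h3.symm, hx, hz, ax, az, fun w hw k => by rcases ho w hw k with h | h | h <;> simp [h]⟩
  · exact ⟨x, y, h1, h2, h3, hx, hy, ax, ay, fun w hw k => by rcases ho w hw k with h | h | h <;> simp [h]⟩

lemma match4 {a b c d : ℕ} (h1 : a + b ≤ 1) (h2 : c + d ≤ 1) (h3 : a + c ≤ 1) (h4 : b + d ≤ 1) (h : a + b + c + d = 2) : (a = 1 ∧ d = 1) ∨ (b = 1 ∧ c = 1) := by omega

lemma ee_pp {a b c d : V} (h : a ≠ b) (h' : c ≠ d) : ee X {a, b} {c, d} = ad X a c + ad X a d + ad X b c + ad X b d := by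
  rw [ee_insert_left (by simpa using h), ee_pair h', ee_pair h']; omega

lemma R_uniq [Fintype V] {P : Finset V} (hc : P.card = 10) (he : en X P = 14) (hd : ∀ v ∈ P, 2 ≤ ee X {v} P ∧ ee X {v} P ≤ 3) (hn : NS 5 X P) :
    Nonempty (X.induce (P : Set V) ≃g Rgraph) := by
  obtain ⟨v, hv, hv3, hnb⟩ : ∃ v ∈ P, ee X {v} P = 3 ∧ ∀ w ∈ P, X.Adj v w → ee X {w} P = 3 := by
    have hD : (P.filter (fun v => ee X {v} P = 2)).card = 2 := by
      have h1 : ∑ u ∈ P, (ee X {u} P + if ee X {u} P = 2 then 1 else 0) = ∑ u ∈ P, 3 := by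
        apply Finset.sum_congr rfl
        intro u hu
        have := hd u hu
        split <;> omega
      rw [Finset.sum_add_distrib, ← ee_sum_left, ← Finset.card_filter, ee_self] at h1
      simp at h1; omega
    obtain ⟨d, e, hde, hDe⟩ := Finset.card_eq_two.1 hD
    have hdm : ∀ w, w ∈ P ∧ ee X {w} P = 2 ↔ w = d ∨ w = e := by
      intro w
      have : w ∈ P.filter (fun v => ee X {v} P = 2) ↔ w ∈ ({d, e} : Finset V) := by rw [hDe]
      simpa using this
    have hdd := (hdm d).2 (Or.inl rfl)
    have hee := (hdm e).2 (Or.inr rfl)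
    have hb : (({d, e} : Finset V) ∪ (P.filter (X.Adj d) ∪ P.filter (X.Adj e))).card < P.card := by
      have h1 := Finset.card_union_le ({d, e} : Finset V) (P.filter (X.Adj d) ∪ P.filter (X.Adj e))
      have h2 := Finset.card_union_le (P.filter (X.Adj d)) (P.filter (X.Adj e))
      have h3 : (P.filter (X.Adj d)).card = 2 := by rw [← hdd.2, ee_single_card]
      have h4 : (P.filter (X.Adj e)).card = 2 := by rw [← hee.2, ee_single_card]
      have := Finset.card_le_two (a := d) (b := e)
      omega
    obtain ⟨v, hv, hvn⟩ := Finset.exists_mem_notMem_of_card_lt_card hb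
    simp at hvn
    refine ⟨v, hv, ?_, fun w hw k => ?_⟩
    · have := hd v hv
      have : ee X {v} P ≠ 2 := fun k => by rcases (hdm v).1 ⟨hv, k⟩ with h | h <;> simp [h] at hvn
      omega
    · have := hd w hw
      have : ee X {w} P ≠ 2 := fun k' => by
        rcases (hdm w).1 ⟨hw, k'⟩ with h | h
        · exact hvn.2.2.1 hv (h ▸ k.symm)
        · exact hvn.2.2.2 hv (h ▸ k.symm)
      omega
  obtain ⟨x1, x2, x3, h12, h13, h23, hx1, hx2, hx3, a1, a2, a3, ho⟩ := nb3 hv3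
  obtain ⟨y1, z1, n1, yv1, zv1, hy1, hz1, xy1, xz1, -⟩ := nb3_of (hnb x1 hx1 a1) hv a1.symm
  obtain ⟨y2, z2, n2, yv2, zv2, hy2, hz2, xy2, xz2, -⟩ := nb3_of (hnb x2 hx2 a2) hv a2.symm
  obtain ⟨y3, z3, n3, yv3, zv3, hy3, hz3, xy3, xz3, -⟩ := nb3_of (hnb x3 hx3 a3) hv a3.symm
  have T : ∀ {a b c : V}, a ∈ P → b ∈ P → c ∈ P → X.Adj a b → X.Adj b c → X.Adj a c → False := fun a b c => hn.tri (by omega) a b c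
  have offQ : ∀ {x w : V}, x ∈ P → X.Adj v x → w ∈ P → w ≠ v → X.Adj x w → w ∉ ({v, x1, x2, x3} : Finset V) := by
    intro x w hx hvx hw hwv hxw k
    simp only [Finset.mem_insert, Finset.mem_singleton] at k
    rcases k with rfl | rfl | rfl | rfl
    · exact hwv rfl
    · exact T hv hx hw hvx hxw a1
    · exact T hv hx hw hvx hxw a2
    · exact T hv hx hw hvx hxw a3
  have offA : ∀ {x x' w w' : V}, x ∈ P → x' ∈ P → x ≠ x' → X.Adj v x → X.Adj v x' → w ∈ P → w ≠ v → X.Adj x w → X.Adj x' w' → w ≠ w' := by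
    intro x x' w w' hx hx' hxx hvx hvx' hw hwv k k' e
    subst e
    exact hn.quad le_rfl hv hx hw hx' hvx k k'.symm hvx'.symm hwv.symm hxx
  have D12 : Disjoint ({y1, z1} : Finset V) {y2, z2} := by
    simp only [Finset.disjoint_insert_left, Finset.disjoint_singleton_left, Finset.mem_insert, Finset.mem_singleton, not_or]
    exact ⟨⟨offA hx1 hx2 h12 a1 a2 hy1 yv1 xy1 xy2, offA hx1 hx2 h12 a1 a2 hy1 yv1 xy1 xz2⟩, offA hx1 hx2 h12 a1 a2 hz1 zv1 xz1 xy2, offA hx1 hx2 h12 a1 a2 hz1 zv1 xz1 xz2⟩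
  have D13 : Disjoint ({y1, z1} : Finset V) {y3, z3} := by
    simp only [Finset.disjoint_insert_left, Finset.disjoint_singleton_left, Finset.mem_insert, Finset.mem_singleton, not_or]
    exact ⟨⟨offA hx1 hx3 h13 a1 a3 hy1 yv1 xy1 xy3, offA hx1 hx3 h13 a1 a3 hy1 yv1 xy1 xz3⟩, offA hx1 hx3 h13 a1 a3 hz1 zv1 xz1 xy3, offA hx1 hx3 h13 a1 a3 hz1 zv1 xz1 xz3⟩
  have D23 : Disjoint ({y2, z2} : Finset V) {y3, z3} := by
    simp only [Finset.disjoint_insert_left, Finset.disjoint_singleton_left, Finset.mem_insert, Finset.mem_singleton, not_or]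
    exact ⟨⟨offA hx2 hx3 h23 a2 a3 hy2 yv2 xy2 xy3, offA hx2 hx3 h23 a2 a3 hy2 yv2 xy2 xz3⟩, offA hx2 hx3 h23 a2 a3 hz2 zv2 xz2 xy3, offA hx2 hx3 h23 a2 a3 hz2 zv2 xz2 xz3⟩
  have D1 : Disjoint ({y1, z1} : Finset V) ({y2, z2} ∪ {y3, z3}) := Finset.disjoint_union_right.2 ⟨D12, D13⟩
  have DQ : Disjoint ({v, x1, x2, x3} : Finset V) ({y1, z1} ∪ ({y2, z2} ∪ {y3, z3})) := by
    rw [disjoint_comm, Finset.disjoint_union_left, Finset.disjoint_union_left]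
    have : ∀ {x y z : V}, x ∈ P → X.Adj v x → y ∈ P → z ∈ P → y ≠ v → z ≠ v → X.Adj x y → X.Adj x z → Disjoint ({y, z} : Finset V) {v, x1, x2, x3} := by
      intro x y z hx hvx hy hz yv zv xy xz
      rw [Finset.disjoint_insert_left, Finset.disjoint_singleton_left]
      exact ⟨offQ hx hvx hy yv xy, offQ hx hvx hz zv xz⟩
    exact ⟨this hx1 a1 hy1 hz1 yv1 zv1 xy1 xz1, this hx2 a2 hy2 hz2 yv2 zv2 xy2 xz2, this hx3 a3 hy3 hz3 yv3 zv3 xy3 xz3⟩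
  have hQ : ({v, x1, x2, x3} : Finset V).card = 4 := Finset.card_eq_four.2 ⟨v, x1, x2, x3, a1.ne, a2.ne, a3.ne, h12, h13, h23, rfl⟩
  have hPe : ({v, x1, x2, x3} : Finset V) ∪ ({y1, z1} ∪ ({y2, z2} ∪ {y3, z3})) = P := by
    apply Finset.eq_of_subset_of_card_le
    · intro w hw
      simp only [Finset.mem_union, Finset.mem_insert, Finset.mem_singleton] at hw
      rcases hw with (rfl | rfl | rfl | rfl) | (rfl | rfl) | (rfl | rfl) | (rfl | rfl) <;> assumption
    · rw [Finset.card_union_of_disjoint DQ, Finset.card_union_of_disjoint D1, Finset.card_union_of_disjoint D23, hQ, Finset.card_pair n1,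
        Finset.card_pair n2, Finset.card_pair n3, hc]
  have r : RC X P v x1 x2 x3 y1 z1 y2 z2 y3 z3 := by
    refine ⟨fun w hw => ?_, a1, a2, a3, xy1, xz1, xy2, xz2, xy3, xz3, ⟨hy1, hz1⟩, ⟨hy2, hz2⟩, ⟨hy3, hz3⟩⟩
    rw [← hPe] at hw
    simp only [Finset.mem_union, Finset.mem_insert, Finset.mem_singleton] at hw
    rcases hw with (h | h | h | h) | h
    · exact Or.inl h
    · exact Or.inr (Or.inl (Or.inl h))
    · exact Or.inr (Or.inl (Or.inr (Or.inl h)))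
    · exact Or.inr (Or.inl (Or.inr (Or.inr h)))
    · exact Or.inr (Or.inr h)
  have eQ : en X {v, x1, x2, x3} = 3 := by
    rw [en_quad a1.ne a2.ne a3.ne h12 h13 h23, ad_eq_one a1, ad_eq_one a2, ad_eq_one a3, ad_eq_zero fun k => T hv hx1 hx2 a1 k a2,
      ad_eq_zero fun k => T hv hx1 hx3 a1 k a3, ad_eq_zero fun k => T hv hx2 hx3 a2 k a3]
  have eQP : ee X {v, x1, x2, x3} P = 12 := by
    rw [ee_insert_left (by simp [a1.ne, a2.ne, a3.ne]), ee_insert_left (by simp [h12, h13]), ee_insert_left (by simp [h23]), hv3, hnb x1 hx1 a1, hnb x2 hx2 a2, hnb x3 hx3 a3]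
  have eQY : ee X {v, x1, x2, x3} ({y1, z1} ∪ ({y2, z2} ∪ {y3, z3})) = 6 := by
    have := ee_union_right (X := X) (C := {v, x1, x2, x3}) DQ
    rw [hPe, eQP, ee_self, eQ] at this; omega
  have eY : en X ({y1, z1} ∪ ({y2, z2} ∪ {y3, z3})) = 5 := by
    have := en_union (X := X) DQ
    rw [hPe, he, eQ, eQY] at this; omega
  have i0 : ∀ {x y z : V}, x ∈ P → y ∈ P → z ∈ P → X.Adj x y → X.Adj x z → y ≠ z → en X {y, z} = 0 := by
    intro x y z hx hy hz h1 h2 h3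
    rw [en_pair h3]; exact ad_eq_zero fun k => T hx hy hz h1 k h2
  rw [en_union D1, en_union D23, ee_union_right D23, i0 hx1 hy1 hz1 xy1 xz1 n1, i0 hx2 hy2 hz2 xy2 xz2 n2, i0 hx3 hy3 hz3 xy3 xz3 n3] at eY
  have q0 : ∀ {x y z w : V}, x ∈ P → y ∈ P → z ∈ P → w ∈ P → X.Adj x y → X.Adj x z → y ≠ z → w ≠ x → ad X w y + ad X w z ≤ 1 := by
    intro x y z w hx hy hz hw h1 h2 h3 h4
    by_contra hcon
    have b1 := ad_le (X := X) w y
    have b2 := ad_le (X := X) w z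
    have k1 : X.Adj w y := ad_pos.1 (by omega)
    have k2 : X.Adj w z := ad_pos.1 (by omega)
    exact hn.quad le_rfl hx hy hw hz h1 k1.symm k2 h2.symm h4.symm h3
  have bal : ∀ {x x' y z y' z' : V}, x ∈ P → x' ∈ P → X.Adj v x → X.Adj v x' → y ∈ P → z ∈ P → y' ∈ P → z' ∈ P → X.Adj x y → X.Adj x z → X.Adj x' y' → X.Adj x' z' → y ≠ z → y' ≠ z' →
      ee X {y, z} {y', z'} ≤ 2 ∧ (ee X {y, z} {y', z'} = 2 → X.Adj y y' ∧ X.Adj z z' ∨ X.Adj y z' ∧ X.Adj z y') ∧ (1 ≤ ee X {y, z} {y', z'} → X.Adj y y' ∨ X.Adj y z' ∨ X.Adj z y' ∨ X.Adj z z') := by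
    intro x x' y z y' z' hx hx' vx vx' hy hz hy' hz' h1 h2 h3 h4 n n'
    have w1 : y ≠ x' := fun e => T hv hx hx' vx (e ▸ h1) vx'
    have w2 : z ≠ x' := fun e => T hv hx hx' vx (e ▸ h2) vx'
    have w3 : y' ≠ x := fun e => T hv hx' hx vx' (e ▸ h3) vx
    have w4 : z' ≠ x := fun e => T hv hx' hx vx' (e ▸ h4) vx
    have g1 := q0 hx' hy' hz' hy h3 h4 n' w1
    have g2 := q0 hx' hy' hz' hz h3 h4 n' w2
    have g3 := q0 hx hy hz hy' h1 h2 n w3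
    have g4 := q0 hx hy hz hz' h1 h2 n w4
    rw [ad_comm y', ad_comm y'] at g3
    rw [ad_comm z', ad_comm z'] at g4
    rw [ee_pp n n']
    refine ⟨by omega, fun k => ?_, fun k => ?_⟩
    · rcases match4 g1 g2 g3 g4 k with ⟨a, b⟩ | ⟨a, b⟩
      · exact Or.inl ⟨ad_pos.1 (by omega), ad_pos.1 (by omega)⟩
      · exact Or.inr ⟨ad_pos.1 (by omega), ad_pos.1 (by omega)⟩
    · by_contra hcon
      push Not at hcon
      have := ad_eq_zero hcon.1
      have := ad_eq_zero hcon.2.1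
      have := ad_eq_zero hcon.2.2.1
      have := ad_eq_zero hcon.2.2.2
      omega
  obtain ⟨u12, t12, o12⟩ := bal hx1 hx2 a1 a2 hy1 hz1 hy2 hz2 xy1 xz1 xy2 xz2 n1 n2
  obtain ⟨u13, t13, o13⟩ := bal hx1 hx3 a1 a3 hy1 hz1 hy3 hz3 xy1 xz1 xy3 xz3 n1 n3
  obtain ⟨u32, t32, o32⟩ := bal hx3 hx2 a3 a2 hy3 hz3 hy2 hz2 xy3 xz3 xy2 xz2 n3 n2
  obtain ⟨u31, t31, o31⟩ := bal hx3 hx1 a3 a1 hy3 hz3 hy1 hz1 xy3 xz3 xy1 xz1 n3 n1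
  obtain ⟨u23, t23, o23⟩ := bal hx2 hx3 a2 a3 hy2 hz2 hy3 hz3 xy2 xz2 xy3 xz3 n2 n3
  obtain ⟨u21, t21, o21⟩ := bal hx2 hx1 a2 a1 hy2 hz2 hy1 hz1 xy2 xz2 xy1 xz1 n2 n1
  have c23 := ee_comm (X := X) {y2, z2} {y3, z3}
  have c13 := ee_comm (X := X) {y1, z1} {y3, z3}
  have c12 := ee_comm (X := X) {y1, z1} {y2, z2}
  by_cases k1 : ee X {y1, z1} {y2, z2} = 2
  · by_cases k2 : ee X {y2, z2} {y3, z3} = 2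
    · exact r.mid hn hc he (t12 k1) (t32 (by omega)) (o13 (by omega))
    · exact r.p12.mid hn hc he (t21 (by omega)) (t31 (by omega)) (o23 (by omega))
  · exact r.p23.mid hn hc he (t13 (by omega)) (t23 (by omega)) (o12 (by omega))

end

open scoped Classical in
/-- `Y` is divided into `n` pieces, the first one satisfying `Q`, the other being copies of `L`/`R` -/
def Ch {V : Type} (g : ℕ) (G : SimpleGraph V) (Q : Finset V → Prop) (s n : ℕ) (Y : Finset V) : Prop :=
  1 ≤ n ∧ ∃ q : V → ℕ, (∀ v ∈ Y, q v < n) ∧ Q (Y.filter (fun v => q v = 0)) ∧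
    (∀ l, 0 < l → l < n → PieceIso g (G.induce (↑(Y.filter (fun v => q v = l)) : Set V))) ∧
    en G Y + s = ∑ l ∈ Finset.range n, en G (Y.filter (fun v => q v = l)) + n

section
set_option linter.all false
open scoped Classical
variable {V : Type} {X G : SimpleGraph V} {g : ℕ}

abbrev Pc (g : ℕ) (G : SimpleGraph V) (P : Finset V) : Prop := PieceIso g (G.induce (↑P : Set V))

lemma Ch.base {Q : Finset V → Prop} {Y : Finset V} (h : Q Y) : Ch g G Q 1 1 Y := by
  refine ⟨le_rfl, fun _ => 0, by simp, by simpa using h, fun l h1 h2 => by omega, by simp⟩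

lemma Ch.join {Q : Finset V → Prop} {A B : Finset V} {s1 s2 s m n : ℕ} (hA : Ch g G Q s1 m A) (hB : Ch g G (Pc g G) s2 n B) (hd : Disjoint A B)
    (hs : s + ee G A B = s1 + s2) : Ch g G Q s (m + n) (A ∪ B) := by
  obtain ⟨hm, qA, a1, a2, a3, a4⟩ := hA
  obtain ⟨hn, qB, b1, b2, b3, b4⟩ := hB
  refine ⟨by omega, fun v => if v ∈ A then qA v else m + qB v, ?_, ?_, ?_, ?_⟩
  all_goals
    have hl : ∀ l, l < m → (A ∪ B).filter (fun v => (if v ∈ A then qA v else m + qB v) = l) = A.filter (fun v => qA v = l) := by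
      intro l hl
      ext x
      simp only [Finset.mem_filter, Finset.mem_union]
      by_cases hx : x ∈ A
      · simp [hx]
      · simp only [hx, if_false, false_and, iff_false, not_and]; omega
    have hr : ∀ l, (A ∪ B).filter (fun v => (if v ∈ A then qA v else m + qB v) = m + l) = B.filter (fun v => qB v = l) := by
      intro l
      ext x
      simp only [Finset.mem_filter, Finset.mem_union]
      by_cases hx : x ∈ A
      · have := a1 x hx
        have hxB := Finset.disjoint_left.1 hd hx
        simp only [hx, if_true, hxB, false_and, iff_false, not_and]; omega
      · simp [hx]
  · intro v hv
    by_cases hx : v ∈ A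
    · have := a1 v hx; simp only [hx, if_true]; omega
    · have := b1 v (by simpa [hx] using hv); simp only [hx, if_false]; omega
  · rw [hl 0 (by omega)]; exact a2
  · intro l h1 h2
    by_cases h3 : l < m
    · rw [hl l h3]; exact a3 l h1 h3
    · obtain ⟨t, rfl⟩ := Nat.exists_eq_add_of_le (not_lt.1 h3)
      rw [hr]
      rcases Nat.eq_zero_or_pos t with rfl | ht
      · exact b2
      · exact b3 t ht (by omega)
  · rw [en_union hd, Finset.sum_range_add]
    have e1 : ∑ x ∈ Finset.range m, en G ((A ∪ B).filter (fun v => (if v ∈ A then qA v else m + qB v) = x)) = ∑ x ∈ Finset.range m, en G (A.filter (fun v => qA v = x)) :=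
      Finset.sum_congr rfl fun l hh => by rw [hl l (Finset.mem_range.1 hh)]
    have e2 : ∑ x ∈ Finset.range n, en G ((A ∪ B).filter (fun v => (if v ∈ A then qA v else m + qB v) = m + x)) = ∑ x ∈ Finset.range n, en G (B.filter (fun v => qB v = x)) :=
      Finset.sum_congr rfl fun l hh => by rw [hr l]
    rw [e1, e2]; omega

lemma PieceIso.either {H : SimpleGraph V} {g : ℕ} : PieceIso g H ↔ (g = 4 ∧ Nonempty (H ≃g Lgraph)) ∨ (g = 5 ∧ Nonempty (H ≃g Rgraph)) := Iff.rfl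

lemma Ch.memFG [Fintype V] (h : MC g G) {i j n : ℕ} (hc : Ch g G (FF i j G) 0 n Finset.univ) : ∃ k, MemFG g i j k G := by
  obtain ⟨hn, q, a1, a2, a3, a4⟩ := hc
  obtain ⟨k, rfl⟩ : ∃ k, n = k + 1 := ⟨n - 1, by omega⟩
  let p : V → Fin (k + 1) := fun v => ⟨q v, a1 v (Finset.mem_univ v)⟩
  let H : SimpleGraph V := { Adj := fun u v => G.Adj u v ∧ q u = q v, symm := ⟨fun u v k => ⟨k.1.symm, k.2.symm⟩⟩, loopless := ⟨fun u k => G.irrefl k.1⟩ }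
  have hle : H ≤ G := fun u v k => k.1
  have hpre : ∀ l : Fin (k + 1), p ⁻¹' {l} = (↑(Finset.univ.filter (fun v => q v = l.1)) : Set V) := by
    intro l; ext v; simp [p, Fin.ext_iff]
  have hHG : ∀ l : ℕ, ∀ u ∈ Finset.univ.filter (fun v => q v = l), ∀ v ∈ Finset.univ.filter (fun v => q v = l), H.Adj u v ↔ G.Adj u v := by
    intro l u hu v hv
    simp at hu hv
    exact ⟨fun k => k.1, fun k => ⟨k, hu.trans hv.symm⟩⟩
  have hind : ∀ l : ℕ, H.induce (↑(Finset.univ.filter (fun v => q v = l)) : Set V) = G.induce (↑(Finset.univ.filter (fun v => q v = l)) : Set V) := by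
    intro l; ext u v
    exact hHG l u.1 u.2 v.1 v.2
  have hpc : ∀ l : Fin (k + 1), l ≠ 0 → PieceIso g (H.induce (p ⁻¹' {l})) := by
    intro l hl
    rw [hpre, hind]
    exact a3 l.1 (Nat.pos_of_ne_zero fun h0 => hl (Fin.ext h0)) l.2
  refine ⟨k, h.ec.two h.deg h.card, fun v => by rw [ncard_neighborSet]; exact h.deg v, p, H, hle, fun u v k => Fin.ext k.2, ?_, ?_, ?_, ?_⟩
  · rw [hpre, hind]; exact a2.memF
  · rcases h.hg with hg | hg
    · refine Or.inl ⟨hg, fun l hl => ?_⟩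
      rcases hpc l hl with k | k
      · exact k.2
      · omega
    · refine Or.inr ⟨hg, fun l hl => ?_⟩
      rcases hpc l hl with k | k
      · omega
      · exact k.2
  · rw [← SimpleGraph.edgeSet_sdiff, en_univ]
    have e1 := en_sdiff_graph hle Finset.univ
    have e2 := en_part (X := H) (q := p) (fun u v k => Fin.ext k.2) Finset.univ
    have e3 : ∑ l, en H (pt p Finset.univ l) = ∑ l ∈ Finset.range (k + 1), en G (Finset.univ.filter (fun v => q v = l)) := by
      rw [Finset.sum_range]
      apply Finset.sum_congr rfl
      intro l _
      have : pt p Finset.univ l = Finset.univ.filter (fun v => q v = l.1) := by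
        ext v; simp [pt, p, Fin.ext_iff]
      rw [this, ← en_eq_ncard_induce, ← en_eq_ncard_induce, hind]
    omega
  · intro _ u v h1 h2 h3
    exact h2 ⟨h1, by simpa [p, Fin.ext_iff] using h3⟩

/-- ball of radius two in girth at least five -/
lemma ball {P : Finset V} {v : V} (hn : NS 5 X P) (hv : v ∈ P) : 1 + ∑ u ∈ P.filter (fun u => X.Adj v u), ee X {u} P ≤ P.card := by
  let C : V → Finset V := fun u => insert u ((P.filter (fun w => X.Adj u w)).erase v)
  have hcard : ∀ u ∈ P.filter (fun u => X.Adj v u), (C u).card = ee X {u} P := by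
    intro u hu
    simp at hu
    have : v ∈ P.filter (fun w => X.Adj u w) := by simp [hv, hu.2.symm]
    rw [Finset.card_insert_of_notMem (by simp), Finset.card_erase_of_mem this, ee_single_card]
    have := Finset.card_pos.2 ⟨v, this⟩
    omega
  have hdis : ∀ u ∈ P.filter (fun u => X.Adj v u), ∀ w ∈ P.filter (fun u => X.Adj v u), u ≠ w → Disjoint (C u) (C w) := by
    intro u hu w hw huw
    simp at hu hw
    rw [Finset.disjoint_left]
    intro x hx hx'
    simp only [C, Finset.mem_insert, Finset.mem_erase, Finset.mem_filter] at hx hx'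
    rcases hx with rfl | hx <;> rcases hx' with rfl | hx'
    · exact huw rfl
    · exact hn.tri (by omega) hv hw.1 hu.1 hw.2 hx'.2.2 hu.2
    · exact hn.tri (by omega) hv hu.1 hw.1 hu.2 hx.2.2 hw.2
    · exact hn.quad le_rfl hv hu.1 hx.2.1 hw.1 hu.2 hx.2.2 hx'.2.2.symm hw.2.symm (Ne.symm hx.1) huw
  have h1 : (insert v ((P.filter (fun u => X.Adj v u)).biUnion C)).card ≤ P.card := by
    apply Finset.card_le_card
    intro x hx
    simp only [C, Finset.mem_insert, Finset.mem_biUnion, Finset.mem_erase, Finset.mem_filter] at hx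
    rcases hx with rfl | ⟨u, hu, rfl | hx⟩
    · exact hv
    · exact hu.1
    · exact hx.2.1
  rw [Finset.card_insert_of_notMem, Finset.card_biUnion hdis, Finset.sum_congr rfl hcard] at h1
  · omega
  · intro hx
    simp only [C, Finset.mem_insert, Finset.mem_biUnion, Finset.mem_erase, Finset.mem_filter] at hx
    obtain ⟨u, hu, rfl | hx⟩ := hx
    · exact X.irrefl hu.2
    · exact hx.1 rfl

lemma peel [Fintype V] {P : Finset V} (hd : ∀ A ⊆ P, ∀ v ∈ A, ee X {v} A ≤ 3) (hc : P.card = 6) (he : en X P = 8) (hn : NS 5 X P) : False := by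
  obtain ⟨v, hv, h1⟩ := exists_low (X := X) (P := P) (d := 2) (by omega)
  have h2 := en_erase (X := X) hv
  have h3 := Finset.card_erase_of_mem hv
  have h4 : ee X (P.erase v) (P.erase v) ≤ 3 * (P.erase v).card := ee_le_of_deg (hd _ (Finset.erase_subset _ _))
  rw [ee_self] at h4
  obtain ⟨u, hu, h5⟩ := exists_low (X := X) (P := P.erase v) (d := 2) (by omega)
  have h6 := en_erase (X := X) hu
  have h7 := Finset.card_erase_of_mem hu
  exact not_acy_of_en (X := X) (P := (P.erase v).erase u) (by omega) (by rw [← Finset.card_pos]; omega)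
    (hn _ ((Finset.erase_subset _ _).trans (Finset.erase_subset _ _)) (by omega))

lemma no79 {P : Finset V} (hd : ∀ v ∈ P, 2 ≤ ee X {v} P ∧ ee X {v} P ≤ 3) (hc : P.card = 7) (he : en X P = 9) (hn : NS 5 X P) : False := by
  let T := P.filter (fun v => ee X {v} P = 3)
  let D := P.filter (fun v => ee X {v} P = 2)
  have hT : T.card = 4 := by
    have h1 : ∑ u ∈ P, ee X {u} P = ∑ u ∈ P, (2 + if ee X {u} P = 3 then 1 else 0) := by
      apply Finset.sum_congr rfl
      intro u hu
      have := hd u hu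
      split <;> omega
    rw [Finset.sum_add_distrib, ← ee_sum_left, ← Finset.card_filter, ee_self] at h1
    simp at h1; show (P.filter _).card = 4; omega
  have hTD : T.card + D.card = P.card := by
    rw [← Finset.card_union_of_disjoint]
    · congr 1; ext x; simp only [T, D, Finset.mem_union, Finset.mem_filter]
      constructor
      · rintro (h | h) <;> exact h.1
      · intro hx; have := hd x hx
        by_cases k : ee X {x} P = 3
        · exact Or.inl ⟨hx, k⟩
        · exact Or.inr ⟨hx, by omega⟩
    · rw [Finset.disjoint_left]; intro x hx hx'; simp [T, D] at hx hx'; omega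
  have hTn : ∀ v ∈ T, ee X {v} D = 3 := by
    intro v hv
    simp only [T, Finset.mem_filter] at hv
    have h1 := ball hn hv.1
    have h2 := hv.2
    rw [ee_single_card] at h2 ⊢
    rw [← h2]
    congr 1
    have h3 : ∀ u ∈ P.filter (fun u => X.Adj v u), ee X {u} P = 2 := by
      by_contra hcon
      push Not at hcon
      obtain ⟨u, hu, hu2⟩ := hcon
      have : ∑ u ∈ P.filter (fun u => X.Adj v u), 2 < ∑ u ∈ P.filter (fun u => X.Adj v u), ee X {u} P := by
        apply Finset.sum_lt_sum
        · intro w hw; exact (hd w (Finset.mem_filter.1 hw).1).1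
        · exact ⟨u, hu, by have := hd u (Finset.mem_filter.1 hu).1; omega⟩
      simp only [Finset.sum_const, smul_eq_mul] at this
      have : (P.filter (fun u => X.Adj v u)).card = 3 := by rw [← h2]
      omega
    ext u
    simp only [D, Finset.mem_filter]
    constructor
    · rintro ⟨⟨a, b⟩, c⟩; exact ⟨a, c⟩
    · rintro ⟨a, b⟩; exact ⟨⟨a, h3 u (Finset.mem_filter.2 ⟨a, b⟩)⟩, b⟩
  have h4 : ee X T D = 12 := by rw [ee_sum_left, Finset.sum_congr rfl hTn]; simp [hT]
  have h5 : ee X D T ≤ ee X D P := ee_mono subset_rfl (Finset.filter_subset _ _)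
  have h6 : ee X D P ≤ 2 * D.card := ee_le_of_deg fun u hu => by simp [D] at hu; omega
  rw [ee_comm] at h4
  omega

end

section
set_option linter.all false
open scoped Classical
variable {V : Type} [Fintype V] {X G : SimpleGraph V} {g : ℕ}

lemma dd_univ : dd G Finset.univ = 0 := by simp [dd]

lemma wt_union (h : MC g G) {A B : Finset V} (hd : Disjoint A B) (hf : fv X (A ∪ B) ≤ fv X A + fv X B) :
    wt g X (A ∪ B) ≤ wt g X A + wt g X B - tt g * ee X A B := by
  have h1 := en_union (X := X) hd
  unfold wt
  rw [h1]
  rcases h.tt_pos with ⟨_, e1, e2⟩ | ⟨_, e1, e2⟩ <;> rw [e1, e2] <;> push_cast <;> omega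

lemma wt_acy {P : Finset V} (h : AcyOn X P) : wt g X P = - tt g * en X P := by
  have : fv X P ≤ (∅ : Finset V).card := fv_le (by simpa using h)
  simp at this
  unfold wt; rw [this]; push_cast; ring

lemma chain_base (h : MC g G) {Y : Finset V} (hd : dd G Y = 2) (hec : EC2 G Y) (h2 : 2 ≤ Y.card) :
    (NS g G Y → wt g G Y ≤ tt g ∧ (tt g ≤ wt g G Y → Pc g G Y)) ∧
    (wt g G Y ≤ tt g + 1 ∧ (tt g + 1 ≤ wt g G Y → ∃ j, FF 3 j G Y)) := by
  have hYu : Y ≠ Finset.univ := by rintro rfl; rw [dd_univ] at hd; omega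
  have hcnt := h.dd_cnt Y
  rcases h.min' hYu hec h2 (fun v _ => h.degP Y v) (h.nd.mono (Finset.subset_univ _)) with k | ⟨i, j, hf, hw⟩ | k
  · rcases h.tt_pos with ⟨_, e1, e2⟩ | ⟨_, e1, e2⟩ <;> rw [e1] <;>
      exact ⟨fun _ => ⟨by omega, fun _ => by omega⟩, by omega, fun _ => by omega⟩
  · obtain ⟨c1, c2, c3, c4⟩ := hf.counts
    have hne : Y.Nonempty := Finset.card_pos.1 (by omega)
    have hij : j + 2 ≤ i := by omega
    have nac : ∀ m, NS g G Y → Y.card = m → m < g → Y.card ≤ en G Y → False := fun m hn e1 e2 e3 =>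
      not_acy_of_en e3 hne (hn Y subset_rfl (by omega))
    rcases h.tt_pos with ⟨rfl, e1, e2⟩ | ⟨rfl, e1, e2⟩ <;> rw [e1, e2] at hw <;> rw [e1]
    · refine ⟨fun hn => ?_, by omega, fun hh => ?_⟩
      · have h30 : ¬ (i = 3 ∧ j = 0) := by
          rintro ⟨rfl, rfl⟩
          exact nac 3 hn (by omega) (by omega) (by omega)
        refine ⟨by omega, fun hh => ?_⟩
        have : i = 3 ∧ j = 1 := by omega
        obtain ⟨rfl, rfl⟩ := this
        exact Or.inl ⟨rfl, L_uniq c1 c2 (fun v hv => (c3 v hv).2) hn⟩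
      · have : i = 3 := by omega
        exact ⟨j, this ▸ hf⟩
    · refine ⟨fun hn => ?_, by omega, fun hh => ?_⟩
      · have h3 : i ≠ 3 := by
          rintro rfl
          have : j = 0 ∨ j = 1 := by omega
          rcases this with rfl | rfl
          · exact nac 3 hn (by omega) (by omega) (by omega)
          · exact peel (fun A _ v _ => h.degP A v) c1 c2 hn
        refine ⟨by omega, fun hh => ?_⟩
        have : i = 4 := by omega
        subst this
        have : j = 0 ∨ j = 1 ∨ j = 2 := by omega
        rcases this with rfl | rfl | rfl
        · exact (nac 4 hn (by omega) (by omega) (by omega)).elim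
        · exact (no79 c3 c1 c2 hn).elim
        · exact Or.inr ⟨rfl, R_uniq c1 c2 c3 hn⟩
      · have : i = 3 := by omega
        exact ⟨j, this ▸ hf⟩
  · obtain ⟨k1, k2⟩ := k
    obtain ⟨_, _, k3⟩ := k2 (by omega)
    omega

lemma nd_split (hn : ND g G Finset.univ) {A B : Finset V} (hd : Disjoint A B) : NS g G A ∨ NS g G B := by
  by_contra hc
  unfold NS at hc
  push Not at hc
  obtain ⟨⟨C, c1, c2, c3⟩, D, d1, d2, d3⟩ := hc
  exact hn C (Finset.subset_univ _) D (Finset.subset_univ _) c2 d2 c3 d3 (hd.mono c1 d1)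

lemma not_ec2 {P : Finset V} (h : ¬ EC2 X P) : ∃ Z ⊆ P, Z.Nonempty ∧ Z ≠ P ∧ ee X Z (P \ Z) ≤ 1 := by
  unfold EC2 at h
  push Not at h
  obtain ⟨Z, a, b, c, d⟩ := h
  exact ⟨Z, a, b, c, by omega⟩

lemma dd_split {Z Z' : Finset V} (hd : Disjoint Z Z') : dd G Z + dd G Z' = dd G (Z ∪ Z') + 2 * ee G Z Z' := by
  have h1 := dd_eq (G := G) Z
  have h2 := dd_eq (G := G) Z'
  have h3 := dd_eq (G := G) (Z ∪ Z')
  rw [ee_union_left hd] at h3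
  rw [en_union hd] at h3
  omega

lemma MC.chain (h : MC g G) : ∀ N : ℕ, ∀ Y : Finset V, Y.card = N → Y.Nonempty → dd G Y = 2 →
    (NS g G Y → wt g G Y ≤ tt g ∧ (tt g ≤ wt g G Y → ∃ n, Ch g G (Pc g G) 1 n Y)) ∧
    (wt g G Y ≤ tt g + 1 ∧ (tt g + 1 ≤ wt g G Y → ∃ j n, Ch g G (FF 3 j G) 1 n Y)) := by
  intro N
  induction N using Nat.strong_induction_on with
  | _ N IH =>
  intro Y hN hne hd
  by_cases h1 : Y.card = 1
  · obtain ⟨v, rfl⟩ := Finset.card_eq_one.1 h1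
    have hw : wt g G {v} = 0 := by rw [wt_acy (acyOn_singleton _), en_single]; simp
    rw [hw]
    rcases h.tt_pos with ⟨_, e1, _⟩ | ⟨_, e1, _⟩ <;> rw [e1] <;> exact ⟨fun _ => ⟨by omega, fun _ => by omega⟩, by omega, fun _ => by omega⟩
  have hpos := Finset.card_pos.2 hne
  by_cases hec : EC2 G Y
  · obtain ⟨a, b, c⟩ := chain_base h hd hec (by omega)
    refine ⟨fun hn => ⟨(a hn).1, fun k => ⟨1, Ch.base ((a hn).2 k)⟩⟩, b, fun k => ?_⟩
    obtain ⟨j, hj⟩ := c k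
    exact ⟨j, 1, Ch.base hj⟩
  obtain ⟨Z, hZ, hZn, hZY, hee⟩ := not_ec2 hec
  have hYu : Y ≠ Finset.univ := by rintro rfl; rw [dd_univ] at hd; omega
  have hZ'n : (Y \ Z).Nonempty := Finset.sdiff_nonempty.2 fun k => hZY (Finset.Subset.antisymm hZ k)
  have hdis : Disjoint Z (Y \ Z) := Finset.disjoint_sdiff
  have hun : Z ∪ (Y \ Z) = Y := Finset.union_sdiff_of_subset hZ
  have hs := dd_split (G := G) hdis
  rw [hun] at hs
  have pu : ∀ A, A ⊆ Y → A ≠ Finset.univ := fun A hA k => hYu (Finset.univ_subset_iff.1 (k ▸ hA))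
  have g1 := h.dd_ge hZn (pu Z hZ)
  have g2 := h.dd_ge hZ'n (pu _ Finset.sdiff_subset)
  have hw := wt_union h hdis (fv_union_le hdis hee)
  have he1 : ee G Z (Y \ Z) = 1 := by omega
  rw [hun, he1] at hw
  have c1 := Finset.card_lt_card (Finset.ssubset_iff_subset_ne.2 ⟨hZ, hZY⟩)
  have c2 := Finset.card_sdiff_of_subset hZ
  have c3 := Finset.card_pos.2 hZn
  obtain ⟨a1, b1, d1⟩ := IH Z.card (by omega) Z rfl hZn (by omega)
  obtain ⟨a2, b2, d2⟩ := IH (Y \ Z).card (by omega) (Y \ Z) rfl hZ'n (by omega)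
  have hun2 : (Y \ Z) ∪ Z = Y := Finset.sdiff_union_of_subset hZ
  have he2 : ee G (Y \ Z) Z = 1 := by rw [ee_comm]; exact he1
  constructor
  · intro hn
    obtain ⟨p1, p2⟩ := a1 (hn.mono hZ)
    obtain ⟨q1, q2⟩ := a2 (hn.mono Finset.sdiff_subset)
    push_cast at hw
    refine ⟨by linarith, fun hh => ?_⟩
    obtain ⟨m, hm⟩ := p2 (by linarith)
    obtain ⟨n, hn⟩ := q2 (by linarith)
    have := hm.join hn hdis (s := 1) (by omega)
    rw [hun] at this
    exact ⟨_, this⟩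
  · push_cast at hw
    rcases nd_split h.nd hdis with hn | hn
    · obtain ⟨p1, p2⟩ := a1 hn
      refine ⟨by linarith, fun hh => ?_⟩
      obtain ⟨m, hm⟩ := p2 (by linarith)
      obtain ⟨j, n, hn⟩ := d2 (by linarith)
      have := hn.join hm hdis.symm (s := 1) (by omega)
      rw [hun2] at this
      exact ⟨j, _, this⟩
    · obtain ⟨p1, p2⟩ := a2 hn
      refine ⟨by linarith, fun hh => ?_⟩
      obtain ⟨m, hm⟩ := p2 (by linarith)
      obtain ⟨j, n, hn⟩ := d1 (by linarith)
      have := hn.join hm hdis (s := 1) (by omega)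
      rw [hun] at this
      exact ⟨j, _, this⟩

lemma MC.lemI (h : MC g G) {Y : Finset V} (hne : Y.Nonempty) (hd : dd G Y = 2) (hf : fv G Finset.univ ≤ fv G Y + fv G (Finset.univ \ Y)) : False := by
  have hYu : Y ≠ Finset.univ := by rintro rfl; rw [dd_univ] at hd; omega
  have hne' : (Finset.univ \ Y).Nonempty := Finset.sdiff_nonempty.2 fun k => hYu (Finset.univ_subset_iff.1 k)
  have hdis : Disjoint Y (Finset.univ \ Y) := Finset.disjoint_sdiff
  have hun : Y ∪ (Finset.univ \ Y) = Finset.univ := Finset.union_sdiff_of_subset (Finset.subset_univ _)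
  have hw := wt_union (X := G) h hdis (by rw [hun]; exact hf)
  have he : ee G Y (Finset.univ \ Y) = 2 := hd
  rw [hun, he] at hw
  have hp := h.pos
  obtain ⟨a1, b1, d1⟩ := h.chain _ Y rfl hne hd
  obtain ⟨a2, b2, d2⟩ := h.chain _ (Finset.univ \ Y) rfl hne' (by rw [dd_compl]; exact hd)
  push_cast at hw
  rcases nd_split h.nd hdis with hn | hn
  · obtain ⟨p1, p2⟩ := a1 hn
    obtain ⟨m, hm⟩ := p2 (by linarith)
    obtain ⟨j, n, hn⟩ := d2 (by linarith)
    have := hn.join hm hdis.symm (s := 0) (by rw [ee_comm, he])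
    rw [Finset.union_comm, hun] at this
    obtain ⟨k, hk⟩ := this.memFG h
    exact h.nFG _ _ _ hk
  · obtain ⟨p1, p2⟩ := a2 hn
    obtain ⟨m, hm⟩ := p2 (by linarith)
    obtain ⟨j, n, hn⟩ := d1 (by linarith)
    have := hn.join hm hdis (s := 0) (by rw [he])
    rw [hun] at this
    obtain ⟨k, hk⟩ := this.memFG h
    exact h.nFG _ _ _ hk

end

/-- contract the complement of `Y` to the vertex `b` -/
def cl {V : Type} (G : SimpleGraph V) (Y : Finset V) (b : V) : SimpleGraph V where
  Adj u w := u ≠ w ∧ ((u ∈ Y ∧ w ∈ Y ∧ G.Adj u w) ∨ (u ∈ Y ∧ w = b ∧ ∃ y, y ∉ Y ∧ G.Adj u y) ∨ (w ∈ Y ∧ u = b ∧ ∃ y, y ∉ Y ∧ G.Adj w y))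
  symm := ⟨by
    rintro u w ⟨h, k⟩
    refine ⟨h.symm, ?_⟩
    rcases k with k | k | k
    · exact Or.inl ⟨k.2.1, k.1, k.2.2.symm⟩
    · exact Or.inr (Or.inr k)
    · exact Or.inr (Or.inl k)⟩
  loopless := ⟨fun u k => k.1 rfl⟩

section
set_option linter.all false
open scoped Classical
variable {V : Type} [Fintype V] {X G : SimpleGraph V} {g : ℕ}

lemma MC.lemIsep (h : MC g G) {Y S : Finset V} (hne : Y.Nonempty) (hd : dd G Y = 2) (hS : AcyOn G (Y \ S)) (hc : S.card ≤ fv G Y)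
    (he : ee G (Y \ S) (Finset.univ \ Y) ≤ 1) : False := by
  refine h.lemI hne hd ?_
  obtain ⟨T, t1, t2, t3⟩ := fv_exists G (Finset.univ \ Y)
  have hdis : Disjoint (Y \ S) ((Finset.univ \ Y) \ T) := Finset.disjoint_sdiff.mono Finset.sdiff_subset Finset.sdiff_subset
  have h1 : AcyOn G ((Y \ S) ∪ ((Finset.univ \ Y) \ T)) := hS.union t2 hdis ((ee_mono subset_rfl Finset.sdiff_subset).trans he)
  have h2 : fv G Finset.univ ≤ (S ∪ T).card := by
    refine fv_le (h1.mono ?_)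
    intro x hx
    simp at hx ⊢
    by_cases k : x ∈ Y <;> simp [k, hx]
  have := Finset.card_union_le S T
  omega

/-- forest count -/
lemma fv_lower {P : Finset V} (hd : ∀ v ∈ P, ee X {v} P ≤ 3) (h : fv X P < P.card) : en X P + 1 ≤ P.card + 2 * fv X P := by
  obtain ⟨S, s1, s2, s3⟩ := fv_exists X P
  have h1 : ee X S P ≤ 3 * S.card := ee_le_of_deg fun u hu => hd u (s1 hu)
  have h2 := en_union (X := X) (A := S) (B := P \ S) Finset.disjoint_sdiff
  rw [Finset.union_sdiff_of_subset s1] at h2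
  have h3 := ee_sdiff_right (X := X) (A := S) s1
  rw [ee_self] at h3
  have h4 := Finset.card_sdiff_of_subset s1
  rw [acyOn_iff] at s2
  have h5 := s2 (P \ S) subset_rfl (by rw [← Finset.card_pos]; omega)
  omega

lemma MC.A8 (h : MC g G) {A S : Finset V} (hA : A.card = 6) (hen : 8 ≤ en G A) (hu : A ≠ Finset.univ) (hSA : S ⊆ A) (hS : S.card = 2)
    (hacy : AcyOn G (A \ S)) {s t : V} (hs : s ∈ S) (ht : t ∉ A) (hst : G.Adj s t) : False := by
  have hne : A.Nonempty := Finset.card_pos.1 (by omega)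
  have h1 := h.dd_cnt A
  have h2 := h.dd_ge hne hu
  have h3 : 2 ≤ fv G A := by
    by_contra hc
    have := fv_lower (X := G) (P := A) (fun v _ => h.degP A v) (by omega)
    omega
  refine h.lemIsep hne (by omega) hacy (by omega) ?_
  have h4 : dd G A = ee G S (Finset.univ \ A) + ee G (A \ S) (Finset.univ \ A) := by
    unfold dd; rw [← ee_union_left Finset.disjoint_sdiff, Finset.union_sdiff_of_subset hSA]
  have h5 : 0 < ee G S (Finset.univ \ A) := ee_pos.2 ⟨s, hs, t, by simp [ht], hst⟩
  omega

/-- in a 2-edge cut the ends on one side are distinct -/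
lemma MC.cut_le (h : MC g G) {Y : Finset V} (hd : dd G Y = 2) (h2 : 2 ≤ Y.card) {u : V} (hu : u ∈ Y) : ee G {u} (Finset.univ \ Y) ≤ 1 := by
  by_contra hc
  have h1 : dd G {u} + dd G (Y.erase u) = dd G Y + 2 * ee G {u} (Y.erase u) := by
    have := dd_split (G := G) (Z := {u}) (Z' := Y.erase u) (by simp)
    rwa [← Finset.insert_eq, Finset.insert_erase hu] at this
  have h3 : dd G {u} = ee G {u} (Y.erase u) + ee G {u} (Finset.univ \ Y) := by
    have k := dd_eq (G := G) {u}
    rw [en_single, ee_univ_sdiff {u} Y, ee_erase_self hu] at k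
    omega
  have h4 := h.deg u
  have h5 := dd_eq (G := G) {u}
  rw [en_single] at h5
  have hYu : Y ≠ Finset.univ := by rintro rfl; rw [dd_univ] at hd; omega
  have h6 := h.dd_ge (Y := Y.erase u) (by rw [← Finset.card_pos, Finset.card_erase_of_mem hu]; omega)
    (fun k => hYu (Finset.univ_subset_iff.1 (k ▸ Finset.erase_subset u Y)))
  omega

lemma cl_ad {Y : Finset V} {b u w : V} (hu : u ∈ Y) (hw : w ∈ Y) (hb : b ∉ Y) : (cl G Y b).Adj u w ↔ G.Adj u w := by
  have h1 : w ≠ b := fun k => hb (k ▸ hw)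
  have h2 : u ≠ b := fun k => hb (k ▸ hu)
  simp only [cl, hu, hw, h1, h2, true_and, false_and, and_false, or_false]
  exact ⟨fun k => k.2, fun k => ⟨k.ne, k⟩⟩

lemma cl_b {Y : Finset V} {b u : V} (hu : u ∈ Y) (hb : b ∉ Y) (h1 : ee G {u} (Finset.univ \ Y) ≤ 1) : ad (cl G Y b) u b = ee G {u} (Finset.univ \ Y) := by
  have h2 : u ≠ b := fun k => hb (k ▸ hu)
  by_cases k : ∃ y, y ∉ Y ∧ G.Adj u y
  · have : 0 < ee G {u} (Finset.univ \ Y) := by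
      obtain ⟨y, h3, h4⟩ := k
      exact ee_pos.2 ⟨u, by simp, y, by simp [h3], h4⟩
    rw [ad_eq_one (show (cl G Y b).Adj u b from ⟨h2, Or.inr (Or.inl ⟨hu, rfl, k⟩)⟩)]; omega
  · rw [ad_eq_zero, eq_comm]
    · rw [ee_eq_zero]
      intro x hx y hy hxy
      simp at hx hy
      subst hx
      exact k ⟨y, hy, hxy⟩
    · rintro ⟨_, k1 | k1 | k1⟩
      · exact hb k1.2.1
      · exact k k1.2.2
      · exact hb k1.1

lemma cl_ee {Y A : Finset V} {b : V} (hA : A ⊆ Y) (hb : b ∉ Y) (h1 : ∀ u ∈ Y, ee G {u} (Finset.univ \ Y) ≤ 1) : ee (cl G Y b) A {b} = ee G A (Finset.univ \ Y) := by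
  rw [ee_sum_left, ee_sum_left A]
  apply Finset.sum_congr rfl
  intro u hu
  rw [ee_single, cl_b (hA hu) hb (h1 u (hA hu))]

lemma cl_ee2 {Y A B : Finset V} {b : V} (hA : A ⊆ Y) (hB : B ⊆ Y) (hb : b ∉ Y) : ee (cl G Y b) A B = ee G A B :=
  ee_congr_graph fun u hu v hv => cl_ad (hA hu) (hB hv) hb

lemma cl_en {Y A : Finset V} {b : V} (hA : A ⊆ Y) (hb : b ∉ Y) : en (cl G Y b) A = en G A := by
  have := cl_ee2 (G := G) hA hA hb
  rw [ee_self, ee_self] at this; omega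

lemma cl_acy {Y A : Finset V} {b : V} (hA : A ⊆ Y) (hb : b ∉ Y) : AcyOn (cl G Y b) A ↔ AcyOn G A := by
  rw [acyOn_iff, acyOn_iff]
  constructor
  · intro h B hB hne; rw [← cl_en (hB.trans hA) hb]; exact h B hB hne
  · intro h B hB hne; rw [cl_en (hB.trans hA) hb]; exact h B hB hne

lemma MC.Qp (h : MC g G) {Y : Finset V} (hd : dd G Y = 2) (hc2 : 2 ≤ (Finset.univ \ Y).card) (hns : NS g G Y) (hcy : ¬ AcyOn G Y) :
    wt g G Y ≤ -1 ∧ (9 ≤ Y.card → wt g G Y + cc g - 2 * tt g ≤ 1) := by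
  obtain ⟨b, hb⟩ : (Finset.univ \ Y).Nonempty := Finset.card_pos.1 (by omega)
  replace hb : b ∉ Y := by simpa using hb
  have h2 : 2 < Y.card := by
    by_contra hc
    exact hcy (hns Y subset_rfl (by rcases h.hg with rfl | rfl <;> omega))
  have hne : Y.Nonempty := Finset.card_pos.1 (by omega)
  have hcut : ∀ u ∈ Y, ee G {u} (Finset.univ \ Y) ≤ 1 := fun u hu => h.cut_le hd (by omega) hu
  set X := cl G Y b with hX
  have hYu : Y ≠ Finset.univ := fun k => hb (k ▸ Finset.mem_univ b)
  have hsplit : ∀ Z ⊆ Y, Z.Nonempty → 2 ≤ ee X Z (insert b Y \ Z) := by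
    intro Z hZ hZn
    have e1 : insert b Y \ Z = insert b (Y \ Z) := Finset.insert_sdiff_of_notMem _ (fun k => hb (hZ k))
    rw [e1, ee_insert_right (by simp [hb]), cl_ee hZ hb hcut, cl_ee2 hZ Finset.sdiff_subset hb]
    have := h.dd_ge hZn (fun k => hYu (Finset.univ_subset_iff.1 (k ▸ hZ)))
    have e2 := dd_eq (G := G) Z
    rw [ee_univ_sdiff Z Y] at e2
    have e3 := ee_sdiff_right (X := G) (A := Z) hZ
    rw [ee_self] at e3
    omega
  have hec : EC2 X (insert b Y) := by
    intro Z hZ hZn hZne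
    by_cases hbZ : b ∈ Z
    · have h3 : insert b Y \ Z ⊆ Y := by
        intro x hx
        simp at hx
        rcases hx with ⟨rfl | hx, k⟩
        · exact absurd hbZ k
        · exact hx
      have h4 := hsplit _ h3 (Finset.sdiff_nonempty.2 fun k => hZne (Finset.Subset.antisymm hZ k))
      rw [Finset.sdiff_sdiff_eq_self hZ, ee_comm] at h4
      exact h4
    · exact hsplit Z (fun x hx => by
        rcases Finset.mem_insert.1 (hZ hx) with rfl | k
        · exact absurd hx hbZ
        · exact k) hZn
  have hcard : (insert b Y).card = Y.card + 1 := Finset.card_insert_of_notMem hb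
  have hun : insert b Y ≠ Finset.univ := by
    intro k
    have e1 := Finset.card_sdiff_of_subset (Finset.subset_univ Y)
    rw [k] at hcard
    omega
  have hdb : ee X {b} Y = 2 := by rw [ee_comm, cl_ee subset_rfl hb hcut]; exact hd
  have hdeg : ∀ v ∈ insert b Y, ee X {v} (insert b Y) ≤ 3 := by
    intro v hv
    rw [ee_insert_right hb]
    rcases Finset.mem_insert.1 hv with rfl | hv
    · rw [ee_single, ad_self, hdb]; omega
    · rw [cl_ee (by simpa using hv) hb hcut, cl_ee2 (by simpa using hv) subset_rfl hb]
      have := h.deg v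
      rw [ee_univ_sdiff {v} Y] at this; omega
  have hnd : ND g X (insert b Y) := by
    have hb' : ∀ A ⊆ insert b Y, A.card < g → ¬ AcyOn X A → b ∈ A := by
      intro A hA hc hn
      by_contra hbA
      have hAY : A ⊆ Y := fun x hx => by
        rcases Finset.mem_insert.1 (hA hx) with rfl | k
        · exact absurd hx hbA
        · exact k
      exact hn ((cl_acy hAY hb).2 (hns A hAY hc))
    intro A hA B hB a1 b1 a2 b2 hdis
    exact Finset.disjoint_left.1 hdis (hb' A hA a1 a2) (hb' B hB b1 b2)
  have hen : en X (insert b Y) = en G Y + 2 := by rw [en_insert hb, hdb, cl_en subset_rfl hb]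
  have hfv : fv G Y + 1 ≤ fv X (insert b Y) := by
    by_contra hcon
    obtain ⟨S, s1, s2, s3⟩ := fv_exists X (insert b Y)
    have hYS : AcyOn G (Y \ S) := (cl_acy Finset.sdiff_subset hb).1 (s2.mono (Finset.sdiff_subset_sdiff (Finset.subset_insert _ _) subset_rfl))
    have hbS : b ∉ S := by
      intro k
      have : fv G Y ≤ (S.erase b).card := fv_le (by
        convert hYS using 1
        ext x; simp only [Finset.mem_sdiff, Finset.mem_erase]
        constructor
        · rintro ⟨a, c⟩; exact ⟨a, fun hh => c ⟨fun e => hb (e ▸ a), hh⟩⟩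
        · rintro ⟨a, c⟩; exact ⟨a, fun hh => c hh.2⟩)
      rw [Finset.card_erase_of_mem k] at this
      have := Finset.card_pos.2 ⟨b, k⟩
      omega
    refine h.lemI hne hd ?_
    obtain ⟨T, t1, t2, t3⟩ := fv_exists G (Finset.univ \ Y)
    have hfin : AcyOn G (Finset.univ \ (S ∪ T)) := by
      rw [acyOn_iff]
      intro B hB hBn
      have hsp : B = (B ∩ Y) ∪ (B \ Y) := by rw [Finset.union_comm, Finset.sdiff_union_inter]
      have hds : Disjoint (B ∩ Y) (B \ Y) := (Finset.disjoint_sdiff_inter B Y).symm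
      have k1 := en_union (X := G) hds
      have k2 := Finset.card_union_of_disjoint hds
      rw [← hsp] at k1 k2
      have m1 : B ∩ Y ⊆ Y \ S := by
        intro x hx
        have hx' := Finset.mem_inter.1 hx
        have := hB hx'.1
        simp at this ⊢
        exact ⟨hx'.2, this.1⟩
      have m2 : B \ Y ⊆ (Finset.univ \ Y) \ T := by
        intro x hx
        have hx' := Finset.mem_sdiff.1 hx
        have := hB hx'.1
        simp at this ⊢
        exact ⟨hx'.2, this.2⟩
      rw [acyOn_iff] at t2
      by_cases e1 : (B ∩ Y).Nonempty
      · have k3 : ee G (B ∩ Y) (B \ Y) ≤ ee X (B ∩ Y) {b} := by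
          rw [cl_ee Finset.inter_subset_right hb hcut]
          exact ee_mono subset_rfl (Finset.sdiff_subset_sdiff (Finset.subset_univ _) subset_rfl)
        have hbB : b ∉ B ∩ Y := fun k => hb (Finset.mem_inter.1 k).2
        have k4 := en_insert (X := X) hbB
        rw [ee_comm, cl_en Finset.inter_subset_right hb] at k4
        rw [acyOn_iff] at s2
        have k5 := s2 (insert b (B ∩ Y)) (by
          intro x hx
          rcases Finset.mem_insert.1 hx with rfl | hx
          · simp [hbS]
          · have := m1 hx; simp at this ⊢; exact ⟨Or.inr this.1, this.2⟩) (Finset.insert_nonempty _ _)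
        rw [Finset.card_insert_of_notMem hbB] at k5
        by_cases e2 : (B \ Y).Nonempty
        · have := t2 _ m2 e2
          omega
        · rw [Finset.not_nonempty_iff_eq_empty] at e2
          rw [acyOn_iff] at hYS
          have := hYS _ m1 e1
          rw [e2] at k1 k2
          have e3 : en G (∅ : Finset V) = 0 := by have := ee_self (X := G) ∅; simp at this; omega
          simp at k1 k2
          omega
      · rw [Finset.not_nonempty_iff_eq_empty] at e1
        have e3 : en G (∅ : Finset V) = 0 := by have := ee_self (X := G) ∅; simp at this; omega
        rw [e1] at k1 k2
        have e4 : (B \ Y).Nonempty := by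
          rw [e1, Finset.empty_union] at hsp
          rw [← hsp]; exact hBn
        have := t2 _ m2 e4
        simp at k1 k2
        omega
    have := fv_le hfin
    have := Finset.card_union_le S T
    omega
  have hww : wt g G Y + cc g - 2 * tt g ≤ wt g X (insert b Y) := by
    unfold wt; rw [hen]
    rcases h.tt_pos with ⟨_, e1, e2⟩ | ⟨_, e1, e2⟩ <;> rw [e1, e2] <;> push_cast <;> omega
  have hdef : 2 * en X (insert b Y) + 1 ≤ 3 * (insert b Y).card := by
    have := h.dd_cnt Y
    rw [hen, hcard]
    omega
  have h4 : g = 5 → Y.card ≠ 4 := fun e1 e2 => hcy (hns Y subset_rfl (by omega))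
  rcases h.min' hun hec (by omega) hdeg hnd with k | ⟨i, j, hf, hw⟩ | k
  · rcases h.tt_pos with ⟨_, e1, e2⟩ | ⟨_, e1, e2⟩ <;> rw [e1, e2] at hww ⊢ <;> omega
  · have cts := hf.counts
    rcases h.tt_pos with ⟨_, e1, e2⟩ | ⟨h5, e1, e2⟩ <;> rw [e1, e2] at hww hw ⊢
    · constructor
      · omega
      · omega
    · have := h4 h5
      constructor
      · omega
      · omega
  · rcases h.tt_pos with ⟨_, e1, e2⟩ | ⟨_, e1, e2⟩ <;> rw [e1, e2] at hww ⊢ <;> omega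

/-- weight of a side of a 2-edge cut without short cycles -/
lemma MC.Qp0 (h : MC g G) {Y : Finset V} (hd : dd G Y = 2) (hc2 : 2 ≤ (Finset.univ \ Y).card) (hns : NS g G Y) : wt g G Y ≤ 0 := by
  by_cases k : AcyOn G Y
  · rw [wt_acy k]
    rcases h.tt_pos with ⟨_, e1, e2⟩ | ⟨h5, e1, e2⟩ <;> rw [e1] <;> omega
  · have := (h.Qp hd hc2 hns k).1; omega

end

def N3 {V : Type} (G : SimpleGraph V) (v x y z : V) : Prop :=
  x ≠ y ∧ x ≠ z ∧ y ≠ z ∧ ∀ w, G.Adj v w ↔ w = x ∨ w = y ∨ w = z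

section
set_option linter.all false
open scoped Classical
variable {V : Type} [Fintype V] {X G : SimpleGraph V} {g : ℕ}

lemma N3.deg {v x y z : V} (h : N3 G v x y z) (P : Finset V) :
    ee G {v} P = (if x ∈ P then 1 else 0) + (if y ∈ P then 1 else 0) + (if z ∈ P then 1 else 0) := by
  obtain ⟨h1, h2, h3, h4⟩ := h
  rw [ee_single_card]
  have : P.filter (fun w => G.Adj v w) = ({x, y, z} : Finset V).filter (fun w => w ∈ P) := by
    ext w; simp [h4, and_comm]
  rw [this, Finset.card_filter, Finset.sum_insert (by simp [h1, h2]), Finset.sum_insert (by simp [h3]), Finset.sum_singleton]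
  ring

lemma N3.deg3 {v x y z : V} (h : N3 G v x y z) : ee G {v} Finset.univ = 3 := by rw [h.deg]; simp

lemma N3.dd {v x y z : V} (h : N3 G v x y z) : dd G {v} = 3 := by
  have := dd_eq (G := G) {v}
  rw [h.deg3, en_single] at this
  omega

lemma N3.rot {v x y z : V} (h : N3 G v x y z) : N3 G v y z x :=
  ⟨h.2.2.1, h.1.symm, h.2.1.symm, fun w => by rw [h.2.2.2]; tauto⟩
lemma N3.swap {v x y z : V} (h : N3 G v x y z) : N3 G v y x z :=
  ⟨h.1.symm, h.2.2.1, h.2.1, fun w => by rw [h.2.2.2]; tauto⟩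
lemma N3.swap' {v x y z : V} (h : N3 G v x y z) : N3 G v x z y :=
  ⟨h.2.1, h.1, h.2.2.1.symm, fun w => by rw [h.2.2.2]; tauto⟩

lemma N3.a {v x y z : V} (h : N3 G v x y z) : G.Adj v x := (h.2.2.2 x).2 (Or.inl rfl)
lemma N3.b {v x y z : V} (h : N3 G v x y z) : G.Adj v y := (h.2.2.2 y).2 (Or.inr (Or.inl rfl))
lemma N3.c {v x y z : V} (h : N3 G v x y z) : G.Adj v z := (h.2.2.2 z).2 (Or.inr (Or.inr rfl))

lemma exN3 {v x y : V} (hd : ee G {v} Finset.univ = 3) (hx : G.Adj v x) (hy : G.Adj v y) (hxy : x ≠ y) : ∃ z, N3 G v x y z := by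
  obtain ⟨a, b, h1, h2, h3, -, -, h4, h5, h6⟩ := nb3_of hd (Finset.mem_univ x) hx
  rcases h6 y (Finset.mem_univ y) hy with k | k | k
  · exact absurd k.symm hxy
  · subst k
    exact ⟨b, h2.symm, h3.symm, h1, fun w => ⟨fun k => h6 w (Finset.mem_univ w) k, by rintro (rfl | rfl | rfl) <;> assumption⟩⟩
  · subst k
    exact ⟨a, h3.symm, h2.symm, h1.symm, fun w => ⟨fun k => by rcases h6 w (Finset.mem_univ w) k with k | k | k <;> simp [k], by rintro (rfl | rfl | rfl) <;> assumption⟩⟩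

lemma MC.exY (h : MC g G) {n p q r : V} (hn : N3 G n p q r) {D : Finset V} (hnD : n ∈ D) (hpD : p ∈ D) (hqD : q ∈ D)
    (hl : ∀ U, dd G U = 2 → n ∉ U → ¬ (p ∈ U ∧ q ∈ U) → Disjoint U D) :
    ∃ Y, (Y = ∅ ∨ (r ∈ Y ∧ dd G Y = 2)) ∧ Disjoint Y D ∧ EC2 G (Finset.univ \ insert n Y) := by
  obtain ⟨Y, hY, hmax⟩ := Finset.exists_max_image
    (Finset.univ.filter (fun Y : Finset V => (Y = ∅ ∨ (r ∈ Y ∧ dd G Y = 2)) ∧ Disjoint Y D)) Finset.card ⟨∅, by simp⟩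
  simp only [Finset.mem_filter, Finset.mem_univ, true_and] at hY hmax
  refine ⟨Y, hY.1, hY.2, ?_⟩
  obtain ⟨hY1, hYD⟩ := hY
  have hdis := Finset.disjoint_left.1 hYD
  have hnY : n ∉ Y := fun k => hdis k hnD
  have hpY : p ∉ Y := fun k => hdis k hpD
  have hqY : q ∉ Y := fun k => hdis k hqD
  set P0 := Finset.univ \ insert n Y with hP0
  have hddP : dd G P0 = 3 := by
    rw [hP0, dd_compl]
    rcases hY1 with rfl | ⟨hr, hd⟩
    · rw [insert_empty_eq]; exact hn.dd
    · have := dd_split (G := G) (Z := {n}) (Z' := Y) (by simpa using hnY)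
      rw [hn.dd, hd, hn.deg, if_neg hpY, if_neg hqY, if_pos hr, ← Finset.insert_eq] at this
      omega
  have key : ∀ U ⊆ P0, U.Nonempty → dd G U = 2 → ee G U (P0 \ U) = 1 → False := by
    intro U hU hne hd he
    have hUd : Disjoint U (insert n Y) := by
      rw [Finset.disjoint_left]; intro x hx hx'
      have := hU hx
      rw [hP0] at this
      exact (Finset.mem_sdiff.1 this).2 hx'
    have hnU : n ∉ U := fun k => Finset.disjoint_left.1 hUd k (by simp)
    have hUY : Disjoint U Y := hUd.mono_right (Finset.subset_insert _ _)
    have e1 : ee G U (insert n Y) = 1 := by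
      have h1 : insert n Y ⊆ Finset.univ \ U := by
        intro x hx; simp; exact fun k => Finset.disjoint_left.1 hUd k hx
      have h2 := ee_sdiff_right (X := G) (A := U) h1
      have h3 : (Finset.univ \ U) \ insert n Y = P0 \ U := by
        ext x; simp [hP0]; tauto
      rw [h3, he] at h2
      unfold dd at hd
      omega
    rw [ee_insert_right hnY, ee_comm U {n}, hn.deg] at e1
    have hpq : ¬ (p ∈ U ∧ q ∈ U) := by
      rintro ⟨k1, k2⟩
      rw [if_pos k1, if_pos k2] at e1; omega
    have hUD := hl U hd hnU hpq
    have hpU : p ∉ U := fun k => Finset.disjoint_left.1 hUD k hpD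
    have hqU : q ∉ U := fun k => Finset.disjoint_left.1 hUD k hqD
    rw [if_neg hpU, if_neg hqU] at e1
    have hlt : Y.card < (Y ∪ U).card := by
      rw [Finset.card_union_of_disjoint hUY.symm]
      have := hne.card_pos
      omega
    refine absurd (hmax (Y ∪ U) ⟨Or.inr ?_, Finset.disjoint_union_left.2 ⟨hYD, hUD⟩⟩) (by omega)
    rcases hY1 with rfl | ⟨hr, hdY⟩
    · have hrU : r ∈ U := by
        by_contra k
        rw [if_neg k] at e1; simp at e1
      simp [hrU, hd]
    · refine ⟨by simp [hr], ?_⟩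
      have h1 := dd_split (G := G) hUY.symm
      rw [if_neg (fun k => Finset.disjoint_left.1 hUY k hr), ee_comm] at e1
      omega
  by_contra hne
  obtain ⟨Z, hZ, z1, z2, z3⟩ := not_ec2 hne
  have hP0u : P0 ≠ Finset.univ := by
    intro k; have : n ∈ P0 := by rw [k]; simp
    simp [hP0] at this
  have hz2 : (P0 \ Z).Nonempty := by
    rw [Finset.sdiff_nonempty]; exact fun k => z2 (hZ.antisymm k)
  have h1 := dd_split (G := G) (Z := Z) (Z' := P0 \ Z) Finset.disjoint_sdiff
  rw [Finset.union_sdiff_of_subset hZ, hddP] at h1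
  have h2 := h.dd_ge z1 (fun k => hP0u (Finset.univ_subset_iff.1 (k ▸ hZ)))
  have h3 := h.dd_ge hz2 (fun k => hP0u (Finset.univ_subset_iff.1 (k ▸ Finset.sdiff_subset)))
  have he : ee G Z (P0 \ Z) = 1 := by omega
  have h4 : dd G Z = 2 ∨ dd G (P0 \ Z) = 2 := by omega
  rcases h4 with h4 | h4
  · exact key Z hZ z1 h4 he
  · refine key (P0 \ Z) Finset.sdiff_subset hz2 h4 ?_
    rw [Finset.sdiff_sdiff_eq_self hZ, ee_comm]; exact he

lemma MC.wt_del (h : MC g G) (n : V) : wt g G Finset.univ ≤ cc g - tt g * ee G {n} Finset.univ + wt g G (Finset.univ.erase n) := by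
  have h1 := en_erase (X := G) (Finset.mem_univ n)
  obtain ⟨S, s1, s2, s3⟩ := fv_exists G (Finset.univ.erase n)
  have h2 : fv G Finset.univ ≤ (insert n S).card := by
    apply fv_le
    convert s2 using 1
    ext x; simp
  have h3 := Finset.card_insert_le n S
  unfold wt
  rw [h1]
  push_cast
  rcases h.tt_pos with ⟨_, e1, e2⟩ | ⟨_, e1, e2⟩ <;> rw [e1, e2] <;> omega

end

section
set_option linter.all false
open scoped Classical
variable {V : Type} [Fintype V] {X G : SimpleGraph V} {g : ℕ}

lemma leg1 {P : Finset V} {n y t : V} {i j : ℕ} (hF : FF (i + 2) j X P) (hn : n ∉ P) (hy : y ∉ P) (hny : n ≠ y)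
    (hn2 : ee X {n} P = 2) (h2 : ∀ v ∈ P, X.Adj n v → ee X {v} P = 2) (yn : X.Adj y n) (yt : X.Adj y t) (ht : t ∈ P)
    (ho : ∀ v ∈ P, X.Adj y v → v = t) (hnt : ¬ X.Adj n t) (ht2 : ee X {t} P = 2) :
    FF (i + 1) (j + 1) X (insert y (insert n P)) := by
  have hs : Sup X (insert y (insert n P)) y n t := by
    refine ⟨by simp, by simp, by simp [ht], fun k => hn (k ▸ ht), yn, yt, hnt, ?_⟩
    intro v hv k
    simp only [Finset.mem_insert] at hv
    rcases hv with rfl | rfl | hv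
    · exact absurd k (X.irrefl)
    · exact Or.inl rfl
    · exact Or.inr (ho v hv k)
  have hnt' : n ≠ t := fun k => hn (k ▸ ht)
  have hag : ∀ u ∈ P, ∀ v ∈ P, (addE X n t).Adj u v ↔ X.Adj u v := by
    intro u hu v hv
    rw [addE_adj]
    constructor
    · rintro (k | ⟨_, ⟨rfl, rfl⟩ | ⟨rfl, rfl⟩⟩)
      · exact k
      · exact absurd hu hn
      · exact absurd hv hn
    · exact Or.inl
  have hee : ∀ v ∈ P, ee (addE X n t) {v} P = ee X {v} P := fun v hv =>
    ee_congr_graph (fun a ha b hb => hag a (by simp at ha; rwa [ha]) b hb)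
  refine FF.sub hs ?_
  rw [Finset.erase_insert (by simp [hy, Ne.symm hny])]
  refine FF.apex (n := n) (by simp) ?_ ?_ ?_
  · rw [Finset.erase_insert hn, ee_addE hnt' hnt]
    simp [hn2, ht, hn, hnt']
  · rw [Finset.erase_insert hn]
    intro v hv k
    rw [hee v hv]
    rcases addE_adj.1 k with k | ⟨_, ⟨_, rfl⟩ | ⟨rfl, _⟩⟩
    · exact h2 v hv k
    · exact ht2
    · exact absurd ht hn
  · rw [Finset.erase_insert hn]
    exact hF.congr hag

lemma leg2 {P : Finset V} {n y y2 t : V} {i j : ℕ} (hF : FF (i + 2) j X P) (hn : n ∉ P) (hy : y ∉ P) (hny : n ≠ y) (hy2 : y2 ∉ P)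
    (hny2 : n ≠ y2) (hyy2 : y ≠ y2)
    (hn2 : ee X {n} P = 2) (h2 : ∀ v ∈ P, X.Adj n v → ee X {v} P = 2) (yn : X.Adj y n) (yy : X.Adj y y2) (hnyy : ¬ X.Adj n y2)
    (yt : X.Adj y2 t) (ht : t ∈ P) (ho1 : ∀ v ∈ P, ¬ X.Adj y v)
    (ho : ∀ v ∈ P, X.Adj y2 v → v = t) (hnt : ¬ X.Adj n t) (ht2 : ee X {t} P = 2) :
    FF (i + 2) (j + 1) X (insert y (insert y2 (insert n P))) := by
  have hs : Sup X (insert y (insert y2 (insert n P))) y n y2 := by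
    refine ⟨by simp, by simp, by simp, hny2, yn, yy, hnyy, ?_⟩
    intro v hv k
    simp only [Finset.mem_insert] at hv
    rcases hv with rfl | rfl | rfl | hv
    · exact absurd k (X.irrefl)
    · exact Or.inr rfl
    · exact Or.inl rfl
    · exact absurd k (ho1 v hv)
  have hag : ∀ u ∈ P, ∀ v, (addE X n y2).Adj u v ↔ X.Adj u v := by
    intro u hu v
    rw [addE_adj]
    constructor
    · rintro (k | ⟨_, ⟨rfl, rfl⟩ | ⟨rfl, rfl⟩⟩)
      · exact k
      · exact absurd hu hn
      · exact absurd hu hy2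
    · exact Or.inl
  have hee : ∀ v ∈ P, ee (addE X n y2) {v} P = ee X {v} P := fun v hv =>
    ee_congr_graph (fun a ha b hb => hag a (by simp at ha; rwa [ha]) b)
  refine FF.sub hs ?_
  rw [Finset.erase_insert (by simp [hy, Ne.symm hny, hyy2])]
  refine leg1 (t := t) (hF.congr (fun u hu v _ => hag u hu v)) hn hy2 hny2 ?_ ?_ ?_ ?_ ht ?_ ?_ ?_
  · rw [ee_comm, ee_congr_graph (fun a ha b hb => hag a ha b), ee_comm, hn2]
  · intro v hv k
    rw [hee v hv]
    exact h2 v hv ((hag v hv n).1 k.symm).symm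
  · rw [addE_adj]; right; exact ⟨hny2.symm, Or.inr ⟨rfl, rfl⟩⟩
  · exact Or.inl yt
  · intro v hv k
    exact ho v hv ((hag v hv y2).1 k.symm).symm
  · exact fun k => hnt ((hag t ht n).1 k.symm).symm
  · rw [hee t ht, ht2]

end

section
set_option linter.all false
open scoped Classical
variable {V : Type} [Fintype V] {X G : SimpleGraph V} {g : ℕ}

lemma cset1 (n y : V) : Finset.univ = insert y (insert n (Finset.univ \ insert n {y})) := by
  ext x; simp; tauto
lemma cset2 (n r y : V) : Finset.univ = insert r (insert y (insert n (Finset.univ \ insert n {r, y}))) := by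
  ext x; simp; tauto
lemma cset3 {n : V} {Y : Finset V} (h : n ∉ Y) : Finset.univ \ Y = insert n (Finset.univ \ insert n Y) := by
  ext x; by_cases k : x = n
  · subst k; simp [h]
  · simp [k]
lemma cset4 {n : V} {Y : Finset V} (h : n ∉ Y) : Finset.univ.erase n = Y ∪ (Finset.univ \ insert n Y) := by
  ext x; by_cases k : x = n
  · subst k; simp [h]
  · simp [k]; tauto

lemma EC2.deg {P : Finset V} (h : EC2 X P) {v w : V} (hv : v ∈ P) (hw : w ∈ P) (hvw : v ≠ w) : 2 ≤ ee X {v} P := by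
  have h1 := h {v} (by simpa using hv) (by simp) (by rintro rfl; simp at hw; exact hvw hw.symm)
  exact h1.trans (ee_mono subset_rfl Finset.sdiff_subset)

lemma def_pos {P : Finset V} (hd : ∀ v ∈ P, ee X {v} P ≤ 3) {r : V} (hr : r ∈ P) (h2 : ee X {r} P ≤ 2) : 2 * en X P < 3 * P.card := by
  have h1 := ee_insert_left (X := X) (C := P) (Finset.notMem_erase r P)
  rw [Finset.insert_erase hr, ee_self] at h1
  have h3 : ee X (P.erase r) P ≤ 3 * (P.erase r).card := by
    rw [ee_sum_left]
    refine (Finset.sum_le_card_nsmul _ _ 3 (fun v hv => hd v (Finset.mem_of_mem_erase hv))).trans (by simp [mul_comm])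
  rw [Finset.card_erase_of_mem hr] at h3
  have := Finset.card_pos.2 ⟨r, hr⟩
  omega

lemma MC.deg2 (h : MC g G) (v : V) : 2 ≤ ee G {v} Finset.univ := by
  have h1 := dd_eq (G := G) {v}
  have h2 := h.dd_ge (Y := {v}) (by simp) (by
    intro k
    have := congrArg Finset.card k
    rw [Finset.card_singleton, Finset.card_univ] at this
    have := h.card
    omega)
  omega

set_option maxHeartbeats 600000 in
lemma MC.common (h : MC g G) {n p q r : V} (hn : N3 G n p q r) {Y P0 : Finset V} (hY : Y = ∅ ∨ (r ∈ Y ∧ dd G Y = 2))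
    (hnY : n ∉ Y) (hpY : p ∉ Y) (hqY : q ∉ Y) (hP0 : P0 = Finset.univ \ insert n Y) (hns : NS g G Y) (hec : EC2 G P0)
    {a b c d : V} (s1 : Sup G P0 p a b) (s2 : Sup (addE G a b) (P0.erase p) q c d)
    (hnd : ND g (addE (addE G a b) c d) ((P0.erase p).erase q)) :
    g = 5 ∧ ((Y = ∅ ∧ ∃ k, MemFG 5 3 0 k ((addE (addE G a b) c d).induce (((P0.erase p).erase q : Finset V) : Set V)) ∧
        3 * ((P0.erase p).erase q).card = 2 * en (addE (addE G a b) c d) ((P0.erase p).erase q) + 1) ∨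
      (((P0.erase p).erase q).card = 5 ∧ 2 ≤ fv (addE (addE G a b) c d) ((P0.erase p).erase q))) := by
  set X' := addE (addE G a b) c d with hX'
  set P' := (P0.erase p).erase q with hP'
  have hnP : n ∉ P0 := by simp [hP0]
  have hYP : Disjoint Y P0 := by
    rw [Finset.disjoint_left, hP0]; intro x hx; simp [hx]
  have hpP := s1.hz
  have hqP : q ∈ P0 := Finset.mem_of_mem_erase s2.hz
  have hpq := hn.1
  have ec' : EC2 X' P' := s2.ec2 (s1.ec2 hec)
  have hcP' : c ∈ P' := Finset.mem_erase.2 ⟨s2.ne_za, s2.ha⟩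
  have hdP' : d ∈ P' := Finset.mem_erase.2 ⟨s2.ne_zb, s2.hb⟩
  have hc2 : 2 ≤ P'.card := Finset.one_lt_card.2 ⟨c, hcP', d, hdP', s2.hab⟩
  have hdeg : ∀ v ∈ P', ee X' {v} P' = ee G {v} P0 := by
    intro v hv
    simp only [hP', Finset.mem_erase] at hv
    rw [hX', hP', s2.deg (Finset.mem_erase.2 ⟨hv.2.1, hv.2.2⟩) hv.1, s1.deg hv.2.2 hv.2.1]
  have hdeg3 : ∀ v ∈ P', ee X' {v} P' ≤ 3 := fun v hv => by rw [hdeg v hv]; exact h.degP _ _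
  have hP'u : P' ≠ Finset.univ := by
    intro k
    have : n ∈ P' := by rw [k]; simp
    simp only [hP', Finset.mem_erase] at this
    exact hnP this.2.2
  have hw0 : wt g G P0 ≤ wt g X' P' - 2 * tt g := by
    have e1 := s1.wt h
    have e2 := s2.wt h
    linarith
  have hp2 : ee G {p} P0 = 2 := by rw [s1.ee_z subset_rfl, if_pos s1.ha, if_pos s1.hb]
  have hq2 : ee G {q} P0 = 2 := by
    rw [← s1.deg hqP hpq.symm, s2.ee_z subset_rfl, if_pos s2.ha, if_pos s2.hb]
  have hge : ∀ v ∈ P0, 2 ≤ ee G {v} P0 := by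
    intro v hv
    by_cases k : v = p
    · subst k; omega
    · exact hec.deg hv hpP k
  have hsplit : ∀ v, ee G {v} Finset.univ = ad G v n + ee G {v} Y + ee G {v} P0 := by
    intro v
    have h1 : (Finset.univ : Finset V) = insert n Y ∪ P0 := by rw [hP0, Finset.union_sdiff_of_subset (Finset.subset_univ _)]
    rw [h1, ee_union_right (by rw [hP0]; exact Finset.disjoint_sdiff), ee_insert_right hnY, ee_single]
  have hdelw := h.wt_del n
  rw [hn.deg3] at hdelw
  have hpos := h.pos
  have mkF : ∀ i j, FF i j X' P' → FF (i + 2) j G P0 := fun i j hf => FF.sub s1 (FF.sub s2 hf)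
  rcases hY with rfl | ⟨hr, hdY⟩
  · have hP0e : P0 = Finset.univ.erase n := by rw [hP0]; ext x; simp
    have hrP : r ∈ P0 := by rw [hP0e]; simp; exact (hn.c.ne')
    have hr2 : ee G {r} P0 = 2 := by
      have h1 := hsplit r
      have h2 := h.deg r
      have h3 := hge r hrP
      rw [ad_eq_one hn.c.symm] at h1
      omega
    have hrP' : r ∈ P' := by simp [hP', hrP, hn.2.1.symm, hn.2.2.1.symm]
    rw [← hP0e] at hdelw
    rcases h.min' hP'u ec' hc2 hdeg3 hnd with k | ⟨i, j, hf, _⟩ | ⟨k1, k2⟩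
    · exfalso
      rcases h.tt_pos with ⟨_, e1, e2⟩ | ⟨_, e1, e2⟩ <;> rw [e1, e2] at hdelw <;> rw [e1] at hw0 <;> omega
    · exfalso
      refine h.nF i (j + 1) (FF.apex (n := n) (Finset.mem_univ n) ?_ ?_ ?_)
      · rw [← ee_erase_self (Finset.mem_univ n)]; exact hn.deg3
      · rw [← hP0e]
        intro v hv k
        rcases (hn.2.2.2 v).1 k with rfl | rfl | rfl <;> assumption
      · rw [← hP0e]; exact mkF i j hf
    · have h5 : g = 5 := by
        rcases h.tt_pos with ⟨_, e1, e2⟩ | ⟨h5, e1, e2⟩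
        · exfalso
          rw [e1, e2] at hdelw; rw [e1] at hw0; omega
        · exact h5
      subst h5
      exact ⟨rfl, Or.inl ⟨rfl, k2 (def_pos hdeg3 hrP' (by rw [hdeg r hrP', hr2]))⟩⟩
  · have eYn : ee G Y {n} = 1 := by rw [ee_comm, hn.deg, if_neg hpY, if_neg hqY, if_pos hr]
    have eYP : ee G Y P0 = 1 := by
      have h1 : Finset.univ \ Y = insert n P0 := by
        rw [hP0]; exact cset3 hnY
      have h2 := hdY
      unfold dd at h2
      rw [h1, ee_insert_right hnP] at h2
      omega
    have hun : Finset.univ.erase n = Y ∪ P0 := by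
      rw [hP0]; exact cset4 hnY
    have hw1 := wt_union h hYP (fv_union_le (X := G) hYP (by omega))
    rw [← hun, eYP] at hw1
    obtain ⟨y, hy, t, ht, hyt⟩ := ee_pos.1 (show 0 < ee G Y P0 by omega)
    have hty : 1 ≤ ee G {t} Y := ee_pos.2 ⟨t, by simp, y, hy, hyt.symm⟩
    have ht2 : ee G {t} P0 = 2 := by
      have h1 := hsplit t
      have h2 := h.deg t
      have h3 := hge t ht
      omega
    have hnt : ¬ G.Adj n t := by
      intro k
      have h1 := hsplit t
      have h2 := h.deg t
      rw [ad_eq_one k.symm] at h1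
      omega
    have htP' : t ∈ P' := by
      simp only [hP', Finset.mem_erase]
      exact ⟨fun k => hnt (k ▸ hn.b), fun k => hnt (k ▸ hn.a), ht⟩
    have hdef := def_pos hdeg3 htP' (by rw [hdeg t htP', ht2])
    by_cases hac : AcyOn G Y
    · exfalso
      rw [wt_acy hac] at hw1
      obtain ⟨i, j, hf, hw⟩ := h.red hP'u ec' hc2 hdeg3 hnd (by
        rcases h.tt_pos with ⟨_, e1, e2⟩ | ⟨_, e1, e2⟩ <;> rw [e1, e2] at hdelw <;> rw [e1] at hw0 hw1 <;> omega)
      obtain ⟨f1, f2, -, f4⟩ := hf.counts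
      have hi : 2 ≤ i := by
        by_contra k
        have : j = 0 := by omega
        have := f4 this
        omega
      have hen : en G Y ≤ 1 := by
        rcases h.tt_pos with ⟨_, e1, e2⟩ | ⟨_, e1, e2⟩ <;> rw [e1, e2] at hdelw hw <;> rw [e1] at hw0 hw1 <;> omega
      have hY2 : Y.card ≤ en G Y + 1 := by
        have h1 := dd_eq (G := G) Y
        have h2 : 2 * Y.card ≤ ee G Y Finset.univ := by
          rw [ee_sum_left]
          have := Finset.card_nsmul_le_sum Y (fun v => ee G {v} Finset.univ) 2 (fun v hv => h.deg2 v)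
          simpa [mul_comm] using this
        omega
      have hen2 := (acyOn_iff.1 hac) Y subset_rfl ⟨r, hr⟩
      have hf0 := mkF i j hf
      have hrP : r ∉ P0 := fun k => Finset.disjoint_left.1 hYP hr k
      have hn2 : ee G {n} P0 = 2 := by
        rw [hn.deg, if_pos hpP, if_pos hqP, if_neg hrP]
      have hnb : ∀ v ∈ P0, G.Adj n v → ee G {v} P0 = 2 := by
        intro v hv k
        rcases (hn.2.2.2 v).1 k with rfl | rfl | rfl
        · exact hp2
        · exact hq2
        · exact absurd hv hrP
      have huq : ∀ u ∈ Y, ∀ v ∈ P0, G.Adj u v → u = y ∧ v = t := by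
        intro u hu v hv k
        exact uniq_of_ee eYP.le hu hv k hy ht hyt
      rcases (show Y.card = 1 ∨ Y.card = 2 by omega) with h1 | h1
      · obtain ⟨r', hr'⟩ := Finset.card_eq_one.1 h1
        have : r' = r := by rw [hr'] at hr; exact (Finset.mem_singleton.1 hr).symm
        subst this
        have hyr : y = r' := by rw [hr'] at hy; simpa using hy
        subst hyr
        have := leg1 hf0 hnP hrP hn.c.ne hn2 hnb hn.c.symm hyt ht (fun v hv k => (huq _ hr v hv k).2) hnt ht2
        refine h.nF _ _ (?_ : FF (i + 1) (j + 1) G Finset.univ)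
        convert this
        rw [hP0, hr']; exact cset1 n y
      · obtain ⟨y2, hy2⟩ : ∃ y2, Y = {r, y2} ∧ r ≠ y2 := by
          obtain ⟨u, v, huv, e⟩ := Finset.card_eq_two.1 h1
          rw [e] at hr
          simp at hr
          rcases hr with rfl | rfl
          · exact ⟨v, e, huv⟩
          · exact ⟨u, by rw [e, Finset.pair_comm], huv.symm⟩
        obtain ⟨hYe, hry⟩ := hy2
        have hy2Y : y2 ∈ Y := by rw [hYe]; simp
        have hy2P : y2 ∉ P0 := fun k => Finset.disjoint_left.1 hYP hy2Y k
        have hry2 : G.Adj r y2 := by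
          have : en G Y = 1 := by omega
          rw [hYe, en_pair hry] at this
          exact ad_pos.1 (by omega)
        have hny2 : ¬ G.Adj n y2 := by
          intro k
          rcases (hn.2.2.2 y2).1 k with rfl | rfl | rfl
          · exact hpY hy2Y
          · exact hqY hy2Y
          · exact hry rfl
        have hyr : y ≠ r := by
          rintro rfl
          have d1 := hsplit y2
          have d2 := h.deg2 y2
          rw [ad_eq_zero (fun k => hny2 k.symm), hYe, ee_insert_right (by simpa using hry), ee_single, ee_single, ad_self] at d1
          have d3 : ee G {y2} P0 = 0 := by
            rw [ee_eq_zero]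
            intro u hu v hv k
            simp at hu; subst hu
            exact hry (huq _ hy2Y v hv k).1.symm
          have d4 := ad_le (X := G) y2 y
          omega
        have hyy : y = y2 := by
          rw [hYe] at hy; simp at hy; exact hy.resolve_left hyr
        subst hyy
        have hnne : n ≠ y := fun k => hnY (k ▸ hy)
        have := leg2 hf0 hnP hrP hn.c.ne hy2P hnne hry hn2 hnb hn.c.symm hry2 hny2 hyt ht
          (fun v hv k => hyr (huq _ hr v hv k).1.symm) (fun v hv k => (huq _ hy v hv k).2) hnt ht2
        refine h.nF _ _ (?_ : FF (i + 2) (j + 1) G Finset.univ)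
        convert this
        rw [hP0, hYe]; exact cset2 n r y
    · have hcY : 2 ≤ (Finset.univ \ Y).card := by
        refine Finset.one_lt_card.2 ⟨p, by simp [hpY], q, by simp [hqY], hpq⟩
      have hq := (h.Qp hdY hcY hns hac).1
      obtain ⟨i, j, hf, hw⟩ := h.red hP'u ec' hc2 hdeg3 hnd (by
        rcases h.tt_pos with ⟨_, e1, e2⟩ | ⟨_, e1, e2⟩ <;> rw [e1, e2] at hdelw <;> rw [e1] at hw0 hw1 <;> omega)
      obtain ⟨f1, f2, -, f4⟩ := hf.counts
      have hi : 2 ≤ i := by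
        by_contra k
        have : j = 0 := by omega
        have := f4 this
        omega
      rcases h.tt_pos with ⟨_, e1, e2⟩ | ⟨h5, e1, e2⟩
      · exfalso
        rw [e1, e2] at hdelw hw; rw [e1] at hw0 hw1; omega
      · refine ⟨h5, Or.inr ?_⟩
        rw [e1, e2] at hdelw hw; rw [e1] at hw0 hw1
        have hi2 : i = 2 := by omega
        have hj : j = 1 := by
          by_contra k
          have : j = 0 := by omega
          have := f4 this
          omega
        subst hi2; subst hj
        refine ⟨by omega, ?_⟩
        have : (3 : ℤ) ≤ wt g X' P' := by omega
        unfold wt at this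
        rw [e1, e2, f2] at this
        push_cast at this
        omega

end

section
set_option linter.all false
open scoped Classical
variable {V : Type} [Fintype V] {X G : SimpleGraph V} {g : ℕ}

lemma def_two {P : Finset V} (hd : ∀ v ∈ P, ee X {v} P ≤ 3) {r s : V} (hr : r ∈ P) (h2 : ee X {r} P ≤ 2) (hs : s ∈ P)
    (h2' : ee X {s} P ≤ 2) (hrs : s ≠ r) : 2 * en X P + 2 ≤ 3 * P.card := by
  have hs' : s ∈ P.erase r := Finset.mem_erase.2 ⟨hrs, hs⟩
  have h1 := ee_insert_left (X := X) (C := P) (Finset.notMem_erase r P)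
  have h4 := ee_insert_left (X := X) (C := P) (Finset.notMem_erase s (P.erase r))
  rw [Finset.insert_erase hr, ee_self] at h1
  rw [Finset.insert_erase hs'] at h4
  have h3 : ee X ((P.erase r).erase s) P ≤ 3 * ((P.erase r).erase s).card :=
    ee_le_of_deg (fun v hv => hd v (Finset.mem_of_mem_erase (Finset.mem_of_mem_erase hv)))
  rw [Finset.card_erase_of_mem hs', Finset.card_erase_of_mem hr] at h3
  have := Finset.card_pos.2 ⟨s, hs'⟩
  rw [Finset.card_erase_of_mem hr] at this
  omega

lemma MC.step (h : MC g G) {n p q r : V} (hn : N3 G n p q r) {D : Finset V} (hnD : n ∈ D) (hpD : p ∈ D) (hqD : q ∈ D)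
    (hD : ∀ A, Disjoint A D → NS g G A)
    (hl : ∀ U, dd G U = 2 → n ∉ U → ¬ (p ∈ U ∧ q ∈ U) → Disjoint U D) {a b c d : V}
    (mk : ∀ P0 : Finset V, EC2 G P0 → n ∉ P0 → (∀ v ∈ D, v ≠ n → v ∈ P0) →
      Sup G P0 p a b ∧ Sup (addE G a b) (P0.erase p) q c d)
    (hx : ∀ u v, u ≠ c → v ≠ c → u ≠ p → u ≠ q → v ≠ p → v ≠ q → (addE (addE G a b) c d).Adj u v → G.Adj u v)
    (hDx : ∀ v ∈ D, v = n ∨ v = p ∨ v = q ∨ v = c) :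
    g = 5 ∧ (∃ y z, (y ≠ n ∧ y ≠ p ∧ y ≠ q) ∧ (z ≠ n ∧ z ≠ p ∧ z ≠ q) ∧
      (addE (addE G a b) c d).Adj r y ∧ (addE (addE G a b) c d).Adj r z ∧ (addE (addE G a b) c d).Adj y z) ∧
      ∀ v, v ≠ n → v ≠ p → v ≠ q → v ≠ r → ee (addE (addE G a b) c d) {v} (((Finset.univ.erase n).erase p).erase q) = 3 := by
  obtain ⟨Y, hY, hYD, hec⟩ := h.exY hn hnD hpD hqD hl
  have hdis := Finset.disjoint_left.1 hYD
  have hnY : n ∉ Y := fun k => hdis k hnD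
  have hpY : p ∉ Y := fun k => hdis k hpD
  have hqY : q ∉ Y := fun k => hdis k hqD
  obtain ⟨s1, s2⟩ := mk _ hec (by simp) (by
    intro v hv k
    simp [k]
    exact fun k' => hdis k' hv)
  set X' := addE (addE G a b) c d with hX'
  have hacy : ∀ A ⊆ ((Finset.univ \ insert n Y).erase p).erase q, c ∉ A → A.card < g → AcyOn X' A := by
    intro A hA hc hcard
    have hAd : Disjoint A D := by
      rw [Finset.disjoint_left]
      intro v hv hv'
      have := hA hv
      simp at this
      rcases hDx v hv' with rfl | rfl | rfl | rfl
      · exact this.2.2.1 rfl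
      · exact this.2.1 rfl
      · exact this.1 rfl
      · exact hc hv
    refine (hD A hAd A subset_rfl hcard).anti ?_
    intro u hu v hv k
    have h1 := hA hu
    have h2 := hA hv
    simp at h1 h2
    exact hx u v (fun k => hc (k ▸ hu)) (fun k => hc (k ▸ hv)) h1.2.1 h1.1 h2.2.1 h2.1 k
  have hnd : ND g X' (((Finset.univ \ insert n Y).erase p).erase q) := by
    intro A hA B hB cA cB nA nB hAB
    have h1 : c ∈ A := by by_contra k; exact nA (hacy A hA k cA)
    have h2 : c ∈ B := by by_contra k; exact nB (hacy B hB k cB)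
    exact Finset.disjoint_left.1 hAB h1 h2
  obtain ⟨h5, k⟩ := h.common hn hY hnY hpY hqY rfl (hD Y hYD) hec s1 s2 hnd
  have ec' := s2.ec2 (s1.ec2 hec)
  refine ⟨h5, ?_⟩
  rcases k with ⟨hY0, k, hm, hcard⟩ | ⟨h1, h2⟩
  · subst hY0
    have e0 : Finset.univ \ insert n ∅ = Finset.univ.erase n := by ext x; simp
    rw [e0] at s1 s2 hm hcard ec'
    rw [← hX'] at hcard
    have hdeg : ∀ v ∈ ((Finset.univ.erase n).erase p).erase q, ee X' {v} (((Finset.univ.erase n).erase p).erase q) = ee G {v} (Finset.univ.erase n) := by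
      intro v hv
      simp only [Finset.mem_erase] at hv
      rw [hX', s2.deg (by simp [hv.2.1, hv.2.2.1]) hv.1, s1.deg (by simp [hv.2.2.1]) hv.2.1]
    have hr2 : ee G {r} (Finset.univ.erase n) ≤ 2 := by
      have h1 := ee_erase_right (X := G) (v := r) (Finset.mem_univ n)
      have h2 := h.deg r
      rw [ad_eq_one hn.c.symm] at h1
      omega
    have hrP : r ∈ ((Finset.univ.erase n).erase p).erase q := by
      simp [hn.c.ne', hn.2.1.symm, hn.2.2.1.symm]
    have hd3 : ∀ v ∈ ((Finset.univ.erase n).erase p).erase q, ee X' {v} (((Finset.univ.erase n).erase p).erase q) ≤ 3 :=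
      fun v hv => by rw [hdeg v hv]; exact h.degP _ _
    constructor
    · obtain ⟨H, f, hf⟩ := hm.fgd
      obtain ⟨-, htri⟩ := hf.tri (ec2_induce ec') (fun v => by rw [deg_induce]; exact hd3 _ v.2)
      obtain ⟨y, z, a1, a2, a3⟩ := htri ⟨r, hrP⟩ (by rw [deg_induce, hdeg r hrP]; exact hr2)
      have hy := y.2
      have hz := z.2
      simp only [Finset.mem_coe, Finset.mem_erase] at hy hz
      exact ⟨y.1, z.1, ⟨hy.2.2.1, hy.2.1, hy.1⟩, ⟨hz.2.2.1, hz.2.1, hz.1⟩, a1, a2, a3⟩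
    · intro v v1 v2 v3 v4
      by_contra hne
      have hv : v ∈ ((Finset.univ.erase n).erase p).erase q := by simp [v1, v2, v3]
      have h1 := hd3 v hv
      have h2 := def_two hd3 hrP (by rw [hdeg r hrP]; exact hr2) hv (by omega) v4
      omega
  · exfalso
    have hc : c ∈ ((Finset.univ \ insert n Y).erase p).erase q := Finset.mem_erase.2 ⟨s2.ne_za, s2.ha⟩
    have h3 := fv_le (S := {c}) (hacy (_ \ {c}) Finset.sdiff_subset (by simp) (by
      rw [← Finset.erase_eq, Finset.card_erase_of_mem hc]; omega))
    simp at h3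
    rw [← hX'] at h2
    omega

end

section
set_option linter.all false
open scoped Classical
variable {V : Type} [Fintype V] {X G : SimpleGraph V} {g : ℕ}

lemma third {P : Finset V} {u : V} (h : ee X {u} P = 3) (a b : V) : ∃ w ∈ P, X.Adj u w ∧ w ≠ a ∧ w ≠ b := by
  obtain ⟨x, y, z, h1, h2, h3, hx, hy, hz, ax, ay, az, ho⟩ := nb3 h
  by_cases k1 : x ≠ a ∧ x ≠ b
  · exact ⟨x, hx, ax, k1⟩
  by_cases k2 : y ≠ a ∧ y ≠ b
  · exact ⟨y, hy, ay, k2⟩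
  · refine ⟨z, hz, az, ?_⟩
    constructor <;> rintro rfl <;> grind

lemma MC.no2 (h : MC g G) {U : Finset V} (hd : dd G U = 2) {v x y z : V} (hv : v ∈ U) (hn : N3 G v x y z) (hx : x ∉ U) (hy : y ∉ U) : False := by
  by_cases h2 : 2 ≤ U.card
  · have := h.cut_le hd h2 hv
    rw [hn.deg] at this
    simp [hx, hy] at this
    split_ifs at this <;> omega
  · have : U = {v} := by
      have := Finset.card_le_one.1 (show U.card ≤ 1 by omega)
      ext x; simp; exact ⟨fun k => this _ k _ hv, fun k => k ▸ hv⟩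
    rw [this, hn.dd] at hd
    omega

lemma MC.T8 (h : MC g G) {d1 d2 d3 r e2 e3 z w : V} (n1 : N3 G d1 d2 d3 r) (n2 : N3 G d2 d1 d3 e2) (n3 : N3 G d3 d1 d2 e3)
    (hne : e2 ≠ e3) (hz1 : z ≠ d1) (hz2 : z ≠ d2) (hz3 : z ≠ d3) (ze2 : G.Adj z e2) (ze3 : G.Adj z e3) (hr : r = e2 ∨ r = z)
    (hw : G.Adj e3 w) (w1 : w ≠ d1) (w2 : w ≠ d2) (w3 : w ≠ d3) (w4 : w ≠ e2) (w5 : w ≠ z) : False := by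
  have a12 := n1.a.ne
  have a13 := n1.b.ne
  have a23 := n2.b.ne
  have b12 : d1 ≠ e2 := n2.2.1
  have b22 := n2.c.ne
  have b32 : d3 ≠ e2 := n2.2.2.1
  have b13 : d1 ≠ e3 := n3.2.1
  have b23 : d2 ≠ e3 := n3.2.2.1
  have b33 := n3.c.ne
  have c2 := ze2.ne
  have c3 := ze3.ne
  have nd3 : ∀ v, G.Adj v d3 → v = d1 ∨ v = d2 ∨ v = e3 := fun v k => (n3.2.2.2 v).1 k.symm
  have nd2 : ∀ v, G.Adj v d2 → v = d1 ∨ v = d3 ∨ v = e2 := fun v k => (n2.2.2.2 v).1 k.symm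
  refine h.A8 (A := {d1, d2, d3, e2, e3, z}) (S := {d1, e3}) ?_ ?_ ?_ ?_ ?_ ?_ (s := e3) (t := w) (by simp) ?_ hw
  · rw [Finset.card_insert_of_notMem, Finset.card_insert_of_notMem, Finset.card_insert_of_notMem, Finset.card_insert_of_notMem,
      Finset.card_insert_of_notMem, Finset.card_singleton] <;> simp <;> grind
  · rw [en_insert (by simp; grind), en_insert (by simp; grind), en_insert (by simp; grind), en_insert (by simp; grind), en_insert (by simp; grind),
      n1.deg, n2.deg, n3.deg, en_single, ee_single, ad_eq_one ze3.symm, ee_insert_right (by simp; grind), ee_single, ee_single, ad_eq_one ze2.symm]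
    rcases hr with rfl | rfl <;> simp <;> omega
  · intro k
    have : w ∈ ({d1, d2, d3, e2, e3, z} : Finset V) := by rw [k]; simp
    simp at this
    have := hw.ne
    grind
  · intro v; simp; grind
  · rw [Finset.card_insert_of_notMem (by simp; grind), Finset.card_singleton]
  · have e : ({d1, d2, d3, e2, e3, z} : Finset V) \ {d1, e3} = insert z (insert e2 {d2, d3}) := by
      ext v; simp; grind
    rw [e]
    refine AcyOn.insert (AcyOn.insert (acyOn_card_le_two (Finset.card_le_two)) ?_) ?_
    · rw [ee_insert_right (by simpa using a23), ee_single, ee_single, ad_eq_zero (u := e2) (v := d3) (by intro k; have := nd3 _ k; grind)]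
      have := ad_le (X := G) e2 d2
      omega
    · rw [ee_insert_right (by simp; grind), ee_insert_right (by simpa using a23), ee_single, ee_single, ee_single,
        ad_eq_zero (u := z) (v := d3) (by intro k; have := nd3 _ k; grind), ad_eq_zero (u := z) (v := d2) (by intro k; have := nd2 _ k; grind)]
      have := ad_le (X := G) z e2
      omega
  · simp
    have := hw.ne
    grind

lemma MC.g4 (h : MC g G) : 4 ≤ g := by rcases h.hg with rfl | rfl <;> omega

lemma MC.triD (h : MC g G) {a b c : V} (h1 : G.Adj a b) (h2 : G.Adj b c) (h3 : G.Adj a c) {A : Finset V} (hA : Disjoint A {a, b, c}) : NS g G A := by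
  rcases nd_split h.nd hA with k | k
  · exact k
  · exact (k.tri h.g4 (by simp) (by simp) (by simp) h1 h2 h3).elim

lemma tri_new {e2 e3 d3 r y z : V} (hne : e2 ≠ e3) (hr : r ≠ d3) (hy : y ≠ d3) (hz : z ≠ d3)
    (a1 : (addE (addE G d3 e2) e2 e3).Adj r y) (a2 : (addE (addE G d3 e2) e2 e3).Adj r z) (a3 : (addE (addE G d3 e2) e2 e3).Adj y z)
    (ht : ¬ (G.Adj r y ∧ G.Adj r z ∧ G.Adj y z)) :
    ∃ x, (x = r ∨ x = y ∨ x = z) ∧ G.Adj x e2 ∧ G.Adj x e3 ∧ (r = e2 ∨ r = e3 ∨ r = x) := by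
  have key : ∀ u v, u ≠ d3 → v ≠ d3 → (addE (addE G d3 e2) e2 e3).Adj u v → G.Adj u v ∨ (u = e2 ∧ v = e3) ∨ (u = e3 ∧ v = e2) := by
    intro u v hu hv k
    rcases addE_adj.1 k with k | ⟨_, k⟩
    · rcases addE_adj.1 k with k | ⟨_, k⟩
      · exact Or.inl k
      · rcases k with k | k
        · exact absurd k.1 hu
        · exact absurd k.2 hv
    · exact Or.inr k
  have n1 := a1.ne
  have n2 := a2.ne
  have n3 := a3.ne
  have b1 := key _ _ hr hy a1
  have b2 := key _ _ hr hz a2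
  have b3 := key _ _ hy hz a3
  rcases b1 with b1 | ⟨rfl, rfl⟩ | ⟨rfl, rfl⟩
  · rcases b2 with b2 | ⟨rfl, rfl⟩ | ⟨rfl, rfl⟩
    · rcases b3 with b3 | ⟨rfl, rfl⟩ | ⟨rfl, rfl⟩
      · exact absurd ⟨b1, b2, b3⟩ ht
      · exact ⟨r, by simp, b1, b2, by simp⟩
      · exact ⟨r, by simp, b2, b1, by simp⟩
    · refine ⟨y, by simp, b1.symm, ?_, by simp⟩
      rcases b3 with b3 | b3 | b3
      · exact b3
      · exact absurd b3.1.symm n1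
      · exact absurd b3.1 n3
    · refine ⟨y, by simp, ?_, b1.symm, by simp⟩
      rcases b3 with b3 | b3 | b3
      · exact b3
      · exact absurd b3.1 n3
      · exact absurd b3.1.symm n1
  · refine ⟨z, by simp, ?_, ?_, by simp⟩
    · rcases b2 with b2 | b2 | b2
      · exact b2.symm
      · exact absurd b2.2.symm n3
      · exact absurd b2.1 hne
    · rcases b3 with b3 | b3 | b3
      · exact b3.symm
      · exact absurd b3.1.symm n1
      · exact absurd b3.2.symm n2
  · refine ⟨z, by simp, ?_, ?_, by simp⟩
    · rcases b3 with b3 | b3 | b3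
      · exact b3.symm
      · exact absurd b3.2.symm n2
      · exact absurd b3.1.symm n1
    · rcases b2 with b2 | b2 | b2
      · exact b2.symm
      · exact absurd b2.1.symm hne
      · exact absurd b2.2.symm n3

lemma MC.Tstep (h : MC g G) {d1 d2 d3 r e2 e3 : V} (n1 : N3 G d1 d2 d3 r) (n2 : N3 G d2 d1 d3 e2) (n3 : N3 G d3 d1 d2 e3)
    (hne : e2 ≠ e3) (hna : ¬ G.Adj e2 e3) : False := by
  have a12 := n1.a.ne
  have a13 := n1.b.ne
  have a23 := n2.b.ne
  have b12 : d1 ≠ e2 := n2.2.1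
  have b22 := n2.c.ne
  have b32 : d3 ≠ e2 := n2.2.2.1
  have b13 : d1 ≠ e3 := n3.2.1
  have b23 : d2 ≠ e3 := n3.2.2.1
  have b33 := n3.c.ne
  have hD : ∀ A : Finset V, Disjoint A {d1, d2, d3} → NS g G A := fun A hA => h.triD n1.a n2.b n1.b hA
  have hnb : ¬ G.Adj d3 e2 := by
    intro k
    rcases (n3.2.2.2 e2).1 k with k | k | k
    · exact b12 k.symm
    · exact b22 k.symm
    · exact hne k
  have r1 := n1.c.ne
  have r2 : d2 ≠ r := n1.2.1
  have r3 : d3 ≠ r := n1.2.2.1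
  have HS := h.step n1 (D := {d1, d2, d3}) (a := d3) (b := e2) (c := e2) (d := e3) (by simp) (by simp) (by simp) hD ?_ ?_ ?_ ?_
  obtain ⟨h5, ⟨y, z, hy, hz, a1, a2, a3⟩, hdeg⟩ := HS
  obtain ⟨x, hx, x2, x3, hrx⟩ := tri_new hne r3.symm hy.2.2 hz.2.2 a1 a2 a3 (by
    rintro ⟨k1, k2, k3⟩
    refine (hD {r, y, z} ?_).tri h.g4 (by simp) (by simp) (by simp) k1 k3 k2
    simp; grind)
  have hx1 : x ≠ d1 ∧ x ≠ d2 ∧ x ≠ d3 := by grind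
  have keyw : ∀ e, e ≠ d1 → e ≠ d2 → e ≠ d3 → e ≠ r → (e = e2 ∨ e = e3) → ∃ w, G.Adj e w ∧ w ≠ d1 ∧ w ≠ d2 ∧ w ≠ d3 ∧ w ≠ e2 ∧ w ≠ e3 ∧ w ≠ x := by
    intro e k1 k2 k3 k4 k5
    obtain ⟨w, hw, hew, hw1, hw2⟩ := third (hdeg e k1 k2 k3 k4) (if e = e2 then e3 else e2) x
    simp only [Finset.mem_erase] at hw
    have hee := hew.ne
    have hw3 : w ≠ e2 ∧ w ≠ e3 := by
      rcases k5 with rfl | rfl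
      · rw [if_pos rfl] at hw1; exact ⟨hee.symm, hw1⟩
      · rw [if_neg hne.symm] at hw1; exact ⟨hw1, hee.symm⟩
    refine ⟨w, ?_, hw.2.2.1, hw.2.1, hw.1, hw3.1, hw3.2, hw2⟩
    rcases addE_adj.1 hew with k | ⟨_, k⟩
    · rcases addE_adj.1 k with k | ⟨_, k⟩
      · exact k
      · grind
    · grind
  by_cases hre : r = e3
  · obtain ⟨w, w0, w1, w2, w3, w4, w5, w6⟩ := keyw e2 b12.symm b22.symm b32.symm (by rw [hre]; exact hne) (Or.inl rfl)
    exact h.T8 (w := w) n1.swap n3 n2 hne.symm hx1.1 hx1.2.2 hx1.2.1 x3 x2 (Or.inl hre) w0 w1 w3 w2 w5 w6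
  · obtain ⟨w, w0, w1, w2, w3, w4, w5, w6⟩ := keyw e3 b13.symm b23.symm b33.symm (Ne.symm hre) (Or.inr rfl)
    exact h.T8 (w := w) n1 n2 n3 hne hx1.1 hx1.2.1 hx1.2.2 x2 x3 (by tauto) w0 w1 w2 w3 w4 w6
  · intro U hd hnU hpq
    have k2 : d2 ∉ U := fun k => h.no2 hd k n2 hnU (fun k' => hpq ⟨k, k'⟩)
    have k3 : d3 ∉ U := fun k => h.no2 hd k n3 hnU (fun k' => hpq ⟨k', k⟩)
    simp [hnU, k2, k3]
  · intro P0 hec hn0 hDP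
    have p2 : d2 ∈ P0 := hDP d2 (by simp) a12.symm
    have p3 : d3 ∈ P0 := hDP d3 (by simp) a13.symm
    have f2 := hec.deg p2 p3 a23
    have f3 := hec.deg p3 p2 a23.symm
    rw [n2.deg, if_neg hn0] at f2
    rw [n3.deg, if_neg hn0] at f3
    have q2 : e2 ∈ P0 := by by_contra k; rw [if_neg k] at f2; split_ifs at f2 <;> omega
    have q3 : e3 ∈ P0 := by by_contra k; rw [if_neg k] at f3; split_ifs at f3 <;> omega
    refine ⟨⟨p2, p3, q2, b32, n2.b, n2.c, hnb, ?_⟩, ⟨?_, ?_, ?_, hne, ?_, Or.inl n3.c, ?_, ?_⟩⟩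
    · intro v hv k
      rcases (n2.2.2.2 v).1 k with rfl | k | k
      · exact absurd hv hn0
      · exact Or.inl k
      · exact Or.inr k
    · simp [p3, a23.symm]
    · simp [q2, b22.symm]
    · simp [q3, b23.symm]
    · exact Or.inr ⟨b32, Or.inl ⟨rfl, rfl⟩⟩
    · intro k
      rcases addE_adj.1 k with k | ⟨_, ⟨k, _⟩ | ⟨_, k⟩⟩
      · exact hna k
      · exact b32 k.symm
      · exact b33 k.symm
    · intro v hv k
      simp only [Finset.mem_erase] at hv
      rcases addE_adj.1 k with k | ⟨_, ⟨_, k⟩ | ⟨k, _⟩⟩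
      · rcases (n3.2.2.2 v).1 k with rfl | k | k
        · exact absurd hv.2 hn0
        · exact absurd k hv.1
        · exact Or.inr k
      · exact Or.inl k
      · exact absurd k b32
  · intro u v hu hv _ _ _ _ k
    rcases addE_adj.1 k with k | ⟨_, ⟨k, _⟩ | ⟨_, k⟩⟩
    · rcases addE_adj.1 k with k | ⟨_, ⟨_, k⟩ | ⟨k, _⟩⟩
      · exact k
      · exact absurd k hv
      · exact absurd k hu
    · exact absurd k hu
    · exact absurd k hv
  · intro v hv
    simp at hv
    rcases hv with k | k | k <;> simp [k]

end

section
set_option linter.all false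
open scoped Classical
variable {V : Type} [Fintype V] {X G : SimpleGraph V} {g : ℕ}

lemma MC.fv_ge1 {P : Finset V} (h : ¬ AcyOn X P) : 1 ≤ fv X P := by
  by_contra hc
  obtain ⟨S, s1, s2, s3⟩ := fv_exists X P
  have : S = ∅ := Finset.card_eq_zero.1 (by omega)
  subst this
  exact h (by simpa using s2)

lemma MC.dd_small (h : MC g G) {A : Finset V} (hne : A.Nonempty) (hc : 3 * A.card ≤ 2 * en G A + 1) : A = Finset.univ := by
  by_contra k
  have := h.dd_ge hne k
  have := h.dd_cnt A
  omega

lemma MC.triDeg (h : MC g G) {d1 d2 d3 : V} (a12 : G.Adj d1 d2) (a23 : G.Adj d2 d3) (a13 : G.Adj d1 d3) : ee G {d3} Finset.univ = 3 := by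
  by_contra hc
  have k3 : ee G {d3} Finset.univ ≤ 2 := by have := h.deg d3; omega
  have k2 := h.deg d2
  have k1 := h.deg d1
  have n12 := a12.ne
  have n23 := a23.ne
  have n13 := a13.ne
  set D : Finset V := {d1, d2, d3} with hD
  have e3 : ee G {d3} D = 2 := by
    rw [hD, ee_insert_right (by simp; grind), ee_insert_right (by simp; grind), ee_single, ee_single, ee_single, ad_self, ad_eq_one a13.symm, ad_eq_one a23.symm]
  have e2 : ee G {d2} D = 2 := by
    rw [hD, ee_insert_right (by simp; grind), ee_insert_right (by simp; grind), ee_single, ee_single, ee_single, ad_self, ad_eq_one a12.symm, ad_eq_one a23]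
  have e1 : ee G {d1} D = 2 := by
    rw [hD, ee_insert_right (by simp; grind), ee_insert_right (by simp; grind), ee_single, ee_single, ee_single, ad_self, ad_eq_one a12, ad_eq_one a13]
  have f3 := ee_univ_sdiff (X := G) {d3} D
  have f2 := ee_univ_sdiff (X := G) {d2} D
  have f1 := ee_univ_sdiff (X := G) {d1} D
  have hd : dd G D ≤ 2 := by
    unfold dd
    conv_lhs => rw [hD]
    rw [ee_insert_left (by simp; grind), ee_insert_left (by simp; grind), ← hD]
    omega
  have hne : D.Nonempty := ⟨d1, by simp [hD]⟩
  by_cases hu : D = Finset.univ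
  · exact h.nF 3 0 (FF.tri d1 d2 d3 a12 a23 a13 (by rw [← hu]))
  have hd2 := h.dd_ge hne hu
  refine h.lemIsep (Y := D) (S := {d1}) hne (by omega) ?_ ?_ ?_
  · refine acyOn_card_le_two ?_
    have : D \ {d1} ⊆ {d2, d3} := by intro v; simp [hD]; grind
    exact (Finset.card_le_card this).trans Finset.card_le_two
  · rw [Finset.card_singleton]
    exact MC.fv_ge1 (tri_not_acy a12 a23 a13)
  · have : D \ {d1} = insert d2 {d3} := by ext v; simp [hD]; grind
    rw [this, ee_insert_left (by simpa using n23)]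
    omega

lemma N3.memD {d x y z : V} (n : N3 G d x y z) {A : Finset V} (hx : x ∈ A) (hy : y ∈ A) (hz : z ∈ A) : ee G {d} A = 3 := by
  rw [n.deg, if_pos hx, if_pos hy, if_pos hz]

lemma MC.noTri (h : MC g G) {d1 d2 d3 : V} (a12 : G.Adj d1 d2) (a23 : G.Adj d2 d3) (a13 : G.Adj d1 d3) : False := by
  have n12 := a12.ne
  have n23 := a23.ne
  have n13 := a13.ne
  obtain ⟨e1, n1⟩ := exN3 (h.triDeg a23 a13.symm a12.symm) a12 a13 n23
  obtain ⟨e2, n2⟩ := exN3 (h.triDeg a13 a23.symm a12) a12.symm a23 n13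
  obtain ⟨e3, n3⟩ := exN3 (h.triDeg a12 a23 a13) a13.symm a23.symm n12
  -- two equal outer neighbours
  have eq2 : ∀ {d1 d2 d3 w e : V}, N3 G d1 d2 d3 w → N3 G d2 d1 d3 w → N3 G d3 d1 d2 e → w ≠ e → G.Adj w e → False := by
    intro d1 d2 d3 w e n1 n2 n3 hwe hadj
    have m12 := n1.a.ne
    have m13 := n1.b.ne
    have m23 := n2.b.ne
    have m1w := n1.c.ne
    have m2w := n2.c.ne
    have m3w : d3 ≠ w := n1.2.2.1
    have m1e : d1 ≠ e := n3.2.1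
    have m2e : d2 ≠ e := n3.2.2.1
    have m3e := n3.c.ne
    have hu : ({d1, d2, d3, w, e} : Finset V) = Finset.univ := by
      refine h.dd_small ⟨d1, by simp⟩ ?_
      rw [Finset.card_insert_of_notMem (by simp; grind), Finset.card_insert_of_notMem (by simp; grind), Finset.card_insert_of_notMem (by simp; grind), Finset.card_insert_of_notMem (by simp; grind),
        Finset.card_singleton, en_insert (by simp; grind), en_insert (by simp; grind), en_insert (by simp; grind), en_insert (by simp; grind), n1.deg, n2.deg, n3.deg, en_single, ee_single, ad_eq_one hadj]
      simp
      omega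
    have hun : ∀ v, v = d1 ∨ v = d2 ∨ v = d3 ∨ v = w ∨ v = e := by
      intro v
      have : v ∈ ({d1, d2, d3, w, e} : Finset V) := by rw [hu]; simp
      simpa using this
    have q1 : ¬ G.Adj e d1 := by intro k; have := (n1.2.2.2 e).1 k.symm; grind
    have q2 : ¬ G.Adj e d2 := by intro k; have := (n2.2.2.2 e).1 k.symm; grind
    have q3 : ¬ G.Adj d3 w := by intro k; have := (n3.2.2.2 w).1 k; grind
    have hs : Sup G Finset.univ e d3 w := by
      refine ⟨by simp, by simp, by simp, m3w, n3.c.symm, hadj.symm, q3, ?_⟩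
      intro v _ k
      rcases hun v with rfl | rfl | rfl | rfl | rfl
      · exact absurd k q1
      · exact absurd k q2
      · simp
      · simp
      · exact absurd rfl k.ne
    have hE : Finset.univ.erase e = ({d1, d2, d3, w} : Finset V) := by
      ext v; simp
      have := hun v
      grind
    refine h.B1 hs ?_
    rw [hE]
    intro A hA B hB _ _ hA' hB' hAB
    have h0 : A ∪ B ⊆ ({d1, d2, d3, w} : Finset V) := Finset.union_subset hA hB
    have h1 := Finset.card_le_card h0
    rw [Finset.card_union_of_disjoint hAB] at h1
    have h2 : ({d1, d2, d3, w} : Finset V).card ≤ 4 := Finset.card_le_four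
    have : 3 ≤ A.card := by
      by_contra k; exact hA' (acyOn_card_le_two (by omega))
    have : 3 ≤ B.card := by
      by_contra k; exact hB' (acyOn_card_le_two (by omega))
    omega
  by_cases h23 : e2 = e3
  · by_cases h12 : e1 = e2
    · subst h23; subst h12
      have hu : ({e1, d1, d2, d3} : Finset V) = Finset.univ := by
        have m1 := n1.c.ne
        have m2 := n2.c.ne
        have m3 := n3.c.ne
        refine h.dd_small ⟨d1, by simp⟩ ?_
        rw [Finset.insert_comm, Finset.insert_comm e1 d2, Finset.pair_comm, Finset.card_insert_of_notMem (by simp; grind), Finset.card_insert_of_notMem (by simp; grind), Finset.card_insert_of_notMem (by simp; grind),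
          Finset.card_singleton, en_insert (by simp; grind), en_insert (by simp; grind), en_insert (by simp; grind), n1.deg, n2.deg, n3.deg, en_single]
        simp
        omega
      have hE : Finset.univ.erase e1 = ({d1, d2, d3} : Finset V) := by
        rw [← hu, Finset.erase_insert]
        simp; have m1 := n1.c.ne
        have m2 := n2.c.ne
        have m3 := n3.c.ne
        grind
      have f1 : ee G {d1} ({d1, d2, d3} : Finset V) = 2 := by rw [n1.deg]; have m1 := n1.c.ne; have := n2.c.ne; have := n3.c.ne; simp; grind
      have f2 : ee G {d2} ({d1, d2, d3} : Finset V) = 2 := by rw [n2.deg]; have m1 := n1.c.ne; have := n2.c.ne; have := n3.c.ne; simp; grind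
      have f3 : ee G {d3} ({d1, d2, d3} : Finset V) = 2 := by rw [n3.deg]; have m1 := n1.c.ne; have := n2.c.ne; have := n3.c.ne; simp; grind
      refine h.nF 1 1 (FF.apex (n := e1) (by simp) ?_ ?_ ?_)
      · rw [hE, ee_insert_right (by simp; grind), ee_insert_right (by simp; grind), ee_single, ee_single, ee_single, ad_eq_one n1.c.symm, ad_eq_one n2.c.symm, ad_eq_one n3.c.symm]
      · rw [hE]; intro v hv _
        simp at hv
        rcases hv with rfl | rfl | rfl <;> assumption
      · rw [hE]; exact FF.tri d1 d2 d3 a12 a23 a13 rfl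
    · by_cases ha : G.Adj e1 e2
      · subst h23
        exact eq2 n2.rot.swap' n3.rot.swap' n1.rot.rot.rot (Ne.symm h12) ha.symm
      · exact h.Tstep n3 n1.swap n2.swap h12 ha
  · by_cases ha : G.Adj e2 e3
    · by_cases h12 : e1 = e2
      · subst h12
        exact eq2 n1 n2 n3 h23 ha
      · by_cases h13 : e1 = e3
        · subst h13
          exact eq2 n1.swap n3 n2 (Ne.symm h23) ha.symm
        · by_cases hb : G.Adj e1 e2
          · by_cases hc : G.Adj e1 e3
            · refine (h.triD a12 a23 a13 (A := {e1, e2, e3}) ?_).tri h.g4 (by simp) (by simp) (by simp) hb ha hc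
              have := n1.c.ne
              have := n2.c.ne
              have := n3.c.ne
              have := n1.2
              have := n2.2
              have := n3.2
              simp; grind
            · exact h.Tstep n2 n1 n3.swap h13 hc
          · exact h.Tstep n3 n1.swap n2.swap h12 hb
    · exact h.Tstep n1 n2 n3 h23 ha

lemma MC.ns4 (h : MC g G) (P : Finset V) : NS 4 G P := by
  intro A hA hc
  by_contra k
  obtain ⟨a, ha, b, hb, c, hc, h1, h2, h3⟩ := short3 k hc
  exact h.noTri h1 h2 h3
end

section
set_option linter.all false
open scoped Classical
variable {V : Type} [Fintype V] {X G : SimpleGraph V} {g : ℕ}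

lemma acy_addE {a b : V} {A : Finset V} (h : ¬ AcyOn (addE G a b) A) (hab : ¬ (a ∈ A ∧ b ∈ A)) : ¬ AcyOn G A := by
  intro k
  refine h (AcyOn.anti k ?_)
  intro u hu v hv huv
  rcases addE_adj.1 huv with k | ⟨_, ⟨rfl, rfl⟩ | ⟨rfl, rfl⟩⟩
  · exact k
  · exact absurd ⟨hu, hv⟩ hab
  · exact absurd ⟨hv, hu⟩ hab

lemma MC.sup2 (h : MC g G) {x a b : V} (hx : ee G {x} Finset.univ = 2) (ha : G.Adj x a) (hb : G.Adj x b) (hab : a ≠ b)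
    (hB : ∀ B : Finset V, x ∉ B → a ∉ B → b ∉ B → B.card < g → AcyOn G B) : False := by
  have hs : Sup G Finset.univ x a b := by
    refine ⟨by simp, by simp, by simp, hab, ha, hb, fun k => h.noTri ha k hb, ?_⟩
    intro v _ hv
    obtain ⟨p, _, q, _, k⟩ := deg2_nbrs hx
    grind
  refine h.B1 hs ?_
  intro A hA B hB' cA cB nA nB hdis
  have hd := Finset.disjoint_left.1 hdis
  have xA : x ∉ A := fun k => by simpa using hA k
  have xB : x ∉ B := fun k => by simpa using hB' k
  by_cases k1 : a ∈ A ∧ b ∈ A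
  · exact acy_addE nB (fun k => hd k1.1 k.1) (hB B xB (hd k1.1) (hd k1.2) cB)
  · by_cases k2 : a ∈ B ∧ b ∈ B
    · exact acy_addE nA k1 (hB A xA (fun k => hd k k2.1) (fun k => hd k k2.2) cA)
    · exact h.nd A (Finset.subset_univ _) B (Finset.subset_univ _) cA cB (acy_addE nA k1) (acy_addE nB k2) hdis

lemma MC.cubic (h : MC g G) (hns : NS g G Finset.univ) (v : V) : ee G {v} Finset.univ = 3 := by
  by_contra hc
  have h2 : ee G {v} Finset.univ = 2 := by
    have := h.deg v
    have := h.deg2 v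
    omega
  obtain ⟨p, _, q, _, hpq, hp, hq, _⟩ := deg2_nbrs h2
  exact h.sup2 h2 hp hq hpq fun B _ _ _ hB => hns B (Finset.subset_univ _) hB

lemma MC.quadD (h : MC g G) (h5 : g = 5) {a b c d : V} (h1 : G.Adj a b) (h2 : G.Adj b c) (h3 : G.Adj c d) (h4 : G.Adj d a) (hac : a ≠ c) (hbd : b ≠ d)
    {A : Finset V} (hA : Disjoint A {a, b, c, d}) : NS g G A := by
  rcases nd_split h.nd hA with k | k
  · exact k
  · exact (k.quad (by omega) (by simp) (by simp) (by simp) (by simp) h1 h2 h3 h4 hac hbd).elim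

lemma MC.quadDeg (h : MC g G) (h5 : g = 5) {d1 d2 d3 d4 : V} (h1 : G.Adj d1 d2) (h2 : G.Adj d2 d3) (h3 : G.Adj d3 d4) (h4 : G.Adj d4 d1) (h13 : d1 ≠ d3) (h24 : d2 ≠ d4) :
    ee G {d4} Finset.univ = 3 := by
  by_contra hc
  have hd2 : ee G {d4} Finset.univ = 2 := by
    have := h.deg d4
    have := h.deg2 d4
    omega
  refine h.sup2 hd2 h4 h3.symm h13 fun B k4 k1 k3 hB => ?_
  have hns : NS g G (B.erase d2) := by
    refine h.quadD h5 h1 h2 h3 h4 h13 h24 ?_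
    simp [k4, k1, k3]
  have hE := hns (B.erase d2) subset_rfl (lt_of_le_of_lt (Finset.card_le_card (Finset.erase_subset _ _)) hB)
  by_cases kk : d2 ∈ B
  · rw [← Finset.insert_erase kk]
    refine hE.insert ?_
    have q1 := h.deg d2
    rw [ee_univ_sdiff {d2} ({d1, d3} : Finset V), ee_insert_right (by simpa using h13), ee_single, ee_single, ad_eq_one h1.symm, ad_eq_one h2] at q1
    have q2 : ee G {d2} (B.erase d2) ≤ ee G {d2} (Finset.univ \ {d1, d3}) := by
      refine ee_mono subset_rfl ?_
      intro v hv
      simp at hv ⊢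
      grind
    omega
  · rwa [Finset.erase_eq_of_notMem kk] at hE

lemma MC.ladder0 (h : MC g G) {d1 d2 d3 d4 e1 e2 e3 e4 : V} (n1 : N3 G d1 d2 d4 e1) (n2 : N3 G d2 d1 d3 e2) (n3 : N3 G d3 d2 d4 e3) (n4 : N3 G d4 d1 d3 e4)
    (hD : ∀ A, Disjoint A {d1, d2, d3, d4} → NS g G A) {U : Finset V} (hd : dd G U = 2) (u2 : d2 ∈ U) (u3 : d3 ∈ U) (u1 : d1 ∉ U) (u4 : d4 ∉ U) (hns : NS g G U) : False := by
  have n14 : d1 ≠ d4 := n1.b.ne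
  have n23 : d2 ≠ d3 := n2.b.ne
  have m1 := n1.c.ne
  have m4 := n4.c.ne
  have m14 : d4 ≠ e1 := n1.2.2.1
  have m41 : d1 ≠ e4 := n4.2.1
  set A0 := ((Finset.univ \ U).erase d1).erase d4 with hA0
  have a1 : d1 ∉ A0 := by simp [hA0]
  have a4 : d4 ∉ A0 := by simp [hA0]
  have a1' : d1 ∉ insert d4 A0 := by simp [a1, n14]
  have hC : Finset.univ \ U = insert d1 (insert d4 A0) := by
    ext v; simp [hA0]; grind
  have hc := hd
  unfold dd at hc
  have hc' := hc
  rw [ee_comm, hC, ee_insert_left a1', ee_insert_left a4, n1.deg, n4.deg, if_pos u2, if_neg u4, if_pos u3, if_neg u1] at hc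
  have k1 : e1 ∉ U := by intro k; rw [if_pos k] at hc; omega
  have k4 : e4 ∉ U := by intro k; rw [if_pos k] at hc; omega
  rw [if_neg k1, if_neg k4] at hc
  have hAU : ee G A0 U = 0 := by omega
  have e1A : e1 ∈ A0 := by simp [hA0, k1, m14.symm, m1.symm]
  have e4A : e4 ∈ A0 := by simp [hA0, k4, m41.symm, m4.symm]
  have d2A : d2 ∉ A0 := by simp [hA0, u2]
  have d3A : d3 ∉ A0 := by simp [hA0, u3]
  have f4 : ee G {d4} A0 = 1 := by rw [n4.deg]; simp [a1, d3A, e4A]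
  have f1 : ee G {d1} A0 = 1 := by rw [n1.deg]; simp [d2A, a4, e1A]
  have f1' : ee G {d1} (insert d4 A0) = 2 := by rw [ee_insert_right a4, ee_single, ad_eq_one n1.b, f1]
  have f4U : ee G U {d4} = 1 := by rw [ee_comm, n4.deg]; simp [u1, u3, k4]
  have hen : en G Finset.univ = en G U + en G A0 + 5 := by
    have := en_union (X := G) (A := U) (B := Finset.univ \ U) Finset.disjoint_sdiff
    rw [Finset.union_sdiff_of_subset (Finset.subset_univ _), hc', hC, en_insert a1', en_insert a4] at this
    omega
  have hdA : dd G A0 = 2 := by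
    have q1 := dd_split (G := G) (Z := {d4}) (Z' := A0) (by simpa using a4)
    have q2 := dd_split (G := G) (Z := {d1}) (Z' := insert d4 A0) (by simpa using a1')
    rw [← Finset.insert_eq, n4.dd] at q1
    rw [← Finset.insert_eq, ← hC, dd_compl, n1.dd] at q2
    omega
  have w1 := h.Qp0 hd (by
    rw [hC, Finset.card_insert_of_notMem a1', Finset.card_insert_of_notMem a4]; omega) hns
  have w2 := h.Qp0 hdA (by
    have : ({d1, d4} : Finset V) ⊆ Finset.univ \ A0 := by intro v; simp; rintro (rfl | rfl) <;> assumption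
    have := Finset.card_le_card this
    rwa [Finset.card_pair n14] at this) (hD A0 (by simp [a1, a4, d2A, d3A]))
  have hf : fv G Finset.univ ≤ fv G U + fv G A0 + 1 := by
    obtain ⟨S, s1, s2, s3⟩ := fv_exists G U
    obtain ⟨T, t1, t2, t3⟩ := fv_exists G A0
    have c1 : AcyOn G (insert d4 (A0 \ T)) := t2.insert ((ee_mono subset_rfl Finset.sdiff_subset).trans (by omega))
    have hdis : Disjoint (U \ S) (insert d4 (A0 \ T)) := by
      rw [Finset.disjoint_left]; intro v; simp [hA0]; grind
    have c2 := s2.union c1 hdis (by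
      rw [ee_insert_right (by simp [a4])]
      have q1 : ee G (U \ S) {d4} ≤ ee G U {d4} := ee_mono Finset.sdiff_subset subset_rfl
      have q2 : ee G (U \ S) (A0 \ T) ≤ ee G U A0 := ee_mono Finset.sdiff_subset Finset.sdiff_subset
      rw [ee_comm U A0] at q2
      omega)
    have : fv G Finset.univ ≤ (insert d1 (S ∪ T)).card := by
      refine fv_le (c2.mono ?_)
      intro v hv
      simp at hv ⊢
      by_cases kU : v ∈ U
      · grind
      · have : v ∈ Finset.univ \ U := by simp [kU]
        rw [hC] at this
        simp at this
        grind
    have q1 := Finset.card_insert_le d1 (S ∪ T)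
    have q2 := Finset.card_union_le S T
    omega
  have hp := h.pos
  unfold wt at hp w1 w2
  rw [hen] at hp
  rcases h.tt_pos with ⟨_, e1, e2⟩ | ⟨_, e1, e2⟩ <;> rw [e1, e2] at hp w1 w2 <;> push_cast at * <;> omega

/-- no 2-cut through two opposite edges of a 4-cycle -/
lemma MC.ladder (h : MC g G) {d1 d2 d3 d4 e1 e2 e3 e4 : V} (n1 : N3 G d1 d2 d4 e1) (n2 : N3 G d2 d1 d3 e2) (n3 : N3 G d3 d2 d4 e3) (n4 : N3 G d4 d1 d3 e4)
    (hD : ∀ A, Disjoint A {d1, d2, d3, d4} → NS g G A) {U : Finset V} (hd : dd G U = 2) (u2 : d2 ∈ U) (u3 : d3 ∈ U) (u1 : d1 ∉ U) (u4 : d4 ∉ U) : False := by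
  rcases nd_split h.nd (A := U) (B := Finset.univ \ U) Finset.disjoint_sdiff with k | k
  · exact h.ladder0 n1 n2 n3 n4 hD hd u2 u3 u1 u4 k
  · refine h.ladder0 (d1 := d2) (d2 := d1) (d3 := d4) (d4 := d3) n2 n1 n4 n3 ?_ (by rw [dd_compl]; exact hd) (by simp [u1]) (by simp [u4]) (by simp [u2]) (by simp [u3]) k
    intro A hA
    refine hD A ?_
    rwa [Finset.insert_comm, Finset.pair_comm]
end

section
set_option linter.all false
open scoped Classical
variable {V : Type} [Fintype V] {X G : SimpleGraph V} {g : ℕ}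

lemma star_acy {c x y z : V} (h1 : c ≠ x) (hxy : x ≠ y) (hxz : x ≠ z) (hyz : y ≠ z) (a : ¬ G.Adj x y) (b : ¬ G.Adj x z) (d : ¬ G.Adj y z) (k1 : c ≠ y) (k2 : c ≠ z) :
    AcyOn G {x, y, z, c} := by
  refine AcyOn.insert (AcyOn.insert (acyOn_card_le_two Finset.card_le_two) ?_) ?_
  · rw [ee_insert_right (by simpa using k2.symm), ee_single, ee_single, ad_eq_zero d]
    have := ad_le (X := G) y c
    omega
  · rw [ee_insert_right (by simp; grind), ee_insert_right (by simpa using k2.symm), ee_single, ee_single, ee_single, ad_eq_zero a, ad_eq_zero b]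
    have := ad_le (X := G) x c
    omega

lemma en6 {d1 d2 d3 d4 z w : V} {S : ℕ} (n1 : N3 G d1 d2 d4 z) (a23 : G.Adj d2 d3) (a34 : G.Adj d3 d4) (a3z : G.Adj d3 z) (h2w : G.Adj d2 w)
    (h12 : d1 ≠ d3) (h24 : d2 ≠ d4) (m1 : d1 ≠ w) (m2 : d2 ≠ z) (m3 : d3 ≠ w) (m4 : d4 ≠ w) (mz : z ≠ w) (m4z : d4 ≠ z)
    (hS : S ≤ ad G d4 w + ad G z w) : ({d1, d2, d3, d4, z, w} : Finset V).card = 6 ∧ 7 + S ≤ en G {d1, d2, d3, d4, z, w} := by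
  have q1 := n1.a.ne
  have q2 := n1.b.ne
  have q3 := n1.c.ne
  have q4 := a23.ne
  have q5 := a34.ne
  have q6 := a3z.ne
  have q7 := h2w.ne
  constructor
  · rw [Finset.card_insert_of_notMem (by simp; grind), Finset.card_insert_of_notMem (by simp; grind), Finset.card_insert_of_notMem (by simp; grind), Finset.card_insert_of_notMem (by simp; grind),
      Finset.card_insert_of_notMem (by simp; grind), Finset.card_singleton]
  · rw [en_insert (by simp; grind), en_insert (by simp; grind), en_insert (by simp; grind), en_insert (by simp; grind), en_insert (by simp; grind), n1.deg, en_single]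
    have r1 : ee G {d2} {d3, w} ≤ ee G {d2} {d3, d4, z, w} := ee_mono subset_rfl (by intro v; simp; grind)
    rw [ee_insert_right (by simp; grind), ee_single, ee_single, ad_eq_one a23, ad_eq_one h2w] at r1
    have r2 : ee G {d3} {d4, z} ≤ ee G {d3} {d4, z, w} := ee_mono subset_rfl (by intro v; simp; grind)
    rw [ee_insert_right (by simp; grind), ee_single, ee_single, ad_eq_one a34, ad_eq_one a3z] at r2
    have r3 : ee G {d4} {w} ≤ ee G {d4} {z, w} := ee_mono subset_rfl (by intro v; simp; grind)
    rw [ee_single] at r3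
    rw [ee_single]
    simp
    omega

/-- the common `A8` application for a 4-cycle: `d1` and `d3` have the common outer neighbour `z`;
`w` is the outer neighbour of `d2`. -/
lemma MC.Q8 (h : MC g G) {d1 d2 d3 d4 z w t : V} (n1 : N3 G d1 d2 d4 z) (n3 : N3 G d3 d2 d4 z) (n2 : N3 G d2 d1 d3 w)
    (mz : z ≠ w) (hS : G.Adj d4 w ∨ G.Adj z w) (m4 : d4 ≠ w)
    (hwt : G.Adj w t) (t2 : t ≠ d2) (t4 : t ≠ d4) (tz : t ≠ z) : False := by
  have h13 : d1 ≠ d3 := n2.1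
  have h24 : d2 ≠ d4 := n1.1
  have q1 := n1.a.ne
  have q2 := n1.b.ne
  have q3 := n1.c.ne
  have q4 := n2.b.ne
  have q5 := n3.b.ne
  have q6 := n3.c.ne
  have q7 := n2.c.ne
  have m1 : d1 ≠ w := n2.2.1
  have m3 : d3 ≠ w := n2.2.2.1
  have m2 : d2 ≠ z := n1.2.1
  have m4z : d4 ≠ z := n1.2.2.1
  have tw := hwt.ne
  have t1 : t ≠ d1 := by
    rintro rfl
    have := (n1.2.2.2 w).1 hwt.symm
    grind
  have t3 : t ≠ d3 := by
    rintro rfl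
    have := (n3.2.2.2 w).1 hwt.symm
    grind
  obtain ⟨c6, c8⟩ := en6 (S := 1) n1 n2.b n3.b n3.c n2.c h13 h24 m1 m2 m3 m4 mz m4z (by
    rcases hS with k | k
    · have := ad_eq_one k; omega
    · have := ad_eq_one k; omega)
  have htA : t ∉ ({d1, d2, d3, d4, z, w} : Finset V) := by simp; grind
  refine h.A8 (A := {d1, d2, d3, d4, z, w}) (S := {d1, w}) c6 (by omega) ?_ ?_ ?_ ?_ (s := w) (t := t) (by simp) htA hwt
  · intro k; rw [k] at htA; simp at htA
  · intro v; simp; grind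
  · exact Finset.card_pair m1
  · have e : ({d1, d2, d3, d4, z, w} : Finset V) \ {d1, w} = {d2, d4, z, d3} := by
      ext v; simp; grind
    rw [e]
    refine star_acy q4.symm h24 m2 m4z ?_ ?_ ?_ q5 q6
    · exact fun k => h.noTri n1.a k n1.b
    · exact fun k => h.noTri n1.a k n1.c
    · exact fun k => h.noTri n1.b k n1.c

lemma MC.K33 (h : MC g G) {d1 d2 d3 d4 z w : V} (n1 : N3 G d1 d2 d4 z) (n3 : N3 G d3 d2 d4 z) (n2 : N3 G d2 d1 d3 w) (n4 : N3 G d4 d1 d3 w)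
    (mz : z ≠ w) (hzw : G.Adj z w) : False := by
  have h13 : d1 ≠ d3 := n2.1
  have h24 : d2 ≠ d4 := n1.1
  have q1 := n1.a.ne
  have q2 := n1.b.ne
  have q3 := n1.c.ne
  have q4 := n2.b.ne
  have q5 := n3.b.ne
  have q6 := n3.c.ne
  have q7 := n2.c.ne
  have m1 : d1 ≠ w := n2.2.1
  have m3 : d3 ≠ w := n2.2.2.1
  have m2 : d2 ≠ z := n1.2.1
  have m4z : d4 ≠ z := n1.2.2.1
  have m4 := n4.c.ne
  obtain ⟨c6, c8⟩ := en6 (S := 2) n1 n2.b n3.b n3.c n2.c h13 h24 m1 m2 m3 m4 mz m4z (by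
    rw [ad_eq_one hzw, ad_eq_one n4.c])
  have hu : ({d1, d2, d3, d4, z, w} : Finset V) = Finset.univ := h.dd_small ⟨d1, by simp⟩ (by omega)
  have x24 : ¬ G.Adj d2 d4 := fun k => h.noTri n1.a k n1.b
  have x13 : ¬ G.Adj d1 d3 := fun k => h.noTri n1.a n2.b k
  have x2z : ¬ G.Adj d2 z := fun k => h.noTri n1.a k n1.c
  have x4z : ¬ G.Adj d4 z := fun k => h.noTri n1.b k n1.c
  have x1w : ¬ G.Adj d1 w := fun k => h.noTri n1.a n2.c k
  have x3w : ¬ G.Adj d3 w := fun k => h.noTri n3.a n2.c k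
  have hun : ∀ v, v = d1 ∨ v = d2 ∨ v = d3 ∨ v = d4 ∨ v = z ∨ v = w := by
    intro v
    have : v ∈ ({d1, d2, d3, d4, z, w} : Finset V) := by rw [hu]; simp
    simpa using this
  have hf : fv G Finset.univ ≤ 2 := by
    have : fv G Finset.univ ≤ ({d1, w} : Finset V).card := by
      refine fv_le ((star_acy (G := G) (c := d3) q4.symm h24 m2 m4z x24 x2z x4z q5 q6).mono ?_)
      rw [← hu]
      intro v; simp; grind
    rwa [Finset.card_pair m1] at this
  have hp := h.pos
  unfold wt at hp
  rw [← hu] at hp hf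
  rcases h.tt_pos with ⟨_, e1, e2⟩ | ⟨h5, e1, e2⟩
  · rw [e1, e2] at hp; omega
  refine h.nFG 3 1 0 ⟨h.ec.two h.deg h.card, fun v => by rw [ncard_neighborSet]; exact h.deg v, fun _ => 0, delE G z w, fun u v k => k.1, fun _ _ _ => rfl, ?_, Or.inr ⟨h5, ?_⟩, ?_, ?_⟩
  · have e : ((fun _ => 0 : V → Fin (0 + 1)) ⁻¹' {0}) = ((Finset.univ : Finset V) : Set V) := by ext; simp
    rw [e]
    apply FF.memF
    have s1 : Sup (delE G z w) Finset.univ z d1 d3 := by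
      refine ⟨by simp, by simp, by simp, h13, ?_, ?_, ?_, ?_⟩
      · rw [delE_adj]; exact ⟨n1.c.symm, by grind⟩
      · rw [delE_adj]; exact ⟨n3.c.symm, by grind⟩
      · rw [delE_adj]; exact fun k => x13 k.1
      · intro v _ k
        rw [delE_adj] at k
        obtain ⟨k1, k2⟩ := k
        rcases hun v with rfl | rfl | rfl | rfl | rfl | rfl
        · simp
        · exact absurd k1.symm x2z
        · simp
        · exact absurd k1.symm x4z
        · exact absurd rfl k1.ne
        · simp at k2
    have s2 : Sup (addE (delE G z w) d1 d3) (Finset.univ.erase z) w d2 d4 := by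
      refine ⟨by simp [mz.symm], by simp [m2], by simp [m4z], h24, ?_, ?_, ?_, ?_⟩
      · rw [addE_adj, delE_adj]; exact Or.inl ⟨n2.c.symm, by grind⟩
      · rw [addE_adj, delE_adj]; exact Or.inl ⟨n4.c.symm, by grind⟩
      · rw [addE_adj, delE_adj]; grind
      · intro v hv k
        rw [addE_adj, delE_adj] at k
        have := hun v
        have l1 : ¬ G.Adj w d1 := fun k => x1w k.symm
        have l3 : ¬ G.Adj w d3 := fun k => x3w k.symm
        have lw : ¬ G.Adj w w := G.irrefl
        simp at hv
        grind
    refine FF.sub s1 (FF.sub s2 ?_)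
    have hE : (Finset.univ.erase z).erase w = ({d1, d2, d3, d4} : Finset V) := by
      ext v
      have := hun v
      simp
      grind
    rw [hE]
    have hE1 : ({d1, d2, d3, d4} : Finset V).erase d1 = {d2, d3, d4} := by
      rw [Finset.erase_insert]; simp; grind
    set H := addE (addE (delE G z w) d1 d3) d2 d4 with hH
    have b13 : H.Adj d1 d3 := by rw [hH, addE_adj, addE_adj, delE_adj]; grind
    have b24 : H.Adj d2 d4 := by rw [hH, addE_adj, addE_adj, delE_adj]; grind
    have bG : ∀ u v, G.Adj u v → u ≠ z → u ≠ w → H.Adj u v := by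
      intro u v k k1 k2; rw [hH, addE_adj, addE_adj, delE_adj]; exact Or.inl (Or.inl ⟨k, by grind⟩)
    have b12 := bG _ _ n1.a q3 m1
    have b14 := bG _ _ n1.b q3 m1
    have b23 := bG _ _ n2.b m2 q7
    have b34 := bG _ _ n3.b q6 m3
    have D2 : ({d2, d3, d4} : Finset V) = insert d2 (insert d3 {d4}) := rfl
    refine FF.apex (n := d1) (by simp) ?_ ?_ ?_
    · rw [hE1, ee_insert_right (by simp; grind), ee_insert_right (by simp; grind), ee_single, ee_single, ee_single, ad_eq_one b12, ad_eq_one b13, ad_eq_one b14]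
    · rw [hE1]; intro v hv _
      rw [ee_insert_right (by simp; grind), ee_insert_right (by simp; grind), ee_single, ee_single, ee_single]
      simp at hv
      rcases hv with rfl | rfl | rfl
      · rw [ad_self, ad_eq_one b23, ad_eq_one b24]
      · rw [ad_self, ad_eq_one b23.symm, ad_eq_one b34]
      · rw [ad_self, ad_eq_one b34.symm, ad_eq_one b24.symm]
    · rw [hE1]; exact FF.tri d2 d3 d4 b23 b34 b24 rfl
  · intro l hl
    exact absurd (Fin.ext (by have := l.2; simp)) hl
  · have : G.edgeSet \ (delE G z w).edgeSet = {s(z, w)} := by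
      ext e
      induction e using Sym2.ind with
      | _ x y =>
        simp only [Set.mem_diff, SimpleGraph.mem_edgeSet, delE_adj, Set.mem_singleton_iff, Sym2.eq_iff]
        constructor
        · rintro ⟨k1, k2⟩; by_contra k3; exact k2 ⟨k1, k3⟩
        · rintro (⟨rfl, rfl⟩ | ⟨rfl, rfl⟩)
          · exact ⟨hzw, by simp⟩
          · exact ⟨hzw.symm, by simp⟩
    rw [this]; simp
  · intro k; omega

end

section
set_option linter.all false
open scoped Classical
variable {V : Type} [Fintype V] {X G : SimpleGraph V} {g : ℕ}

lemma MC.Q4step (h : MC g G) {d1 d2 d3 d4 e1 e2 e3 e4 : V} (n1 : N3 G d1 d2 d4 e1) (n2 : N3 G d2 d1 d3 e2) (n3 : N3 G d3 d2 d4 e3) (n4 : N3 G d4 d1 d3 e4)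
    (hD : ∀ A, Disjoint A {d1, d2, d3, d4} → NS g G A) (hne : e2 ≠ e4) : False := by
  have h13 : d1 ≠ d3 := n2.1
  have h24 : d2 ≠ d4 := n1.1
  have q12 := n1.a.ne
  have q14 := n1.b.ne
  have q23 := n2.b.ne
  have q34 := n3.b.ne
  have m1 := n1.c.ne
  have m2 := n2.c.ne
  have m4 := n4.c.ne
  have x32 : ¬ G.Adj d3 e2 := fun k => h.noTri n3.a n2.c k
  have x34 : ¬ G.Adj d3 e4 := fun k => h.noTri n3.b n4.c k
  have b32 : d3 ≠ e2 := n2.2.2.1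
  have b34 : d3 ≠ e4 := n4.2.2.1
  have b12 : d1 ≠ e2 := n2.2.1
  have b14 : d1 ≠ e4 := n4.2.1
  have b24 : d2 ≠ e4 := by rintro rfl; exact h.noTri n1.a n4.c.symm n1.b
  have b42 : d4 ≠ e2 := by rintro rfl; exact h.noTri n1.a n2.c n1.b
  have r3 : e1 ≠ d3 := by rintro rfl; exact h.noTri n1.a n2.b n1.c
  have r2 : e1 ≠ e2 := by rintro rfl; exact h.noTri n1.a n2.c n1.c
  have r4 : e1 ≠ e4 := by rintro rfl; exact h.noTri n1.b n4.c n1.c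
  have rd2 : d2 ≠ e1 := n1.2.1
  have rd4 : d4 ≠ e1 := n1.2.2.1
  have key : ∀ u v, (addE (addE G d3 e2) d3 e4).Adj u v → G.Adj u v ∨ (u = d3 ∧ (v = e2 ∨ v = e4)) ∨ (v = d3 ∧ (u = e2 ∨ u = e4)) := by
    intro u v k
    rw [addE_adj, addE_adj] at k
    grind
  have HS := h.step n1 (D := {d1, d2, d3, d4}) (a := d3) (b := e2) (c := d3) (d := e4) (by simp) (by simp) (by simp) hD ?_ ?_ ?_ ?_
  obtain ⟨h5, ⟨y, z, hy, hz, a1, a2, a3⟩, hdeg⟩ := HS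
  · have c1 : G.Adj e1 y := by have := key _ _ a1; grind
    have c2 : G.Adj e1 z := by have := key _ _ a2; grind
    have c3 : (y = d3 ∧ (z = e2 ∨ z = e4)) ∨ (z = d3 ∧ (y = e2 ∨ y = e4)) := by
      rcases key _ _ a3 with k | k
      · exact (h.noTri c1 k c2).elim
      · exact k
    have c4 : G.Adj e1 d3 := by
      rcases c3 with ⟨rfl, _⟩ | ⟨rfl, _⟩ <;> assumption
    have c5 : G.Adj e1 e2 ∨ G.Adj e1 e4 := by
      rcases c3 with ⟨_, rfl | rfl⟩ | ⟨_, rfl | rfl⟩ <;> simp [c1, c2]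
    have c6 : e1 = e3 := by
      rcases (n3.2.2.2 e1).1 c4.symm with k | k | k
      · exact absurd k.symm rd2
      · exact absurd k.symm rd4
      · exact k
    subst c6
    have keyw : ∀ e, e ≠ d1 → e ≠ d2 → e ≠ d4 → e ≠ e1 → e ≠ d3 → ∃ w, G.Adj e w ∧ w ≠ d2 ∧ w ≠ d4 ∧ w ≠ e1 := by
      intro e k1 k2 k3 k4 k5
      obtain ⟨w, hw, hew, hw1, hw2⟩ := third (hdeg e k1 k2 k3 k4) d3 e1
      simp only [Finset.mem_erase] at hw
      refine ⟨w, ?_, hw.2.1, hw.1, hw2⟩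
      have := key _ _ hew
      grind
    rcases c5 with c5 | c5
    · obtain ⟨w, w1, w2, w3, w4⟩ := keyw e2 b12.symm m2.symm b42.symm r2.symm b32.symm
      exact h.Q8 n1 n3 n2 r2 (Or.inr c5) b42 w1 w2 w3 w4
    · obtain ⟨w, w1, w2, w3, w4⟩ := keyw e4 b14.symm b24.symm m4.symm r4.symm b34.symm
      exact h.Q8 n1.swap n3.swap n4 r4 (Or.inr c5) b24 w1 w3 w2 w4
  · intro U hd hnU hpq
    have k2 : d2 ∉ U := by
      intro k
      have k' : d4 ∉ U := fun k' => hpq ⟨k, k'⟩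
      by_cases k3 : d3 ∈ U
      · exact h.ladder n1 n2 n3 n4 hD hd k k3 hnU k'
      · exact h.no2 hd k n2 hnU k3
    have k4 : d4 ∉ U := by
      intro k
      by_cases k3 : d3 ∈ U
      · refine h.ladder (d1 := d1) (d2 := d4) (d3 := d3) (d4 := d2) n1.swap n4 n3.swap n2 ?_ hd k k3 hnU k2
        intro A hA
        refine hD A ?_
        convert hA using 1
        ext v; simp; grind
      · exact h.no2 hd k n4 hnU k3
    have k3 : d3 ∉ U := fun k => h.no2 hd k n3 k2 k4
    simp [hnU, k2, k3, k4]
  · intro P0 hec hn0 hDP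
    have p2 : d2 ∈ P0 := hDP d2 (by simp) q12.symm
    have p3 : d3 ∈ P0 := hDP d3 (by simp) h13.symm
    have p4 : d4 ∈ P0 := hDP d4 (by simp) q14.symm
    have f2 := hec.deg p2 p3 q23
    have f4 := hec.deg p4 p3 q34.symm
    rw [n2.deg, if_neg hn0] at f2
    rw [n4.deg, if_neg hn0] at f4
    have q2 : e2 ∈ P0 := by by_contra k; rw [if_neg k] at f2; split_ifs at f2 <;> omega
    have q4 : e4 ∈ P0 := by by_contra k; rw [if_neg k] at f4; split_ifs at f4 <;> omega
    refine ⟨⟨p2, p3, q2, b32, n2.b, n2.c, x32, ?_⟩, ⟨?_, ?_, ?_, b34, Or.inl n4.b, Or.inl n4.c, ?_, ?_⟩⟩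
    · intro v hv k
      rcases (n2.2.2.2 v).1 k with rfl | k | k
      · exact absurd hv hn0
      · exact Or.inl k
      · exact Or.inr k
    · simp [p4, h24.symm]
    · simp [p3, q23.symm]
    · simp [q4, b24.symm]
    · intro k
      rw [addE_adj] at k
      grind
    · intro v hv k
      simp only [Finset.mem_erase] at hv
      rw [addE_adj, n4.2.2.2] at k
      grind
  · intro u v hu hv _ _ _ _ k
    have := key _ _ k
    grind
  · intro v hv
    simp at hv
    grind

lemma MC.Q4 (h : MC g G) {d1 d2 d3 d4 e1 e2 e3 e4 : V} (n1 : N3 G d1 d2 d4 e1) (n2 : N3 G d2 d1 d3 e2) (n3 : N3 G d3 d2 d4 e3) (n4 : N3 G d4 d1 d3 e4)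
    (hD : ∀ A, Disjoint A {d1, d2, d3, d4} → NS g G A)
    (hq : ∀ {a b c d : V}, G.Adj a b → G.Adj b c → G.Adj c d → G.Adj d a → a ≠ c → b ≠ d → ee G {d} Finset.univ = 3) : False := by
  by_cases k : e2 = e4
  · by_cases k' : e1 = e3
    · subst k; subst k'
      have mz : e1 ≠ e2 := by rintro rfl; exact h.noTri n1.a n2.c n1.c
      by_cases hz : G.Adj e1 e2
      · exact h.K33 n1 n3 n2 n4 mz hz
      · have h24 : d2 ≠ d4 := n1.1
        have b12 : d1 ≠ e2 := n2.2.1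
        obtain ⟨t, -, t1, t2, t4⟩ := third (hq n2.a n1.b n4.c n2.c.symm h24 b12) d2 d4
        exact h.Q8 n1 n3 n2 mz (Or.inl n4.c) n4.c.ne t1 t2 t4 (by rintro rfl; exact hz t1.symm)
    · refine h.Q4step (d1 := d2) (d2 := d3) (d3 := d4) (d4 := d1) n2.swap n3 n4.swap n1 ?_ (Ne.symm k')
      intro A hA
      refine hD A ?_
      convert hA using 1
      ext v; simp; grind
  · exact h.Q4step n1 n2 n3 n4 hD k
end

section
set_option linter.all false
open scoped Classical
variable {V : Type} [Fintype V] {X G : SimpleGraph V} {g : ℕ}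

lemma MC.ns5 (h : MC g G) : NS 5 G Finset.univ := by
  have hq : ∀ {a b c d : V}, G.Adj a b → G.Adj b c → G.Adj c d → G.Adj d a → a ≠ c → b ≠ d → ee G {d} Finset.univ = 3 := by
    intro a b c d h1 h2 h3 h4 hac hbd
    rcases h.hg with hg | hg
    · exact h.cubic (by subst hg; exact h.ns4 _) d
    · exact h.quadDeg hg h1 h2 h3 h4 hac hbd
  intro A hA hc
  by_contra k
  rcases short4 k hc with ⟨a, _, b, _, c, _, h1, h2, h3⟩ | ⟨_, a, _, b, _, c, _, d, _, h1, h2, h3, h4, hac, hbd, _⟩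
  · exact h.noTri h1 h2 h3
  · obtain ⟨e1, n1⟩ := exN3 (hq h2 h3 h4 h1 hbd hac.symm) h1 h4.symm hbd
    obtain ⟨e2, n2⟩ := exN3 (hq h3 h4 h1 h2 hac.symm hbd.symm) h1.symm h2 hac
    obtain ⟨e3, n3⟩ := exN3 (hq h4 h1 h2 h3 hbd.symm hac) h2.symm h3 hbd
    obtain ⟨e4, n4⟩ := exN3 (hq h1 h2 h3 h4 hac hbd) h4 h3.symm hac
    refine h.Q4 n1 n2 n3 n4 ?_ hq
    intro A hA
    rcases h.hg with hg | hg
    · subst hg; exact h.ns4 _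
    · exact h.quadD hg h1 h2 h3 h4 hac hbd hA

lemma MC.nsg (h : MC g G) (P : Finset V) : NS g G P := by
  rcases h.hg with hg | hg
  · subst hg; exact h.ns4 _
  · subst hg; exact h.ns5.mono (Finset.subset_univ _)

lemma MC.deg3 (h : MC g G) (v : V) : ee G {v} Finset.univ = 3 := h.cubic (h.nsg _) v

lemma MC.dd3 (h : MC g G) (Y : Finset V) : 3 * Y.card = 2 * en G Y + dd G Y := by
  rw [← dd_eq, ee_sum_left, Finset.sum_congr rfl (fun u _ => h.deg3 u)]
  simp [mul_comm]

lemma MC.no4 (h : MC g G) {a b c d : V} (h1 : G.Adj a b) (h2 : G.Adj b c) (h3 : G.Adj c d) (h4 : G.Adj d a) (hac : a ≠ c) (hbd : b ≠ d) : False :=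
  h.ns5.quad le_rfl (by simp) (by simp) (by simp) (by simp) h1 h2 h3 h4 hac hbd

lemma MC.cut_cyc (h : MC g G) {Y : Finset V} (hd : dd G Y = 2) : ¬ AcyOn G Y := by
  intro k
  rw [acyOn_iff] at k
  have h3 := h.dd3 Y
  have hne : Y.Nonempty := by
    rw [Finset.nonempty_iff_ne_empty]; rintro rfl
    simp at h3; omega
  have := k Y subset_rfl hne
  have := hne.card_pos
  omega

lemma MC.cut9 (h : MC g G) {Y : Finset V} (hd : dd G Y = 2) : 9 ≤ Y.card := by
  have h5 : 5 ≤ Y.card := by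
    by_contra k
    exact h.cut_cyc hd (h.ns5 Y (Finset.subset_univ _) (by omega))
  have hf1 : ∀ u ∈ Y, ee G {u} (Finset.univ \ Y) ≤ 1 := fun u hu => h.cut_le hd (by omega) hu
  have hsum : ∑ u ∈ Y, ee G {u} (Finset.univ \ Y) = 2 := by rw [← ee_sum_left]; exact hd
  have hB : (Y.filter (fun u => ee G {u} (Finset.univ \ Y) = 1)).card = 2 := by
    rw [← hsum, Finset.card_filter]
    apply Finset.sum_congr rfl
    intro u hu
    have := hf1 u hu
    split_ifs <;> omega
  obtain ⟨a, b, hab, hBab⟩ := Finset.card_eq_two.1 hB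
  have ha : a ∈ Y ∧ ee G {a} (Finset.univ \ Y) = 1 := by
    have : a ∈ Y.filter (fun u => ee G {u} (Finset.univ \ Y) = 1) := by rw [hBab]; simp
    simpa using this
  have hb : b ∈ Y ∧ ee G {b} (Finset.univ \ Y) = 1 := by
    have : b ∈ Y.filter (fun u => ee G {u} (Finset.univ \ Y) = 1) := by rw [hBab]; simp
    simpa using this
  have h0 : ∀ v ∈ Y, v ≠ a → v ≠ b → ee G {v} (Finset.univ \ Y) = 0 := by
    intro v hv k1 k2
    have h1 := hf1 v hv
    by_contra k
    have : v ∈ Y.filter (fun u => ee G {u} (Finset.univ \ Y) = 1) := by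
      simp only [Finset.mem_filter]; exact ⟨hv, by omega⟩
    rw [hBab] at this
    simp [k1, k2] at this
  -- a good vertex
  obtain ⟨v, hv, va, vb, hgood⟩ : ∃ v ∈ Y, v ≠ a ∧ v ≠ b ∧ ∃ c, (c = a ∨ c = b) ∧ ¬ G.Adj v c := by
    have hc : 1 < ((Y.erase a).erase b).card := by
      rw [Finset.card_erase_of_mem (by simp [hb.1, hab.symm]), Finset.card_erase_of_mem ha.1]; omega
    obtain ⟨x, hx, y, hy, hxy⟩ := Finset.one_lt_card.1 hc
    simp at hx hy
    by_contra hcon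
    push Not at hcon
    exact h.no4 (hcon x hx.2.2 hx.2.1 hx.1 a (by simp)).symm (hcon x hx.2.2 hx.2.1 hx.1 b (by simp)) (hcon y hy.2.2 hy.2.1 hy.1 b (by simp)).symm
      (hcon y hy.2.2 hy.2.1 hy.1 a (by simp)) hab hxy
  obtain ⟨c, hc, hvc⟩ := hgood
  have hcY : c ∈ Y ∧ ee G {c} (Finset.univ \ Y) = 1 := by rcases hc with rfl | rfl <;> assumption
  have hball := ball (h.ns5.mono (Finset.subset_univ Y)) hv
  set N := Y.filter (fun u => G.Adj v u) with hN
  have hNc : N.card = 3 := by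
    have h1 := ee_univ_sdiff (X := G) {v} Y
    rw [h.deg3, h0 v hv va vb] at h1
    have h2 : ee G {v} Y = N.card := by
      rw [ee_single_card]
    omega
  have hs2 : ∑ u ∈ N, ee G {u} (Finset.univ \ Y) ≤ 1 := by
    have h1 : ∑ u ∈ N, ee G {u} (Finset.univ \ Y) ≤ ∑ u ∈ Y.erase c, ee G {u} (Finset.univ \ Y) := by
      refine Finset.sum_le_sum_of_subset ?_
      intro u hu
      simp [hN] at hu
      simp [hu.1]
      rintro rfl
      exact hvc hu.2
    have h2 := Finset.add_sum_erase Y (fun u => ee G {u} (Finset.univ \ Y)) hcY.1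
    simp only [hcY.2, hsum] at h2
    omega
  have hs3 : ∑ u ∈ N, ee G {u} Y + ∑ u ∈ N, ee G {u} (Finset.univ \ Y) = 9 := by
    rw [← Finset.sum_add_distrib, Finset.sum_congr rfl (fun u _ => (show ee G {u} Y + ee G {u} (Finset.univ \ Y) = 3 by rw [← ee_univ_sdiff, h.deg3]))]
    simp [hNc]
  have : ∑ u ∈ N, ee G {u} Y ≤ Y.card - 1 := by
    have := hball
    convert Nat.le_sub_of_add_le' this using 1
  omega

lemma MC.no2cut (h : MC g G) {Y : Finset V} (hd : dd G Y = 2) : False := by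
  have hd' : dd G (Finset.univ \ Y) = 2 := by rw [dd_compl]; exact hd
  have c1 := h.cut9 hd
  have c2 := h.cut9 hd'
  have w1 := (h.Qp hd (by omega) (h.nsg _) (h.cut_cyc hd)).2 c1
  have w2 := (h.Qp hd' (by rw [Finset.sdiff_sdiff_eq_self (Finset.subset_univ _)]; omega) (h.nsg _) (h.cut_cyc hd')).2 c2
  have hen := en_union (X := G) (A := Y) (B := Finset.univ \ Y) Finset.disjoint_sdiff
  have hee : ee G Y (Finset.univ \ Y) = 2 := hd
  rw [Finset.union_sdiff_of_subset (Finset.subset_univ _), hee] at hen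
  have hf : fv G Finset.univ ≤ fv G Y + fv G (Finset.univ \ Y) + 1 := by
    obtain ⟨S, s1, s2, s3⟩ := fv_exists G Y
    obtain ⟨T, t1, t2, t3⟩ := fv_exists G (Finset.univ \ Y)
    obtain ⟨a, ha, y, hy, hay⟩ := ee_pos.1 (show 0 < ee G Y (Finset.univ \ Y) by omega)
    have ha1 : 0 < ee G {a} (Finset.univ \ Y) := ee_pos.2 ⟨a, by simp, y, hy, hay⟩
    have hsp : ee G Y (Finset.univ \ Y) = ee G {a} (Finset.univ \ Y) + ee G (Y.erase a) (Finset.univ \ Y) := by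
      conv_lhs => rw [← Finset.insert_erase ha]
      rw [ee_insert_left (by simp), Finset.insert_erase ha]
    have hdis : Disjoint ((Y.erase a) \ S) ((Finset.univ \ Y) \ T) := by
      rw [Finset.disjoint_left]; intro v; simp; tauto
    have c2 := (s2.mono (Finset.sdiff_subset_sdiff (Finset.erase_subset a Y) subset_rfl)).union t2 hdis (by
      have : ee G (Y.erase a \ S) ((Finset.univ \ Y) \ T) ≤ ee G (Y.erase a) (Finset.univ \ Y) := ee_mono Finset.sdiff_subset Finset.sdiff_subset
      omega)
    have : fv G Finset.univ ≤ (insert a (S ∪ T)).card := by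
      refine fv_le (c2.mono ?_)
      intro v hv
      simp at hv ⊢
      tauto
    have q1 := Finset.card_insert_le a (S ∪ T)
    have q2 := Finset.card_union_le S T
    omega
  have hp := h.pos
  unfold wt at hp w1 w2
  rw [hen] at hp
  rcases h.tt_pos with ⟨_, e1, e2⟩ | ⟨_, e1, e2⟩ <;> rw [e1, e2] at hp w1 w2 <;> push_cast at * <;> omega

lemma MC.ec3 (h : MC g G) {Y : Finset V} (h1 : Y.Nonempty) (h2 : Y ≠ Finset.univ) : 3 ≤ dd G Y := by
  have := h.dd_ge h1 h2
  by_contra k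
  exact h.no2cut (show dd G Y = 2 by omega)

lemma tri_cl (no4 : ∀ {a b c d : V}, G.Adj a b → G.Adj b c → G.Adj c d → G.Adj d a → a ≠ c → b ≠ d → False) {p p1 p2 q1 q2 z : V}
    (hp1 : G.Adj p p1) (hp2 : G.Adj p p2) (hp : p1 ≠ p2) (k1 : p1 ≠ q1) (k2 : p1 ≠ q2) (k3 : p2 ≠ q1) (k4 : p2 ≠ q2) (hz : z ≠ p)
    (key : ∀ u v, X.Adj u v → G.Adj u v ∨ (u = p1 ∧ v = p2) ∨ (u = p2 ∧ v = p1) ∨ (u = q1 ∧ v = q2) ∨ (u = q2 ∧ v = q1))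
    (z1 : X.Adj p1 z) (z2 : X.Adj p2 z) : False := by
  have n1 := z1.ne
  have n2 := z2.ne
  have a1 : G.Adj p1 z := by have := key _ _ z1; grind
  have a2 : G.Adj p2 z := by have := key _ _ z2; grind
  exact no4 hp1 a1 a2.symm hp2.symm hz.symm hp

lemma MC.ne4 (h : MC g G) : g ≠ 4 := by
  intro h4
  have hcd := h.card
  obtain ⟨v⟩ : Nonempty V := Fintype.card_pos_iff.1 (by omega)
  obtain ⟨p, q, r, h1, h2, h3, -, -, -, ap, aq, ar, ho⟩ := nb3 (h.deg3 v)
  have hn : N3 G v p q r := ⟨h1, h2, h3, fun w => ⟨fun k => ho w (by simp) k, by rintro (rfl | rfl | rfl) <;> assumption⟩⟩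
  obtain ⟨p1, p2, g1, g2, g3, -, -, ap1, ap2, gp⟩ := nb3_of (h.deg3 p) (Finset.mem_univ v) ap.symm
  obtain ⟨q1, q2, f1, f2, f3, -, -, aq1, aq2, fq⟩ := nb3_of (h.deg3 q) (Finset.mem_univ v) aq.symm
  have m : ∀ x, G.Adj p x → G.Adj q x → x ≠ v → False := fun x k1 k2 k3 => h.no4 ap k1 k2.symm aq.symm (Ne.symm k3) h1
  have k1 : p1 ≠ q1 := by rintro rfl; exact m _ ap1 aq1 g2
  have k2 : p1 ≠ q2 := by rintro rfl; exact m _ ap1 aq2 g2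
  have k3 : p2 ≠ q1 := by rintro rfl; exact m _ ap2 aq1 g3
  have k4 : p2 ≠ q2 := by rintro rfl; exact m _ ap2 aq2 g3
  have xpq : ¬ G.Adj p q := fun k => h.noTri ap k aq
  have key : ∀ u w, (addE (addE G p1 p2) q1 q2).Adj u w → G.Adj u w ∨ (u = p1 ∧ w = p2) ∨ (u = p2 ∧ w = p1) ∨ (u = q1 ∧ w = q2) ∨ (u = q2 ∧ w = q1) := by
    intro u w k
    rw [addE_adj, addE_adj] at k
    grind
  have key' : ∀ u w, (addE (addE G p1 p2) q1 q2).Adj u w → G.Adj u w ∨ (u = q1 ∧ w = q2) ∨ (u = q2 ∧ w = q1) ∨ (u = p1 ∧ w = p2) ∨ (u = p2 ∧ w = p1) := by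
    intro u w k
    have := key u w k
    tauto
  have hec : EC2 G (Finset.univ \ insert v ∅) := by
    by_contra hne
    obtain ⟨Z, hZ, z1, z2, z3⟩ := not_ec2 hne
    set P := Finset.univ \ insert v (∅ : Finset V) with hP
    have hvZ : v ∉ Z := fun k => by have := hZ k; simp [hP] at this
    have hZu : Z ≠ Finset.univ := by rintro rfl; simp at hvZ
    have hW : (P \ Z).Nonempty := Finset.sdiff_nonempty.2 fun k => z2 (Finset.Subset.antisymm hZ k)
    have hWu : P \ Z ≠ Finset.univ := by
      intro k
      have : v ∈ P \ Z := by rw [k]; simp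
      simp [hP] at this
    have e1 := h.ec3 z1 hZu
    have e2 := h.ec3 hW hWu
    have hvW : v ∉ P \ Z := by simp [hP]
    have t1 : Finset.univ \ Z = insert v (P \ Z) := by ext x; simp [hP]; grind
    have t2 : Finset.univ \ (P \ Z) = insert v Z := by
      ext x
      have : x ∈ Z → x ∈ P := fun k => hZ k
      simp [hP] at this ⊢; grind
    unfold dd at e1 e2
    rw [t1, ee_insert_right hvW] at e1
    rw [t2, ee_insert_right hvZ, ee_comm (P \ Z) Z] at e2
    have e3 := h.deg3 v
    have e4 : ee G {v} Finset.univ = ee G {v} Z + ee G {v} (P \ Z) := by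
      rw [ee_univ_sdiff {v} Z, t1, ee_insert_right hvW, ee_single, ad_self]; omega
    rw [ee_comm Z {v}] at e1
    rw [ee_comm (P \ Z) {v}] at e2
    omega
  have cm := h.common hn (Y := ∅) (P0 := Finset.univ \ insert v ∅) (a := p1) (b := p2) (c := q1) (d := q2) (Or.inl rfl) (by simp) (by simp) (by simp) rfl (h.nsg _) hec ?_ ?_ ?_
  · omega
  · refine ⟨by simp [ap.ne.symm], by simp [g2], by simp [g3], g1, ap1, ap2, fun k => h.noTri ap1 k ap2, ?_⟩
    intro w hw k
    simp at hw
    rcases gp w (by simp) k with k | k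
    · exact absurd k hw
    · exact k
  · have n1 := ap.ne
    have n2 := aq.ne
    refine ⟨by simp [n2.symm, h1.symm], ?_, ?_, f1, Or.inl aq1, Or.inl aq2, ?_, ?_⟩
    · simp [f2]; rintro rfl; exact xpq aq1.symm
    · simp [f3]; rintro rfl; exact xpq aq2.symm
    · rw [addE_adj]
      rintro (k | ⟨_, ⟨k, _⟩ | ⟨_, k⟩⟩)
      · exact h.noTri aq1 k aq2
      · exact k1 k.symm
      · exact k2 k.symm
    · intro w hw k
      simp at hw
      rw [addE_adj] at k
      have yq1 : q ≠ p1 := by rintro rfl; exact xpq ap1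
      have yq2 : q ≠ p2 := by rintro rfl; exact xpq ap2
      rcases k with k | ⟨_, ⟨k, _⟩ | ⟨k, _⟩⟩
      · rcases fq w (by simp) k with k | k
        · exact absurd k hw.2
        · exact k
      · exact absurd k yq1
      · exact absurd k yq2
  · intro A hA B hB cA cB nA nB hdis
    obtain ⟨a, ha, b, hb, c, hc, x1, x2, x3⟩ := short3 nA (by omega)
    have hmem : ∀ x ∈ A, x ≠ p ∧ x ≠ q := by
      intro x hx
      have := hA hx
      simp at this
      exact ⟨this.2.1, this.1⟩
    have clp : ∀ z, z ∈ A → (addE (addE G p1 p2) q1 q2).Adj p1 z → (addE (addE G p1 p2) q1 q2).Adj p2 z → False :=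
      fun z hz => tri_cl h.no4 ap1 ap2 g1 k1 k2 k3 k4 (hmem z hz).1 key
    have clq : ∀ z, z ∈ A → (addE (addE G p1 p2) q1 q2).Adj q1 z → (addE (addE G p1 p2) q1 q2).Adj q2 z → False :=
      fun z hz => tri_cl h.no4 aq1 aq2 f1 k1.symm k3.symm k2.symm k4.symm (hmem z hz).2 key'
    have gen : ∀ x y z, z ∈ A → (addE (addE G p1 p2) q1 q2).Adj x y → (addE (addE G p1 p2) q1 q2).Adj x z → (addE (addE G p1 p2) q1 q2).Adj y z → G.Adj x y := by
      intro x y z hz e1 e2 e3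
      rcases key _ _ e1 with k | ⟨rfl, rfl⟩ | ⟨rfl, rfl⟩ | ⟨rfl, rfl⟩ | ⟨rfl, rfl⟩
      · exact k
      · exact (clp z hz e2 e3).elim
      · exact (clp z hz e3 e2).elim
      · exact (clq z hz e2 e3).elim
      · exact (clq z hz e3 e2).elim
    exact h.noTri (gen a b c hc x1 x3 x2) (gen b c a ha x2 x1.symm x3.symm) (gen a c b hb x3 x1 x2.symm)

theorem main_thm (g : ℕ) (hg : g = 4 ∨ g = 5) (G : SimpleGraph V) (hG : GMinimal g G) :
    g = 5 ∧ Cubic G ∧ ThreeConnected G ∧ 5 ≤ G.egirth := by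
  have h := GMinimal.mc hg hG
  refine ⟨?_, fun v => by rw [ncard_neighborSet]; exact h.deg3 v, ?_, egirth_of_ns h.ns5⟩
  · rcases hg with k | k
    · exact absurd k h.ne4
    · exact k
  · refine three_conn (fun Y h1 h2 => h.ec3 h1 h2) h.deg3 ?_
    have hc := h.card
    obtain ⟨v⟩ : Nonempty V := Fintype.card_pos_iff.1 (by omega)
    have h3 := h.deg3 v
    rw [ee_univ_sdiff {v} {v}, ee_single, ad_self, ee_single_card] at h3
    have := Finset.card_filter_le (Finset.univ \ {v}) (fun u => G.Adj v u)
    rw [Finset.card_sdiff_of_subset (by simp), Finset.card_singleton, Finset.card_univ] at this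
    omega
end

/-- every `g`-minimal graph has `g = 5` and is cubic, 3-connected, and of
girth at least 5. -/
theorem statement18 (g : ℕ) (hg : g = 4 ∨ g = 5) {V : Type} [Fintype V]
    (G : SimpleGraph V) (hG : GMinimal g G) :
    g = 5 ∧ Cubic G ∧ ThreeConnected G ∧ 5 ≤ G.egirth :=
  main_thm g hg G hG

end InducedForest
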